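/- Let K be a nonempty compact subset of a closed surface S and let D be an upper semicontinuous decomposition of K into subcontinua. Then all but finitely many elements of D are strictly planar; that is, the set {δ ∈ D : δ is not strictly planar} is finite. -/

import Mathlib

open Set Metric Filter Topology unitInterval

/-- A space is locally euclidean of dimension 2 if every point has an open neighborhood
homeomorphic to `ℝ²`. A *closed surface* is a nonempty compact connected Hausdorff space
with this property. -/
def IsSurfaceLocallyEuclidean (S : Type*) [TopologicalSpace S] : Prop :=
  ∀ x : S, ∃ U : Set S, IsOpen U ∧ x ∈ U ∧ Nonempty (U ≃ₜ (ℝ × ℝ))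

/-- An upper semicontinuous decomposition of `K`: a partition of `K` into nonempty closed
sets such that each element `δ` and open `U ⊇ δ` admit a relatively open `V` (a union of
elements of the decomposition) with `δ ⊆ V ⊆ U`. -/
def IsUSCDecomp {X : Type*} [TopologicalSpace X] (K : Set X) (D : Set (Set X)) : Prop :=
  (∀ δ ∈ D, δ.Nonempty ∧ IsClosed δ ∧ δ ⊆ K) ∧
  (∀ δ ∈ D, ∀ δ' ∈ D, δ ≠ δ' → Disjoint δ δ') ∧
  ⋃₀ D = K ∧
  ∀ δ ∈ D, ∀ U : Set X, IsOpen U → δ ⊆ U →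
    ∃ D' ⊆ D, (∃ W : Set X, IsOpen W ∧ ⋃₀ D' = W ∩ K) ∧ δ ⊆ ⋃₀ D' ∧ ⋃₀ D' ⊆ U

/-- An upper semicontinuous decomposition into subcontinua. -/
def IsUSCDecompCont {X : Type*} [TopologicalSpace X] (K : Set X) (D : Set (Set X)) : Prop :=
  IsUSCDecomp K D ∧ ∀ δ ∈ D, IsConnected δ

/-- The relation on `↥K` identifying two points lying in a common element of `D`. -/
def decompRel {X : Type*} (K : Set X) (D : Set (Set X)) : K → K → Prop :=
  fun x y => ∃ δ ∈ D, (x : X) ∈ δ ∧ (y : X) ∈ δ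

/-- The quotient space of the decomposition `D` of `K`, with the quotient topology. -/
abbrev DecompQuot {X : Type*} [TopologicalSpace X] (K : Set X) (D : Set (Set X)) : Type _ :=
  Quot (decompRel K D)

/-- A topological space is a *Peano compactum* if it is compact, all of its connected
components are locally connected, and there is a metric inducing its topology for which,
for every `ε > 0`, at most finitely many connected components have diameter `> ε`. -/
def IsPeanoCompactumSp (Y : Type*) [ty : TopologicalSpace Y] : Prop :=
  CompactSpace Y ∧
  (∀ y : Y, LocallyConnectedSpace (connectedComponent y)) ∧
  ∃ m : MetricSpace Y, m.toPseudoMetricSpace.toUniformSpace.toTopologicalSpace = ty ∧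
    ∀ ε : ℝ, 0 < ε →
      {C : Set Y | (∃ y : Y, C = connectedComponent y) ∧
        ε < @Metric.diam Y m.toPseudoMetricSpace C}.Finite

/-- A compact subset `K` of a metric space is a Peano compactum with the restricted
metric iff all of its connected components are locally connected and for each `ε > 0`
only finitely many components have diameter `> ε`. -/
def IsPeanoCompactumSet {X : Type*} [MetricSpace X] (K : Set X) : Prop :=
  IsCompact K ∧
  (∀ x ∈ K, LocallyConnectedSpace (connectedComponentIn K x)) ∧
  ∀ ε : ℝ, 0 < ε →
    {C : Set X | (∃ x ∈ K, C = connectedComponentIn K x) ∧ ε < Metric.diam C}.Finite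

/-- A Peano decomposition: a usc decomposition into subcontinua whose quotient space
(with the quotient topology) is a Peano compactum. -/
def IsPeanoDecomp {X : Type*} [MetricSpace X] (K : Set X) (D : Set (Set X)) : Prop :=
  IsUSCDecompCont K D ∧ IsPeanoCompactumSp (DecompQuot K D)

/-- A decomposition `D` refines `D'` if every element of `D` is contained in an
element of `D'`. -/
def Refines {X : Type*} (D D' : Set (Set X)) : Prop :=
  ∀ δ ∈ D, ∃ δ' ∈ D', δ ⊆ δ'

/-- A subset `δ` of a surface `S` is strictly planar if some open set `U ⊇ δ` embeds
topologically into the plane. -/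
def IsStrictlyPlanar {S : Type*} [TopologicalSpace S] (δ : Set S) : Prop :=
  ∃ U : Set S, IsOpen U ∧ δ ⊆ U ∧ ∃ e : U → ℝ × ℝ, Topology.IsEmbedding e


/-- `f` has a continuous logarithm on `A`. -/
def HasLogOn {X : Type*} [TopologicalSpace X] (f : X → ℂ) (A : Set X) : Prop :=
  ∃ L : X → ℂ, ContinuousOn L A ∧ ∀ x ∈ A, Complex.exp (L x) = f x

section logs
variable {X Y : Type*} [TopologicalSpace X] [TopologicalSpace Y] {f g : X → ℂ} {A B : Set X}

lemma HasLogOn.mono (h : HasLogOn f A) (hBA : B ⊆ A) : HasLogOn f B := by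
  obtain ⟨L, hL, h⟩ := h
  exact ⟨L, hL.mono hBA, fun x hx => h x (hBA hx)⟩

lemma HasLogOn.congr (h : HasLogOn f A) (hfg : ∀ x ∈ A, f x = g x) : HasLogOn g A := by
  obtain ⟨L, hL, h⟩ := h
  exact ⟨L, hL, fun x hx => (h x hx).trans (hfg x hx)⟩

lemma HasLogOn.mul (hf : HasLogOn f A) (hg : HasLogOn g A) : HasLogOn (fun x => f x * g x) A := by
  obtain ⟨L, hL, h⟩ := hf
  obtain ⟨M, hM, h'⟩ := hg
  exact ⟨fun x => L x + M x, hL.add hM, fun x hx => by rw [Complex.exp_add, h x hx, h' x hx]⟩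

lemma HasLogOn.inv (hf : HasLogOn f A) : HasLogOn (fun x => (f x)⁻¹) A := by
  obtain ⟨L, hL, h⟩ := hf
  exact ⟨fun x => - L x, hL.neg, fun x hx => by rw [Complex.exp_neg, h x hx]⟩

lemma HasLogOn.div (hf : HasLogOn f A) (hg : HasLogOn g A) : HasLogOn (fun x => f x / g x) A := by
  simpa [div_eq_mul_inv] using hf.mul hg.inv

lemma HasLogOn.comp {k : Y → X} {B : Set Y} (hf : HasLogOn f A) (hk : ContinuousOn k B)
    (hm : MapsTo k B A) : HasLogOn (fun y => f (k y)) B := by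
  obtain ⟨L, hL, h⟩ := hf
  exact ⟨fun y => L (k y), hL.comp hk hm, fun x hx => h _ (hm hx)⟩

lemma hasLogOn_of_near_one (hf : ContinuousOn f A) (h : ∀ x ∈ A, ‖f x - 1‖ < 1) :
    HasLogOn f A := by
  have hs : ∀ x ∈ A, f x ∈ Complex.slitPlane := by
    intro x hx
    have := Complex.mem_slitPlane_of_norm_lt_one (h x hx)
    simpa using this
  refine ⟨fun x => Complex.log (f x), fun x hx => (hf x hx).clog (hs x hx), fun x hx => ?_⟩
  exact Complex.exp_log (Complex.slitPlane_ne_zero (hs x hx))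

lemma hasLogOn_const {c : ℂ} (hc : c ≠ 0) : HasLogOn (fun _ : X => c) A :=
  ⟨fun _ => Complex.log c, continuousOn_const, fun _ _ => Complex.exp_log hc⟩

lemma hasLogOn_iff_restrict : HasLogOn f A ↔ HasLogOn (A.domRestrict f) univ := by
  constructor
  · rintro ⟨L, hL, h⟩
    exact ⟨A.domRestrict L, (continuousOn_iff_continuous_domRestrict.1 hL).continuousOn,
      fun x _ => h x x.2⟩
  · rintro ⟨L, hL, h⟩
    refine ⟨fun x => open Classical in if hx : x ∈ A then L ⟨x, hx⟩ else 0, ?_, ?_⟩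
    · rw [continuousOn_iff_continuous_domRestrict]
      convert continuousOn_univ.1 hL using 1
      ext x
      simp
    · intro x hx
      have := h ⟨x, hx⟩ (mem_univ _)
      simp only [hx, dite_true]
      exact this

/-- Homotopy invariance, type-level version. -/
lemma hasLog_param_aux {T : Type*} [TopologicalSpace T] [PreconnectedSpace T] [CompactSpace X]
    (H : T → X → ℂ) (hH : Continuous (Function.uncurry H)) (h0 : ∀ t x, H t x ≠ 0) {s : T}
    (h : HasLogOn (H s) univ) (t : T) : HasLogOn (H t) univ := by
  have key : ∀ t₀ : T, ∀ᶠ t in 𝓝 t₀, ∀ x : X, ‖H t x / H t₀ x - 1‖ < 1 := by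
    intro t₀
    have : ∀ᶠ t in 𝓝 t₀, ∀ x ∈ (univ : Set X), ‖H t x / H t₀ x - 1‖ < 1 := by
      apply IsCompact.eventually_forall_of_forall_eventually isCompact_univ
      intro x _
      have hc : ContinuousAt (fun p : T × X => ‖H p.1 p.2 / H t₀ p.2 - 1‖) (t₀, x) := by
        refine ContinuousAt.norm (ContinuousAt.sub (ContinuousAt.div ?_ ?_ (h0 _ _))
          continuousAt_const)
        · exact hH.continuousAt
        · exact (hH.comp (continuous_const.prodMk continuous_snd)).continuousAt
      have h1 : (fun p : T × X => ‖H p.1 p.2 / H t₀ p.2 - 1‖) (t₀, x) < 1 := by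
        simp [div_self (h0 t₀ x)]
      have := hc.eventually (gt_mem_nhds h1)
      simpa using this
    simpa using this
  have hcont : ∀ t, Continuous (H t) := fun t => hH.comp (continuous_const.prodMk continuous_id)
  have hloc : ∀ t₀ : T, ∀ᶠ t in 𝓝 t₀, (HasLogOn (H t) univ ↔ HasLogOn (H t₀) univ) := by
    intro t₀
    filter_upwards [key t₀] with t ht
    have h1 : HasLogOn (fun x => H t x / H t₀ x) univ :=
      hasLogOn_of_near_one ((hcont t).div (hcont t₀) (h0 t₀)).continuousOn (fun x _ => ht x)
    constructor
    · intro h2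
      refine (h2.div h1).congr (fun x _ => ?_)
      have := h0 t x
      have := h0 t₀ x
      field_simp
    · intro h2
      refine (h2.mul h1).congr (fun x _ => ?_)
      have := h0 t₀ x
      field_simp
  have hopen : IsClopen {t | HasLogOn (H t) univ} := by
    constructor
    · rw [← isOpen_compl_iff, isOpen_iff_mem_nhds]
      intro t₀ ht₀
      filter_upwards [hloc t₀] with t ht h'
      exact ht₀ (ht.1 h')
    · rw [isOpen_iff_mem_nhds]
      intro t₀ ht₀
      filter_upwards [hloc t₀] with t ht
      exact ht.2 ht₀
  have := hopen.eq_univ ⟨s, h⟩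
  have ht : t ∈ {t | HasLogOn (H t) univ} := this ▸ mem_univ t
  exact ht

/-- Homotopy invariance of having a logarithm. -/
lemma hasLog_param {T : Type*} [TopologicalSpace T] {C : Set T} (hC : IsPreconnected C)
    (hA : IsCompact A) (H : T → X → ℂ) (hH : ContinuousOn (Function.uncurry H) (C ×ˢ A))
    (h0 : ∀ t ∈ C, ∀ x ∈ A, H t x ≠ 0) {s t : T} (hs : s ∈ C) (ht : t ∈ C)
    (h : HasLogOn (H s) A) : HasLogOn (H t) A := by
  have := isPreconnected_iff_preconnectedSpace.1 hC
  have := isCompact_iff_compactSpace.1 hA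
  rw [hasLogOn_iff_restrict] at h ⊢
  refine hasLog_param_aux (T := C) (X := A) (fun t x => H t x) ?_ (fun t x => h0 t t.2 x x.2)
    (s := ⟨s, hs⟩) h ⟨t, ht⟩
  have hm : Continuous (fun p : C × A => ((p.1 : T), (p.2 : X))) := by fun_prop
  exact hH.comp_continuous hm (fun p => ⟨p.1.2, p.2.2⟩)

lemma hasLogOn_starConvex {E : Type*} [NormedAddCommGroup E] [NormedSpace ℝ E] {A : Set E}
    {f : E → ℂ} (hA : IsCompact A) {a : E} (hs : StarConvex ℝ a A) (hne : A.Nonempty)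
    (hf : ContinuousOn f A) (h0 : ∀ x ∈ A, f x ≠ 0) : HasLogOn f A := by
  have hm : ∀ p ∈ (Icc (0:ℝ) 1) ×ˢ A, a + p.1 • (p.2 - a) ∈ A := by
    rintro ⟨t, x⟩ ⟨ht, hx⟩
    have := hs hx (a := 1 - t) (b := t) (by linarith [ht.2]) ht.1 (by ring)
    convert this using 1
    simp only [smul_sub, sub_smul, one_smul]
    abel
  have := hasLog_param (isPreconnected_Icc (a := (0:ℝ)) (b := 1)) hA
    (fun t x => f (a + t • (x - a))) (hf.comp (by fun_prop) hm)
    (fun t ht x hx => h0 _ (hm (t, x) ⟨ht, hx⟩)) (s := 0) (t := 1) (by simp) (by simp)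
    (by
      have ha : a ∈ A := hs.mem hne
      simpa using hasLogOn_const (X := E) (A := A) (h0 a ha))
  exact this.congr (fun x hx => by simp)

lemma log_unique {D : X → ℂ} (hA : IsPreconnected A) (hD : ContinuousOn D A) {c : ℂ}
    (h : ∀ x ∈ A, Complex.exp (D x) = c) {x y : X} (hx : x ∈ A) (hy : y ∈ A) : D x = D y := by
  have hintq : ∀ z ∈ A, ∃ n : ℤ, D z - D x = n * (2 * Real.pi * Complex.I) := by
    intro z hz
    have : Complex.exp (D z - D x) = 1 := by
      rw [Complex.exp_sub, h z hz, h x hx, div_self]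
      rw [← h x hx]; exact Complex.exp_ne_zero _
    obtain ⟨n, hn⟩ := Complex.exp_eq_one_iff.1 this
    exact ⟨n, hn⟩
  let r : X → ℝ := fun z => (D z - D x).im / (2 * Real.pi)
  have hr : ContinuousOn r A := by
    have := (Complex.continuous_im.comp_continuousOn (hD.sub (continuousOn_const (c := D x))))
    exact this.div_const _
  have hrn : ∀ z ∈ A, ∀ n : ℤ, D z - D x = n * (2 * Real.pi * Complex.I) → r z = n := by
    intro z hz n hn
    simp only [r, hn]
    have : ((n:ℂ) * (2 * Real.pi * Complex.I)).im = n * (2 * Real.pi) := by simp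
    rw [this]; field_simp
  have hpre : IsPreconnected (r '' A) := hA.image r hr
  have hsub : (r '' A).Subsingleton := by
    intro u hu v hv
    by_contra huv
    wlog hlt : u < v generalizing u v
    · exact this hv hu (Ne.symm huv) (lt_of_le_of_ne (not_lt.1 hlt) (Ne.symm huv))
    have hoc := hpre.ordConnected
    obtain ⟨z, hz, rfl⟩ := hu
    obtain ⟨n, hn⟩ := hintq z hz
    have h1 := hrn z hz n hn
    obtain ⟨w, hw, rfl⟩ := hv
    obtain ⟨m, hm⟩ := hintq w hw
    have h2 := hrn w hw m hm
    have hmn : n + 1 ≤ m := by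
      have : (n:ℝ) < m := by rw [← h1, ← h2]; exact hlt
      exact_mod_cast this
    have hmn' : (n:ℝ) + 1 ≤ m := by exact_mod_cast hmn
    have : (n:ℝ) + 1/2 ∈ r '' A := hoc.out ⟨z, hz, rfl⟩ ⟨w, hw, rfl⟩ ⟨by linarith, by linarith⟩
    obtain ⟨u, hu, hu'⟩ := this
    obtain ⟨k, hk⟩ := hintq u hu
    have h3 := hrn u hu k hk
    rw [h3] at hu'
    have h4 : (n:ℝ) < k := by linarith
    have h5 : (k:ℝ) < n + 1 := by linarith
    have h6 : n < k := by exact_mod_cast h4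
    have h7 : k < n + 1 := by exact_mod_cast h5
    omega
  obtain ⟨n, hn⟩ := hintq y hy
  have h1 := hrn y hy n hn
  have h2 : r x = 0 := by simp [r]
  have h3 := hsub ⟨x, hx, rfl⟩ ⟨y, hy, rfl⟩
  have : (n:ℝ) = 0 := by rw [← h1, ← h3, h2]
  have : n = 0 := by exact_mod_cast this
  rw [this] at hn
  simp at hn
  exact (sub_eq_zero.1 hn).symm

end logs

lemma no_log_odd {g : ℂ → ℂ} {r : ℝ} (hr : 0 < r) (hodd : ∀ x ∈ sphere (0:ℂ) r, g (-x) = - g x) :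
    ¬ HasLogOn g (sphere 0 r) := by
  rintro ⟨L, hL, h⟩
  have hpre : IsPreconnected (sphere (0:ℂ) r) :=
    isPreconnected_sphere (by rw [Complex.rank_real_complex]; norm_num) 0 r
  have hneg : ∀ x ∈ sphere (0:ℂ) r, -x ∈ sphere (0:ℂ) r := by intro x hx; simpa using hx
  have hc : ContinuousOn (fun x => L (-x) - L x) (sphere (0:ℂ) r) :=
    (hL.comp continuousOn_neg hneg).sub hL
  have hg : ∀ x ∈ sphere (0:ℂ) r, Complex.exp (L (-x) - L x) = -1 := by
    intro x hx
    rw [Complex.exp_sub, h _ (hneg x hx), h x hx, hodd x hx, neg_div, div_self]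
    rw [← h x hx]; exact Complex.exp_ne_zero _
  have hx : (r:ℂ) ∈ sphere (0:ℂ) r := by simp [hr.le]
  have := log_unique hpre hc hg hx (hneg _ hx)
  simp only [neg_neg] at this
  have h0 : L (-(r:ℂ)) - L r = 0 := by linear_combination this / 2
  have h1 := hg _ hx
  rw [h0] at h1
  simp at h1
  norm_num [Complex.ext_iff] at h1

/-- An injective map of a closed disc winds around its centre. -/
lemma no_log_of_injOn {f : ℂ → ℂ} {r : ℝ} (hr : 0 < r) (hf : ContinuousOn f (closedBall 0 r))
    (hi : InjOn f (closedBall 0 r)) : ¬ HasLogOn (fun x => f x - f 0) (sphere 0 r) := by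
  intro h
  let H : ℝ → ℂ → ℂ := fun t x => f (((1 + t)⁻¹ : ℝ) * x) - f (-((t * (1+t)⁻¹ : ℝ) * x))
  have hA : ∀ p ∈ Icc (0:ℝ) 1 ×ˢ sphere (0:ℂ) r, (((1 + p.1)⁻¹ : ℝ) : ℂ) * p.2 ∈ closedBall (0:ℂ) r := by
    rintro ⟨t, x⟩ ⟨ht, hx⟩
    simp at hx ⊢
    have h1 := ht.1
    simp at h1
    have h2 : ‖(1 + t : ℂ)‖ = 1 + t := by
      have : (1 + t : ℂ) = ((1 + t : ℝ) : ℂ) := by push_cast; rfl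
      rw [this, Complex.norm_real, Real.norm_of_nonneg (by linarith)]
    rw [h2, hx]
    exact mul_le_of_le_one_left hr.le (inv_le_one_of_one_le₀ (by linarith))
  have hB : ∀ p ∈ Icc (0:ℝ) 1 ×ˢ sphere (0:ℂ) r, -(((p.1 * (1 + p.1)⁻¹ : ℝ) : ℂ) * p.2) ∈ closedBall (0:ℂ) r := by
    rintro ⟨t, x⟩ ⟨ht, hx⟩
    simp only [mem_closedBall, dist_zero_right, norm_neg, norm_mul, Complex.norm_real, mem_sphere] at hx ⊢
    have h1 := ht.1
    simp at h1
    have h3 : 0 ≤ (1+t)⁻¹ := by positivity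
    rw [hx, Real.norm_of_nonneg h1, Real.norm_of_nonneg h3]
    refine mul_le_of_le_one_left hr.le ?_
    rw [← div_eq_mul_inv, div_le_one (by linarith)]
    linarith
  have hk : HasLogOn (H 1) (sphere 0 r) := by
    refine hasLog_param (isPreconnected_Icc (a := (0:ℝ)) (b := 1)) (isCompact_sphere 0 r) H ?_ ?_
      (s := 0) (t := 1) (by simp) (by simp) (h.congr (fun x _ => by simp [H]))
    · have hne : ∀ p ∈ Icc (0:ℝ) 1 ×ˢ sphere (0:ℂ) r, 1 + p.1 ≠ 0 := by
        rintro ⟨t, x⟩ ⟨ht, hx⟩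
        have := ht.1
        simp at this ⊢; linarith
      have hinv : ContinuousOn (fun p : ℝ × ℂ => (1 + p.1)⁻¹) (Icc (0:ℝ) 1 ×ˢ sphere (0:ℂ) r) :=
        ContinuousOn.inv₀ (by fun_prop) hne
      have hinv' : ContinuousOn (fun p : ℝ × ℂ => (((1 + p.1)⁻¹ : ℝ) : ℂ)) (Icc (0:ℝ) 1 ×ˢ sphere (0:ℂ) r) :=
        Complex.continuous_ofReal.comp_continuousOn hinv
      refine ContinuousOn.sub (hf.comp (hinv'.mul continuousOn_snd) hA) (hf.comp ?_ hB)
      refine ContinuousOn.neg (ContinuousOn.mul ?_ continuousOn_snd)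
      exact Complex.continuous_ofReal.comp_continuousOn (continuousOn_fst.mul hinv)
    · intro t ht x hx h0
      have := hi (hA (t, x) ⟨ht, hx⟩) (hB (t, x) ⟨ht, hx⟩) (sub_eq_zero.1 h0)
      simp only at this
      have hx0 : x ≠ 0 := by rintro rfl; simp at hx; exact hr.ne hx
      have h1 : (((1 + t)⁻¹ : ℝ) : ℂ) + ((t * (1+t)⁻¹ : ℝ) : ℂ) = 0 := by
        have : ((((1 + t)⁻¹ : ℝ) : ℂ) + ((t * (1+t)⁻¹ : ℝ) : ℂ)) * x = 0 := by linear_combination this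
        exact (mul_eq_zero.1 this).resolve_right hx0
      have h2 : ((1 + t)⁻¹ : ℝ) + (t * (1+t)⁻¹ : ℝ) = 0 := by exact_mod_cast h1
      have h3 := ht.1
      have : 0 < (1 + t)⁻¹ + t * (1+t)⁻¹ := by positivity
      linarith
  refine no_log_odd hr ?_ hk
  intro x hx
  simp only [H]
  norm_num

/-- Invariance of domain in the plane, local version. -/
lemma invariance_of_domain_ball {f : ℂ → ℂ} {r : ℝ} (hr : 0 < r) (hf : ContinuousOn f (closedBall 0 r))
    (hi : InjOn f (closedBall 0 r)) : f '' closedBall 0 r ∈ 𝓝 (f 0) := by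
  have hne : ∀ x ∈ sphere (0:ℂ) r, f x - f 0 ≠ 0 := by
    intro x hx h0
    have := hi (sphere_subset_closedBall hx) (by simp [hr.le]) (sub_eq_zero.1 h0)
    subst this
    simp at hx; exact hr.ne hx
  obtain ⟨m, hm, hmle⟩ : ∃ m > 0, ∀ x ∈ sphere (0:ℂ) r, m ≤ ‖f x - f 0‖ := by
    have hc : ContinuousOn (fun x => ‖f x - f 0‖) (sphere (0:ℂ) r) :=
      ((hf.mono sphere_subset_closedBall).sub continuousOn_const).norm
    have hcpt := isCompact_sphere (0:ℂ) r
    obtain ⟨x, hx, hxm⟩ := hcpt.exists_isMinOn ⟨(r:ℂ), by simp [hr.le]⟩ hc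
    exact ⟨‖f x - f 0‖, norm_pos_iff.2 (hne x hx), fun y hy => hxm hy⟩
  refine Filter.mem_of_superset (ball_mem_nhds (f 0) hm) ?_
  intro p hp
  by_contra hpn
  have h1 : HasLogOn (fun x => f x - p) (closedBall 0 r) := by
    refine hasLogOn_starConvex (isCompact_closedBall 0 r)
      ((convex_closedBall (0:ℂ) r).starConvex (x := 0) (by simp [hr.le])) ⟨0, by simp [hr.le]⟩
      (hf.sub continuousOn_const) ?_
    intro x hx h0
    exact hpn ⟨x, hx, sub_eq_zero.1 h0⟩
  have h1' := h1.mono sphere_subset_closedBall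
  have h2 : HasLogOn (fun x => (f x - p) / (f x - f 0)) (sphere 0 r) := by
    refine hasLogOn_of_near_one ?_ ?_
    · exact ((hf.mono sphere_subset_closedBall).sub continuousOn_const).div
        ((hf.mono sphere_subset_closedBall).sub continuousOn_const) hne
    · intro x hx
      have : (f x - p) / (f x - f 0) - 1 = (f 0 - p) / (f x - f 0) := by
        have := hne x hx
        field_simp
        ring
      rw [this, norm_div, div_lt_one (lt_of_lt_of_le hm (hmle x hx))]
      refine lt_of_lt_of_le ?_ (hmle x hx)
      rw [mem_ball, dist_eq_norm] at hp
      rwa [norm_sub_rev]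
  refine no_log_of_injOn hr hf hi ((h1'.div h2).congr ?_)
  intro x hx
  have h3 := hne x hx
  have h4 : f x - p ≠ 0 := fun h0 => hpn ⟨x, sphere_subset_closedBall hx, sub_eq_zero.1 h0⟩
  field_simp


lemma log_mismatch {X : Type*} [TopologicalSpace X] {F L M : X → ℂ} {P : Set X}
    (hP : IsPreconnected P) (hL : ContinuousOn L P) (hM : ContinuousOn M P)
    (hLF : ∀ x ∈ P, Complex.exp (L x) = F x) (hMF : ∀ x ∈ P, Complex.exp (M x) = F x) :
    ∃ n : ℤ, ∀ x ∈ P, L x = M x + n * (2 * Real.pi * Complex.I) := by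
  rcases P.eq_empty_or_nonempty with rfl | ⟨x₀, hx₀⟩
  · exact ⟨0, by simp⟩
  have h1 : ∀ x ∈ P, Complex.exp (L x - M x) = 1 := by
    intro x hx
    rw [Complex.exp_sub, hLF x hx, hMF x hx, div_self]
    rw [← hLF x hx]; exact Complex.exp_ne_zero _
  obtain ⟨n, hn⟩ := Complex.exp_eq_one_iff.1 (h1 x₀ hx₀)
  refine ⟨n, fun x hx => ?_⟩
  have := log_unique hP (hL.sub hM) h1 hx hx₀
  simp only [Pi.sub_apply] at this
  linear_combination this + hn

lemma glue_log {X : Type*} [TopologicalSpace X] {F L M : X → ℂ} {A B : Set X}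
    (hA : IsClosed A) (hB : IsClosed B) (hL : ContinuousOn L A) (hM : ContinuousOn M B)
    (hLF : ∀ x ∈ A, Complex.exp (L x) = F x) (hMF : ∀ x ∈ B, Complex.exp (M x) = F x)
    (h : ∀ x ∈ A ∩ B, L x = M x) : HasLogOn F (A ∪ B) := by
  classical
  have h1 : EqOn (fun x => if x ∈ A then L x else M x) L A := by
    intro x hx; simp [hx]
  have h2 : EqOn (fun x => if x ∈ A then L x else M x) M B := by
    intro x hx
    by_cases hxA : x ∈ A
    · simp [hxA, h x ⟨hxA, hx⟩]
    · simp [hxA]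
  refine ⟨fun x => if x ∈ A then L x else M x, ?_, ?_⟩
  · exact (hL.congr h1).union_of_isClosed (hM.congr h2) hA hB
  · rintro x (hx | hx)
    · rw [h1 hx, hLF x hx]
    · rw [h2 hx, hMF x hx]

/-- Finite products of powers of `z - t`, `t ∈ T`. -/
inductive GenFun (T : Set ℂ) : (ℂ → ℂ) → Prop
  | one : GenFun T (fun _ => 1)
  | mul {g : ℂ → ℂ} {t : ℂ} (ht : t ∈ T) (k : ℤ) (hg : GenFun T g) :
      GenFun T (fun z => g z * (z - t) ^ k)

lemma GenFun.mono {T T' : Set ℂ} (h : T ⊆ T') {g : ℂ → ℂ} (hg : GenFun T g) : GenFun T' g := by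
  induction hg with
  | one => exact .one
  | mul ht k _ ih => exact .mul (h ht) k ih

lemma GenFun.ne_zero {T : Set ℂ} {g : ℂ → ℂ} (hg : GenFun T g) {z : ℂ} (hz : z ∉ T) : g z ≠ 0 := by
  induction hg with
  | one => simp
  | mul ht k _ ih =>
    refine mul_ne_zero ih (zpow_ne_zero _ (sub_ne_zero.2 ?_))
    rintro rfl; exact hz ht

lemma GenFun.continuousOn {T : Set ℂ} {g : ℂ → ℂ} (hg : GenFun T g) : ContinuousOn g Tᶜ := by
  induction hg with
  | one => exact continuousOn_const
  | @mul g t ht k _ ih =>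
    refine ih.mul (ContinuousOn.zpow₀ (by fun_prop) _ ?_)
    intro z hz
    left
    refine sub_ne_zero.2 ?_
    rintro rfl; exact hz ht

lemma HasLogOn.zpow {X : Type*} [TopologicalSpace X] {f : X → ℂ} {A : Set X} (h : HasLogOn f A)
    (k : ℤ) : HasLogOn (fun x => f x ^ k) A := by
  obtain ⟨L, hL, h⟩ := h
  exact ⟨fun x => k * L x, continuousOn_const.mul hL, fun x hx => by
    rw [Complex.exp_int_mul, h x hx]⟩

lemma GenFun.hasLogOn {T : Set ℂ} {g : ℂ → ℂ} (hg : GenFun T g) {M : Set ℂ}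
    (h : ∀ t ∈ T, HasLogOn (fun z => z - t) M) : HasLogOn g M := by
  induction hg with
  | one => exact hasLogOn_const one_ne_zero
  | mul ht k _ ih => exact ih.mul ((h _ ht).zpow k)

/-- the closed unit square with lower left corner `(i,j)`. -/
def usq (p : ℤ × ℤ) : Set ℂ := Icc (p.1:ℝ) (p.1 + 1) ×ℂ Icc (p.2:ℝ) (p.2+1)

/-- its centre -/
noncomputable def csq (p : ℤ × ℤ) : ℂ := ⟨p.1 + 1/2, p.2 + 1/2⟩

lemma mem_usq {p : ℤ × ℤ} {z : ℂ} :
    z ∈ usq p ↔ (p.1:ℝ) ≤ z.re ∧ z.re ≤ p.1 + 1 ∧ (p.2:ℝ) ≤ z.im ∧ z.im ≤ p.2 + 1 := by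
  simp [usq, Complex.mem_reProdIm, and_assoc]

lemma isCompact_usq (p : ℤ × ℤ) : IsCompact (usq p) := isCompact_Icc.reProdIm isCompact_Icc

lemma convex_usq (p : ℤ × ℤ) : Convex ℝ (usq p) := by
  rw [convex_iff_forall_pos]
  intro x hx y hy a b ha hb hab
  rw [mem_usq] at *
  simp only [Complex.add_re, Complex.add_im, Complex.smul_re, Complex.smul_im, smul_eq_mul]
  obtain ⟨h1, h2, h3, h4⟩ := hx
  obtain ⟨k1, k2, k3, k4⟩ := hy
  have : b = 1 - a := by linarith
  subst this
  refine ⟨?_, ?_, ?_, ?_⟩ <;> nlinarith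

lemma csq_mem_usq {p q : ℤ × ℤ} (h : csq p ∈ usq q) : p = q := by
  rw [mem_usq] at h
  simp only [csq] at h
  obtain ⟨h1, h2, h3, h4⟩ := h
  have a1 : (q.1:ℝ) < p.1 + 1 := by linarith
  have a2 : (p.1:ℝ) < q.1 + 1 := by linarith
  have a3 : (q.2:ℝ) < p.2 + 1 := by linarith
  have a4 : (p.2:ℝ) < q.2 + 1 := by linarith
  norm_cast at a1 a2 a3 a4
  ext <;> omega

lemma grid_log (s : Finset (ℤ × ℤ)) (f : ℂ → ℂ) (hf : ContinuousOn f (⋃ p ∈ s, usq p))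
    (h0 : ∀ z ∈ ⋃ p ∈ s, usq p, f z ≠ 0) :
    ∃ g, GenFun {t | ∃ p, p ∉ s ∧ (p.1 + 1, p.2) ∈ s ∧ t = csq p} g ∧
      HasLogOn (fun z => f z * g z) (⋃ p ∈ s, usq p) := by
  classical
  induction hn : s.card generalizing s with
  | zero =>
    have : s = ∅ := Finset.card_eq_zero.1 hn
    subst this
    exact ⟨_, .one, 0, by simp, by simp⟩
  | succ n ih =>
    have hne : s.Nonempty := Finset.card_pos.1 (by omega)
    obtain ⟨⟨i, j⟩, hij, hmax⟩ := s.exists_max_image (fun p => toLex p) hne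
    set s' := s.erase (i, j) with hs'
    have hcard : s'.card = n := by rw [hs', Finset.card_erase_of_mem hij]; omega
    have hsub : ∀ p ∈ s', p ∈ s := fun p hp => Finset.mem_of_mem_erase hp
    have hlt : ∀ p ∈ s', p.1 < i ∨ p.1 = i ∧ p.2 < j := by
      rintro ⟨a, b⟩ hp
      have h1 := hmax _ (hsub _ hp)
      have h2 : (a, b) ≠ (i, j) := Finset.ne_of_mem_erase hp
      have := Prod.Lex.toLex_le_toLex.1 h1
      simp only [ne_eq, Prod.mk.injEq] at h2 this ⊢
      omega
    have hU : (⋃ p ∈ s, usq p) = (⋃ p ∈ s', usq p) ∪ usq (i, j) := by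
      ext z
      simp only [mem_iUnion, mem_union, hs', Finset.mem_erase]
      constructor
      · rintro ⟨p, hp, hz⟩
        by_cases hpe : p = (i, j)
        · right; rwa [← hpe]
        · left; exact ⟨p, ⟨hpe, hp⟩, hz⟩
      · rintro (⟨p, ⟨_, hp⟩, hz⟩ | hz)
        · exact ⟨p, hp, hz⟩
        · exact ⟨_, hij, hz⟩
    set A := ⋃ p ∈ s', usq p with hA
    have hAcl : IsClosed A := by
      apply isClosed_biUnion_finset
      intro p _; exact (isCompact_usq p).isClosed
    have hqcl : IsClosed (usq (i, j)) := (isCompact_usq _).isClosed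
    obtain ⟨g, hg, hlog⟩ := ih s' (hf.mono (by rw [hU]; exact subset_union_left))
      (fun z hz => h0 z (by rw [hU]; exact Or.inl hz)) hcard
    set T := {t | ∃ p, p ∉ s ∧ (p.1 + 1, p.2) ∈ s ∧ t = csq p} with hT
    have hgT : GenFun T g := by
      refine hg.mono ?_
      rintro t ⟨p, hp, hp', rfl⟩
      refine ⟨p, ?_, hsub _ hp', rfl⟩
      intro hps
      have : p = (i, j) := by
        by_contra hpe
        exact hp (Finset.mem_erase.2 ⟨hpe, hps⟩)
      subst this
      have := hlt _ hp'
      simp at this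
    have hTU : ∀ z ∈ ⋃ p ∈ s, usq p, z ∉ T := by
      rintro z hz ⟨p, hp, _, rfl⟩
      simp only [mem_iUnion] at hz
      obtain ⟨q, hq, hz⟩ := hz
      exact hp (csq_mem_usq hz ▸ hq)
    have hqU : usq (i, j) ⊆ ⋃ p ∈ s, usq p := by rw [hU]; exact subset_union_right
    have hAU : A ⊆ ⋃ p ∈ s, usq p := by rw [hU]; exact subset_union_left
    set F := fun z => f z * g z with hF
    have hFq : HasLogOn F (usq (i, j)) := by
      have hne : (usq (i, j)).Nonempty := ⟨⟨i, j⟩, by simp [mem_usq]⟩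
      obtain ⟨x, hx⟩ := hne
      refine hasLogOn_starConvex (isCompact_usq _) ((convex_usq _).starConvex hx) ⟨x, hx⟩ ?_ ?_
      · exact (hf.mono hqU).mul (hgT.continuousOn.mono (fun z hz => hTU z (hqU hz)))
      · intro z hz
        exact mul_ne_zero (h0 z (hqU hz)) (hgT.ne_zero (hTU z (hqU hz)))
    obtain ⟨L, hL, hLF⟩ := hlog
    obtain ⟨M, hM, hMF⟩ := hFq
    -- the intersection
    have hintq : ∀ z ∈ A ∩ usq (i, j), (z.im = j ∧ (i, j-1) ∈ s') ∨ (z.re = i ∧ z.im = j) ∨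
        (z.re = i ∧ (i-1, j) ∈ s') ∨ (z.re = i ∧ z.im = j + 1) := by
      rintro z ⟨hzA, hzq⟩
      simp only [hA, mem_iUnion] at hzA
      obtain ⟨⟨a, b⟩, hab, hz⟩ := hzA
      have h1 := hlt _ hab
      rw [mem_usq] at hz hzq
      simp only at hz hzq h1
      obtain ⟨u1, u2, u3, u4⟩ := hz
      obtain ⟨v1, v2, v3, v4⟩ := hzq
      have w1 : (i:ℝ) ≤ a + 1 := by linarith
      have w2 : (j:ℝ) ≤ b + 1 := by linarith
      have w3 : (b:ℝ) ≤ j + 1 := by linarith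
      norm_cast at w1 w2 w3
      rcases h1 with h1 | ⟨h1, h2⟩
      · have ha : a = i - 1 := by omega
        have hzre : z.re = i := by
          subst ha; push_cast at *; linarith
        have hb : b = j - 1 ∨ b = j ∨ b = j + 1 := by omega
        rcases hb with rfl | rfl | rfl
        · right; left; refine ⟨hzre, ?_⟩; push_cast at *; linarith
        · right; right; left; exact ⟨hzre, ha ▸ hab⟩
        · right; right; right; refine ⟨hzre, ?_⟩; push_cast at *; linarith
      · have hb : b = j - 1 := by omega
        left
        refine ⟨?_, by rw [← h1, ← hb]; exact hab⟩
        subst hb; push_cast at *; linarith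
    have hbotA : (i, j-1) ∈ s' → ∀ z : ℂ, z.im = j → (i:ℝ) ≤ z.re → z.re ≤ i + 1 → z ∈ A := by
      intro h z h1 h2 h3
      simp only [hA, mem_iUnion]
      refine ⟨_, h, ?_⟩
      rw [mem_usq]; push_cast
      refine ⟨h2, h3, ?_, ?_⟩ <;> linarith
    have hbotpre : IsPreconnected (A ∩ usq (i, j) ∩ {z | z.im = j}) := by
      by_cases h : (i, j-1) ∈ s'
      · have : A ∩ usq (i, j) ∩ {z | z.im = j} = usq (i, j) ∩ {z : ℂ | z.im = j} := by
          ext z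
          constructor
          · rintro ⟨⟨_, h1⟩, h2⟩; exact ⟨h1, h2⟩
          · rintro ⟨h1, h2⟩
            have h1' := mem_usq.1 h1
            exact ⟨⟨hbotA h z h2 h1'.1 h1'.2.1, h1⟩, h2⟩
        rw [this]
        refine Convex.isPreconnected ((convex_usq _).inter ?_)
        rw [convex_iff_forall_pos]
        intro x hx y hy a b ha hb hab
        simp only [mem_ofPred_eq, Complex.add_im, Complex.smul_im, smul_eq_mul] at *
        rw [hx, hy, ← add_mul, hab, one_mul]
      · refine Set.Subsingleton.isPreconnected ?_
        have hh : ∀ z ∈ A ∩ usq (i, j) ∩ {z | z.im = j}, (i-1, j) ∉ s' ∨ True → z.re = i ∨ z.re = i := by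
          rintro z ⟨hz, hz2⟩ _
          rcases hintq z hz with h1 | h1 | h1 | h1
          · exact absurd h1.2 h
          · exact Or.inl h1.1
          · exact Or.inl h1.1
          · exact Or.inl h1.1
        intro x hx y hy
        apply Complex.ext
        · rw [or_self_iff.1 (hh x hx (Or.inr trivial)), or_self_iff.1 (hh y hy (Or.inr trivial))]
        · exact hx.2.trans hy.2.symm
    have hLM : ∀ {P : Set ℂ}, P ⊆ A ∩ usq (i, j) → IsPreconnected P →
        ∃ n : ℤ, ∀ x ∈ P, L x = M x + n * (2 * Real.pi * Complex.I) := by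
      intro P hP hpre
      exact log_mismatch (F := F) hpre (hL.mono fun z hz => (hP hz).1) (hM.mono fun z hz => (hP hz).2)
        (fun z hz => hLF z (hP hz).1) (fun z hz => hMF z (hP hz).2)
    by_cases hleft : (i-1, j) ∈ s'
    · -- connected intersection
      refine ⟨g, hgT, ?_⟩
      have hpre : IsPreconnected (A ∩ usq (i, j)) := by
        have hleq : A ∩ usq (i, j) = (A ∩ usq (i, j) ∩ {z | z.im = j}) ∪ (usq (i, j) ∩ {z | z.re = i}) := by
          ext z
          constructor
          · intro hz
            rcases hintq z hz with h1 | h1 | h1 | h1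
            · exact Or.inl ⟨hz, h1.1⟩
            · exact Or.inl ⟨hz, h1.2⟩
            · exact Or.inr ⟨hz.2, h1.1⟩
            · exact Or.inr ⟨hz.2, h1.1⟩
          · rintro (hz | ⟨hz, hz2⟩)
            · exact hz.1
            · refine ⟨?_, hz⟩
              simp only [hA, mem_iUnion]
              refine ⟨_, hleft, ?_⟩
              have := mem_usq.1 hz
              simp only [mem_ofPred_eq] at hz2
              rw [mem_usq]; push_cast
              refine ⟨?_, ?_, this.2.2.1, this.2.2.2⟩ <;> linarith
        have hBL : (⟨i, j⟩ : ℂ) ∈ usq (i, j) := by simp [mem_usq]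
        rw [hleq]
        refine IsPreconnected.union (⟨i, j⟩ : ℂ) ?_ ⟨hBL, rfl⟩ hbotpre ?_
        · refine ⟨⟨?_, hBL⟩, rfl⟩
          simp only [hA, mem_iUnion]
          refine ⟨_, hleft, ?_⟩
          rw [mem_usq]; push_cast
          refine ⟨?_, ?_, ?_, ?_⟩ <;> simp
        · refine Convex.isPreconnected ((convex_usq _).inter ?_)
          rw [convex_iff_forall_pos]
          intro x hx y hy a b ha hb hab
          simp only [mem_ofPred_eq, Complex.add_re, Complex.smul_re, smul_eq_mul] at *
          rw [hx, hy, ← add_mul, hab, one_mul]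
      obtain ⟨n, hn⟩ := hLM subset_rfl hpre
      rw [hU]
      refine glue_log hAcl hqcl hL (hM.add continuousOn_const) hLF ?_ hn
      intro z hz
      rw [Pi.add_apply, Complex.exp_add, hMF z hz, Complex.exp_int_mul_two_pi_mul_I, mul_one]
    · -- two pieces
      obtain ⟨m, hm⟩ := hLM (P := A ∩ usq (i, j) ∩ {z | z.im = j}) inter_subset_left hbotpre
      obtain ⟨n, hn⟩ := hLM (P := A ∩ usq (i, j) ∩ {z | z.re = i ∧ z.im = j + 1}) inter_subset_left
        (Set.Subsingleton.isPreconnected (by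
          rintro x ⟨_, hx⟩ y ⟨_, hy⟩
          exact Complex.ext (hx.1.trans hy.1.symm) (hx.2.trans hy.2.symm)))
      set t := csq (i-1, j) with ht
      have hnots : (i-1, j) ∉ s := by
        intro h
        exact hleft (Finset.mem_erase.2 ⟨by simp, h⟩)
      have htT : t ∈ T := ⟨(i-1, j), hnots, by simpa using hij, rfl⟩
      have htre : t.re = i - 1/2 := by simp [ht, csq]; ring
      have htim : t.im = j + 1/2 := by simp [ht, csq]
      -- two branches of `log (z - t)`
      have hA1 : ∀ z ∈ A, -(z - t) ∈ Complex.slitPlane := by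
        intro z hz
        rw [Complex.mem_slitPlane_iff]
        by_contra hcon
        push Not at hcon
        simp only [Complex.neg_re, Complex.neg_im, Complex.sub_re, Complex.sub_im, htre, htim] at hcon
        simp only [hA, mem_iUnion] at hz
        obtain ⟨⟨a, b⟩, hab, hz⟩ := hz
        have h1 := hlt _ hab
        rw [mem_usq] at hz
        simp only at hz h1
        obtain ⟨u1, u2, u3, u4⟩ := hz
        have w1 : (j:ℝ) < b + 1 := by linarith
        have w2 : (b:ℝ) < j + 1 := by linarith
        have w3 : (i:ℝ) < a + 2 := by linarith
        norm_cast at w1 w2 w3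
        have hb : b = j := by omega
        have ha : a = i - 1 := by omega
        rw [ha, hb] at hab
        exact hleft hab
      have hq1 : ∀ z ∈ usq (i, j), z - t ∈ Complex.slitPlane := by
        intro z hz
        rw [Complex.mem_slitPlane_iff]
        left
        have := (mem_usq.1 hz).1
        simp only [Complex.sub_re, htre]
        simp only at this
        linarith
      refine ⟨fun z => g z * (z - t) ^ (n - m), .mul htT _ hgT, ?_⟩
      rw [hU]
      have hcL : ContinuousOn (fun z => L z + (n - m : ℤ) * (Complex.log (-(z - t)) + Real.pi * Complex.I)) A := by
        refine hL.add (continuousOn_const.mul (ContinuousOn.add ?_ continuousOn_const))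
        exact ContinuousOn.clog (by fun_prop) hA1
      have hcM : ContinuousOn (fun z => M z + (n - m : ℤ) * Complex.log (z - t) + n * (2 * Real.pi * Complex.I)) (usq (i, j)) := by
        refine (hM.add (continuousOn_const.mul ?_)).add continuousOn_const
        exact ContinuousOn.clog (by fun_prop) hq1
      refine glue_log hAcl hqcl hcL hcM ?_ ?_ ?_
      · intro z hz
        simp only
        rw [Complex.exp_add, hLF z hz, Complex.exp_int_mul, Complex.exp_add,
          Complex.exp_log (Complex.slitPlane_ne_zero (hA1 z hz)), Complex.exp_pi_mul_I]
        simp only [hF]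
        rw [mul_neg_one, neg_neg, mul_assoc]
      · intro z hz
        simp only
        rw [Complex.exp_add, Complex.exp_add, hMF z hz, Complex.exp_int_mul,
          Complex.exp_log (Complex.slitPlane_ne_zero (hq1 z hz)), Complex.exp_int_mul_two_pi_mul_I]
        simp only [hF]
        rw [mul_one, mul_assoc]
      · intro z hz
        have key : (z.im = j) ∨ (z.re = i ∧ z.im = j + 1) := by
          rcases hintq z hz with h1 | h1 | h1 | h1
          · exact Or.inl h1.1
          · exact Or.inl h1.2
          · exact absurd h1.2 hleft
          · exact Or.inr h1
        rcases key with hk | hk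
        · have e1 := hm z ⟨hz, hk⟩
          have him : (z - t).im < 0 := by
            simp only [Complex.sub_im, htim, hk]; linarith
          have e2 : Complex.log (-(z - t)) = Complex.log (z - t) + Real.pi * Complex.I := by
            simp only [Complex.log, norm_neg, Complex.arg_neg_eq_arg_add_pi_of_im_neg him]
            push_cast; ring
          rw [e1, e2]; push_cast; ring
        · have e1 := hn z ⟨hz, hk⟩
          have him : 0 < (z - t).im := by
            simp only [Complex.sub_im, htim, hk.2]; linarith
          have e2 : Complex.log (-(z - t)) = Complex.log (z - t) - Real.pi * Complex.I := by
            simp only [Complex.log, norm_neg, Complex.arg_neg_eq_arg_sub_pi_of_im_pos him]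
            push_cast; ring
          rw [e1, e2]; push_cast; ring

lemma exists_usq (z : ℂ) : z ∈ usq (⌊z.re⌋, ⌊z.im⌋) := by
  rw [mem_usq]
  exact ⟨Int.floor_le _, (Int.lt_floor_add_one _).le, Int.floor_le _, (Int.lt_floor_add_one _).le⟩

lemma dist_usq {p : ℤ × ℤ} {x y : ℂ} (hx : x ∈ usq p) (hy : y ∈ usq p) : dist x y ≤ 2 := by
  rw [mem_usq] at hx hy
  rw [Complex.dist_eq]
  refine (Complex.norm_le_abs_re_add_abs_im _).trans ?_
  have h1 : |(x - y).re| ≤ 1 := by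
    rw [abs_le, Complex.sub_re]; constructor <;> linarith [hx.1, hx.2.1, hy.1, hy.2.1]
  have h2 : |(x - y).im| ≤ 1 := by
    rw [abs_le, Complex.sub_im]
    constructor <;> linarith [hx.2.2.1, hx.2.2.2, hy.2.2.1, hy.2.2.2]
  linarith

lemma hasLogOn_compact_aux {Ω : Set ℂ} (hb : Bornology.IsBounded Ω)
    {f : ℂ → ℂ} (hf : ContinuousOn f Ω) (h0 : ∀ z ∈ Ω, f z ≠ 0)
    {M : Set ℂ} (hM : IsCompact M) (hMΩ : M ⊆ Ω)
    (hsc : ∀ t ∉ Ω, HasLogOn (fun z => z - t) M)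
    (hd : ∀ x ∈ M, ∀ y ∉ Ω, 2 < dist x y) : HasLogOn f M := by
  have hfin : {p : ℤ × ℤ | usq p ⊆ Ω}.Finite := by
    obtain ⟨R, hR⟩ := hb.subset_closedBall 0
    refine (Set.finite_Icc ((⌊-R⌋, ⌊-R⌋) : ℤ × ℤ) (⌈R⌉, ⌈R⌉)).subset ?_
    rintro ⟨a, b⟩ hp
    have h1 : (⟨a, b⟩ : ℂ) ∈ closedBall (0:ℂ) R := hR (hp (by simp [mem_usq]))
    rw [mem_closedBall_zero_iff] at h1
    have h2 := abs_le.1 ((Complex.abs_re_le_norm _).trans h1)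
    have h3 := abs_le.1 ((Complex.abs_im_le_norm _).trans h1)
    simp only at h2 h3
    refine ⟨⟨?_, ?_⟩, ⟨?_, ?_⟩⟩ <;> simp only
    · exact_mod_cast (Int.floor_le (-R)).trans h2.1
    · exact_mod_cast (Int.floor_le (-R)).trans h3.1
    · exact_mod_cast h2.2.trans (Int.le_ceil R)
    · exact_mod_cast h3.2.trans (Int.le_ceil R)
  set s := hfin.toFinset with hs
  have hsΩ : ⋃ p ∈ s, usq p ⊆ Ω := by
    intro z hz
    simp only [mem_iUnion] at hz
    obtain ⟨p, hp, hz⟩ := hz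
    exact (hfin.mem_toFinset.1 hp) hz
  have hMs : M ⊆ ⋃ p ∈ s, usq p := by
    intro z hz
    simp only [mem_iUnion]
    refine ⟨_, ?_, exists_usq z⟩
    rw [hs, hfin.mem_toFinset]
    intro y hy
    by_contra hcon
    exact absurd (hd z hz y hcon) (not_lt.2 (dist_usq (exists_usq z) hy))
  obtain ⟨g, hg, hlog⟩ := grid_log s f (hf.mono hsΩ) (fun z hz => h0 z (hsΩ hz))
  have hgM : HasLogOn g M := by
    refine hg.hasLogOn ?_
    rintro t ⟨p, hp, _, rfl⟩
    rw [hs, hfin.mem_toFinset] at hp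
    obtain ⟨y, hy, hyΩ⟩ := not_subset.1 hp
    have hpM : ∀ z ∈ M, z ∉ usq p := fun z hz hzp =>
      absurd (hd z hz y hyΩ) (not_lt.2 (dist_usq hzp hy))
    refine hasLog_param (convex_usq p).isPreconnected hM (fun t z => z - t) (by fun_prop) ?_ hy ?_
      (hsc y hyΩ)
    · intro t ht x hx h
      rw [sub_eq_zero.1 h] at hx
      exact hpM _ hx ht
    · rw [mem_usq, csq]; simp only
      refine ⟨?_, ?_, ?_, ?_⟩ <;> linarith
  refine ((hlog.mono hMs).div hgM).congr ?_
  intro z hz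
  obtain ⟨L, -, hL⟩ := hgM
  have : g z ≠ 0 := by rw [← hL z hz]; exact Complex.exp_ne_zero _
  field_simp

theorem hasLogOn_compact {Ω : Set ℂ} (hΩ : IsOpen Ω) (hb : Bornology.IsBounded Ω)
    (hsc : ∀ M ⊆ Ω, IsCompact M → ∀ t ∉ Ω, HasLogOn (fun z => z - t) M)
    {f : ℂ → ℂ} (hf : ContinuousOn f Ω) (h0 : ∀ z ∈ Ω, f z ≠ 0)
    {M : Set ℂ} (hM : IsCompact M) (hMΩ : M ⊆ Ω) : HasLogOn f M := by
  obtain ⟨δ, hδ, hd⟩ := hM.exists_thickening_subset_open hΩ hMΩ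
  set h : ℝ := δ / 4 with hh
  have hpos : 0 < h := by positivity
  have hne : (h:ℂ) ≠ 0 := by exact_mod_cast hpos.ne'
  set u : ℂ → ℂ := fun z => h * z with hu
  set v : ℂ → ℂ := fun z => (h:ℂ)⁻¹ * z with hv
  have huv : ∀ z, u (v z) = z := fun z => by simp [hu, hv, hne]
  have hvu : ∀ z, v (u z) = z := fun z => by simp [hu, hv, hne]
  have hcu : Continuous u := by fun_prop
  have hcv : Continuous v := by fun_prop
  have key : HasLogOn (fun z => f (u z)) (v '' M) := by
    refine hasLogOn_compact_aux (Ω := u ⁻¹' Ω) ?_ (hf.comp hcu.continuousOn (mapsTo_preimage _ _))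
      (fun z hz => h0 _ hz) (hM.image hcv) ?_ ?_ ?_
    · have : u ⁻¹' Ω ⊆ v '' closure Ω := by
        intro z hz
        exact ⟨u z, subset_closure hz, hvu z⟩
      exact ((hb.isCompact_closure.image hcv).isBounded).subset this
    · rintro _ ⟨z, hz, rfl⟩
      rw [mem_preimage, huv]; exact hMΩ hz
    · intro t ht
      have h1 := (hsc M hMΩ hM (u t) ht)
      have h2 := (h1.comp (k := u) (B := v '' M) hcu.continuousOn (by
        rintro _ ⟨z, hz, rfl⟩; rw [huv]; exact hz)).div (hasLogOn_const hne)
      refine h2.congr ?_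
      intro z _
      simp only [hu]; field_simp
    · rintro _ ⟨x, hx, rfl⟩ y hy
      have h1 : δ ≤ dist x (u y) := by
        by_contra hcon
        push Not at hcon
        exact hy (hd (mem_thickening_iff.2 ⟨x, hx, by rwa [dist_comm]⟩))
      have h2 : dist x (u y) = h * dist (v x) y := by
        rw [Complex.dist_eq, Complex.dist_eq]
        conv_lhs => rw [← huv x]
        simp only [hu]
        rw [← mul_sub, norm_mul, Complex.norm_real, Real.norm_of_nonneg hpos.le]
      rw [h2] at h1
      have : h * 4 ≤ h * dist (v x) y := by rw [hh] at *; linarith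
      have := le_of_mul_le_mul_left this hpos
      linarith
  have := key.comp (k := v) (B := M) hcv.continuousOn (mapsTo_image _ _)
  exact this.congr (fun z _ => by rw [huv])

theorem hasLogOn_open {Ω : Set ℂ} (hΩ : IsOpen Ω) (hconn : IsPreconnected Ω)
    {f : ℂ → ℂ} (hM : ∀ M ⊆ Ω, IsCompact M → HasLogOn f M) : HasLogOn f Ω := by
  rcases Ω.eq_empty_or_nonempty with rfl | ⟨x0, hx0⟩
  · exact ⟨0, by simp, by simp⟩
  have hpc : IsPathConnected Ω := (hΩ.isConnected_iff_isPathConnected).1 ⟨⟨x0, hx0⟩, hconn⟩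
  have hf0 : f x0 ≠ 0 := by
    obtain ⟨L, -, hL⟩ := hM {x0} (by simpa using hx0) isCompact_singleton
    rw [← hL x0 rfl]; exact Complex.exp_ne_zero _
  -- a normalized logarithm on any connected compact set through the base point
  have norm : ∀ M ⊆ Ω, IsCompact M → x0 ∈ M → ∃ L : ℂ → ℂ, ContinuousOn L M ∧
      (∀ x ∈ M, Complex.exp (L x) = f x) ∧ L x0 = Complex.log (f x0) := by
    intro M hMΩ hMc hx
    obtain ⟨L, hL, h⟩ := hM M hMΩ hMc
    refine ⟨fun z => L z + (Complex.log (f x0) - L x0), hL.add continuousOn_const, ?_, by simp⟩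
    intro z hz
    rw [Complex.exp_add, h z hz, Complex.exp_sub, Complex.exp_log hf0, h x0 hx, div_self hf0, mul_one]
  have cov : ∀ x ∈ Ω, ∃ M ⊆ Ω, IsCompact M ∧ IsPreconnected M ∧ x0 ∈ M ∧ M ∈ 𝓝 x := by
    intro x hx
    obtain ⟨r, hr, hrΩ⟩ := nhds_basis_closedBall.mem_iff.1 (hΩ.mem_nhds hx)
    obtain ⟨γ, hγ⟩ := hpc.joinedIn x0 hx0 x hx
    refine ⟨range γ ∪ closedBall x r, union_subset (by rintro _ ⟨t, rfl⟩; exact hγ t) hrΩ,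
      (isCompact_range γ.continuous).union (isCompact_closedBall _ _), ?_, ?_, ?_⟩
    · exact IsPreconnected.union x ⟨1, γ.target⟩ (mem_closedBall_self hr.le)
        (isPreconnected_range γ.continuous) (convex_closedBall x r).isPreconnected
    · exact Or.inl ⟨0, γ.source⟩
    · exact mem_of_superset (closedBall_mem_nhds x hr) subset_union_right
  have uniq : ∀ M N : Set ℂ, IsPreconnected M → x0 ∈ M → M ⊆ N → ∀ L L' : ℂ → ℂ,
      ContinuousOn L M → ContinuousOn L' N → (∀ x ∈ M, Complex.exp (L x) = f x) →
      (∀ x ∈ N, Complex.exp (L' x) = f x) → L x0 = L' x0 → ∀ x ∈ M, L x = L' x := by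
    intro M N hMp hxM hMN L L' hL hL' h h' he x hx
    have := log_unique (D := fun z => L z - L' z) (c := 1) hMp (hL.sub (hL'.mono hMN)) (by
      intro z hz
      rw [Complex.exp_sub, h z hz, h' z (hMN hz), div_self]
      rw [← h z hz]; exact Complex.exp_ne_zero _) hx hxM
    simp only [he, sub_self] at this
    exact sub_eq_zero.1 this
  choose! M hMΩ hMc hMp hMx hMn using cov
  choose! L hL hLe hL0 using norm
  refine ⟨fun x => L (M x) x, ?_, ?_⟩
  · intro x hx
    have hev : (fun y => L (M y) y) =ᶠ[𝓝[Ω] x] L (M x) := by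
      filter_upwards [mem_nhdsWithin_of_mem_nhds (hMn x hx), self_mem_nhdsWithin] with y hy hyΩ
      have hUc := (hMc x hx).union (hMc y hyΩ)
      have hUΩ := union_subset (hMΩ x hx) (hMΩ y hyΩ)
      have hUx : x0 ∈ M x ∪ M y := Or.inl (hMx x hx)
      have e1 := uniq (M x) (M x ∪ M y) (hMp x hx) (hMx x hx) subset_union_left _ _
        (hL _ (hMΩ x hx) (hMc x hx) (hMx x hx)) (hL _ hUΩ hUc hUx)
        (hLe _ (hMΩ x hx) (hMc x hx) (hMx x hx)) (hLe _ hUΩ hUc hUx)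
        ((hL0 _ (hMΩ x hx) (hMc x hx) (hMx x hx)).trans (hL0 _ hUΩ hUc hUx).symm) y hy
      have e2 := uniq (M y) (M x ∪ M y) (hMp y hyΩ) (hMx y hyΩ) subset_union_right _ _
        (hL _ (hMΩ y hyΩ) (hMc y hyΩ) (hMx y hyΩ)) (hL _ hUΩ hUc hUx)
        (hLe _ (hMΩ y hyΩ) (hMc y hyΩ) (hMx y hyΩ)) (hLe _ hUΩ hUc hUx)
        ((hL0 _ (hMΩ y hyΩ) (hMc y hyΩ) (hMx y hyΩ)).trans (hL0 _ hUΩ hUc hUx).symm) y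
        (mem_of_mem_nhds (hMn y hyΩ))
      exact e2.trans e1.symm
    have hc : ContinuousWithinAt (L (M x)) Ω x :=
      ((hL _ (hMΩ x hx) (hMc x hx) (hMx x hx)).continuousAt (hMn x hx)).continuousWithinAt
    exact hc.congr_of_eventuallyEq hev rfl
  · intro x hx
    exact hLe _ (hMΩ x hx) (hMc x hx) (hMx x hx) x (mem_of_mem_nhds (hMn x hx))


/-- Moebius transformation of the disc moving `u` to `0`. -/
noncomputable def mob (u z : ℂ) : ℂ := (z - u) / (1 - (starRingEnd ℂ) u * z)

lemma mob_den {u z : ℂ} (hu : ‖u‖ < 1) (hz : ‖z‖ < 1) : 1 - (starRingEnd ℂ) u * z ≠ 0 := by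
  intro h
  have h1 : ‖(starRingEnd ℂ) u * z‖ = 1 := by rw [← sub_eq_zero.1 h]; simp
  rw [norm_mul, Complex.norm_conj] at h1
  nlinarith [norm_nonneg u, norm_nonneg z]

lemma mob_lt {u z : ℂ} (hu : ‖u‖ < 1) (hz : ‖z‖ < 1) : ‖mob u z‖ < 1 := by
  have hd := mob_den hu hz
  rw [mob, norm_div, div_lt_one (norm_pos_iff.2 hd)]
  have key : ‖1 - (starRingEnd ℂ) u * z‖ ^ 2 - ‖z - u‖ ^ 2 = (1 - ‖u‖^2) * (1 - ‖z‖^2) := by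
    simp only [← Complex.normSq_eq_norm_sq, Complex.normSq_apply, Complex.sub_re, Complex.sub_im,
      Complex.mul_re, Complex.mul_im, Complex.conj_re, Complex.conj_im, Complex.one_re,
      Complex.one_im]
    ring
  have h1 : 0 < 1 - ‖u‖^2 := by nlinarith [norm_nonneg u]
  have h2 : 0 < 1 - ‖z‖^2 := by nlinarith [norm_nonneg z]
  have h3 := mul_pos h1 h2
  exact lt_of_pow_lt_pow_left₀ 2 (norm_nonneg _) (by linarith)

lemma mob_injOn {u : ℂ} (hu : ‖u‖ < 1) : InjOn (mob u) (ball 0 1) := by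
  intro x hx y hy h
  rw [mem_ball_zero_iff] at hx hy
  have h1 := mob_den hu hx
  have h2 := mob_den hu hy
  rw [mob, mob, div_eq_div_iff h1 h2] at h
  have h3 : (1 - u * (starRingEnd ℂ) u) * (x - y) = 0 := by linear_combination h
  have h4 : 1 - u * (starRingEnd ℂ) u ≠ 0 := by
    have := mob_den hu hu
    rwa [mul_comm] at this
  exact sub_eq_zero.1 ((mul_eq_zero.1 h3).resolve_left h4)

lemma mob_diff {u : ℂ} (hu : ‖u‖ < 1) : DifferentiableOn ℂ (mob u) (ball 0 1) := by
  intro z hz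
  refine DifferentiableAt.differentiableWithinAt ?_
  unfold mob
  exact DifferentiableAt.div (by fun_prop) (by fun_prop) (mob_den hu (mem_ball_zero_iff.1 hz))

lemma mob_zero_iff {u z : ℂ} (hu : ‖u‖ < 1) (hz : ‖z‖ < 1) : mob u z = 0 ↔ z = u := by
  rw [mob, div_eq_zero_iff, sub_eq_zero, or_iff_left (mob_den hu hz)]

lemma mob_sq {u v w f : ℂ} (hu : ‖u‖ < 1) (hv : ‖v‖ < 1) (hw : ‖w‖ < 1) (hf : ‖f‖ < 1)
    (h1 : u ^ 2 = mob w 0) (h2 : v ^ 2 = mob w f) (hf0 : f ≠ 0) : ‖f‖ < ‖mob u v‖ := by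
  have hww : w = - u^2 := by rw [h1]; simp [mob]
  have hu2 : ‖-u‖ < 1 := by simpa
  have hd1 := mob_den hu hv
  have hd2 := mob_den hu2 hv
  have hd3 := mob_den hw hf
  have hkey : f = mob u v * mob (-u) v := by
    rw [mob, eq_div_iff hd3] at h2
    rw [mob, mob, div_mul_div_comm, eq_div_iff (mul_ne_zero hd1 hd2)]
    rw [hww] at h2
    simp only [map_neg, map_pow] at h2 ⊢
    linear_combination -h2
  have hm := mob_lt hu2 hv
  have hne : mob u v ≠ 0 := fun h => hf0 (by rw [hkey, h, zero_mul])
  calc ‖f‖ = ‖mob u v‖ * ‖mob (-u) v‖ := by rw [← norm_mul, ← hkey]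
    _ < ‖mob u v‖ * 1 := by
      exact mul_lt_mul_of_pos_left hm (norm_pos_iff.2 hne)
    _ = _ := mul_one _

lemma HasLogOn.sqrt_diff {Ω : Set ℂ} {g : ℂ → ℂ} (hΩ : IsOpen Ω) (h : HasLogOn g Ω)
    (hg : DifferentiableOn ℂ g Ω) : ∃ q : ℂ → ℂ, DifferentiableOn ℂ q Ω ∧ ∀ z ∈ Ω, q z ^ 2 = g z := by
  obtain ⟨L, hL, hLg⟩ := h
  have hLd : DifferentiableOn ℂ L Ω := by
    intro x hx
    have hc : ContinuousAt L x := hL.continuousAt (hΩ.mem_nhds hx)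
    have hgx : g x ≠ 0 := by rw [← hLg x hx]; exact Complex.exp_ne_zero _
    have hev : L =ᶠ[𝓝 x] fun z => L x + Complex.log (g z / g x) := by
      filter_upwards [hc.eventually (ball_mem_nhds (L x) one_pos), hΩ.mem_nhds hx] with z hz hzΩ
      rw [← hLg x hx, ← hLg z hzΩ, ← Complex.exp_sub, Complex.log_exp]
      · ring
      · have := Complex.abs_im_le_norm (L z - L x)
        rw [← Complex.dist_eq] at this
        have := abs_le.1 (this.trans (mem_ball.1 hz).le)
        linarith [Real.pi_gt_three]
      · have := Complex.abs_im_le_norm (L z - L x)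
        rw [← Complex.dist_eq] at this
        have := abs_le.1 (this.trans (mem_ball.1 hz).le)
        linarith [Real.pi_gt_three]
    refine DifferentiableAt.differentiableWithinAt ?_
    refine DifferentiableAt.congr_of_eventuallyEq ?_ hev
    refine (differentiableAt_const _).add (DifferentiableAt.clog ?_ ?_)
    · exact (hg.differentiableAt (hΩ.mem_nhds hx)).div_const _
    · rw [div_self hgx]; exact Complex.one_mem_slitPlane
  refine ⟨fun z => Complex.exp (L z / 2), (hLd.div_const 2).cexp, ?_⟩
  intro z hz
  rw [← Complex.exp_nat_mul, ← hLg z hz]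
  congr 1; push_cast; ring

lemma montel {Ω : Set ℂ} (hΩ : IsOpen Ω) {φ : Ultrafilter ℕ} {F : ℕ → ℂ → ℂ}
    (hF : ∀ n, DifferentiableOn ℂ (F n) Ω) (hm : ∀ n, MapsTo (F n) Ω (ball 0 1)) :
    ∃ f : ℂ → ℂ, TendstoLocallyUniformlyOn F f φ Ω := by
  have hlim : ∀ z ∈ Ω, ∃ w, Tendsto (fun n => F n z) φ (𝓝 w) := by
    intro z hz
    have := (isCompact_closedBall (0:ℂ) 1).ultrafilter_le_nhds (φ.map (fun n => F n z)) (by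
      rw [le_principal_iff]
      exact mem_map.2 (Eventually.of_forall fun n => ball_subset_closedBall (hm n hz)))
    obtain ⟨w, -, hw⟩ := this
    exact ⟨w, hw⟩
  choose! f hf using hlim
  refine ⟨f, ?_⟩
  rw [tendstoLocallyUniformlyOn_iff]
  intro ε hε x hx
  obtain ⟨R, hR, hRΩ⟩ := isOpen_iff.1 hΩ x hx
  have hlip : ∀ n, ∀ y ∈ ball x R, dist (F n y) (F n x) ≤ 2 / R * dist y x := by
    intro n y hy
    refine Complex.dist_le_div_mul_dist_of_mapsTo_ball ((hF n).mono hRΩ) ?_ hy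
    intro z hz
    have h1 := mem_ball_zero_iff.1 (hm n (hRΩ hz))
    have h2 := mem_ball_zero_iff.1 (hm n hx)
    rw [mem_closedBall, dist_eq_norm]
    exact (norm_sub_le _ _).trans (by linarith)
  have hlipf : ∀ y ∈ ball x R, dist (f y) (f x) ≤ 2 / R * dist y x := by
    intro y hy
    exact le_of_tendsto ((hf y (hRΩ hy)).dist (hf x hx)) (Eventually.of_forall fun n => hlip n y hy)
  set ρ := min R (R * ε / 8) with hρ
  have hρ0 : 0 < ρ := by positivity
  refine ⟨ball x ρ, mem_nhdsWithin_of_mem_nhds (ball_mem_nhds x hρ0), ?_⟩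
  have h3 : ∀ᶠ n in (φ : Filter ℕ), dist (F n x) (f x) < ε / 3 :=
    (hf x hx).eventually (ball_mem_nhds _ (by positivity))
  filter_upwards [h3] with n hn y hy
  have hyR : y ∈ ball x R := ball_subset_ball (min_le_left _ _) hy
  have hb : 2 / R * dist y x ≤ ε / 4 := by
    have : dist y x ≤ R * ε / 8 := (mem_ball.1 hy).le.trans (min_le_right _ _)
    calc 2 / R * dist y x ≤ 2 / R * (R * ε / 8) := by gcongr
      _ = ε / 4 := by field_simp; norm_num
  calc dist (f y) (F n y) ≤ dist (f y) (f x) + dist (f x) (F n x) + dist (F n x) (F n y) :=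
        dist_triangle4 _ _ _ _
    _ ≤ ε / 4 + ε / 3 + ε / 4 := by
      gcongr
      · exact (hlipf y hyR).trans hb
      · rw [dist_comm]; exact hn.le
      · rw [dist_comm]; exact (hlip n y hyR).trans hb
    _ < ε := by linarith

lemma hurwitz_inj {Ω : Set ℂ} (hΩ : IsOpen Ω) (hc : IsPreconnected Ω) {φ : Filter ℕ} [φ.NeBot]
    {F : ℕ → ℂ → ℂ} {f : ℂ → ℂ} (hF : ∀ n, DifferentiableOn ℂ (F n) Ω) (hi : ∀ n, InjOn (F n) Ω)
    (hf : TendstoLocallyUniformlyOn F f φ Ω) (hnc : ∃ x ∈ Ω, ∃ y ∈ Ω, f x ≠ f y) : InjOn f Ω := by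
  have hfd : DifferentiableOn ℂ f Ω := hf.differentiableOn (Eventually.of_forall hF) hΩ
  have hfa : AnalyticOnNhd ℂ f Ω := hfd.analyticOnNhd hΩ
  intro a ha b hb hab
  by_contra hne
  have hiso : ∀ᶠ z in 𝓝[≠] a, f z ≠ f b := by
    rcases (hfa a ha).eventually_eq_or_eventually_ne (g := fun _ => f b) analyticAt_const with h | h
    · obtain ⟨x, hx, y, hy, hxy⟩ := hnc
      have := hfa.eqOn_of_preconnected_of_eventuallyEq analyticOnNhd_const hc ha h
      exact absurd ((this hx).trans (this hy).symm) hxy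
    · exact h
  have hev : ∀ᶠ r in 𝓝[>] (0:ℝ), closedBall a r ⊆ Ω ∧ b ∉ closedBall a r ∧
      ∀ z ∈ closedBall a r, z ≠ a → f z ≠ f b := by
    rw [eventually_nhdsWithin_iff] at hiso
    have h1 : ∀ᶠ z in 𝓝 a, z ∈ Ω ∧ z ≠ b ∧ (z ≠ a → f z ≠ f b) := by
      filter_upwards [hiso, hΩ.mem_nhds ha, isOpen_ne.mem_nhds hne] with z h1 h2 h3
      exact ⟨h2, h3, fun h => h1 h⟩
    obtain ⟨R, hR, h2⟩ := eventually_nhds_iff_ball.1 h1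
    filter_upwards [Ioo_mem_nhdsGT hR] with r hr
    have hs : closedBall a r ⊆ ball a R := closedBall_subset_ball hr.2
    exact ⟨fun z hz => (h2 z (hs hz)).1, fun h => (h2 b (hs h)).2.1 rfl,
      fun z hz => (h2 z (hs hz)).2.2⟩
  obtain ⟨r, ⟨hrΩ, hbr, hfr⟩, hr⟩ := (hev.and self_mem_nhdsWithin).exists
  replace hr : 0 < r := hr
  have hsph : sphere a r ⊆ closedBall a r := sphere_subset_closedBall
  have hcf : ContinuousOn (fun z => ‖f z - f b‖) (sphere a r) :=
    ((hfd.continuousOn.mono (hsph.trans hrΩ)).sub continuousOn_const).norm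
  obtain ⟨z0, hz0, hmin⟩ := (isCompact_sphere a r).exists_isMinOn
    (NormedSpace.sphere_nonempty.2 hr.le) hcf
  set μ := ‖f z0 - f b‖ with hμ
  have hμ0 : 0 < μ := norm_pos_iff.2 (sub_ne_zero.2 (hfr z0 (hsph hz0) (by
    rintro rfl; simp at hz0; exact hr.ne hz0)))
  have hunif : ∀ᶠ n in φ, ∀ z ∈ sphere a r, dist (f z) (F n z) < μ / 4 := by
    have := (tendstoLocallyUniformlyOn_iff_forall_isCompact hΩ).1 hf _ (hsph.trans hrΩ)
      (isCompact_sphere a r)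
    exact Metric.tendstoUniformlyOn_iff.1 this _ (by positivity)
  have hb' : ∀ᶠ n in φ, dist (f b) (F n b) < μ / 4 := by
    have := (hf.tendsto_at hb).eventually (ball_mem_nhds _ (show 0 < μ / 4 by positivity))
    filter_upwards [this] with n hn
    rw [dist_comm]; exact hn
  have hfin : ∀ᶠ n in φ, μ / 2 ≤ ‖F n a - F n b‖ := by
    filter_upwards [hunif, hb'] with n hn hnb
    have hg0 : ∀ z ∈ closedBall a r, F n z - F n b ≠ 0 := by
      intro z hz h
      have := hi n (hrΩ hz) hb (sub_eq_zero.1 h)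
      exact hbr (this ▸ hz)
    have hd : DiffContOnCl ℂ (fun z => (F n z - F n b)⁻¹) (ball a r) := by
      refine DifferentiableOn.diffContOnCl ?_
      rw [closure_ball a hr.ne']
      exact (((hF n).mono hrΩ).sub_const _).inv hg0
    have := Complex.norm_le_of_forall_mem_frontier_norm_le isBounded_ball hd (C := 2 / μ) (z := a) (by
      intro z hz
      rw [frontier_ball a hr.ne'] at hz
      have e1 := hn z hz
      have e2 : μ ≤ ‖f z - f b‖ := hmin hz
      have e3 : ‖f z - f b‖ ≤ dist (f z) (F n z) + ‖F n z - F n b‖ + dist (F n b) (f b) := by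
        rw [← dist_eq_norm, ← dist_eq_norm]; exact dist_triangle4 _ _ _ _
      rw [dist_comm (F n b)] at e3
      rw [norm_inv, inv_le_comm₀ (norm_pos_iff.2 (hg0 z (hsph hz))) (by positivity), inv_div]
      linarith) (subset_closure (mem_ball_self hr))
    rw [norm_inv, inv_le_comm₀ (norm_pos_iff.2 (hg0 a (mem_closedBall_self hr.le))) (by positivity),
      inv_div] at this
    exact this
  have := ge_of_tendsto ((hf.tendsto_at ha).sub (hf.tendsto_at hb)).norm hfin
  rw [hab, sub_self, norm_zero] at this
  linarith

theorem riemann_map {Ω : Set ℂ} (hΩ : IsOpen Ω) (hb : Bornology.IsBounded Ω) (hc : IsPreconnected Ω)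
    (hne : Ω.Nonempty)
    (hlog : ∀ f : ℂ → ℂ, ContinuousOn f Ω → (∀ z ∈ Ω, f z ≠ 0) → HasLogOn f Ω) :
    ∃ ψ : ℂ → ℂ, DifferentiableOn ℂ ψ Ω ∧ InjOn ψ Ω ∧ ψ '' Ω = ball 0 1 := by
  obtain ⟨x0, hx0⟩ := hne
  obtain ⟨x1, hx1, hx01⟩ : ∃ x1 ∈ Ω, x1 ≠ x0 := by
    obtain ⟨R, hR, hRΩ⟩ := isOpen_iff.1 hΩ x0 hx0
    refine ⟨x0 + (R/2 : ℝ), hRΩ ?_, ?_⟩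
    · rw [mem_ball, dist_eq_norm, add_sub_cancel_left, Complex.norm_real, Real.norm_of_nonneg] <;>
        linarith
    · simp [hR.ne']
  let P : (ℂ → ℂ) → Prop := fun f => DifferentiableOn ℂ f Ω ∧ InjOn f Ω ∧ MapsTo f Ω (ball 0 1) ∧
    f x0 = 0
  set V : Set ℝ := {v | ∃ f, P f ∧ v = ‖f x1‖} with hV
  have hVb : BddAbove V := ⟨1, by
    rintro v ⟨f, hf, rfl⟩
    exact (mem_ball_zero_iff.1 (hf.2.2.1 hx1)).le⟩
  have hpos : ∀ f, P f → 0 < ‖f x1‖ := by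
    intro f hf
    rw [norm_pos_iff]
    intro h
    exact hx01 (hf.2.1 hx1 hx0 (h.trans hf.2.2.2.symm))
  have hVne : V.Nonempty := by
    obtain ⟨R, hR⟩ := hb.subset_ball x0
    have hR0 : 0 < R := by
      have := hR hx0; simpa using this
    have hRc : (R:ℂ) ≠ 0 := by exact_mod_cast hR0.ne'
    refine ⟨_, fun z => (z - x0) / R, ⟨?_, ?_, ?_, by simp⟩, rfl⟩
    · fun_prop
    · intro x _ y _ h
      simpa [hRc] using h
    · intro z hz
      have := hR hz
      rw [mem_ball, dist_eq_norm] at this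
      rw [mem_ball_zero_iff, norm_div, Complex.norm_real, Real.norm_of_nonneg hR0.le,
        div_lt_one hR0]
      exact this
  obtain ⟨v, -, hvt, hvV⟩ := exists_seq_tendsto_sSup hVne hVb
  choose F hF hFv using hvV
  obtain ⟨f, hf⟩ := montel hΩ (φ := hyperfilter ℕ) (fun n => (hF n).1) (fun n => (hF n).2.2.1)
  have hfx1 : ‖f x1‖ = sSup V := by
    have h1 := (hf.tendsto_at hx1).norm
    have h2 : Tendsto (fun n => ‖F n x1‖) (hyperfilter ℕ) (𝓝 (sSup V)) := by
      refine (hvt.congr hFv).mono_left ?_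
      rw [← Nat.cofinite_eq_atTop]; exact hyperfilter_le_cofinite
    exact tendsto_nhds_unique h1 h2
  have hfx0 : f x0 = 0 := by
    have h1 := hf.tendsto_at hx0
    refine tendsto_nhds_unique h1 ?_
    simp only [(hF _).2.2.2]; exact tendsto_const_nhds
  have hsup : 0 < sSup V := by
    obtain ⟨v, hv⟩ := hVne
    refine lt_of_lt_of_le ?_ (le_csSup hVb hv)
    obtain ⟨g, hg, rfl⟩ := hv
    exact hpos g hg
  have hfne : f x1 ≠ f x0 := by
    rw [hfx0, ← norm_pos_iff, hfx1]; exact hsup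
  have hfd : DifferentiableOn ℂ f Ω := hf.differentiableOn (Eventually.of_forall fun n => (hF n).1) hΩ
  have hfi : InjOn f Ω := hurwitz_inj hΩ hc (fun n => (hF n).1) (fun n => (hF n).2.1) hf
    ⟨x1, hx1, x0, hx0, hfne⟩
  have hfm : MapsTo f Ω (ball 0 1) := by
    have hcl : f '' Ω ⊆ closedBall 0 1 := by
      rintro _ ⟨z, hz, rfl⟩
      refine isClosed_closedBall.mem_of_tendsto (hf.tendsto_at hz) (Eventually.of_forall fun n => ?_)
      exact ball_subset_closedBall ((hF n).2.2.1 hz)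
    rcases (hfd.analyticOnNhd hΩ).is_constant_or_isOpen hc with ⟨w, hw⟩ | h
    · exact absurd ((hw x1 hx1).trans (hw x0 hx0).symm) hfne
    · have := (h Ω subset_rfl hΩ).subset_interior_iff.2 hcl
      rw [interior_closedBall _ one_ne_zero] at this
      exact mapsTo_iff_image_subset.2 this
  refine ⟨f, hfd, hfi, subset_antisymm (mapsTo_iff_image_subset.1 hfm) ?_⟩
  intro w hw
  by_contra hwf
  rw [mem_ball_zero_iff] at hw
  have hf1 : ∀ z ∈ Ω, ‖f z‖ < 1 := fun z hz => mem_ball_zero_iff.1 (hfm hz)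
  have hgd : DifferentiableOn ℂ (fun z => mob w (f z)) Ω := (mob_diff hw).comp hfd hfm
  have hg0 : ∀ z ∈ Ω, mob w (f z) ≠ 0 := by
    intro z hz h
    rw [mob_zero_iff hw (hf1 z hz)] at h
    exact hwf ⟨z, hz, h⟩
  obtain ⟨q, hqd, hq⟩ := (hlog _ hgd.continuousOn hg0).sqrt_diff hΩ hgd
  have hq1 : ∀ z ∈ Ω, ‖q z‖ < 1 := by
    intro z hz
    have := mob_lt hw (hf1 z hz)
    rw [← hq z hz, norm_pow] at this
    exact lt_of_pow_lt_pow_left₀ 2 zero_le_one (by simpa using this)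
  have hqi : InjOn q Ω := by
    intro x hx y hy hxy
    refine hfi hx hy (mob_injOn hw (hfm hx) (hfm hy) ?_)
    rw [← hq x hx, ← hq y hy, hxy]
  have hqm : MapsTo q Ω (ball 0 1) := fun z hz => mem_ball_zero_iff.2 (hq1 z hz)
  have hh : P (fun z => mob (q x0) (q z)) := by
    refine ⟨(mob_diff (hq1 x0 hx0)).comp hqd hqm, (mob_injOn (hq1 x0 hx0)).comp hqi hqm, ?_, ?_⟩
    · intro z hz
      exact mem_ball_zero_iff.2 (mob_lt (hq1 x0 hx0) (hq1 z hz))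
    · simp [mob]
  have hlt := mob_sq (hq1 x0 hx0) (hq1 x1 hx1) hw (hf1 x1 hx1) (by rw [hq x0 hx0, hfx0])
    (hq x1 hx1) (by rw [← hfx0]; exact hfne)
  have hle := le_csSup hVb ⟨_, hh, rfl⟩
  rw [hfx1] at hlt
  exact absurd hlt (not_lt.2 hle)

/-- a biholomorphic map of a bounded domain onto the disc, with its inverse -/
structure IsRM (Ω : Set ℂ) (ψ φ : ℂ → ℂ) : Prop where
  op : IsOpen Ω
  bdd : Bornology.IsBounded Ω
  dψ : DifferentiableOn ℂ ψ Ω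
  dφ : DifferentiableOn ℂ φ (ball 0 1)
  mψ : MapsTo ψ Ω (ball 0 1)
  mφ : MapsTo φ (ball 0 1) Ω
  φψ : ∀ z ∈ Ω, φ (ψ z) = z
  ψφ : ∀ z ∈ ball (0:ℂ) 1, ψ (φ z) = z

theorem exists_isRM {Ω : Set ℂ} (hΩ : IsOpen Ω) (hb : Bornology.IsBounded Ω) (hc : IsPreconnected Ω)
    (hne : Ω.Nonempty)
    (hlog : ∀ f : ℂ → ℂ, ContinuousOn f Ω → (∀ z ∈ Ω, f z ≠ 0) → HasLogOn f Ω) :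
    ∃ ψ φ : ℂ → ℂ, IsRM Ω ψ φ := by
  obtain ⟨ψ, hd, hi, him⟩ := riemann_map hΩ hb hc hne hlog
  set φ := Function.invFunOn ψ Ω with hφ
  have hm : MapsTo φ (ball 0 1) Ω := by
    intro z hz
    rw [← him] at hz
    exact Function.invFunOn_mem hz
  have hr : ∀ z ∈ ball (0:ℂ) 1, ψ (φ z) = z := by
    intro z hz
    rw [← him] at hz
    exact Function.invFunOn_eq hz
  have hl : ∀ z ∈ Ω, φ (ψ z) = z := fun z hz => hi.leftInvOn_invFunOn hz
  have hmψ : MapsTo ψ Ω (ball 0 1) := fun z hz => him ▸ mem_image_of_mem ψ hz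
  have hnc : ∀ a ∈ Ω, ¬ ∀ᶠ z in 𝓝 a, ψ z = ψ a := by
    intro a ha h
    have h1 : ∀ᶠ z in 𝓝 a, z = a := by
      filter_upwards [h, hΩ.mem_nhds ha] with z h1 h2
      exact hi h2 ha h1
    have h2 : ∀ᶠ z in 𝓝[≠] a, False := by
      filter_upwards [nhdsWithin_le_nhds h1, self_mem_nhdsWithin] with z h1 h2
      exact h2 h1
    exact h2.exists.elim fun _ h => h
  have hop : ∀ s ⊆ Ω, IsOpen s → IsOpen (ψ '' s) := by
    rcases (hd.analyticOnNhd hΩ).is_constant_or_isOpen hc with ⟨w, hw⟩ | h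
    · obtain ⟨a, ha⟩ := hne
      exfalso
      refine hnc a ha ?_
      filter_upwards [hΩ.mem_nhds ha] with z hz
      rw [hw z hz, hw a ha]
    · exact h
  have hcont : ∀ z ∈ ball (0:ℂ) 1, ContinuousAt φ z := by
    intro z hz
    rw [ContinuousAt, Filter.tendsto_def]
    intro N hN
    obtain ⟨N', hN', hN'o, hzN'⟩ := _root_.mem_nhds_iff.1 hN
    have : ψ '' (N' ∩ Ω) ∈ 𝓝 z :=
      (hop _ inter_subset_right (hN'o.inter hΩ)).mem_nhds ⟨φ z, ⟨hzN', hm hz⟩, hr z hz⟩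
    filter_upwards [this]
    rintro _ ⟨y, ⟨hy, hyΩ⟩, rfl⟩
    rw [mem_preimage, hl y hyΩ]
    exact hN' hy
  refine ⟨ψ, φ, hΩ, hb, hd, ?_, hmψ, hm, hl, hr⟩
  intro z hz
  refine DifferentiableAt.differentiableWithinAt ?_
  refine (Complex.analyticAt_of_differentiable_on_punctured_nhds_of_continuousAt ?_ (hcont z hz)).differentiableAt
  have hder : ∀ᶠ a in 𝓝[≠] (φ z), deriv ψ a ≠ 0 := by
    have han := (hd.analyticOnNhd hΩ (φ z) (hm hz)).deriv
    rcases han.eventually_eq_zero_or_eventually_ne_zero with h | h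
    · exfalso
      refine hnc _ (hm hz) ?_
      obtain ⟨R, hR, hR2⟩ := eventually_nhds_iff_ball.1 (h.and (hΩ.eventually_mem (hm hz)))
      filter_upwards [ball_mem_nhds _ hR] with y hy
      refine (convex_ball (φ z) R).is_const_of_fderivWithin_eq_zero (𝕜 := ℂ)
        (hd.mono fun x hx => (hR2 x hx).2) ?_ hy (mem_ball_self hR)
      intro x hx
      rw [fderivWithin_of_isOpen isOpen_ball hx]
      ext
      simp [(hR2 x hx).1]
    · exact h
  have ht : Tendsto φ (𝓝[≠] z) (𝓝[≠] (φ z)) := by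
    refine tendsto_nhdsWithin_iff.2 ⟨(hcont z hz).mono_left nhdsWithin_le_nhds, ?_⟩
    filter_upwards [self_mem_nhdsWithin, nhdsWithin_le_nhds (isOpen_ball.mem_nhds hz)] with y hy hy1 h
    have : ψ (φ y) = ψ (φ z) := by rw [h]
    rw [hr y hy1, hr z hz] at this
    exact hy this
  filter_upwards [ht.eventually hder, nhdsWithin_le_nhds (isOpen_ball.mem_nhds hz)] with y hy hy1
  refine (HasDerivAt.of_local_left_inverse (hcont y hy1)
    (hd.differentiableAt (hΩ.mem_nhds (hm hy1))).hasDerivAt hy ?_).differentiableAt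
  filter_upwards [isOpen_ball.mem_nhds hy1] with x hx
  exact hr x hx


open MeasureTheory ENNReal in
/-- length–area lemma. -/
lemma length_area' (g : ℂ → ENNReal) (hg : Measurable g) (hfin : ∫⁻ z, g z ^ (2:ℝ) ≠ ⊤) (c : ℂ)
    {ε : ENNReal} (hε : ε ≠ 0) {ρ₀ : ℝ} (hρ₀ : 0 < ρ₀) :
    ∃ r, 0 < r ∧ r < ρ₀ ∧
      ∫⁻ θ in Ioo (-Real.pi) Real.pi, ENNReal.ofReal r * g (c + r * Complex.exp (θ * Complex.I)) < ε := by
  by_contra hcon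
  push Not at hcon
  -- the key inequality
  have key : ∀ ρ, 0 < ρ → ρ < ρ₀ →
      ε ≤ (∫⁻ z in ball c ρ, g z ^ (2:ℝ)) ^ (1/2:ℝ) * (NNReal.pi : ENNReal) ^ (1/2:ℝ) := by
    intro ρ hρ hρρ
    have h1 : ENNReal.ofReal ρ * ε ≤ ∫⁻ z in ball c ρ, g z := by
      have e0 : ∫⁻ z in ball c ρ, g z = ∫⁻ z, (ball (0:ℂ) ρ).indicator (fun z => g (c + z)) z := by
        rw [← lintegral_indicator measurableSet_ball,
          ← lintegral_add_left_eq_self _ c]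
        congr 1; ext z
        simp [indicator, mem_ball, dist_eq_norm]
      rw [e0, ← Complex.lintegral_comp_polarCoord_symm]
      have hmeas : Measurable (fun p : ℝ × ℝ => ENNReal.ofReal p.1 •
          (ball (0:ℂ) ρ).indicator (fun z => g (c + z)) (Complex.polarCoord.symm p)) := by
        have h1 : Measurable ((ball (0:ℂ) ρ).indicator (fun z => g (c + z))) :=
          (hg.comp (measurable_const_add c)).indicator measurableSet_ball
        have h2 : Measurable (fun p : ℝ × ℝ => (Complex.polarCoord.symm p : ℂ)) := by
          simp only [Complex.polarCoord_symm_apply]; fun_prop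
        simp only [smul_eq_mul]
        exact (by fun_prop : Measurable fun p : ℝ × ℝ => ENNReal.ofReal p.1).mul (h1.comp h2)
      have ht : polarCoord.target = Ioi (0:ℝ) ×ˢ Ioo (-Real.pi) Real.pi := rfl
      rw [ht, Measure.volume_eq_prod, ← Measure.prod_restrict, lintegral_prod _ hmeas.aemeasurable]
      calc ENNReal.ofReal ρ * ε = ∫⁻ r in Ioo 0 ρ, ε := by
            rw [lintegral_const, Measure.restrict_apply_univ, Real.volume_Ioo, sub_zero, mul_comm]
        _ ≤ ∫⁻ r in Ioo 0 ρ, ∫⁻ θ in Ioo (-Real.pi) Real.pi, ENNReal.ofReal r •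
            (ball (0:ℂ) ρ).indicator (fun z => g (c + z)) (Complex.polarCoord.symm (r, θ)) := by
          refine setLIntegral_mono' measurableSet_Ioo ?_
          intro r hr
          refine (hcon r hr.1 (hr.2.trans hρρ)).trans (le_of_eq ?_)
          congr 1; ext θ
          have e1 : Complex.polarCoord.symm (r, θ) = r * Complex.exp (θ * Complex.I) := by
            rw [Complex.polarCoord_symm_apply, Complex.exp_mul_I]; simp
          rw [e1, indicator_of_mem, smul_eq_mul]
          rw [mem_ball_zero_iff, norm_mul, Complex.norm_exp_ofReal_mul_I, mul_one,
            Complex.norm_real, Real.norm_of_nonneg hr.1.le]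
          exact hr.2
        _ ≤ _ := lintegral_mono_set Ioo_subset_Ioi_self
    have h2 : ∫⁻ z in ball c ρ, g z ≤ (∫⁻ z in ball c ρ, g z ^ (2:ℝ)) ^ (1/2:ℝ) *
        (ENNReal.ofReal ρ * (NNReal.pi : ENNReal) ^ (1/2:ℝ)) := by
      have := ENNReal.lintegral_mul_le_Lp_mul_Lq (volume.restrict (ball c ρ))
        (Real.HolderConjugate.two_two) hg.aemeasurable (measurable_const (a := (1:ENNReal))).aemeasurable
      simp only [Pi.mul_apply, mul_one, ENNReal.one_rpow, lintegral_const, one_mul,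
        Measure.restrict_apply_univ, Complex.volume_ball] at this
      refine this.trans (le_of_eq ?_)
      rw [ENNReal.mul_rpow_of_nonneg _ _ (by norm_num), ← ENNReal.rpow_natCast, ← ENNReal.rpow_mul]
      norm_num
    have h3 := h1.trans h2
    have hρ' : ENNReal.ofReal ρ ≠ 0 := by simpa using hρ
    rw [mul_left_comm] at h3
    exact (ENNReal.mul_le_mul_iff_right hρ' ENNReal.ofReal_ne_top).1 h3
  -- choose a small radius
  obtain ⟨η, hη0, hη⟩ : ∃ η : ENNReal, η ≠ 0 ∧ η ^ (1/2:ℝ) * (NNReal.pi : ENNReal) ^ (1/2:ℝ) < ε := by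
    have : Tendsto (fun η : ENNReal => η ^ (1/2:ℝ) * (NNReal.pi : ENNReal) ^ (1/2:ℝ)) (𝓝 0) (𝓝 0) := by
      have h1 : Tendsto (fun η : ENNReal => η ^ (1/2:ℝ)) (𝓝 0) (𝓝 0) := by
        have := (ENNReal.continuous_rpow_const (y := 1/2)).tendsto (0:ENNReal)
        simpa using this
      have := ENNReal.Tendsto.mul_const (b := (NNReal.pi : ENNReal) ^ (1/2:ℝ)) h1
        (Or.inr (ENNReal.rpow_ne_top_of_nonneg (by norm_num) ENNReal.coe_ne_top))
      simpa using this
    have hev := (this.eventually (Iio_mem_nhds (pos_iff_ne_zero.2 hε)))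
    have hev' : ∀ᶠ η in 𝓝[>] (0:ENNReal), η ^ (1/2:ℝ) * (NNReal.pi : ENNReal) ^ (1/2:ℝ) < ε :=
      nhdsWithin_le_nhds hev
    obtain ⟨η, h1, h2⟩ := (hev'.and self_mem_nhdsWithin).exists
    exact ⟨η, (show (0:ENNReal) < η from h2).ne', h1⟩
  obtain ⟨δ, hδ, hsmall⟩ := exists_pos_setLIntegral_lt_of_measure_lt hfin hη0
  have hvol : ∀ᶠ ρ in 𝓝[>] (0:ℝ), volume (ball c ρ) < δ := by
    have : Tendsto (fun ρ : ℝ => volume (ball c ρ)) (𝓝 0) (𝓝 0) := by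
      simp only [Complex.volume_ball]
      have h1 : Tendsto (fun ρ : ℝ => ENNReal.ofReal ρ ^ 2) (𝓝 0) (𝓝 0) := by
        have := ((ENNReal.continuous_pow 2).comp ENNReal.continuous_ofReal).tendsto 0
        simpa [Function.comp_def] using this
      have := ENNReal.Tendsto.mul_const (b := (NNReal.pi : ENNReal)) h1 (Or.inr ENNReal.coe_ne_top)
      simpa using this
    exact nhdsWithin_le_nhds (this.eventually (Iio_mem_nhds hδ))
  obtain ⟨ρ, hρδ, hρ0, hρ1⟩ := (hvol.and (Ioo_mem_nhdsGT hρ₀)).exists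
  have := key ρ hρ0 hρ1
  refine absurd (this.trans_lt (lt_of_le_of_lt ?_ hη)) (lt_irrefl _)
  gcongr
  exact (hsmall _ hρδ).le

open MeasureTheory in
/-- finite Dirichlet integral of an injective holomorphic map with bounded image. -/
lemma dirichlet_finite {G : Set ℂ} (hG : IsOpen G) {f : ℂ → ℂ} (hf : DifferentiableOn ℂ f G)
    (hi : InjOn f G) (hb : Bornology.IsBounded (f '' G)) :
    ∫⁻ z, (G.indicator (fun z => ‖deriv f z‖ₑ) z) ^ (2:ℝ) ≠ ⊤ := by
  have h1 : ∫⁻ z, (G.indicator (fun z => ‖deriv f z‖ₑ) z) ^ (2:ℝ) = volume (f '' G) := by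
    have := lintegral_abs_det_fderiv_eq_addHaar_image volume hG.measurableSet
      (f := f) (f' := fun z => (ContinuousLinearMap.toSpanSingleton ℂ (deriv f z)).restrictScalars ℝ)
      (fun z hz => ((hf.differentiableAt (hG.mem_nhds hz)).hasDerivAt.hasFDerivAt.restrictScalars ℝ).hasFDerivWithinAt) hi
    rw [← this, ← lintegral_indicator hG.measurableSet]
    congr 1; ext z
    by_cases hz : z ∈ G
    · rw [indicator_of_mem hz, indicator_of_mem hz]
      simp only [ContinuousLinearMap.det, ContinuousLinearMap.coe_restrictScalars,
        LinearMap.det_restrictScalars]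
      rw [← ofReal_norm, ENNReal.ofReal_rpow_of_nonneg (norm_nonneg _) (by norm_num)]
      congr 1
      simp [Algebra.norm_complex_eq, Complex.normSq_eq_norm_sq]
    · rw [indicator_of_notMem hz, indicator_of_notMem hz]
      simp
  rw [h1]
  exact hb.measure_lt_top.ne

open MeasureTheory in
lemma length_area (g : ℂ → ENNReal) (hg : Measurable g) (hfin : ∫⁻ z, g z ^ (2:ℝ) ≠ ⊤) (c : ℂ)
    {ε : ENNReal} (hε : ε ≠ 0) {ρ₀ : ℝ} (hρ₀ : 0 < ρ₀) :
    ∃ r, 0 < r ∧ r < ρ₀ ∧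
      ∫⁻ θ in Ioc (-Real.pi) Real.pi, ENNReal.ofReal r * g (c + r * Complex.exp (θ * Complex.I)) < ε := by
  obtain ⟨r, h1, h2, h3⟩ := length_area' g hg hfin c hε hρ₀
  refine ⟨r, h1, h2, ?_⟩
  rwa [← Measure.restrict_congr_set (Ioo_ae_eq_Ioc (μ := (volume : Measure ℝ)))]

/-- a collared boundary point -/
structure Collar (Ω : Set ℂ) (c : ℂ → ℂ) (p : ℂ) (R : ℝ) : Prop where
  pos : 0 < R
  re0 : p.re = 0
  cont : ContinuousOn c (ball p R)
  inj : InjOn c (ball p R)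
  iff : ∀ q ∈ ball p R, c q ∈ Ω ↔ 0 < q.re

lemma image_ball_mem_nhds {c : ℂ → ℂ} {p : ℂ} {R : ℝ} (hR : 0 < R) (hc : ContinuousOn c (ball p R))
    (hi : InjOn c (ball p R)) : c '' ball p R ∈ 𝓝 (c p) := by
  have hm : MapsTo (fun z => p + z) (closedBall 0 (R/2)) (ball p R) := by
    intro z hz
    rw [mem_closedBall_zero_iff] at hz
    rw [mem_ball, dist_eq_norm, add_sub_cancel_left]
    linarith
  have h := invariance_of_domain_ball (f := fun z => c (p + z)) (r := R/2) (by positivity)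
    (hc.comp (by fun_prop) hm) (hi.comp (fun x _ y _ h => by simpa using h) hm)
  rw [add_zero] at h
  refine mem_of_superset h ?_
  rintro _ ⟨z, hz, rfl⟩
  exact ⟨p + z, hm hz, rfl⟩

namespace Collar
variable {Ω : Set ℂ} {c : ℂ → ℂ} {p : ℂ} {R : ℝ}

lemma mono (h : Collar Ω c p R) {p' : ℂ} {R' : ℝ} (hR' : 0 < R') (hp' : p'.re = 0)
    (hs : ball p' R' ⊆ ball p R) : Collar Ω c p' R' :=
  ⟨hR', hp', h.cont.mono hs, h.inj.mono hs, fun q hq => h.iff q (hs hq)⟩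

lemma nhds (h : Collar Ω c p R) : c '' ball p R ∈ 𝓝 (c p) := image_ball_mem_nhds h.pos h.cont h.inj

lemma half_mem (h : Collar Ω c p R) : c '' (ball p R ∩ {q | 0 < q.re}) ∈ 𝓝[Ω] (c p) := by
  filter_upwards [nhdsWithin_le_nhds h.nhds, self_mem_nhdsWithin]
  rintro _ ⟨q, hq, rfl⟩ hΩ
  exact ⟨q, ⟨hq, (h.iff q hq).1 hΩ⟩, rfl⟩

lemma half_sub (h : Collar Ω c p R) : c '' (ball p R ∩ {q | 0 < q.re}) ⊆ Ω := by
  rintro _ ⟨q, ⟨hq, hq'⟩, rfl⟩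
  exact (h.iff q hq).2 hq'

lemma half_preconn (h : Collar Ω c p R) : IsPreconnected (c '' (ball p R ∩ {q | 0 < q.re})) := by
  refine IsPreconnected.image ?_ c (h.cont.mono inter_subset_left)
  exact ((convex_ball p R).inter (convex_halfSpace_re_gt 0)).isPreconnected

lemma notMem (h : Collar Ω c p R) : c p ∉ Ω := by
  rw [h.iff p (mem_ball_self h.pos), h.re0]; exact lt_irrefl _

lemma tendsto (h : Collar Ω c p R) : Tendsto c (𝓝[{q | 0 < q.re}] p) (𝓝[Ω] (c p)) := by
  have hb : ball p R ∈ 𝓝[{q | 0 < q.re}] p := nhdsWithin_le_nhds (ball_mem_nhds p h.pos)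
  refine tendsto_nhdsWithin_iff.2 ⟨?_, ?_⟩
  · exact (h.cont.continuousAt (ball_mem_nhds p h.pos)).mono_left nhdsWithin_le_nhds
  · filter_upwards [hb, self_mem_nhdsWithin] with q hq hq'
    exact (h.iff q hq).2 hq'

lemma neBot_half {p : ℂ} (hp : p.re = 0) : (𝓝[{q : ℂ | 0 < q.re}] p).NeBot := by
  rw [← mem_closure_iff_nhdsWithin_neBot, Complex.closure_setOfPred_lt_re]
  exact hp.ge

lemma neBot (h : Collar Ω c p R) : (𝓝[Ω] (c p)).NeBot :=
  have := neBot_half h.re0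
  h.tendsto.neBot

lemma exists_small (h : Collar Ω c p R) {N : Set ℂ} (hN : N ∈ 𝓝 (c p)) :
    ∃ s, 0 < s ∧ s ≤ R ∧ Collar Ω c p s ∧ c '' ball p s ⊆ N := by
  have := (h.cont.continuousAt (ball_mem_nhds p h.pos)).eventually hN
  obtain ⟨s, hs, hsN⟩ := eventually_nhds_iff_ball.1 this
  refine ⟨min s R, lt_min hs h.pos, min_le_right _ _,
    h.mono (lt_min hs h.pos) h.re0 (ball_subset_ball (min_le_right _ _)), ?_⟩
  rintro _ ⟨q, hq, rfl⟩
  exact hsN q (ball_subset_ball (min_le_left _ _) hq)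

end Collar

lemma IsRM.tendsto_norm {Ω : Set ℂ} {ψ φ : ℂ → ℂ} (h : IsRM Ω ψ φ) {w : ℂ} (hw : w ∉ Ω) :
    Tendsto (fun z => ‖ψ z‖) (𝓝[Ω] w) (𝓝 1) := by
  rw [tendsto_order]
  constructor
  · intro s hs
    have hsub : closedBall (0:ℂ) s ⊆ ball 0 1 := closedBall_subset_ball hs
    have hcpt : IsCompact (φ '' closedBall 0 s) :=
      (isCompact_closedBall 0 s).image_of_continuousOn (h.dφ.continuousOn.mono hsub)
    have hnot : w ∉ φ '' closedBall 0 s := by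
      rintro ⟨z, hz, rfl⟩
      exact hw (h.mφ (hsub hz))
    filter_upwards [nhdsWithin_le_nhds (hcpt.isClosed.isOpen_compl.mem_nhds hnot),
      self_mem_nhdsWithin] with z hz hzΩ
    by_contra hcon
    push Not at hcon
    exact hz ⟨ψ z, mem_closedBall_zero_iff.2 hcon, h.φψ z hzΩ⟩
  · intro s hs
    filter_upwards [self_mem_nhdsWithin] with z hz
    exact (mem_ball_zero_iff.1 (h.mψ hz)).trans hs


open MeasureTheory in
lemma image_small {f : ℂ → ℂ} {G : Set ℂ} (hG : IsOpen G) (hf : DifferentiableOn ℂ f G) (c : ℂ) {r : ℝ}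
    (hr : 0 < r) (U : ℂ → ℝ) (C : NNReal)
    (hU : ∀ θ : ℝ, c + r * Complex.exp (θ * Complex.I) ∈ G →
      DifferentiableAt ℝ U (f (c + r * Complex.exp (θ * Complex.I))) ∧
      ‖fderiv ℝ U (f (c + r * Complex.exp (θ * Complex.I)))‖ ≤ C) :
    volume ((fun θ : ℝ => U (f (c + r * Complex.exp (θ * Complex.I)))) ''
      {θ | θ ∈ Ioc (-Real.pi) Real.pi ∧ c + r * Complex.exp (θ * Complex.I) ∈ G}) ≤
    C * ∫⁻ θ in Ioc (-Real.pi) Real.pi, ENNReal.ofReal r *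
      G.indicator (fun z => ‖deriv f z‖ₑ) (c + r * Complex.exp (θ * Complex.I)) := by
  set γ : ℝ → ℂ := fun θ => c + r * Complex.exp (θ * Complex.I) with hγ
  have hγc : Continuous γ := by fun_prop
  set Θ : Set ℝ := {θ | θ ∈ Ioc (-Real.pi) Real.pi ∧ γ θ ∈ G} with hΘ
  have hΘm : MeasurableSet Θ := measurableSet_Ioc.inter (hG.preimage hγc).measurableSet
  have hγd : ∀ θ : ℝ, HasDerivAt γ (r * (Complex.exp (θ * Complex.I) * Complex.I)) θ := by
    intro θ
    have h1 : HasDerivAt (fun θ : ℝ => (θ : ℂ) * Complex.I) Complex.I θ := by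
      simpa using (Complex.ofRealCLM.hasDerivAt (x := θ)).mul_const Complex.I
    exact (h1.cexp.const_mul (r : ℂ)).const_add c
  have hfd : ∀ θ ∈ Θ, HasDerivAt (fun θ => f (γ θ))
      (deriv f (γ θ) * (r * (Complex.exp (θ * Complex.I) * Complex.I))) θ := by
    intro θ hθ
    exact (hf.differentiableAt (hG.mem_nhds hθ.2)).hasDerivAt.comp θ (hγd θ)
  have hd : ∀ θ ∈ Θ, HasDerivAt (fun θ => U (f (γ θ)))
      (fderiv ℝ U (f (γ θ)) (deriv f (γ θ) * (r * (Complex.exp (θ * Complex.I) * Complex.I)))) θ := by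
    intro θ hθ
    exact (hU θ hθ.2).1.hasFDerivAt.comp_hasDerivAt θ (hfd θ hθ)
  have h1 := addHaar_image_le_lintegral_abs_det_fderiv volume hΘm
    (fun θ hθ => (hd θ hθ).hasFDerivAt.hasFDerivWithinAt)
  refine h1.trans ?_
  rw [← lintegral_const_mul' _ _ ENNReal.coe_ne_top]
  refine le_trans ?_ (lintegral_mono_set (fun θ hθ => hθ.1 : Θ ⊆ Ioc (-Real.pi) Real.pi))
  refine setLIntegral_mono' hΘm ?_
  intro θ hθ
  rw [indicator_of_mem hθ.2]
  have hdet : |(ContinuousLinearMap.toSpanSingleton ℝ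
      (fderiv ℝ U (f (γ θ)) (deriv f (γ θ) * (r * (Complex.exp (θ * Complex.I) * Complex.I))))).det|
      ≤ C * (r * ‖deriv f (γ θ)‖) := by
    have : (ContinuousLinearMap.toSpanSingleton ℝ
      (fderiv ℝ U (f (γ θ)) (deriv f (γ θ) * (r * (Complex.exp (θ * Complex.I) * Complex.I))))).det =
      (fderiv ℝ U (f (γ θ)) (deriv f (γ θ) * (r * (Complex.exp (θ * Complex.I) * Complex.I)))) := by
      simp
    rw [this, ← Real.norm_eq_abs]
    refine (ContinuousLinearMap.le_opNorm _ _).trans ?_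
    refine mul_le_mul (hU θ hθ.2).2 (le_of_eq ?_) (norm_nonneg _) C.2
    simp [abs_of_pos hr, mul_comm]
  refine (ENNReal.ofReal_le_ofReal hdet).trans (le_of_eq ?_)
  rw [ENNReal.ofReal_mul (NNReal.coe_nonneg C), ENNReal.ofReal_mul hr.le, ENNReal.ofReal_coe_nnreal, ofReal_norm]

open MeasureTheory in
lemma osc_le {B T : Set ℝ} (hB : IsPreconnected B) (hBT : B ⊆ T) {e : ℝ} (he : 0 ≤ e)
    (hT : volume T ≤ ENNReal.ofReal e) {a b : ℝ} (ha : a ∈ B) (hb : b ∈ B) : |b - a| ≤ e := by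
  have h1 : uIcc a b ⊆ B := hB.ordConnected.uIcc_subset ha hb
  have h2 := (measure_mono (μ := volume) (h1.trans hBT)).trans hT
  rw [Real.volume_interval, ENNReal.ofReal_le_ofReal_iff he] at h2
  exact h2

/-- the radial projection -/
noncomputable def radn (z : ℂ) : ℂ := ((‖z‖⁻¹ : ℝ) : ℂ) * z

lemma radn_lip {a b : ℂ} (hb : 1/2 < ‖b‖) (ha : a ≠ 0) : ‖radn a - radn b‖ ≤ 4 * ‖a - b‖ := by
  have hb0 : 0 < ‖b‖ := by linarith
  have ha0 : 0 < ‖a‖ := norm_pos_iff.2 ha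
  have e : radn a - radn b = ((‖b‖⁻¹ : ℝ) : ℂ) * ((((‖b‖ - ‖a‖) * ‖a‖⁻¹ : ℝ) : ℂ) * a + (a - b)) := by
    have h1 : ((‖a‖ : ℝ) : ℂ) ≠ 0 := by exact_mod_cast ha0.ne'
    have h2 : ((‖b‖ : ℝ) : ℂ) ≠ 0 := by exact_mod_cast hb0.ne'
    simp only [radn]
    push_cast
    field_simp
    ring
  rw [e, norm_mul, Complex.norm_real, norm_inv, norm_norm]
  have h3 : ‖(((‖b‖ - ‖a‖) * ‖a‖⁻¹ : ℝ) : ℂ) * a + (a - b)‖ ≤ 2 * ‖a - b‖ := by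
    refine (norm_add_le _ _).trans ?_
    rw [norm_mul, Complex.norm_real, norm_mul, norm_inv, norm_norm, mul_assoc, inv_mul_cancel₀ ha0.ne',
      mul_one, Real.norm_eq_abs]
    have := abs_norm_sub_norm_le b a
    rw [norm_sub_rev] at this
    linarith
  have h4 : ‖b‖⁻¹ ≤ 2 := by
    rw [inv_le_comm₀ hb0 (by norm_num)]; linarith
  calc ‖b‖⁻¹ * _ ≤ 2 * (2 * ‖a - b‖) := mul_le_mul h4 h3 (norm_nonneg _) (by norm_num)
    _ = _ := by ring

lemma radn_diff {z : ℂ} (hz : z ≠ 0) : DifferentiableAt ℝ radn z := by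
  have h : DifferentiableAt ℝ (fun z : ℂ => ‖z‖⁻¹) z :=
    (differentiableAt_id.norm ℝ hz).inv (norm_ne_zero_iff.2 hz)
  exact (Complex.ofRealCLM.differentiableAt.comp z h).mul differentiableAt_id

lemma radn_fderiv (V : ℂ →L[ℝ] ℝ) (hV : ‖V‖ ≤ 1) {z : ℂ} (hz : 1/2 < ‖z‖) :
    DifferentiableAt ℝ (fun z => V (radn z)) z ∧ ‖fderiv ℝ (fun z => V (radn z)) z‖ ≤ ((4:NNReal):ℝ) := by
  have hz0 : z ≠ 0 := by rintro rfl; simp at hz; linarith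
  refine ⟨V.differentiableAt.comp z (radn_diff hz0), ?_⟩
  refine norm_fderiv_le_of_lip' ℝ (by norm_num) ?_
  filter_upwards [isOpen_ne.mem_nhds hz0] with x hx
  rw [← map_sub]
  refine (V.le_opNorm _).trans ?_
  calc ‖V‖ * _ ≤ 1 * (4 * ‖x - z‖) := mul_le_mul hV (radn_lip hz hx) (norm_nonneg _) (by norm_num)
    _ = _ := by simp

lemma radn_smul {t : ℝ} (ht : 0 < t) (z : ℂ) : radn (t * z) = radn z := by
  have h1 : ((t : ℝ) : ℂ) ≠ 0 := by exact_mod_cast ht.ne'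
  simp only [radn, norm_mul, Complex.norm_real, Real.norm_eq_abs, abs_of_pos ht, mul_inv]
  push_cast
  field_simp

namespace IsRM
variable {Ω : Set ℂ} {ψ φ : ℂ → ℂ}

lemma injψ (h : IsRM Ω ψ φ) : InjOn ψ Ω := fun x hx y hy hxy => by
  rw [← h.φψ x hx, ← h.φψ y hy, hxy]

lemma injφ (h : IsRM Ω ψ φ) : InjOn φ (ball 0 1) := fun x hx y hy hxy => by
  rw [← h.ψφ x hx, ← h.ψφ y hy, hxy]

open MeasureTheory in
lemma osc (h : IsRM Ω ψ φ) {c : ℂ → ℂ} {p : ℂ} {R : ℝ} (hc : Collar Ω c p R) {ε : ℝ} (hε : 0 < ε) :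
    ∃ A ∈ 𝓝[Ω] (c p), ∀ x ∈ A, ∀ y ∈ A, ‖radn (ψ x) - radn (ψ y)‖ ≤ ε := by
  have hsub : closedBall (0:ℂ) (3/4) ⊆ ball 0 1 := closedBall_subset_ball (by norm_num)
  have hcpt : IsCompact (φ '' closedBall 0 (3/4)) :=
    (isCompact_closedBall 0 (3/4)).image_of_continuousOn (h.dφ.continuousOn.mono hsub)
  have hnot : c p ∉ φ '' closedBall 0 (3/4) := by
    rintro ⟨z, hz, hzw⟩
    exact hc.notMem (hzw ▸ h.mφ (hsub hz))
  obtain ⟨ρ0, hρ0, hρ⟩ := Metric.mem_nhds_iff.1 (hcpt.isClosed.isOpen_compl.mem_nhds hnot)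
  have hbig : ∀ z ∈ Ω, dist z (c p) < ρ0 → 1/2 < ‖ψ z‖ := by
    intro z hz hd
    by_contra hcon
    push Not at hcon
    exact hρ (mem_ball.2 hd) ⟨ψ z, mem_closedBall_zero_iff.2 (by linarith), h.φψ z hz⟩
  have hgm : Measurable (Ω.indicator (fun z => ‖deriv ψ z‖ₑ)) :=
    ((measurable_deriv ψ).enorm).indicator h.op.measurableSet
  have hfin := dirichlet_finite h.op h.dψ h.injψ
    (isBounded_ball.subset h.mψ.image_subset)
  have hε' : ENNReal.ofReal (ε / 8) ≠ 0 := by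
    rw [Ne, ENNReal.ofReal_eq_zero]; linarith
  obtain ⟨r, hr0, hr1, hr2⟩ := length_area _ hgm hfin (c p) hε' hρ0
  obtain ⟨s, hs0, hsR, hs, hsN⟩ := hc.exists_small (ball_mem_nhds (c p) hr0)
  set A := c '' (ball p s ∩ {q | 0 < q.re}) with hA
  have hAΩ : A ⊆ Ω := hs.half_sub
  have hAr : A ⊆ ball (c p) r := (image_mono inter_subset_left).trans hsN
  have hconn : IsPreconnected A := hs.half_preconn
  have hγd : ∀ θ : ℝ, dist (c p + r * Complex.exp (θ * Complex.I)) (c p) = r := by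
    intro θ
    simp [dist_eq_norm, Complex.norm_exp_ofReal_mul_I, abs_of_pos hr0]
  -- one linear functional
  have key : ∀ V : ℂ →L[ℝ] ℝ, ‖V‖ ≤ 1 → ∀ x ∈ A, ∀ y ∈ A, |V (radn (ψ x)) - V (radn (ψ y))| ≤ ε / 2 := by
    intro V hV x hx y hy
    have h1 := image_small h.op h.dψ (c p) hr0 (fun z => V (radn z)) 4
      (fun θ hθ => radn_fderiv V hV (hbig _ hθ (by rw [hγd]; exact hr1)))
    have h2 : (((4:NNReal):ENNReal) * ∫⁻ θ in Ioc (-Real.pi) Real.pi, ENNReal.ofReal r *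
      Ω.indicator (fun z => ‖deriv ψ z‖ₑ) (c p + r * Complex.exp (θ * Complex.I))) ≤
        ENNReal.ofReal (ε/2) := by
      calc _ ≤ ((4:NNReal):ENNReal) * ENNReal.ofReal (ε/8) := by gcongr
        _ = ENNReal.ofReal (ε/2) := by
          rw [show ((4:NNReal):ENNReal) = ENNReal.ofReal 4 by simp, ← ENNReal.ofReal_mul (by norm_num)]
          congr 1; ring
    have hcont : ContinuousOn (fun z => V (radn (ψ z))) A := by
      intro z hz
      have hz1 : ψ z ≠ 0 := by
        have := hbig z (hAΩ hz) ((mem_ball.1 (hAr hz)).trans hr1)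
        rintro h0
        rw [h0] at this; simp at this; linarith
      have h3 : ContinuousAt radn (ψ z) := (radn_diff hz1).continuousAt
      exact V.continuous.continuousAt.comp_continuousWithinAt
        (h3.comp_continuousWithinAt (h.dψ.continuousOn.mono hAΩ z hz))
    refine osc_le (hconn.image _ hcont) ?_ (by linarith) (h1.trans h2) (mem_image_of_mem _ hy)
      (mem_image_of_mem _ hx)
    rintro _ ⟨z, hz, rfl⟩
    have hψz : ‖ψ z‖ < 1 := mem_ball_zero_iff.1 (h.mψ (hAΩ hz))
    have hmem : ∀ t ∈ Icc (0:ℝ) 1, (t:ℂ) * ψ z ∈ ball (0:ℂ) 1 := by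
      intro t ht
      rw [mem_ball_zero_iff, norm_mul, Complex.norm_real, Real.norm_of_nonneg ht.1]
      nlinarith [norm_nonneg (ψ z), ht.2]
    have hct : ContinuousOn (fun t : ℝ => dist (φ (t * ψ z)) (c p)) (Icc 0 1) := by
      have hct0 : ContinuousOn (fun t : ℝ => φ (t * ψ z)) (Icc 0 1) :=
        h.dφ.continuousOn.comp (t := ball 0 1) (by fun_prop) hmem
      exact continuous_dist.comp_continuousOn (hct0.prodMk continuousOn_const)
    have h0 : ρ0 ≤ dist (φ ((0:ℝ) * ψ z)) (c p) := by
      by_contra hcon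
      push Not at hcon
      exact hρ (mem_ball.2 hcon) ⟨0, by simp; norm_num, by simp⟩
    have h1' : dist (φ ((1:ℝ) * ψ z)) (c p) < r := by
      simp only [Complex.ofReal_one, one_mul]
      rw [h.φψ z (hAΩ hz)]
      exact hAr hz
    obtain ⟨t, ht, htr⟩ := intermediate_value_Icc' (zero_le_one) hct
      (show r ∈ Icc _ _ from ⟨h1'.le, hr1.le.trans h0⟩)
    replace htr : dist (φ (t * ψ z)) (c p) = r := htr
    have htpos : 0 < t := by
      rcases ht.1.eq_or_lt with h5 | h5
      · exfalso
        subst h5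
        linarith
      · exact h5
    set w := φ (t * ψ z) with hw
    have hwΩ : w ∈ Ω := h.mφ (hmem t ht)
    have hwr : c p + r * Complex.exp (Complex.arg (w - c p) * Complex.I) = w := by
      have h6 := Complex.norm_mul_exp_arg_mul_I (w - c p)
      rw [← dist_eq_norm, htr] at h6
      rw [h6]; ring
    refine ⟨Complex.arg (w - c p), ⟨Complex.arg_mem_Ioc _, ?_⟩, ?_⟩
    · rw [hwr]; exact hwΩ
    · simp only
      rw [hwr, hw, h.ψφ _ (hmem t ht), radn_smul htpos]
  refine ⟨A, hs.half_mem, ?_⟩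
  intro x hx y hy
  have h1 := key Complex.reCLM (by simp) x hx y hy
  have h2 := key Complex.imCLM (by simp) x hx y hy
  have h3 := Complex.norm_le_abs_re_add_abs_im (radn (ψ x) - radn (ψ y))
  simp only [Complex.reCLM_apply, Complex.imCLM_apply] at h1 h2
  rw [Complex.sub_re, Complex.sub_im] at h3
  linarith

/-- boundary limits exist at collared points -/
theorem exists_lim (h : IsRM Ω ψ φ) {c : ℂ → ℂ} {p : ℂ} {R : ℝ} (hc : Collar Ω c p R) :
    ∃ ζ, ‖ζ‖ = 1 ∧ Tendsto ψ (𝓝[Ω] (c p)) (𝓝 ζ) := by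
  have := hc.neBot
  have hcau : Cauchy (map (fun z => radn (ψ z)) (𝓝[Ω] (c p))) := by
    rw [Metric.cauchy_iff]
    refine ⟨inferInstance, fun ε hε => ?_⟩
    obtain ⟨A, hA, hA2⟩ := h.osc hc (half_pos hε)
    refine ⟨_, image_mem_map hA, ?_⟩
    rintro _ ⟨x, hx, rfl⟩ _ ⟨y, hy, rfl⟩
    rw [dist_eq_norm]
    exact (hA2 x hx y hy).trans_lt (half_lt_self hε)
  obtain ⟨ζ, hζ⟩ := CompleteSpace.complete hcau
  have hζ' : Tendsto (fun z => radn (ψ z)) (𝓝[Ω] (c p)) (𝓝 ζ) := hζ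
  have hn := h.tendsto_norm hc.notMem
  have ht : Tendsto ψ (𝓝[Ω] (c p)) (𝓝 ζ) := by
    have h1 : Tendsto (fun z => ((‖ψ z‖ : ℝ) : ℂ) * radn (ψ z)) (𝓝[Ω] (c p)) (𝓝 (((1:ℝ):ℂ) * ζ)) :=
      ((Complex.continuous_ofReal.tendsto 1).comp hn).mul hζ'
    rw [Complex.ofReal_one, one_mul] at h1
    refine h1.congr' ?_
    filter_upwards [hn.eventually (lt_mem_nhds (show (0:ℝ) < 1 by norm_num))] with z hz
    rw [radn, ← mul_assoc, ← Complex.ofReal_mul, mul_inv_cancel₀ hz.ne']; simp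
  refine ⟨ζ, ?_, ht⟩
  exact tendsto_nhds_unique ht.norm hn

lemma hits (h : IsRM Ω ψ φ) {c : ℂ → ℂ} {p : ℂ} {R : ℝ} (hc : Collar Ω c p R) {ζ : ℂ}
    (hζ1 : ‖ζ‖ = 1) (hζ : Tendsto ψ (𝓝[Ω] (c p)) (𝓝 ζ)) {N : Set ℂ} (hN : N ∈ 𝓝 (c p)) :
    ∃ r0 > 0, ∀ r, 0 < r → r < r0 → ∃ z ∈ ball (0:ℂ) 1, dist z ζ = r ∧ φ z ∈ N := by
  have := hc.neBot
  obtain ⟨s, hs0, hsR, hs, hsN⟩ := hc.exists_small hN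
  set A := c '' (ball p s ∩ {q | 0 < q.re}) with hA
  have hAΩ : A ⊆ Ω := hs.half_sub
  have hAN : A ⊆ N := (image_mono inter_subset_left).trans hsN
  have hconn : IsPreconnected A := hs.half_preconn
  have hAm : A ∈ 𝓝[Ω] (c p) := hs.half_mem
  obtain ⟨x, hx⟩ := Filter.nonempty_of_mem hAm
  have hxb := h.mψ (hAΩ hx)
  have hxne : ψ x ≠ ζ := by
    intro h0
    rw [h0, mem_ball_zero_iff, hζ1] at hxb
    exact lt_irrefl _ hxb
  refine ⟨dist (ψ x) ζ, dist_pos.2 hxne, ?_⟩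
  intro r hr0 hr1
  obtain ⟨y, hy, hyA⟩ := ((hζ.eventually (ball_mem_nhds ζ hr0)).and hAm).exists
  have hcont : ContinuousOn (fun z => dist (ψ z) ζ) A :=
    continuous_dist.comp_continuousOn ((h.dψ.continuousOn.mono hAΩ).prodMk continuousOn_const)
  obtain ⟨z, hz, hzr⟩ := hconn.intermediate_value hyA hx hcont (show r ∈ Icc _ _ from ⟨le_of_lt hy, hr1.le⟩)
  exact ⟨ψ z, h.mψ (hAΩ hz), hzr, by rw [h.φψ z (hAΩ hz)]; exact hAN hz⟩

open MeasureTheory in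
theorem lim_ne (h : IsRM Ω ψ φ) {c c' : ℂ → ℂ} {p p' : ℂ} {R R' : ℝ} (hc : Collar Ω c p R)
    (hc' : Collar Ω c' p' R') (hne : c p ≠ c' p') {ζ : ℂ} (hζ1 : ‖ζ‖ = 1)
    (hζ : Tendsto ψ (𝓝[Ω] (c p)) (𝓝 ζ)) (hζ' : Tendsto ψ (𝓝[Ω] (c' p')) (𝓝 ζ)) : False := by
  set d := ‖c' p' - c p‖ with hd
  have hd0 : 0 < d := norm_pos_iff.2 (sub_ne_zero.2 hne.symm)
  obtain ⟨r0, hr0, H0⟩ := h.hits hc hζ1 hζ (ball_mem_nhds _ (by positivity : 0 < d/8))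
  obtain ⟨r1, hr1, H1⟩ := h.hits hc' hζ1 hζ' (ball_mem_nhds _ (by positivity : 0 < d/8))
  have hζ0 : ζ ≠ 0 := by rintro rfl; simp at hζ1
  -- move ζ to the origin
  set f : ℂ → ℂ := fun z => φ (ζ * (1 - z)) with hf
  set G : Set ℂ := ball 1 1 with hGdef
  have hm : ∀ z, ζ * (1 - z) ∈ ball (0:ℂ) 1 ↔ z ∈ G := by
    intro z
    rw [mem_ball_zero_iff, norm_mul, hζ1, one_mul, hGdef, mem_ball, dist_eq_norm, norm_sub_rev]
  have hfd : DifferentiableOn ℂ f G :=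
    h.dφ.comp (by fun_prop) (fun z hz => (hm z).2 hz)
  have hfi : InjOn f G := by
    intro x hx y hy hxy
    have := h.injφ ((hm x).2 hx) ((hm y).2 hy) hxy
    have := mul_left_cancel₀ hζ0 this
    linear_combination -this
  have hfb : Bornology.IsBounded (f '' G) := by
    refine h.bdd.subset ?_
    rintro _ ⟨z, hz, rfl⟩
    exact h.mφ ((hm z).2 hz)
  have hgm : Measurable (G.indicator (fun z => ‖deriv f z‖ₑ)) :=
    ((measurable_deriv f).enorm).indicator measurableSet_ball
  have hfin := dirichlet_finite isOpen_ball hfd hfi hfb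
  have hε' : ENNReal.ofReal (d / 4) ≠ 0 := by
    rw [Ne, ENNReal.ofReal_eq_zero]; linarith
  obtain ⟨r, hrp, hrlt, hr2⟩ := length_area _ hgm hfin 0 hε' (lt_min (lt_min hr0 hr1) one_pos)
  obtain ⟨z0, hz0, hz0r, hz0N⟩ := H0 r hrp (hrlt.trans_le ((min_le_left _ _).trans (min_le_left _ _)))
  obtain ⟨z1, hz1, hz1r, hz1N⟩ := H1 r hrp (hrlt.trans_le ((min_le_left _ _).trans (min_le_right _ _)))
  -- the functional
  set u : ℂ := (starRingEnd ℂ) (c' p' - c p) / d with hu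
  have hun : ‖u‖ = 1 := by
    rw [hu, norm_div, RCLike.norm_conj, Complex.norm_real, norm_norm]
    exact div_self hd0.ne'
  set V : ℂ →L[ℝ] ℝ := Complex.reCLM.comp ((ContinuousLinearMap.mul ℝ ℂ) u) with hV
  have hVa : ∀ z, V z = (u * z).re := fun z => rfl
  have hVn : ‖V‖ ≤ 1 := by
    refine V.opNorm_le_bound (by norm_num) ?_
    intro z
    rw [hVa, Real.norm_eq_abs, one_mul]
    refine (Complex.abs_re_le_norm _).trans ?_
    rw [norm_mul, hun, one_mul]
  have h1 := image_small isOpen_ball hfd 0 hrp (fun z => V z) 1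
    (fun θ _ => ⟨V.differentiableAt, by
      have : fderiv ℝ (fun z => V z) (f (0 + r * Complex.exp (θ * Complex.I))) = V := V.fderiv
      rw [this]; simpa using hVn⟩)
  simp only [zero_add] at h1 hr2
  set Θ : Set ℝ := {θ | θ ∈ Ioc (-Real.pi) Real.pi ∧ (r * Complex.exp (θ * Complex.I) : ℂ) ∈ ball (1:ℂ) 1} with hΘ
  have hcosI : ∀ θ : ℝ, (r * Complex.exp (θ * Complex.I) : ℂ) ∈ ball (1:ℂ) 1 ↔ r / 2 < Real.cos θ := by
    intro θ
    rw [mem_ball, dist_eq_norm, ← sq_lt_one_iff₀ (norm_nonneg _), ← Complex.normSq_eq_norm_sq,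
      Complex.normSq_apply]
    have e1 : (r * Complex.exp (θ * Complex.I) - 1 : ℂ).re = r * Real.cos θ - 1 := by
      simp [Complex.exp_ofReal_mul_I_re]
    have e2 : (r * Complex.exp (θ * Complex.I) - 1 : ℂ).im = r * Real.sin θ := by
      simp [Complex.exp_ofReal_mul_I_im]
    rw [e1, e2]
    have := Real.sin_sq_add_cos_sq θ
    have e3 : (r * Real.cos θ - 1) * (r * Real.cos θ - 1) + r * Real.sin θ * (r * Real.sin θ) =
      r * (r - 2 * Real.cos θ) + 1 := by linear_combination r^2 * this
    rw [e3]
    constructor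
    · intro hh
      have : r * (r - 2 * Real.cos θ) < 0 := by linarith
      have := neg_of_mul_neg_right this hrp.le
      linarith
    · intro hh
      have : r * (r - 2 * Real.cos θ) < 0 := mul_neg_of_pos_of_neg hrp (by linarith)
      linarith
  have hΘo : Θ.OrdConnected := by
    refine ⟨?_⟩
    intro a ha b hb x hx
    have hxI : x ∈ Ioc (-Real.pi) Real.pi := ⟨ha.1.1.trans_le hx.1, hx.2.trans hb.1.2⟩
    refine ⟨hxI, ?_⟩
    have ha2 := (hcosI a).1 ha.2
    have hb2 := (hcosI b).1 hb.2
    rw [hcosI]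
    rcases le_total 0 x with h0 | h0
    · exact hb2.trans_le (Real.cos_le_cos_of_nonneg_of_le_pi h0 hb.1.2 hx.2)
    · refine ha2.trans_le ?_
      rw [← Real.cos_neg a, ← Real.cos_neg x]
      exact Real.cos_le_cos_of_nonneg_of_le_pi (by linarith) (by linarith [ha.1.1]) (by linarith [hx.1])
  have hFc : ContinuousOn (fun θ : ℝ => V (f (r * Complex.exp (θ * Complex.I)))) Θ := by
    refine V.continuous.comp_continuousOn ?_
    exact hfd.continuousOn.comp (by fun_prop) (fun θ hθ => hθ.2)
  have hmemΘ : ∀ z ∈ ball (0:ℂ) 1, dist z ζ = r → ∃ θ ∈ Θ, f (r * Complex.exp (θ * Complex.I)) = φ z := by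
    intro z hz hzr
    set y := 1 - z / ζ with hy
    have hzy : ζ * (1 - y) = z := by rw [hy]; field_simp; ring
    have hyr : ‖y‖ = r := by
      have : ζ * y = ζ - z := by rw [hy]; field_simp
      have h4 : ‖ζ * y‖ = r := by rw [this, ← hzr, dist_eq_norm, norm_sub_rev]
      rwa [norm_mul, hζ1, one_mul] at h4
    have hye : (r * Complex.exp (Complex.arg y * Complex.I) : ℂ) = y := by
      rw [← hyr]; exact Complex.norm_mul_exp_arg_mul_I y
    refine ⟨Complex.arg y, ⟨Complex.arg_mem_Ioc _, ?_⟩, ?_⟩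
    · rw [hye]; exact (hm y).1 (hzy ▸ hz)
    · rw [hye, hf]; simp only; rw [hzy]
  obtain ⟨θ0, hθ0, e0⟩ := hmemΘ z0 hz0 hz0r
  obtain ⟨θ1, hθ1, e1⟩ := hmemΘ z1 hz1 hz1r
  have hfinal := osc_le (hΘo.isPreconnected.image _ hFc) Subset.rfl (by positivity : 0 ≤ d/4)
    (h1.trans (by rw [ENNReal.coe_one, one_mul]; exact hr2.le)) (mem_image_of_mem _ hθ0) (mem_image_of_mem _ hθ1)
  simp only [e0, e1] at hfinal
  rw [← map_sub, hVa] at hfinal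
  have e5 : (u * (c' p' - c p)).re = d := by
    have : u * (c' p' - c p) = (d : ℂ) := by
      rw [hu, div_mul_eq_mul_div, mul_comm, Complex.mul_conj, Complex.normSq_eq_norm_sq, ← hd]
      have : (d:ℂ) ≠ 0 := by exact_mod_cast hd0.ne'
      push_cast
      field_simp
    rw [this, Complex.ofReal_re]
  have e6 : u * (φ z1 - φ z0) = u * (c' p' - c p) + u * ((φ z1 - c' p') - (φ z0 - c p)) := by ring
  rw [e6, Complex.add_re, e5] at hfinal
  have e7 : |(u * ((φ z1 - c' p') - (φ z0 - c p))).re| ≤ d/8 + d/8 := by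
    refine (Complex.abs_re_le_norm _).trans ?_
    rw [norm_mul, hun, one_mul]
    refine (norm_sub_le _ _).trans ?_
    rw [mem_ball, dist_eq_norm] at hz0N hz1N
    linarith
  have e8 := abs_le.1 e7
  have e9 := abs_le.1 hfinal
  linarith

end IsRM

/-- collared boundary points -/
def BAcc (Ω : Set ℂ) : Set ℂ := {w | ∃ c p R, Collar Ω c p R ∧ c p = w}

/-- the boundary extension of the Riemann map -/
noncomputable def bext (Ω : Set ℂ) (ψ : ℂ → ℂ) : ℂ → ℂ := extendFrom Ω ψ

lemma BAcc.notMem {Ω : Set ℂ} {w : ℂ} (hw : w ∈ BAcc Ω) : w ∉ Ω := by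
  obtain ⟨c, p, R, hc, rfl⟩ := hw
  exact hc.notMem

namespace IsRM
variable {Ω : Set ℂ} {ψ φ : ℂ → ℂ}

lemma bext_tendsto (h : IsRM Ω ψ φ) {w : ℂ} (hw : w ∈ Ω ∪ BAcc Ω) :
    (𝓝[Ω] w).NeBot ∧ Tendsto ψ (𝓝[Ω] w) (𝓝 (bext Ω ψ w)) := by
  have hne : (𝓝[Ω] w).NeBot := by
    rcases hw with hw | ⟨c, p, R, hc, rfl⟩
    · exact (mem_closure_iff_nhdsWithin_neBot.1 (subset_closure hw))
    · exact hc.neBot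
  refine ⟨hne, ?_⟩
  refine tendsto_extendFrom ?_
  rcases hw with hw | ⟨c, p, R, hc, rfl⟩
  · exact ⟨_, h.dψ.continuousOn w hw⟩
  · obtain ⟨ζ, _, hζ⟩ := h.exists_lim hc
    exact ⟨ζ, hζ⟩

lemma bext_eq (h : IsRM Ω ψ φ) {w : ℂ} (hw : w ∈ Ω) : bext Ω ψ w = ψ w := by
  obtain ⟨h1, h2⟩ := h.bext_tendsto (Or.inl hw)
  exact tendsto_nhds_unique h2 (h.dψ.continuousOn w hw)

lemma bext_norm (h : IsRM Ω ψ φ) {w : ℂ} (hw : w ∈ BAcc Ω) : ‖bext Ω ψ w‖ = 1 := by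
  obtain ⟨h1, h2⟩ := h.bext_tendsto (Or.inr hw)
  obtain ⟨c, p, R, hc, rfl⟩ := hw
  exact tendsto_nhds_unique h2.norm (h.tendsto_norm hc.notMem)

lemma bext_lt (h : IsRM Ω ψ φ) {w : ℂ} (hw : w ∈ Ω) : ‖bext Ω ψ w‖ < 1 := by
  rw [h.bext_eq hw]; exact mem_ball_zero_iff.1 (h.mψ hw)

lemma bext_le (h : IsRM Ω ψ φ) {w : ℂ} (hw : w ∈ Ω ∪ BAcc Ω) : ‖bext Ω ψ w‖ ≤ 1 := by
  rcases hw with hw | hw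
  · exact (h.bext_lt hw).le
  · exact (h.bext_norm hw).le

lemma bext_cont (h : IsRM Ω ψ φ) : ContinuousOn (bext Ω ψ) (Ω ∪ BAcc Ω) := by
  refine continuousOn_extendFrom ?_ ?_
  · intro w hw
    exact mem_closure_iff_nhdsWithin_neBot.2 (h.bext_tendsto hw).1
  · intro w hw
    exact ⟨_, (h.bext_tendsto hw).2⟩

lemma bext_inj (h : IsRM Ω ψ φ) : InjOn (bext Ω ψ) (Ω ∪ BAcc Ω) := by
  intro x hx y hy hxy
  rcases hx with hx | hx <;> rcases hy with hy | hy
  · rw [h.bext_eq hx, h.bext_eq hy] at hxy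
    exact h.injψ hx hy hxy
  · have h1 := h.bext_lt hx
    rw [hxy, h.bext_norm hy] at h1
    exact absurd h1 (lt_irrefl _)
  · have h1 := h.bext_lt hy
    rw [← hxy, h.bext_norm hx] at h1
    exact absurd h1 (lt_irrefl _)
  · have h1 := (h.bext_tendsto (Or.inr hx)).2
    have h2 := (h.bext_tendsto (Or.inr hy)).2
    have h3 := h.bext_norm hx
    by_contra hne
    obtain ⟨c, p, R, hc, rfl⟩ := hx
    obtain ⟨c', p', R', hc', rfl⟩ := hy
    rw [← hxy] at h2
    exact h.lim_ne hc hc' hne h3 h1 h2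

/-- the boundary extension is open onto its image relative to the closed disc -/
theorem bext_open (h : IsRM Ω ψ φ) {w : ℂ} (hw : w ∈ Ω ∪ BAcc Ω) {N : Set ℂ} (hN : N ∈ 𝓝 w) :
    bext Ω ψ '' (N ∩ (Ω ∪ BAcc Ω)) ∈ 𝓝[closedBall 0 1] (bext Ω ψ w) := by
  rcases hw with hw | hw
  · refine nhdsWithin_le_nhds ?_
    rw [h.bext_eq hw]
    have hφc : ContinuousAt φ (ψ w) :=
      h.dφ.continuousOn.continuousAt (isOpen_ball.mem_nhds (h.mψ hw))
    have hN' : N ∈ 𝓝 (φ (ψ w)) := by rwa [h.φψ w hw]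
    filter_upwards [hφc.eventually hN', isOpen_ball.mem_nhds (h.mψ hw)] with z hz hzb
    exact ⟨φ z, ⟨hz, Or.inl (h.mφ hzb)⟩, by rw [h.bext_eq (h.mφ hzb), h.ψφ z hzb]⟩
  · have hw' : w ∈ Ω ∪ BAcc Ω := Or.inr hw
    have hn1 := h.bext_norm hw
    have hev : ∀ᶠ z in 𝓝[Ω ∪ BAcc Ω] w, bext Ω ψ z ≠ 0 := by
      have := (h.bext_cont w hw').norm
      have h2 := this.eventually (lt_mem_nhds (show (0:ℝ) < ‖bext Ω ψ w‖ by rw [hn1]; norm_num))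
      filter_upwards [h2] with z hz
      exact norm_pos_iff.1 hz
    obtain ⟨N2, hN2, hN2'⟩ := mem_nhdsWithin_iff_exists_mem_nhds_inter.1 hev
    obtain ⟨c, p, R, hc, rfl⟩ := hw
    obtain ⟨s, hs0, hsR, hs, hsN⟩ := hc.exists_small (inter_mem hN hN2)
    have hcl : ∀ q ∈ ball p s, 0 ≤ q.re → c q ∈ Ω ∪ BAcc Ω := by
      intro q hq hq0
      rcases hq0.eq_or_lt with h0 | h0
      · right
        obtain ⟨ε, hε, hεs⟩ := Metric.isOpen_iff.1 isOpen_ball q hq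
        exact ⟨c, q, ε, hs.mono hε h0.symm hεs, rfl⟩
      · left; exact (hs.iff q hq).2 h0
    have hax : ∀ q ∈ ball p s, q.re = 0 → ‖bext Ω ψ (c q)‖ = 1 := by
      intro q hq h0
      rcases hcl q hq h0.ge with h1 | h1
      · have := (hs.iff q hq).1 h1; linarith
      · exact h.bext_norm h1
    have hin : ∀ q ∈ ball p s, 0 < q.re → ‖bext Ω ψ (c q)‖ < 1 := by
      intro q hq h0
      exact h.bext_lt ((hs.iff q hq).2 h0)
    have hnz : ∀ q ∈ ball p s, 0 ≤ q.re → bext Ω ψ (c q) ≠ 0 := by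
      intro q hq hq0
      exact hN2' ⟨(hsN (mem_image_of_mem c hq)).2, hcl q hq hq0⟩
    set ρ : ℂ → ℂ := fun q => -(starRingEnd ℂ) q with hρ
    have hρre : ∀ q, (ρ q).re = -q.re := by intro q; simp [hρ]
    have hρp : ρ p = p := by
      apply Complex.ext
      · rw [hρre, hc.re0]; simp
      · simp [hρ]
    have hρρ : ∀ q, ρ (ρ q) = q := by intro q; simp [hρ]
    have hρc : Continuous ρ := by rw [hρ]; fun_prop
    have hρb : ∀ q ∈ ball p s, ρ q ∈ ball p s := by
      intro q hq
      rw [mem_ball, dist_eq_norm] at *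
      have : ρ q - p = -(starRingEnd ℂ) (q - p) := by
        conv_lhs => rw [← hρp]
        simp [hρ]; ring
      rw [this, norm_neg, RCLike.norm_conj]
      exact hq
    set E : ℂ → ℂ := fun q => bext Ω ψ (c q) with hE
    set B : Set ℂ := ball p s with hB
    have hEc : ContinuousOn E (B ∩ {q | 0 ≤ q.re}) :=
      h.bext_cont.comp (hs.cont.mono inter_subset_left) (fun q hq => hcl q hq.1 hq.2)
    have hEi : InjOn E (B ∩ {q | 0 ≤ q.re}) := by
      intro a ha b hb hab
      exact hs.inj ha.1 hb.1 (h.bext_inj (hcl a ha.1 ha.2) (hcl b hb.1 hb.2) hab)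
    set E2 : ℂ → ℂ := fun q => ((starRingEnd ℂ) (E (ρ q)))⁻¹ with hE2
    have hE2c : ContinuousOn E2 (B ∩ {q | q.re ≤ 0}) := by
      have hm : MapsTo ρ (B ∩ {q | q.re ≤ 0}) (B ∩ {q | 0 ≤ q.re}) := by
        intro q hq
        refine ⟨hρb q hq.1, ?_⟩
        have := hq.2
        simp only [mem_ofPred_eq] at *
        rw [hρre]; linarith
      have h1 : ContinuousOn (fun q => E (ρ q)) (B ∩ {q | q.re ≤ 0}) := hEc.comp hρc.continuousOn hm
      have h2 : ContinuousOn (fun q => (starRingEnd ℂ) (E (ρ q))) (B ∩ {q | q.re ≤ 0}) :=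
        Complex.continuous_conj.comp_continuousOn h1
      refine h2.inv₀ ?_
      intro q hq h0
      exact hnz _ (hm hq).1 (hm hq).2 (by simpa using h0)
    have hagree : ∀ q ∈ B, q.re = 0 → E q = E2 q := by
      intro q hq h0
      have hρq : ρ q = q := by
        apply Complex.ext
        · rw [hρre, h0]; simp
        · simp [hρ]
      rw [hE2]
      simp only
      rw [hρq, ← RCLike.inv_eq_conj (hax q hq h0)]
      simp [hE]
    classical
    set G : ℂ → ℂ := fun q => if 0 ≤ q.re then E q else E2 q with hG
    have hGc : ContinuousOn G B := by
      refine ContinuousOn.if ?_ ?_ ?_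
      · rintro q ⟨hq, hfr⟩
        have h5 : {a : ℂ | 0 ≤ a.re} = {a | (fun _ => (0:ℝ)) a ≤ Complex.re a} := rfl
        have h4 := frontier_le_subset_eq (continuous_const (y := (0:ℝ))) Complex.continuous_re hfr
        exact hagree q hq (Eq.symm h4)
      · refine hEc.mono (inter_subset_inter_right _ ?_)
        exact (isClosed_le continuous_const Complex.continuous_re).closure_subset
      · refine hE2c.mono (inter_subset_inter_right _ ?_)
        refine closure_minimal ?_ (isClosed_le Complex.continuous_re continuous_const)
        intro q hq
        simp only [mem_ofPred_eq, not_le] at *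
        exact hq.le
    have hneg : ∀ q ∈ B, q.re < 0 → 1 < ‖E2 q‖ := by
      intro q hq h0
      have h1 : 0 < (ρ q).re := by rw [hρre]; linarith
      have h2 := hin _ (hρb q hq) h1
      have h3 := norm_pos_iff.2 (hnz _ (hρb q hq) h1.le)
      rw [hE2]
      simp only
      rw [norm_inv, RCLike.norm_conj]
      exact (one_lt_inv₀ h3).2 h2
    have hpos : ∀ q ∈ B, 0 ≤ q.re → ‖E q‖ ≤ 1 := fun q hq h0 => h.bext_le (hcl q hq h0)
    have hGi : InjOn G B := by
      intro a ha b hb hab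
      rw [hG] at hab
      simp only at hab
      split_ifs at hab with h1 h2 h2
      · exact hEi ⟨ha, h1⟩ ⟨hb, h2⟩ hab
      · have h3 := hpos a ha h1
        have h4 := hneg b hb (not_le.1 h2)
        rw [hab] at h3; linarith
      · have h3 := hpos b hb h2
        have h4 := hneg a ha (not_le.1 h1)
        rw [hab] at h4; linarith
      · push Not at h1 h2
        have h3 : E (ρ a) = E (ρ b) := by
          have := inv_injective hab
          exact (starRingEnd ℂ).injective this
        have h4 := hEi ⟨hρb a ha, by simp only [mem_ofPred_eq]; rw [hρre]; linarith⟩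
          ⟨hρb b hb, by simp only [mem_ofPred_eq]; rw [hρre]; linarith⟩ h3
        rw [← hρρ a, h4, hρρ]
    have hfin := image_ball_mem_nhds hs0 hGc hGi
    have hGp : G p = bext Ω ψ (c p) := by
      rw [hG]; simp only; rw [if_pos hc.re0.ge]
    rw [hGp] at hfin
    filter_upwards [nhdsWithin_le_nhds hfin, self_mem_nhdsWithin]
    rintro _ ⟨q, hq, rfl⟩ hq1
    rw [mem_closedBall_zero_iff] at hq1
    by_cases h0 : 0 ≤ q.re
    · have : G q = E q := by rw [hG]; simp only; rw [if_pos h0]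
      rw [this]
      exact ⟨c q, ⟨(hsN (mem_image_of_mem c hq)).1, hcl q hq h0⟩, rfl⟩
    · have : G q = E2 q := by rw [hG]; simp only; rw [if_neg h0]
      rw [this] at hq1
      have := hneg q hq (not_le.1 h0)
      linarith

end IsRM


section Classes
lemma eventually_prod_same_iff' {α : Type*} {f : Filter α} {r : α × α → Prop} :
    (∀ᶠ p in f ×ˢ f, r p) ↔ ∃ t ∈ f, ∀ x ∈ t, ∀ y ∈ t, r (x, y) := by
  rw [Filter.Eventually, mem_prod_self_iff]
  constructor
  · rintro ⟨t, ht, h⟩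
    exact ⟨t, ht, fun x hx y hy => h (mk_mem_prod hx hy)⟩
  · rintro ⟨t, ht, h⟩
    exact ⟨t, ht, fun p hp => h p.1 hp.1 p.2 hp.2⟩

variable {S : Type*} [TopologicalSpace S]

/-- local coboundaries mod 2 -/
def IsCoc {S : Type*} [TopologicalSpace S] (ω : S → S → ZMod 2) : Prop :=
  ∀ z, ∃ b : S → ZMod 2, ∀ᶠ p in 𝓝 z ×ˢ 𝓝 z, ω p.1 p.2 = b p.1 + b p.2

def ZeroAt {S : Type*} [TopologicalSpace S] (ω : S → S → ZMod 2) (z : S) : Prop :=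
  ∀ᶠ p in 𝓝 z ×ˢ 𝓝 z, ω p.1 p.2 = 0

def TrivOn {S : Type*} [TopologicalSpace S] (ω : S → S → ZMod 2) (U : Set S) : Prop :=
  ∃ a : S → ZMod 2, ∀ z ∈ U, ∀ᶠ p in 𝓝 z ×ˢ 𝓝 z, ω p.1 p.2 = a p.1 + a p.2

def GoodSet {S : Type*} [TopologicalSpace S] (U : Set S) : Prop :=
  ∀ (ω : S → S → ZMod 2) (C : Set S), IsCoc ω → IsCompact C → C ⊆ U → (∀ z ∉ C, ZeroAt ω z) → TrivOn ω U

lemma zmod_const {s : Set S} (hs : IsPreconnected s) {f : S → ZMod 2}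
    (h : ∀ z ∈ s, ∀ᶠ x in 𝓝[s] z, f x = f z) {x y : S} (hx : x ∈ s) (hy : y ∈ s) : f x = f y := by
  letI : TopologicalSpace (ZMod 2) := ⊥
  haveI : DiscreteTopology (ZMod 2) := ⟨rfl⟩
  refine hs.constant (f := f) ?_ hx hy
  intro z hz
  rw [ContinuousWithinAt, nhds_discrete, tendsto_pure]
  exact h z hz

lemma z2a (a b c d : ZMod 2) (h : a + b = c + d) : a + c = b + d := by revert a b c d; decide
lemma z2b (a b : ZMod 2) (h : a + b = 0) : a = b := by revert a b; decide

/-- a cocycle in the plane is trivial on the unit disc -/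
lemma coc_ball {ω : ℂ → ℂ → ZMod 2} (hω : IsCoc ω) : TrivOn ω (ball 0 1) := by
  have h1 : ∀ z, ∃ b : ℂ → ZMod 2, ∃ N : Set ℂ, IsOpen N ∧ z ∈ N ∧ ∀ x ∈ N, ∀ y ∈ N, ω x y = b x + b y := by
    intro z
    obtain ⟨b, hb⟩ := hω z
    rw [eventually_prod_same_iff'] at hb
    obtain ⟨t, ht, htb⟩ := hb
    obtain ⟨N, hN, hNo, hzN⟩ := _root_.mem_nhds_iff.1 ht
    exact ⟨b, N, hNo, hzN, fun x hx y hy => htb _ (hN hx) _ (hN hy)⟩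
  choose b N hNo hzN hN using h1
  obtain ⟨δ, hδ, hL⟩ := lebesgue_number_lemma_of_metric (isCompact_closedBall (0:ℂ) 1) hNo
    (fun z _ => mem_iUnion.2 ⟨z, hzN z⟩)
  obtain ⟨n, hn⟩ := exists_nat_gt (4/δ)
  have hn0 : (0:ℝ) < n := lt_trans (by positivity) hn
  have hn1 : 1 / (n:ℝ) < δ / 4 := by
    rw [div_lt_div_iff₀ hn0 (by norm_num)]
    rw [div_lt_iff₀ hδ] at hn
    linarith
  set P : ℂ → ℕ → ℂ := fun x k => (((k:ℝ)/n : ℝ) : ℂ) * x with hP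
  refine ⟨fun x => ∑ k ∈ Finset.range n, ω (P x k) (P x (k+1)), ?_⟩
  intro z hz
  have hev : ∀ᶠ x in 𝓝 z, x ∈ ball z (δ/4) ∩ ball 0 1 :=
    inter_mem (ball_mem_nhds z (by positivity)) (isOpen_ball.mem_nhds hz)
  filter_upwards [hev.prod_mk hev]
  rintro ⟨x, y⟩ ⟨⟨hxz, hx⟩, ⟨hyz, hy⟩⟩
  simp only at *
  have hxy : dist x y < δ/2 := by
    have := dist_triangle_right x y z
    rw [mem_ball] at hxz hyz
    linarith
  have hx1 : ‖x‖ < 1 := mem_ball_zero_iff.1 hx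
  have hy1 : ‖y‖ < 1 := mem_ball_zero_iff.1 hy
  have hkn : ∀ k ≤ n, (k:ℝ)/n ≤ 1 := by
    intro k hk
    rw [div_le_one hn0]; exact_mod_cast hk
  have hPn : ∀ w : ℂ, ‖w‖ < 1 → ∀ k ≤ n, ‖P w k‖ ≤ 1 := by
    intro w hw k hk
    rw [hP]; simp only
    rw [norm_mul, Complex.norm_real, Real.norm_of_nonneg (by positivity)]
    have := hkn k hk
    have h0 : 0 ≤ (k:ℝ)/n := by positivity
    nlinarith [norm_nonneg w]
  have hstep : ∀ w : ℂ, ‖w‖ < 1 → ∀ k, dist (P w (k+1)) (P w k) < δ/4 := by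
    intro w hw k
    rw [dist_eq_norm, hP]; simp only
    have : ((((k+1:ℕ):ℝ)/n : ℝ) : ℂ) * w - (((k:ℝ)/n : ℝ) : ℂ) * w = ((1/(n:ℝ) : ℝ) : ℂ) * w := by
      push_cast; ring
    rw [this, norm_mul, Complex.norm_real, Real.norm_of_nonneg (by positivity)]
    have h0 : 0 < 1/(n:ℝ) := by positivity
    nlinarith [norm_nonneg w]
  have hPxy : ∀ k ≤ n, dist (P y k) (P x k) < δ/2 := by
    intro k hk
    rw [dist_eq_norm, hP]; simp only
    rw [← mul_sub, norm_mul, Complex.norm_real, Real.norm_of_nonneg (by positivity), ← dist_eq_norm, dist_comm]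
    have := hkn k hk
    have h0 : 0 ≤ (k:ℝ)/n := by positivity
    nlinarith [dist_nonneg (x := x) (y := y)]
  have hsq : ∀ k < n, ω (P x k) (P x (k+1)) + ω (P y k) (P y (k+1)) =
      ω (P x k) (P y k) + ω (P x (k+1)) (P y (k+1)) := by
    intro k hk
    obtain ⟨i, hi⟩ := hL (P x k) (mem_closedBall_zero_iff.2 (hPn x hx1 k hk.le))
    have m1 : P x k ∈ N i := hi (mem_ball_self hδ)
    have m2 : P x (k+1) ∈ N i := hi (mem_ball.2 (by have := hstep x hx1 k; linarith))
    have m3 : P y k ∈ N i := hi (mem_ball.2 (by have := hPxy k hk.le; linarith))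
    have m4 : P y (k+1) ∈ N i := hi (mem_ball.2 (by
      have h1 := hPxy k hk.le
      have h2 := hstep y hy1 k
      have h3 := dist_triangle (P y (k+1)) (P y k) (P x k)
      linarith))
    rw [hN i _ m1 _ m2, hN i _ m3 _ m4, hN i _ m1 _ m3, hN i _ m2 _ m4]
    ring
  have hind : ∀ m ≤ n, ∑ k ∈ Finset.range m, ω (P x k) (P x (k+1)) + ∑ k ∈ Finset.range m, ω (P y k) (P y (k+1))
      = ω (P x 0) (P y 0) + ω (P x m) (P y m) := by
    intro m
    induction m with
    | zero => intro _; simp [CharTwo.add_self_eq_zero]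
    | succ m ih =>
      intro hm
      have h1 := ih (by omega)
      have h2 := hsq m (by omega)
      rw [Finset.sum_range_succ, Finset.sum_range_succ]
      have h3 : ∀ A B c d e f g : ZMod 2, A + B = e + f → c + d = f + g → (A + c) + (B + d) = e + g := by
        decide
      exact h3 _ _ _ _ _ _ _ h1 h2
  rw [hind n le_rfl]
  have e0 : ω (P x 0) (P y 0) = 0 := by
    have hx0 : P x 0 = 0 := by simp [hP]
    have hy0 : P y 0 = 0 := by simp [hP]
    rw [hx0, hy0, hN 0 _ (hzN 0) _ (hzN 0)]
    exact CharTwo.add_self_eq_zero _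
  have en : ∀ w, P w n = w := by
    intro w; simp only [hP]; rw [div_self hn0.ne']; simp
  rw [e0, en, en, zero_add]

lemma coc_chart {φ : ℂ → S} (hφ : IsOpenEmbedding φ) {ω : S → S → ZMod 2} (hω : IsCoc ω) :
    TrivOn ω (φ '' ball 0 1) := by
  have h1 : IsCoc (fun x y => ω (φ x) (φ y)) := by
    intro z
    obtain ⟨b, hb⟩ := hω (φ z)
    refine ⟨fun x => b (φ x), ?_⟩
    have ht := (hφ.continuous.tendsto z).prodMap (hφ.continuous.tendsto z)
    exact ht.eventually hb
  obtain ⟨a, ha⟩ := coc_ball h1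
  refine ⟨fun s => a (Function.invFun φ s), ?_⟩
  rintro _ ⟨z, hz, rfl⟩
  have h2 := ha z hz
  rw [← hφ.map_nhds_eq, Filter.prod_map_map_eq, eventually_map]
  filter_upwards [h2] with p hp
  simp only [Function.leftInverse_invFun hφ.injective _]
  exact hp

lemma triv_locconst {ω : S → S → ZMod 2} {a a' : S → ZMod 2} {z : S}
    (h : ∀ᶠ p in 𝓝 z ×ˢ 𝓝 z, ω p.1 p.2 = a p.1 + a p.2)
    (h' : ∀ᶠ p in 𝓝 z ×ˢ 𝓝 z, ω p.1 p.2 = a' p.1 + a' p.2) :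
    ∀ᶠ x in 𝓝 z, a x + a' x = a z + a' z := by
  obtain ⟨t, ht, H⟩ := eventually_prod_same_iff'.1 (h.and h')
  filter_upwards [ht] with x hx
  have h3 := H x hx z (mem_of_mem_nhds ht)
  exact z2a _ _ _ _ (h3.1.symm.trans h3.2)

/-- the group of classes is finite -/
theorem coc_finite [CompactSpace S] [T2Space S]
    (hch : ∀ x : S, ∃ φ : ℂ → S, IsOpenEmbedding φ ∧ φ 0 = x) :
    ∃ n : ℕ, ∃ dat : (S → S → ZMod 2) → Fin n, ∀ ω ω', IsCoc ω → IsCoc ω' → dat ω = dat ω' →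
      TrivOn (fun x y => ω x y + ω' x y) univ := by
  classical
  choose φ hφ hφ0 using hch
  set V : S → Set S := fun x => φ x '' ball 0 1 with hV
  set C : S → Set S := fun x => φ x '' closedBall 0 (1/2) with hC
  have hVo : ∀ x, IsOpen (V x) := fun x => (hφ x).isOpenMap _ isOpen_ball
  have hCV : ∀ x, C x ⊆ V x := fun x => image_mono (closedBall_subset_ball (by norm_num))
  have hCc : ∀ x, IsCompact (C x) := fun x => (isCompact_closedBall _ _).image (hφ x).continuous
  have hCn : ∀ x, C x ∈ 𝓝 x := by
    intro x
    have := (hφ x).isOpenMap.image_mem_nhds (closedBall_mem_nhds (0:ℂ) (show (0:ℝ) < 1/2 by norm_num))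
    rwa [hφ0] at this
  obtain ⟨t, -, ht⟩ := isCompact_univ.elim_nhds_subcover C (fun x _ => hCn x)
  have hconn : ∀ x : S, ∀ O : Set S, IsOpen O → x ∈ O → ∃ N, IsOpen N ∧ IsPreconnected N ∧ x ∈ N ∧ N ⊆ O := by
    intro x O hO hx
    have h1 : φ x ⁻¹' O ∈ 𝓝 (0:ℂ) := (hφ x).continuous.continuousAt.preimage_mem_nhds (by
      rw [hφ0]; exact hO.mem_nhds hx)
    obtain ⟨ε, hε, hεO⟩ := Metric.mem_nhds_iff.1 h1
    refine ⟨φ x '' ball 0 ε, (hφ x).isOpenMap _ isOpen_ball,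
      (convex_ball (0:ℂ) ε).isPreconnected.image _ (hφ x).continuous.continuousOn,
      ⟨0, mem_ball_self hε, hφ0 x⟩, ?_⟩
    rintro _ ⟨y, hy, rfl⟩
    exact hεO hy
  -- base points
  have hbase : ∀ x y : S, ∃ F : Finset S, (∀ f ∈ F, f ∈ V x ∩ V y) ∧ ∀ s ∈ C x ∩ C y, ∃ f ∈ F, ∃ N,
      IsPreconnected N ∧ N ⊆ V x ∩ V y ∧ f ∈ N ∧ s ∈ N := by
    intro x y
    have h1 : ∀ s : S, ∃ N : Set S, s ∈ V x ∩ V y → IsOpen N ∧ IsPreconnected N ∧ s ∈ N ∧ N ⊆ V x ∩ V y := by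
      intro s
      by_cases hs : s ∈ V x ∩ V y
      · obtain ⟨N, hN⟩ := hconn s _ ((hVo x).inter (hVo y)) hs
        exact ⟨N, fun _ => hN⟩
      · exact ⟨∅, fun h => absurd h hs⟩
    choose N hN using h1
    have hsub : C x ∩ C y ⊆ V x ∩ V y := inter_subset_inter (hCV x) (hCV y)
    obtain ⟨F, hF, hF2⟩ := ((hCc x).inter (hCc y)).elim_nhds_subcover N (fun s hs =>
      (hN s (hsub hs)).1.mem_nhds (hN s (hsub hs)).2.2.1)
    refine ⟨F, fun f hf => hsub (hF f hf), ?_⟩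
    intro s hs
    obtain ⟨f, hf, hsf⟩ := mem_iUnion₂.1 (hF2 hs)
    have := hN f (hsub (hF f hf))
    exact ⟨f, hf, N f, this.2.1, this.2.2.2, this.2.2.1, hsf⟩
  choose F hF1 hF2 using hbase
  set B : Finset (S × S × S) := t.biUnion fun x => t.biUnion fun y => (F x y).image fun f => (x, y, f) with hB
  -- primitives
  have hprim : ∀ ω : S → S → ZMod 2, ∀ x, ∃ a : S → ZMod 2, IsCoc ω → ∀ z ∈ V x,
      ∀ᶠ p in 𝓝 z ×ˢ 𝓝 z, ω p.1 p.2 = a p.1 + a p.2 := by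
    intro ω x
    by_cases h : IsCoc ω
    · obtain ⟨a, ha⟩ := coc_chart (hφ x) h
      exact ⟨a, fun _ => ha⟩
    · exact ⟨0, fun h' => absurd h' h⟩
  choose a ha using hprim
  set D : (S → S → ZMod 2) → (B → ZMod 2) := fun ω f => a ω f.1.1 f.1.2.2 + a ω f.1.2.1 f.1.2.2 with hD
  refine ⟨Fintype.card (B → ZMod 2), fun ω => Fintype.equivFin _ (D ω), ?_⟩
  intro ω ω' hω hω' hdat
  have hdat' : D ω = D ω' := (Fintype.equivFin _).injective hdat
  set Ω : S → S → ZMod 2 := fun x y => ω x y + ω' x y with hΩ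
  set α : S → S → ZMod 2 := fun x s => a ω x s + a ω' x s with hα
  have hαp : ∀ x, ∀ z ∈ V x, ∀ᶠ p in 𝓝 z ×ˢ 𝓝 z, Ω p.1 p.2 = α x p.1 + α x p.2 := by
    intro x z hz
    filter_upwards [ha ω x hω z hz, ha ω' x hω' z hz] with p h1 h2
    simp only [hΩ, hα, h1, h2]
    ring
  have hαeq : ∀ x ∈ t, ∀ y ∈ t, ∀ s ∈ C x ∩ C y, α x s = α y s := by
    intro x hx y hy s hs
    obtain ⟨f, hf, N, hN1, hN2, hfN, hsN⟩ := hF2 x y s hs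
    have h1 : α x s + α y s = α x f + α y f := by
      refine zmod_const (f := fun s => α x s + α y s) hN1 ?_ hsN hfN
      intro z hz
      exact nhdsWithin_le_nhds (triv_locconst (hαp x z (hN2 hz).1) (hαp y z (hN2 hz).2))
    have hmem : (x, y, f) ∈ B := by
      rw [hB]
      refine Finset.mem_biUnion.2 ⟨x, hx, Finset.mem_biUnion.2 ⟨y, hy, Finset.mem_image.2 ⟨f, hf, rfl⟩⟩⟩
    have h2 := congrFun hdat' ⟨(x, y, f), hmem⟩
    simp only [hD] at h2
    have h3 : α x f + α y f = 0 := by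
      have : ∀ p q r u : ZMod 2, p + q = r + u → (p + r) + (q + u) = 0 := by decide
      exact this _ _ _ _ h2
    rw [h3] at h1
    exact z2b _ _ h1
  have hk : ∀ s : S, ∃ x ∈ t, s ∈ C x := fun s => by
    obtain ⟨x, hx, hs⟩ := mem_iUnion₂.1 (ht (mem_univ s))
    exact ⟨x, hx, hs⟩
  choose k hkt hkC using hk
  refine ⟨fun s => α (k s) s, ?_⟩
  intro z _
  -- near z only the C x containing z matter, and all α x agree there
  have h1 : ∀ᶠ s in 𝓝 z, ∀ x ∈ t, (s ∈ C x → z ∈ C x) ∧ (z ∈ C x → α x s = α (k z) s) := by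
    rw [Finset.eventually_all]
    intro x hx
    by_cases hzx : z ∈ C x
    · have h2 := triv_locconst (hαp x z (hCV x hzx)) (hαp (k z) z (hCV _ (hkC z)))
      filter_upwards [h2] with s hs
      refine ⟨fun _ => hzx, fun _ => ?_⟩
      rw [hαeq x hx (k z) (hkt z) z ⟨hzx, hkC z⟩, CharTwo.add_self_eq_zero] at hs
      exact z2b _ _ hs
    · filter_upwards [(hCc x).isClosed.isOpen_compl.mem_nhds hzx] with s hs
      exact ⟨fun h => absurd h hs, fun h => absurd h hzx⟩
  have h2 : ∀ᶠ s in 𝓝 z, α (k s) s = α (k z) s := by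
    filter_upwards [h1] with s hs
    have := hs (k s) (hkt s)
    exact this.2 (this.1 (hkC s))
  filter_upwards [hαp (k z) z (hCV _ (hkC z)), h2.prod_mk h2] with p hp hp2
  rw [hp2.1, hp2.2]
  exact hp

/-- among many disjoint open sets one is good -/
theorem exists_good [CompactSpace S] [T2Space S]
    (hch : ∀ x : S, ∃ φ : ℂ → S, IsOpenEmbedding φ ∧ φ 0 = x) :
    ∃ n : ℕ, ∀ U : Fin (n+1) → Set S, (∀ i, IsOpen (U i)) → Pairwise (fun i j => Disjoint (U i) (U j)) →
      ∃ i, GoodSet (U i) := by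
  obtain ⟨n, dat, hdat⟩ := coc_finite hch
  refine ⟨n, fun U hU hd => ?_⟩
  by_contra hcon
  push Not at hcon
  simp only [GoodSet] at hcon
  push Not at hcon
  choose ω C h1 h2 h3 h4 h5 using hcon
  obtain ⟨i, j, hij, he⟩ := Fintype.exists_ne_map_eq_of_card_lt (fun i => dat (ω i)) (by simp)
  obtain ⟨a, ha⟩ := hdat _ _ (h1 i) (h1 j) he
  refine h5 i ⟨a, fun z hz => ?_⟩
  have hzj : z ∉ C j := fun h => (Set.disjoint_left.1 (hd hij) hz) (h3 j h)
  filter_upwards [ha z (mem_univ _), h4 j z hzj] with p hp hp2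
  rw [← hp, hp2, add_zero]

/-- contradiction lemma -/
lemma good_contra {U : Set S} (hU : GoodSet U) {ω : S → S → ZMod 2} (hω : IsCoc ω) {C : Set S}
    (hC : IsCompact C) (hCU : C ⊆ U) (h0 : ∀ z ∉ C, ZeroAt ω z) {Y : Set S} (hY : IsPreconnected Y)
    (hYU : Y ⊆ U) (hYz : ∀ z ∈ Y, ZeroAt ω z) {γ : ℝ → S} (hγ : Continuous γ) {s t : ℝ} (hst : s ≤ t)
    (hγU : ∀ x ∈ Icc s t, γ x ∈ U) (hs : γ s ∈ Y) (ht : γ t ∈ Y) {b : ℝ → ZMod 2}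
    (hb : ∀ x ∈ Icc s t, ∀ᶠ y in 𝓝 x, ω (γ y) (γ x) = b y + b x) : b s = b t := by
  obtain ⟨a, ha⟩ := hU ω C hω hC hCU h0
  have h1 : a (γ s) = a (γ t) := by
    refine zmod_const hY ?_ hs ht
    intro z hz
    obtain ⟨T, hT, H⟩ := eventually_prod_same_iff'.1 ((hYz z hz).and (ha z (hYU hz)))
    refine nhdsWithin_le_nhds ?_
    filter_upwards [hT] with x hx
    have := H x hx z (mem_of_mem_nhds hT)
    exact z2b _ _ (this.2.symm.trans this.1)
  have h2 : a (γ s) + b s = a (γ t) + b t := by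
    refine zmod_const (f := fun x => a (γ x) + b x) isPreconnected_Icc ?_ (left_mem_Icc.2 hst) (right_mem_Icc.2 hst)
    intro x hx
    refine nhdsWithin_le_nhds ?_
    obtain ⟨T, hT, H⟩ := eventually_prod_same_iff'.1 (ha _ (hγU x hx))
    filter_upwards [hb x hx, hγ.continuousAt.preimage_mem_nhds hT] with y hy hyT
    have := H _ hyT _ (mem_of_mem_nhds hT)
    exact z2a _ _ _ _ (this.symm.trans hy)
  rw [h1] at h2
  exact add_left_cancel h2

end Classes


section Planar
variable {S : Type*} [TopologicalSpace S]

/-- an embedding of `W` in the Riemann sphere taking `k0` to infinity -/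
structure Emb {S : Type*} [TopologicalSpace S] (k0 : S) (W : Set S) (e : S → ℂ) : Prop where
  op : IsOpen W
  mem : k0 ∈ W
  cont : ContinuousOn e (W \ {k0})
  inj : InjOn e (W \ {k0})
  tend : Tendsto (fun x => ‖e x‖) (𝓝[≠] k0) atTop

/-- existence of charts -/
def Charted (S : Type*) [TopologicalSpace S] : Prop := ∀ x : S, ∃ φ : ℂ → S, IsOpenEmbedding φ ∧ φ 0 = x

namespace Emb
variable {k0 : S} {W : Set S} {e : S → ℂ}

lemma mono (h : Emb k0 W e) {W' : Set S} (ho : IsOpen W') (hk : k0 ∈ W') (hW : W' ⊆ W) : Emb k0 W' e :=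
  ⟨ho, hk, h.cont.mono (sdiff_subset_sdiff_left hW), h.inj.mono (sdiff_subset_sdiff_left hW), h.tend⟩

lemma op' [T2Space S] (h : Emb k0 W e) : IsOpen (W \ {k0}) := h.op.sdiff isClosed_singleton

lemma big (h : Emb k0 W e) (r : ℝ) : ∃ N, IsOpen N ∧ k0 ∈ N ∧ N ⊆ W ∧ ∀ x ∈ N, x ≠ k0 → r < ‖e x‖ := by
  have h1 := h.tend.eventually (eventually_gt_atTop r)
  rw [eventually_nhdsWithin_iff] at h1
  obtain ⟨N, hN, hNo, hk⟩ := _root_.mem_nhds_iff.1 (inter_mem h1 (h.op.mem_nhds h.mem))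
  exact ⟨N, hNo, hk, fun x hx => (hN hx).2, fun x hx hxk => (hN hx).1 hxk⟩

/-- points not mapped in a compact set -/
lemma open_avoid [T2Space S] (h : Emb k0 W e) {M : Set ℂ} (hM : IsCompact M) :
    IsOpen {x ∈ W | x ≠ k0 → e x ∉ M} := by
  rw [isOpen_iff_mem_nhds]
  rintro x ⟨hxW, hx⟩
  by_cases hxk : x = k0
  · subst hxk
    obtain ⟨r, hr⟩ := hM.isBounded.exists_norm_le
    obtain ⟨N, hN, hk, hNW, hb⟩ := h.big r
    filter_upwards [hN.mem_nhds hk] with y hy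
    exact ⟨hNW hy, fun hyk hyM => not_lt.2 (hr _ hyM) (hb y hy hyk)⟩
  · have h1 : W \ {k0} ∈ 𝓝 x := h.op'.mem_nhds ⟨hxW, hxk⟩
    have h2 := (h.cont.continuousAt h1).preimage_mem_nhds (hM.isClosed.isOpen_compl.mem_nhds (hx hxk))
    filter_upwards [h1, h2] with y hy hy2
    exact ⟨hy.1, fun _ => hy2⟩

lemma image_nhds [T2Space S] (hch : Charted S) (h : Emb k0 W e) {x : S} (hx : x ∈ W) (hxk : x ≠ k0) {N : Set S}
    (hN : N ∈ 𝓝 x) : e '' (N ∩ (W \ {k0})) ∈ 𝓝 (e x) := by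
  obtain ⟨φ, hφ, rfl⟩ := hch x
  have h1 : N ∩ (W \ {k0}) ∈ 𝓝 (φ 0) := inter_mem hN (h.op'.mem_nhds ⟨hx, hxk⟩)
  obtain ⟨r, hr, hb⟩ := Metric.mem_nhds_iff.1 (hφ.continuous.continuousAt.preimage_mem_nhds h1)
  have h2 := image_ball_mem_nhds (c := fun z => e (φ z)) (p := 0) hr
    (h.cont.comp hφ.continuous.continuousOn (fun z hz => (hb hz).2))
    (h.inj.comp hφ.injective.injOn (fun z hz => (hb hz).2))
  refine mem_of_superset h2 ?_
  rintro _ ⟨z, hz, rfl⟩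
  exact ⟨φ z, hb hz, rfl⟩

lemma image_nhds_infty [T2Space S] (hch : Charted S) (h : Emb k0 W e) {N : Set S} (hN : N ∈ 𝓝 k0) :
    ∃ r : ℝ, ∀ z : ℂ, r < ‖z‖ → z ∈ e '' (N \ {k0}) := by
  obtain ⟨φ, hφ, h0⟩ := hch k0
  obtain ⟨N1, hN1, hk1, hNW, hb1⟩ := h.big 1
  have h1 : N ∩ N1 ∈ 𝓝 (φ 0) := by rw [h0]; exact inter_mem hN (hN1.mem_nhds hk1)
  obtain ⟨r, hr, hb⟩ := Metric.mem_nhds_iff.1 (hφ.continuous.continuousAt.preimage_mem_nhds h1)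
  have hne : ∀ z, z ≠ 0 → φ z ≠ k0 := fun z hz hh => hz (hφ.injective (hh.trans h0.symm))
  have hmem : ∀ z ∈ ball (0:ℂ) r, z ≠ 0 → φ z ∈ W \ {k0} := fun z hz hz0 => ⟨hNW (hb hz).2, hne z hz0⟩
  have hen : ∀ z ∈ ball (0:ℂ) r, z ≠ 0 → e (φ z) ≠ 0 := fun z hz hz0 hh => by
    have := hb1 _ (hb hz).2 (hne z hz0)
    rw [hh, norm_zero] at this; linarith
  classical
  set c : ℂ → ℂ := fun z => if z = 0 then 0 else (e (φ z))⁻¹ with hc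
  have hc0 : c 0 = 0 := by simp [hc]
  have hcz : ∀ z, z ≠ 0 → c z = (e (φ z))⁻¹ := fun z hz => by simp [hc, hz]
  have hcc : ContinuousOn c (ball 0 r) := by
    intro z hz
    refine ContinuousAt.continuousWithinAt ?_
    by_cases hz0 : z = 0
    · subst hz0
      rw [ContinuousAt, hc0, tendsto_zero_iff_norm_tendsto_zero]
      have ht : Tendsto (fun z => ‖e (φ z)‖⁻¹) (𝓝[≠] (0:ℂ)) (𝓝 0) := by
        refine (h.tend.comp ?_).inv_tendsto_atTop
        rw [← h0]
        refine tendsto_nhdsWithin_of_tendsto_nhds_of_eventually_within _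
          (hφ.continuous.continuousAt.tendsto.mono_left nhdsWithin_le_nhds) ?_
        filter_upwards [self_mem_nhdsWithin] with z hz
        rw [h0]; exact hne z hz
      have ht' : Tendsto (fun z => ‖c z‖) (𝓝[≠] (0:ℂ)) (𝓝 0) := by
        refine ht.congr' ?_
        filter_upwards [self_mem_nhdsWithin] with z hz
        rw [hcz z hz, norm_inv]
      rw [← nhdsNE_sup_pure, tendsto_sup]
      refine ⟨ht', ?_⟩
      rw [tendsto_pure_left]
      intro s hs
      rw [hc0, norm_zero]; exact mem_of_mem_nhds hs
    · have h3 : ContinuousAt (fun z => (e (φ z))⁻¹) z := by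
        refine ContinuousAt.inv₀ ?_ (hen z hz hz0)
        exact ContinuousAt.comp (h.cont.continuousAt (h.op'.mem_nhds (hmem z hz hz0))) hφ.continuous.continuousAt
      refine h3.congr ?_
      filter_upwards [isOpen_ne.mem_nhds hz0] with y hy
      rw [hcz y hy]
  have hci : InjOn c (ball 0 r) := by
    intro x hx y hy hxy
    by_cases hx0 : x = 0
    · by_cases hy0 : y = 0
      · rw [hx0, hy0]
      · rw [hx0, hc0, hcz y hy0] at hxy
        exact absurd (inv_eq_zero.1 hxy.symm) (hen y hy hy0)
    · by_cases hy0 : y = 0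
      · rw [hy0, hc0, hcz x hx0] at hxy
        exact absurd (inv_eq_zero.1 hxy) (hen x hx hx0)
      · rw [hcz x hx0, hcz y hy0] at hxy
        exact hφ.injective (h.inj (hmem x hx hx0) (hmem y hy hy0) (inv_injective hxy))
  have h2 := image_ball_mem_nhds hr hcc hci
  rw [hc0] at h2
  obtain ⟨ε, hε, hball⟩ := Metric.mem_nhds_iff.1 h2
  refine ⟨ε⁻¹, fun z hz => ?_⟩
  have hz0 : 0 < ‖z‖ := lt_trans (by positivity) hz
  have hz00 : z ≠ 0 := norm_pos_iff.1 hz0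
  obtain ⟨v, hv, hvz⟩ := hball (show z⁻¹ ∈ ball (0:ℂ) ε by
    rw [mem_ball_zero_iff, norm_inv]; exact inv_lt_of_inv_lt₀ hε hz)
  have hv0 : v ≠ 0 := by
    rintro rfl
    rw [hc0] at hvz
    exact hz00 (inv_eq_zero.1 hvz.symm)
  rw [hcz v hv0] at hvz
  exact ⟨φ v, ⟨(hb hv).1, hne v hv0⟩, inv_injective hvz⟩

variable {Y : Set S}

lemma isClosed_image [T2Space S] (h : Emb k0 W e) (hY : IsCompact Y) (hYW : Y ⊆ W) :
    IsClosed (e '' (Y \ {k0})) := by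
  refine isClosed_of_closure_subset fun z hz => ?_
  obtain ⟨N, hNo, hk, hNW, hN⟩ := h.big (‖z‖ + 1)
  have hcomp : IsCompact (e '' (Y \ N)) := (hY.diff hNo).image_of_continuousOn
    (h.cont.mono fun x hx => ⟨hYW hx.1, fun hh => hx.2 (by rw [mem_singleton_iff.1 hh]; exact hk)⟩)
  have hz2 : z ∈ closure (e '' (Y \ N)) := by
    rw [Metric.mem_closure_iff] at hz ⊢
    intro ε hε
    obtain ⟨b, ⟨y, ⟨hy, hyk⟩, rfl⟩, hb⟩ := hz (min ε 1) (by positivity)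
    refine ⟨e y, ⟨y, ⟨hy, fun hyN => ?_⟩, rfl⟩, hb.trans_le (min_le_left _ _)⟩
    have h1 := hN y hyN hyk
    have h2 := hb.trans_le (min_le_right _ _)
    rw [dist_eq_norm] at h2
    have h3 : ‖e y‖ ≤ ‖z‖ + ‖z - e y‖ := by
      have := norm_sub_le z (z - e y)
      simpa using this
    linarith
  rw [hcomp.isClosed.closure_eq] at hz2
  refine image_mono ?_ hz2
  exact fun x hx => ⟨hx.1, fun hh => hx.2 (by rw [mem_singleton_iff.1 hh]; exact hk)⟩

lemma bounded_compl [T2Space S] (hch : Charted S) (h : Emb k0 W e) (hk : k0 ∈ interior Y) :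
    Bornology.IsBounded (e '' (Y \ {k0}))ᶜ := by
  obtain ⟨r, hr⟩ := h.image_nhds_infty hch (mem_interior_iff_mem_nhds.1 hk)
  refine isBounded_iff_forall_norm_le.2 ⟨r, fun z hz => ?_⟩
  by_contra hcon
  exact hz (hr z (not_le.1 hcon))

/-- any component of the complement is conformally a disc -/
theorem exists_rm [T2Space S] (hch : Charted S) (h : Emb k0 W e) (hY : IsCompact Y) (hYW : Y ⊆ W)
    (hYc : IsPreconnected Y) (hk : k0 ∈ interior Y) {t0 : ℂ} (ht0 : t0 ∉ e '' (Y \ {k0})) :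
    ∃ ψ φ, IsRM (connectedComponentIn (e '' (Y \ {k0}))ᶜ t0) ψ φ := by
  set X := e '' (Y \ {k0}) with hX
  have hXc : IsClosed X := h.isClosed_image hY hYW
  have hXb : Bornology.IsBounded Xᶜ := h.bounded_compl hch hk
  set Ω := connectedComponentIn Xᶜ t0 with hΩ
  have hΩs : Ω ⊆ Xᶜ := connectedComponentIn_subset _ _
  have hΩo : IsOpen Ω := hXc.isOpen_compl.connectedComponentIn
  have ht0Ω : t0 ∈ Ω := mem_connectedComponentIn ht0
  have hΩb := hXb.subset hΩs
  have hk0Y : k0 ∈ Y := interior_subset hk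
  have hA : ∀ M ⊆ Ω, IsCompact M → ∀ t ∈ X, HasLogOn (fun z => z - t) M := by
    rintro M hM hMc _ ⟨y, ⟨hy, hyk⟩, rfl⟩
    classical
    set g : S → ℂ := fun y => if y = k0 then 0 else (e y - t0)⁻¹ with hg
    have hne : ∀ y ∈ Y, y ≠ k0 → ∀ z ∈ Ω, e y - z ≠ 0 := fun y hy hyk z hz hh =>
      hΩs hz ⟨y, ⟨hy, hyk⟩, sub_eq_zero.1 hh⟩
    have hg0 : g k0 = 0 := by simp [hg]
    have hgy : ∀ y, y ≠ k0 → g y = (e y - t0)⁻¹ := fun y hy => by simp [hg, hy]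
    have hgc : ContinuousOn g Y := by
      intro y hy
      by_cases hyk : y = k0
      · subst hyk
        refine ContinuousAt.continuousWithinAt ?_
        rw [ContinuousAt, hg0, ← nhdsNE_sup_pure, tendsto_sup]
        constructor
        · have ht : Tendsto (fun x => (e x - t0)⁻¹) (𝓝[≠] y) (𝓝 0) := by
            rw [tendsto_zero_iff_norm_tendsto_zero]
            simp only [norm_inv]
            refine Tendsto.inv_tendsto_atTop ?_
            refine tendsto_atTop_mono (f := fun x => ‖e x‖ - ‖t0‖) (fun x => norm_sub_norm_le _ _) ?_
            exact tendsto_atTop_add_const_right _ _ h.tend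
          refine ht.congr' ?_
          filter_upwards [self_mem_nhdsWithin] with x hx
          rw [hgy x hx]
        · rw [tendsto_pure_left]
          intro s hs
          rw [hg0]; exact mem_of_mem_nhds hs
      · refine ContinuousAt.continuousWithinAt ?_
        have h3 : ContinuousAt (fun x => (e x - t0)⁻¹) y :=
          ((h.cont.continuousAt (h.op'.mem_nhds ⟨hYW hy, hyk⟩)).sub continuousAt_const).inv₀ (hne y hy hyk t0 ht0Ω)
        refine h3.congr ?_
        filter_upwards [isOpen_ne.mem_nhds hyk] with x hx
        rw [hgy x hx]
    have hlog : HasLogOn (fun z => 1 + (t0 - z) * g y) M := by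
      refine hasLog_param (C := Y) hYc hMc (fun y z => 1 + (t0 - z) * g y) ?_ ?_ hk0Y hy ?_
      · have h4 : ContinuousOn (fun p : S × ℂ => g p.1) (Y ×ˢ M) :=
          hgc.comp continuous_fst.continuousOn (fun p hp => hp.1)
        exact continuousOn_const.add (((continuous_const.sub continuous_snd).continuousOn).mul h4)
      · intro y hy z hz
        by_cases hyk : y = k0
        · subst hyk; simp [hg0]
        · have h5 := hne y hy hyk t0 ht0Ω
          rw [hgy y hyk]
          have : 1 + (t0 - z) * (e y - t0)⁻¹ = (e y - z) * (e y - t0)⁻¹ := by field_simp; ring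
          rw [this]
          exact mul_ne_zero (hne y hy hyk z (hM hz)) (inv_ne_zero h5)
      · simp only [hg0, mul_zero, add_zero]
        exact hasLogOn_const one_ne_zero
    have h5 := hne y hy hyk t0 ht0Ω
    have h6 := (hasLogOn_const (X := ℂ) (A := M) (neg_ne_zero.2 h5)).mul hlog
    refine h6.congr fun z hz => ?_
    rw [hgy y hyk]; field_simp; ring
  have hB : ∀ M ⊆ Ω, IsCompact M → ∀ t ∉ Ω, HasLogOn (fun z => z - t) M := by
    intro M hM hMc t ht
    by_cases htX : t ∈ X
    · exact hA M hM hMc t htX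
    set Ω' := connectedComponentIn Xᶜ t with hΩ'
    have hΩ'o : IsOpen Ω' := hXc.isOpen_compl.connectedComponentIn
    have htΩ' : t ∈ Ω' := mem_connectedComponentIn htX
    have hdis : Disjoint Ω Ω' := by
      rw [Set.disjoint_left]
      intro z hz hz'
      have := (connectedComponentIn_eq hz).trans (connectedComponentIn_eq hz').symm
      exact ht (by rw [hΩ, this]; exact htΩ')
    have hdis2 : Disjoint Ω (closure Ω') := hdis.closure_right hΩo
    have hfr : ∃ t1 ∈ closure Ω', t1 ∈ X := by
      by_contra hcon
      push Not at hcon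
      have hcl : closure Ω' ⊆ Ω' := by
        refine IsPreconnected.subset_connectedComponentIn ?_ (subset_closure htΩ') hcon
        exact isPreconnected_connectedComponentIn.closure
      have hcl2 : IsClopen Ω' := ⟨isClosed_of_closure_subset hcl, hΩ'o⟩
      rcases isClopen_iff.1 hcl2 with h1 | h1
      · rw [h1] at htΩ'; exact htΩ'
      · exact (Set.disjoint_left.1 hdis ht0Ω) (by rw [h1]; trivial)
    obtain ⟨t1, ht1, ht1X⟩ := hfr
    refine hasLog_param (C := closure Ω') isPreconnected_connectedComponentIn.closure hMc
      (fun s z => z - s) ?_ ?_ ht1 (subset_closure htΩ') (hA M hM hMc t1 ht1X)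
    · exact (continuous_snd.sub continuous_fst).continuousOn
    · intro s hs z hz hh
      rw [sub_eq_zero] at hh
      subst hh
      exact Set.disjoint_left.1 hdis2 (hM hz) hs
  refine exists_isRM hΩo hΩb isPreconnected_connectedComponentIn ⟨t0, ht0Ω⟩ ?_
  intro f hf hf0
  exact hasLogOn_open hΩo isPreconnected_connectedComponentIn
    (fun M hM hMc => hasLogOn_compact hΩo hΩb hB hf hf0 hMc hM)

/-- gluing in a band -/
theorem band [T2Space S] (h : Emb k0 W e) {R B : Set S} (hR : IsCompact R) (hk : k0 ∉ R) {β : S → ℂ}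
    (hβc : ContinuousOn β R) (hβi : InjOn β R) (hB : IsOpen B) (hBR : B \ R ⊆ W \ {k0})
    (hs : ∀ s ∈ B ∩ R, s ∈ closure (B \ R) → s ∈ W ∧ s ≠ k0 ∧ e s = β s)
    (hd : ∀ x ∈ B \ R, ∀ y ∈ R, e x ≠ β y) {K' : Set S}
    (hK' : ∀ x ∈ K', x ∉ B → x ∈ W ∧ x ∉ R ∧ (x ≠ k0 → ∀ y ∈ R, e x ≠ β y)) (hk0 : k0 ∈ K') :
    ∃ W' e', Emb k0 W' e' ∧ K' ⊆ W' := by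
  classical
  set A : Set S := {x ∈ W | x ≠ k0 → e x ∉ β '' R} \ R with hA
  have hAo : IsOpen A := (h.open_avoid (hR.image_of_continuousOn hβc)).sdiff hR.isClosed
  set e' : S → ℂ := fun x => if x ∈ R then β x else e x with he'
  have heR : ∀ x ∈ R, e' x = β x := fun x hx => by simp [he', hx]
  have heN : ∀ x ∉ R, e' x = e x := fun x hx => by simp [he', hx]
  have hkB : k0 ∉ B := fun hh => (hBR ⟨hh, hk⟩).2 rfl
  have hRo : IsOpen Rᶜ := hR.isClosed.isOpen_compl
  have hout : ∀ x ∈ A ∪ B, x ∉ R → x ∈ W := by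
    rintro x (hx | hx) hxR
    · exact hx.1.1
    · exact (hBR ⟨hx, hxR⟩).1
  have hKs : K' ⊆ A ∪ B := by
    intro x hx
    by_cases hxB : x ∈ B
    · exact Or.inr hxB
    · obtain ⟨h1, h2, h3⟩ := hK' x hx hxB
      refine Or.inl ⟨⟨h1, fun hxk hh => ?_⟩, h2⟩
      obtain ⟨y, hy, hyx⟩ := hh
      exact h3 hxk y hy hyx.symm
  refine ⟨A ∪ B, e', ⟨hAo.union hB, hKs hk0, ?_, ?_, ?_⟩, hKs⟩
  · rintro x ⟨hx, hxk⟩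
    have hxk : x ≠ k0 := hxk
    refine ContinuousAt.continuousWithinAt ?_
    by_cases hxR : x ∈ R
    · have hxB : x ∈ B := by
        rcases hx with hx | hx
        · exact absurd hxR hx.2
        · exact hx
      have hnh : 𝓝 x ≤ 𝓝[R] x ⊔ 𝓝[B \ R] x := by
        rw [← nhdsWithin_union, ← nhdsWithin_eq_nhds.2 (hB.mem_nhds hxB)]
        exact nhdsWithin_mono _ (fun y hy => by by_cases hyR : y ∈ R; exacts [Or.inl hyR, Or.inr ⟨hy, hyR⟩])
      refine Tendsto.mono_left ?_ hnh
      rw [tendsto_sup]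
      constructor
      · rw [heR x hxR]
        refine (hβc x hxR).congr' ?_
        filter_upwards [self_mem_nhdsWithin] with y hy
        rw [heR y hy]
      · by_cases hcl : x ∈ closure (B \ R)
        · obtain ⟨h1, h2, h3⟩ := hs x ⟨hxB, hxR⟩ hcl
          rw [heR x hxR, ← h3]
          have h4 := (h.cont.continuousAt (h.op'.mem_nhds ⟨h1, h2⟩)).tendsto.mono_left
            (nhdsWithin_le_nhds (s := B \ R))
          refine h4.congr' ?_
          filter_upwards [self_mem_nhdsWithin] with y hy
          rw [heN y hy.2]
        · rw [mem_closure_iff_nhdsWithin_neBot, not_neBot] at hcl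
          rw [hcl]; exact tendsto_bot
    · have h1 : x ∈ W := hout x hx hxR
      refine (h.cont.continuousAt (h.op'.mem_nhds ⟨h1, hxk⟩)).congr ?_
      filter_upwards [hRo.mem_nhds hxR] with y hy
      rw [heN y hy]
  · have key : ∀ x ∈ A ∪ B, x ≠ k0 → x ∉ R → ∀ y ∈ R, e x ≠ β y := by
      rintro x (hx | hx) hxk hxR y hy
      · exact fun hh => hx.1.2 hxk ⟨y, hy, hh.symm⟩
      · exact hd x ⟨hx, hxR⟩ y hy
    rintro x ⟨hx, hxk⟩ y ⟨hy, hyk⟩ hxy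
    by_cases hxR : x ∈ R
    · by_cases hyR : y ∈ R
      · rw [heR x hxR, heR y hyR] at hxy
        exact hβi hxR hyR hxy
      · rw [heR x hxR, heN y hyR] at hxy
        exact absurd hxy.symm (key y hy hyk hyR x hxR)
    · by_cases hyR : y ∈ R
      · rw [heN x hxR, heR y hyR] at hxy
        exact absurd hxy (key x hx hxk hxR y hyR)
      · rw [heN x hxR, heN y hyR] at hxy
        exact h.inj ⟨hout x hx hxR, hxk⟩ ⟨hout y hy hyR, hyk⟩ hxy
  · refine h.tend.congr' ?_
    filter_upwards [nhdsWithin_le_nhds (hRo.mem_nhds hk)] with y hy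
    rw [heN y hy]

end Emb
end Planar

namespace IsRM
variable {Ω : Set ℂ} {ψ φ : ℂ → ℂ}

/-- the inverse of the boundary extension is continuous -/
lemma binv_cont (h : IsRM Ω ψ φ) :
    ContinuousOn (Function.invFunOn (bext Ω ψ) (Ω ∪ BAcc Ω)) (bext Ω ψ '' (Ω ∪ BAcc Ω)) := by
  rintro _ ⟨w, hw, rfl⟩
  rw [ContinuousWithinAt, h.bext_inj.leftInvOn_invFunOn hw]
  intro N hN
  have h1 := h.bext_open hw hN
  have h2 : bext Ω ψ '' (Ω ∪ BAcc Ω) ⊆ closedBall 0 1 := by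
    rintro _ ⟨v, hv, rfl⟩
    rw [mem_closedBall_zero_iff]; exact h.bext_le hv
  have h3 := nhdsWithin_mono _ h2 h1
  rw [mem_map]
  refine mem_of_superset h3 ?_
  rintro _ ⟨v, ⟨hvN, hv⟩, rfl⟩
  change Function.invFunOn (bext Ω ψ) (Ω ∪ BAcc Ω) (bext Ω ψ v) ∈ N
  rw [h.bext_inj.leftInvOn_invFunOn hv]
  exact hvN

/-- rotating the uniformization -/
lemma rot (h : IsRM Ω ψ φ) {u : ℂ} (hu : ‖u‖ = 1) :
    IsRM Ω (fun z => u * ψ z) (fun z => φ (u⁻¹ * z)) := by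
  have hu0 : u ≠ 0 := by rw [← norm_pos_iff, hu]; exact one_pos
  have hm : MapsTo (fun z => u⁻¹ * z) (ball (0:ℂ) 1) (ball 0 1) := by
    intro z hz
    rw [mem_ball_zero_iff] at hz ⊢
    rw [norm_mul, norm_inv, hu, inv_one, one_mul]; exact hz
  refine ⟨h.op, h.bdd, h.dψ.const_mul u, h.dφ.comp (by fun_prop) hm, ?_, fun z hz => h.mφ (hm hz), ?_, ?_⟩
  · intro z hz
    have := h.mψ hz
    rw [mem_ball_zero_iff] at this ⊢
    rw [norm_mul, hu, one_mul]; exact this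
  · intro z hz
    rw [inv_mul_cancel_left₀ hu0]; exact h.φψ z hz
  · intro z hz
    rw [h.ψφ _ (hm hz), mul_inv_cancel_left₀ hu0]

lemma rot_bext (h : IsRM Ω ψ φ) {u : ℂ} (hu : ‖u‖ = 1) {w : ℂ} (hw : w ∈ Ω ∪ BAcc Ω) :
    bext Ω (fun z => u * ψ z) w = u * bext Ω ψ w := by
  have h1 := (h.rot hu).bext_tendsto hw
  have h2 := (h.bext_tendsto hw).2.const_mul u
  have hne := h1.1
  exact tendsto_nhds_unique h1.2 h2

end IsRM


section Pieces
variable {S : Type*} [TopologicalSpace S] [T2Space S] {k0 : S} {W K : Set S} {e : S → ℂ}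

/-- `K` has a spherical neighbourhood -/
def Pl {S : Type*} [TopologicalSpace S] (k0 : S) (K : Set S) : Prop := ∃ W e, Emb k0 W e ∧ K ⊆ W

lemma inv_cont {φ : ℂ → S} (hφ : IsOpenEmbedding φ) (z : ℂ) : ContinuousAt (Function.invFun φ) (φ z) := by
  rw [← hφ.continuousAt_iff]
  have : Function.invFun φ ∘ φ = id := Function.invFun_comp hφ.injective
  rw [this]; exact continuousAt_id

lemma band_chart (h : Emb k0 W e) {φ : ℂ → S} (hφ : IsOpenEmbedding φ) {Rb Bb : Set ℂ} (hR : IsCompact Rb)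
    {b : ℂ → ℂ} (hbc : ContinuousOn b Rb) (hbi : InjOn b Rb) (hB : IsOpen Bb) (hk : ∀ z ∈ Rb, φ z ≠ k0)
    (hBR : ∀ z ∈ Bb \ Rb, φ z ∈ W ∧ φ z ≠ k0)
    (hs : ∀ z ∈ Bb ∩ Rb, z ∈ closure (Bb \ Rb) → φ z ∈ W ∧ φ z ≠ k0 ∧ e (φ z) = b z)
    (hd : ∀ z ∈ Bb \ Rb, ∀ w ∈ Rb, e (φ z) ≠ b w) {K' : Set S}
    (hK' : ∀ x ∈ K', x ∉ φ '' Bb → x ∈ W ∧ x ∉ φ '' Rb ∧ (x ≠ k0 → ∀ w ∈ Rb, e x ≠ b w)) (hk0 : k0 ∈ K') :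
    Pl k0 K' := by
  have hι : ∀ z, Function.invFun φ (φ z) = z := Function.leftInverse_invFun hφ.injective
  have hdiff : φ '' Bb \ φ '' Rb = φ '' (Bb \ Rb) := (image_sdiff hφ.injective _ _).symm
  refine Emb.band h (R := φ '' Rb) (B := φ '' Bb) (β := fun x => b (Function.invFun φ x))
    (hR.image hφ.continuous) ?_ ?_ ?_ (hφ.isOpenMap _ hB) ?_ ?_ ?_ ?_ hk0
  · rintro ⟨z, hz, hzk⟩; exact hk z hz hzk
  · refine hbc.comp (t := Rb) ?_ ?_
    · rintro _ ⟨z, hz, rfl⟩; exact (inv_cont hφ z).continuousWithinAt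
    · rintro _ ⟨z, hz, rfl⟩; rw [hι]; exact hz
  · rintro _ ⟨z, hz, rfl⟩ _ ⟨w, hw, rfl⟩ hzw
    simp only [hι] at hzw
    rw [hbi hz hw hzw]
  · rw [hdiff]; rintro _ ⟨z, hz, rfl⟩; exact hBR z hz
  · rw [hdiff]
    rintro s ⟨⟨z, hz, rfl⟩, ⟨w, hw, hwz⟩⟩ hcl
    rw [hφ.injective hwz] at hw
    simp only [hι]
    refine hs z ⟨hz, hw⟩ ?_
    rw [hφ.isInducing.closure_eq_preimage_closure_image]; exact hcl
  · rw [hdiff]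
    rintro _ ⟨z, hz, rfl⟩ _ ⟨w, hw, rfl⟩
    simp only [hι]; exact hd z hz w hw
  · intro x hx hxB
    obtain ⟨h1, h2, h3⟩ := hK' x hx hxB
    refine ⟨h1, h2, fun hxk => ?_⟩
    rintro _ ⟨w, hw, rfl⟩
    simp only [hι]; exact h3 hxk w hw

/-- limits of points off `K` are different from `k0` -/
lemma ne_k0_of_lim (hk : k0 ∈ interior K) {x : S} {ι : Type*} {l : Filter ι} [l.NeBot] {f : ι → S}
    (hf : Tendsto f l (𝓝 x)) (hn : ∀ᶠ i in l, f i ∉ K) : x ≠ k0 := by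
  rintro rfl
  obtain ⟨i, h1, h2⟩ := (hn.and (hf.eventually (mem_interior_iff_mem_nhds.1 hk))).exists
  exact h1 h2

lemma norm_le_abs (z : ℂ) : ‖z‖ ≤ |z.re| + |z.im| := Complex.norm_le_abs_re_add_abs_im z

/-- adding an edge with one end on `K` -/
theorem edge1 (hK : IsClosed K) (hk : k0 ∈ interior K) (hP : Pl k0 K) {φ : ℂ → S}
    (hφ : IsOpenEmbedding φ) (h0 : φ 0 ∈ K) (h1 : ∀ t : ℝ, 0 < t → t ≤ 1 → φ t ∉ K) :
    Pl k0 (K ∪ (fun t : ℝ => φ t) '' Icc 0 1) := by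
  obtain ⟨W, e, h, hKW⟩ := hP
  have hcr : Continuous (fun t : ℝ => φ t) := hφ.continuous.comp Complex.continuous_ofReal
  have h0k : φ 0 ≠ k0 := by
    refine ne_k0_of_lim (l := 𝓝[>] (0:ℝ)) (f := fun t : ℝ => φ t) hk ?_ ?_
    · have := hcr.tendsto 0
      simp only [Complex.ofReal_zero] at this
      exact this.mono_left nhdsWithin_le_nhds
    · filter_upwards [Ioo_mem_nhdsGT one_pos] with t ht
      exact h1 t ht.1 ht.2.le
  obtain ⟨r, hr, hrb⟩ := Metric.mem_nhds_iff.1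
    (hφ.continuous.continuousAt.preimage_mem_nhds (h.op'.mem_nhds (show φ 0 ∈ W \ {k0} from ⟨hKW h0, h0k⟩)))
  obtain ⟨a, ha, ha1, har⟩ : ∃ a : ℝ, 0 < a ∧ a ≤ 1/4 ∧ 4 * a ≤ r := by
    refine ⟨min (1/4) (r/4), by positivity, min_le_left _ _, ?_⟩
    have := min_le_right (1/4) (r/4); linarith
  have hboxW : ∀ z : ℂ, 0 ≤ z.re → z.re ≤ 2 * a → |z.im| ≤ a → φ z ∈ W \ {k0} := by
    intro z hz1 hz2 hz3
    apply hrb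
    rw [mem_ball_zero_iff]
    have := norm_le_abs z
    rw [abs_of_nonneg hz1] at this
    linarith
  have hseg : IsCompact ((fun t : ℝ => (t : ℂ)) '' Icc a 1) := isCompact_Icc.image Complex.continuous_ofReal
  obtain ⟨δ, hδ, hth⟩ := hseg.exists_thickening_subset_open (hK.preimage hφ.continuous).isOpen_compl (by
    rintro _ ⟨t, ht, rfl⟩
    exact h1 t (by linarith [ht.1]) ht.2)
  obtain ⟨η, hη, hηa, hηδ⟩ : ∃ η : ℝ, 0 < η ∧ η ≤ a ∧ 2 * η < δ := by
    refine ⟨min a (δ/3), by positivity, min_le_left _ _, ?_⟩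
    have := min_le_right a (δ/3); linarith
  have hoff : ∀ z : ℂ, a ≤ z.re → z.re ≤ 1 + η → |z.im| ≤ η → φ z ∉ K := by
    intro z hz1 hz2 hz3
    apply hth
    rw [mem_thickening_iff]
    refine ⟨((min z.re 1 : ℝ) : ℂ), ⟨_, ⟨le_min hz1 (by linarith), min_le_right _ _⟩, rfl⟩, ?_⟩
    rw [dist_eq_norm]
    have := norm_le_abs (z - ((min z.re 1 : ℝ) : ℂ))
    simp only [Complex.sub_re, Complex.ofReal_re, Complex.sub_im, Complex.ofReal_im, sub_zero] at this
    have h2 : |z.re - min z.re 1| ≤ η := by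
      rw [abs_of_nonneg (by linarith [min_le_left z.re 1])]
      rcases le_total z.re 1 with hh | hh
      · rw [min_eq_left hh]; linarith
      · rw [min_eq_right hh]; linarith
    linarith
  set G : ℂ → ℂ := fun z => ⟨a + (z.re - a) * (a/2), z.im⟩ with hG
  have hGc : Continuous G := by
    have : G = fun z : ℂ => ((a + (z.re - a) * (a/2) : ℝ) : ℂ) + (z.im : ℂ) * Complex.I := by
      funext z
      apply Complex.ext <;> simp [hG]
    rw [this]; fun_prop
  have hGre : ∀ z, (G z).re = a + (z.re - a) * (a/2) := fun z => rfl
  have hGim : ∀ z, (G z).im = z.im := fun z => rfl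
  set Rb : Set ℂ := Icc a (1+η) ×ℂ Icc (-η) η with hRb
  set Bb : Set ℂ := Ioo (a/2) (1+η) ×ℂ Ioo (-η) η with hBb
  have hRm : ∀ z, z ∈ Rb ↔ (a ≤ z.re ∧ z.re ≤ 1 + η) ∧ |z.im| ≤ η := fun z => by
    rw [hRb, Complex.mem_reProdIm, mem_Icc, mem_Icc, abs_le]
  have hBm : ∀ z, z ∈ Bb ↔ (a/2 < z.re ∧ z.re < 1 + η) ∧ |z.im| < η := fun z => by
    rw [hBb, Complex.mem_reProdIm, mem_Ioo, mem_Ioo, abs_lt]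
  have hGbox : ∀ z ∈ Rb, a ≤ (G z).re ∧ (G z).re ≤ 2 * a ∧ |(G z).im| ≤ η := by
    intro z hz
    obtain ⟨⟨h2, h3⟩, h4⟩ := (hRm z).1 hz
    rw [hGre, hGim]
    refine ⟨?_, ?_, h4⟩ <;> nlinarith
  have hGW : ∀ z ∈ Rb, φ (G z) ∈ W \ {k0} := fun z hz => by
    obtain ⟨h2, h3, h4⟩ := hGbox z hz
    exact hboxW _ (by linarith) h3 (by linarith)
  have hGK : ∀ z ∈ Rb, φ (G z) ∉ K := fun z hz => by
    obtain ⟨h2, h3, h4⟩ := hGbox z hz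
    exact hoff _ h2 (by linarith) h4
  have hBRm : ∀ z ∈ Bb \ Rb, a/2 < z.re ∧ z.re < a ∧ |z.im| < η := by
    rintro z ⟨hzB, hzR⟩
    rw [hBm] at hzB
    rw [hRm] at hzR
    refine ⟨hzB.1.1, ?_, hzB.2⟩
    by_contra hcon
    exact hzR ⟨⟨not_lt.1 hcon, hzB.1.2.le⟩, hzB.2.le⟩
  have hk0K : k0 ∈ K := interior_subset hk
  refine band_chart h hφ (Rb := Rb) (Bb := Bb) (b := fun z => e (φ (G z)))
    (isCompact_Icc.reProdIm isCompact_Icc) ?_ ?_ (isOpen_Ioo.reProdIm isOpen_Ioo) ?_ ?_ ?_ ?_ ?_ (Or.inl hk0K)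
  · exact h.cont.comp (hφ.continuous.comp hGc).continuousOn hGW
  · intro z hz w hw hzw
    have h2 := hφ.injective (h.inj (hGW z hz) (hGW w hw) hzw)
    have h3 : (G z).re = (G w).re := by rw [h2]
    have h4 : (G z).im = (G w).im := by rw [h2]
    rw [hGre, hGre] at h3
    apply Complex.ext
    · have : (z.re - a) * (a/2) = (w.re - a) * (a/2) := by linarith
      have := mul_right_cancel₀ (by positivity) this
      linarith
    · exact h4
  · intro z hz hzk
    obtain ⟨⟨h2, h3⟩, h4⟩ := (hRm z).1 hz
    exact hoff z h2 h3 h4 (by rw [hzk]; exact hk0K)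
  · intro z hz
    obtain ⟨h2, h3, h4⟩ := hBRm z hz
    exact hboxW z (by linarith) (by linarith) (by linarith)
  · rintro z ⟨hzB, hzR⟩ hcl
    obtain ⟨⟨h2, h3⟩, h4⟩ := (hRm z).1 hzR
    have h5 : z.re ≤ a := by
      have : closure (Bb \ Rb) ⊆ {z : ℂ | z.re ≤ a} :=
        closure_minimal (fun z hz => (hBRm z hz).2.1.le) (isClosed_le Complex.continuous_re continuous_const)
      exact this hcl
    have h6 : z.re = a := le_antisymm h5 h2
    have h7 : G z = z := by
      apply Complex.ext
      · rw [hGre, h6]; ring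
      · rfl
    have h8 := hboxW z (by linarith) (by linarith) (by linarith)
    exact ⟨h8.1, h8.2, by rw [h7]⟩
  · intro z hz w hw hzw
    obtain ⟨h2, h3, h4⟩ := hBRm z hz
    have h5 := hφ.injective (h.inj (hboxW z (by linarith) (by linarith) (by linarith)) (hGW w hw) hzw)
    have h6 := (hGbox w hw).1
    rw [← h5] at h6
    linarith
  · have hgen : ∀ x ∈ W, (∀ z, x = φ z → z.re < a ∨ (x ∈ K)) → x ∉ φ '' Rb ∧ (x ≠ k0 → ∀ w ∈ Rb, e x ≠ e (φ (G w))) := by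
      intro x hxW hx
      constructor
      · rintro ⟨z, hz, rfl⟩
        obtain ⟨⟨h2, h3⟩, h4⟩ := (hRm z).1 hz
        rcases hx z rfl with h5 | h5
        · linarith
        · exact hoff z h2 h3 h4 h5
      · intro hxk w hw hh
        have h2 := h.inj ⟨hxW, hxk⟩ (hGW w hw) hh
        rcases hx _ h2 with h5 | h5
        · linarith [(hGbox w hw).1]
        · rw [h2] at h5; exact hGK w hw h5
    rintro x (hx | ⟨t, ht, rfl⟩) hxB
    · obtain ⟨h2, h3⟩ := hgen x (hKW hx) (fun z _ => Or.inr hx)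
      exact ⟨hKW hx, h2, h3⟩
    · have h2 : t ≤ a/2 := by
        by_contra hcon
        refine hxB ⟨(t : ℂ), ?_, rfl⟩
        rw [hBm]
        refine ⟨⟨by simpa using hcon, ?_⟩, by simpa using hη⟩
        rw [Complex.ofReal_re]; linarith [ht.2]
      have h3 : φ t ∈ W \ {k0} := hboxW _ (by simpa using ht.1) (by rw [Complex.ofReal_re]; linarith) (by simpa using ha.le)
      obtain ⟨h4, h5⟩ := hgen (φ t) h3.1 (fun z hz => Or.inl (by
        rw [← hφ.injective hz, Complex.ofReal_re]; linarith))
      exact ⟨h3.1, h4, h5⟩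

lemma annulus_preconn {J : Set ℝ} (hI : IsPreconnected J) (hp : ∀ r ∈ J, 0 < r) : IsPreconnected {z : ℂ | ‖z‖ ∈ J} := by
  have h1 : IsPreconnected ((fun q : ℝ × ℝ => (q.1 : ℂ) * Complex.exp (q.2 * Complex.I)) '' (J ×ˢ univ)) :=
    (hI.prod isPreconnected_univ).image _ (by fun_prop)
  convert h1 using 1
  ext z
  constructor
  · intro hz
    exact ⟨(‖z‖, Complex.arg z), ⟨hz, trivial⟩, Complex.norm_mul_exp_arg_mul_I z⟩
  · rintro ⟨⟨r, θ⟩, ⟨hr, -⟩, rfl⟩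
    simp only [mem_ofPred_eq, norm_mul, Complex.norm_exp_ofReal_mul_I, mul_one, Complex.norm_real]
    rw [Real.norm_of_nonneg (hp r hr).le]; exact hr

lemma BAcc.mem_closure {Ω : Set ℂ} {w : ℂ} (hw : w ∈ BAcc Ω) : w ∈ closure Ω := by
  obtain ⟨c, p, R, hc, rfl⟩ := hw
  exact mem_closure_iff_nhdsWithin_neBot.2 hc.neBot

lemma Collar.neg_notMem {Ω : Set ℂ} {c : ℂ → ℂ} {p : ℂ} {R : ℝ} (h : Collar Ω c p R) {q : ℂ} (hq : q ∈ ball p R)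
    (hq0 : q.re < 0) : c q ∉ closure Ω := by
  have ho : IsOpen (ball p R ∩ {q | q.re < 0}) := isOpen_ball.inter (isOpen_lt Complex.continuous_re continuous_const)
  obtain ⟨r, hr, hb⟩ := Metric.isOpen_iff.1 ho q ⟨hq, hq0⟩
  have h1 := image_ball_mem_nhds hr (h.cont.mono fun x hx => (hb hx).1) (h.inj.mono fun x hx => (hb hx).1)
  intro hcl
  obtain ⟨_, ⟨v, hv, rfl⟩, hvΩ⟩ := mem_closure_iff_nhds.1 hcl _ h1
  have := (h.iff v (hb hv).1).1 hvΩ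
  have h2 : v.re < 0 := (hb hv).2
  linarith

end Pieces


section Face
variable {S : Type*} [TopologicalSpace S] [T2Space S] {k0 : S} {K : Set S}

/-- filling in a face -/
theorem face (hch : Charted S) (hK : IsCompact K) (hKc : IsPreconnected K) (hk : k0 ∈ interior K) (hP : Pl k0 K)
    {φ : ℂ → S} (hφ : IsOpenEmbedding φ) (hsp : ∀ z : ℂ, ‖z‖ = 1 → φ z ∈ K)
    (hoff : ∀ z : ℂ, ‖z‖ < 1 → φ z ∉ K) : Pl k0 (K ∪ φ '' closedBall 0 1) := by
  obtain ⟨W, e, h, hKW⟩ := hP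
  have hk0K : k0 ∈ K := interior_subset hk
  have hspk : ∀ z : ℂ, ‖z‖ = 1 → φ z ≠ k0 := by
    intro z hz
    refine ne_k0_of_lim (l := 𝓝[<] (1:ℝ)) (f := fun t : ℝ => φ (t * z)) hk ?_ ?_
    · have : Continuous (fun t : ℝ => φ (t * z)) := hφ.continuous.comp (by fun_prop)
      have := this.tendsto 1
      simp only [Complex.ofReal_one, one_mul] at this
      exact this.mono_left nhdsWithin_le_nhds
    · filter_upwards [Ioo_mem_nhdsLT (one_pos)] with t ht
      refine hoff _ ?_
      rw [norm_mul, hz, mul_one, Complex.norm_real, Real.norm_of_nonneg ht.1.le]; exact ht.2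
  obtain ⟨δ, hδ, hth⟩ := (isCompact_sphere (0:ℂ) 1).exists_thickening_subset_open (h.op'.preimage hφ.continuous) (by
    intro z hz
    rw [mem_sphere_zero_iff_norm] at hz
    exact ⟨hKW (hsp z hz), hspk z hz⟩)
  obtain ⟨r0, hr0, hr01, hr0δ⟩ : ∃ r0 : ℝ, 1/2 ≤ r0 ∧ r0 < 1 ∧ 1 - δ ≤ r0 :=
    ⟨max (1/2) (1-δ), le_max_left _ _, max_lt (by norm_num) (by linarith), le_max_right _ _⟩
  have hring : ∀ z : ℂ, r0 < ‖z‖ → ‖z‖ ≤ 1 → φ z ∈ W \ {k0} := by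
    intro z hz1 hz2
    have hz0 : 0 < ‖z‖ := by linarith
    apply hth
    rw [mem_thickening_iff]
    refine ⟨((‖z‖⁻¹ : ℝ) : ℂ) * z, ?_, ?_⟩
    · rw [mem_sphere_zero_iff_norm, norm_mul, Complex.norm_real, norm_inv, norm_norm, inv_mul_cancel₀ hz0.ne']
    · have : z - ((‖z‖⁻¹ : ℝ) : ℂ) * z = ((1 - ‖z‖⁻¹ : ℝ) : ℂ) * z := by push_cast; ring
      rw [dist_eq_norm, this, norm_mul, Complex.norm_real, Real.norm_eq_abs, abs_of_nonpos, neg_sub, sub_mul,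
        inv_mul_cancel₀ hz0.ne']
      · linarith
      · have := one_le_inv_iff₀.2 ⟨hz0, hz2⟩
        linarith
  set r1 := (1 + r0)/2 with hr1
  have h01 : r0 < r1 := by linarith
  have h11 : r1 < 1 := by linarith
  set Y : Set S := K ∪ φ '' {z | ‖z‖ ∈ Icc r1 1} with hY
  have hYc : IsCompact Y := by
    refine hK.union (IsCompact.image ?_ hφ.continuous)
    refine (isCompact_closedBall (0:ℂ) 1).of_isClosed_subset (isClosed_Icc.preimage continuous_norm) ?_
    intro z hz
    rw [mem_closedBall_zero_iff]; exact hz.2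
  have hYW : Y ⊆ W := by
    rintro x (hx | ⟨z, hz, rfl⟩)
    · exact hKW hx
    · exact (hring z (by linarith [hz.1]) hz.2).1
  have hYp : IsPreconnected Y := by
    refine IsPreconnected.union (φ 1) (hsp 1 (by simp)) ⟨1, ⟨by simpa using h11.le, by simp⟩, rfl⟩ hKc ?_
    exact (annulus_preconn isPreconnected_Icc (fun r hr => by linarith [hr.1])).image _ hφ.continuous.continuousOn
  have hYk : k0 ∈ interior Y := interior_mono subset_union_left hk
  set X := e '' (Y \ {k0}) with hX
  have hYin : ∀ z : ℂ, ‖z‖ < r1 → φ z ∉ Y := by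
    rintro z hz (hx | ⟨w, hw, hwz⟩)
    · exact hoff z (by linarith) hx
    · rw [hφ.injective hwz] at hw
      linarith [hw.1]
  have hXin : ∀ z : ℂ, r0 < ‖z‖ → ‖z‖ < r1 → e (φ z) ∉ X := by
    rintro z hz hz1 ⟨y, ⟨hy, hyk⟩, hyz⟩
    have := h.inj ⟨hYW hy, hyk⟩ (hring z hz (by linarith)) hyz
    rw [this] at hy
    exact hYin z hz1 hy
  set r2 := (r0 + r1)/2 with hr2
  have hr2n : ‖((r2 : ℝ) : ℂ)‖ = r2 := by
    rw [Complex.norm_real, Real.norm_of_nonneg]; linarith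
  set t0 := e (φ (r2 : ℝ)) with ht0
  have ht0X : t0 ∉ X := hXin _ (by rw [hr2n]; linarith) (by rw [hr2n]; linarith)
  obtain ⟨ψ, φ', hrm⟩ := h.exists_rm hch hYc hYW hYp hYk ht0X
  rw [← hX] at hrm
  set Ω := connectedComponentIn Xᶜ t0 with hΩ
  have hΩX : ∀ w ∈ Ω, w ∉ X := fun w hw => connectedComponentIn_subset _ _ hw
  have hin : ∀ z : ℂ, r0 < ‖z‖ → ‖z‖ < r1 → e (φ z) ∈ Ω := by
    have hp : IsPreconnected ((fun z => e (φ z)) '' {z | ‖z‖ ∈ Ioo r0 r1}) := by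
      refine (annulus_preconn isPreconnected_Ioo (fun r hr => by linarith [hr.1])).image _ ?_
      exact h.cont.comp hφ.continuous.continuousOn (fun z hz => hring z hz.1 (by linarith [hz.2]))
    intro z hz1 hz2
    refine hp.subset_connectedComponentIn ⟨(r2:ℝ), ?_, rfl⟩ ?_ ⟨z, ⟨hz1, hz2⟩, rfl⟩
    · change ‖((r2 : ℝ) : ℂ)‖ ∈ Ioo r0 r1
      rw [hr2n]; constructor <;> linarith
    · rintro _ ⟨w, hw, rfl⟩; exact hXin w hw.1 hw.2
  have hout : ∀ z : ℂ, r1 ≤ ‖z‖ → ‖z‖ ≤ 1 → e (φ z) ∈ X := fun z hz1 hz2 =>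
    ⟨φ z, ⟨Or.inr ⟨z, ⟨hz1, hz2⟩, rfl⟩, (hring z (by linarith) hz2).2⟩, rfl⟩
  -- collars
  have hcol : ∀ v : ℂ, ‖v‖ = r1 → ∃ R, Collar Ω (fun q => e (φ (Complex.exp (-q) * v))) 0 R ∧
      ∀ q ∈ ball (0:ℂ) R, r0 < ‖Complex.exp (-q) * v‖ ∧ ‖Complex.exp (-q) * v‖ < 1 := by
    intro v hv
    have hv0 : v ≠ 0 := by rw [← norm_pos_iff, hv]; linarith
    have hcn : Continuous (fun q : ℂ => ‖Complex.exp (-q) * v‖) := by fun_prop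
    have hmem : {q : ℂ | ‖Complex.exp (-q) * v‖ ∈ Ioo r0 1} ∈ 𝓝 (0:ℂ) := by
      refine (isOpen_Ioo.preimage hcn).mem_nhds ?_
      simp only [mem_preimage, neg_zero, Complex.exp_zero, one_mul, hv]
      exact ⟨h01, h11⟩
    obtain ⟨R', hR', hb⟩ := Metric.mem_nhds_iff.1 hmem
    have hbb : ∀ q ∈ ball (0:ℂ) (min R' 1), ‖Complex.exp (-q) * v‖ ∈ Ioo r0 1 := fun q hq =>
      hb (ball_subset_ball (min_le_left _ _) hq)
    refine ⟨min R' 1, ⟨by positivity, rfl, ?_, ?_, ?_⟩, hbb⟩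
    · refine h.cont.comp (hφ.continuous.comp (by fun_prop)).continuousOn ?_
      intro q hq
      exact hring _ (hbb q hq).1 (hbb q hq).2.le
    · intro q hq q' hq' hqq
      have h1 := hφ.injective (h.inj (hring _ (hbb q hq).1 (hbb q hq).2.le)
        (hring _ (hbb q' hq').1 (hbb q' hq').2.le) hqq)
      have h2 := mul_right_cancel₀ hv0 h1
      have him : ∀ q ∈ ball (0:ℂ) (min R' 1), |(-q).im| < 1 := by
        intro q hq
        rw [mem_ball_zero_iff] at hq
        have := Complex.abs_im_le_norm q
        rw [Complex.neg_im, abs_neg]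
        exact lt_of_le_of_lt this (hq.trans_le (min_le_right _ _))
      have hpi := Real.pi_gt_three
      have a1 := abs_lt.1 (him q hq)
      have a2 := abs_lt.1 (him q' hq')
      have h3 := Complex.exp_inj_of_neg_pi_lt_of_le_pi (by linarith) (by linarith) (by linarith) (by linarith) h2
      exact neg_injective h3
    · intro q hq
      have hn : ‖Complex.exp (-q) * v‖ = Real.exp (-q.re) * r1 := by
        rw [norm_mul, Complex.norm_exp, hv, Complex.neg_re]
      have hr1p : 0 < r1 := by linarith
      constructor
      · intro hmem
        by_contra hcon
        refine hΩX _ hmem (hout _ ?_ (hbb q hq).2.le)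
        rw [hn]
        have : 1 ≤ Real.exp (-q.re) := Real.one_le_exp (by linarith)
        nlinarith
      · intro hq0
        refine hin _ (hbb q hq).1 ?_
        rw [hn]
        have : Real.exp (-q.re) < 1 := Real.exp_lt_one_iff.2 (by linarith)
        nlinarith
  have hJ : ∀ v : ℂ, ‖v‖ = r1 → e (φ v) ∈ BAcc Ω := by
    intro v hv
    obtain ⟨R, hR, -⟩ := hcol v hv
    exact ⟨_, 0, R, hR, by simp⟩
  set E := Ω ∪ BAcc Ω with hE
  set g : ℂ → ℂ := fun v => bext Ω ψ (e (φ v)) with hg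
  have hgc : ContinuousOn g (sphere 0 r1) := by
    refine hrm.bext_cont.comp (h.cont.comp hφ.continuous.continuousOn ?_) ?_
    · intro v hv
      rw [mem_sphere_zero_iff_norm] at hv
      exact hring v (by linarith) (by linarith)
    · intro v hv
      rw [mem_sphere_zero_iff_norm] at hv
      exact Or.inr (hJ v hv)
  have hgn : ∀ v : ℂ, ‖v‖ = r1 → ‖g v‖ = 1 := fun v hv => hrm.bext_norm (hJ v hv)
  have hgi : ∀ v w : ℂ, ‖v‖ = r1 → ‖w‖ = r1 → g v = g w → v = w := by
    intro v w hv hw hvw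
    have h1 := hrm.bext_inj (Or.inr (hJ v hv)) (Or.inr (hJ w hw)) hvw
    exact hφ.injective (h.inj (hring v (by linarith) (by linarith)) (hring w (by linarith) (by linarith)) h1)
  have hsurj : sphere (0:ℂ) 1 ⊆ g '' sphere 0 r1 := by
    have hcl : IsClosed (g '' sphere 0 r1) := ((isCompact_sphere (0:ℂ) r1).image_of_continuousOn hgc).isClosed
    have hopen : ∀ w ∈ g '' sphere 0 r1, ∃ O, IsOpen O ∧ w ∈ O ∧ O ∩ sphere 0 1 ⊆ g '' sphere 0 r1 := by
      rintro _ ⟨v, hv, rfl⟩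
      rw [mem_sphere_zero_iff_norm] at hv
      obtain ⟨R, hR, hRb⟩ := hcol v hv
      have hN := hR.nhds
      simp only [neg_zero, Complex.exp_zero, one_mul] at hN
      have h1 := hrm.bext_open (Or.inr (hJ v hv)) hN
      obtain ⟨O, hO, hvO, hOs⟩ := mem_nhdsWithin.1 h1
      refine ⟨O, hO, hvO, ?_⟩
      rintro z ⟨hzO, hz⟩
      obtain ⟨x, ⟨⟨q, hq, rfl⟩, hxE⟩, hxz⟩ := hOs ⟨hzO, sphere_subset_closedBall hz⟩
      rw [mem_sphere_zero_iff_norm] at hz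
      have hxΩ : e (φ (Complex.exp (-q) * v)) ∉ Ω := by
        intro hh
        have := hrm.bext_lt hh
        simp only at hxz
        rw [hxz] at this; linarith
      have hxB : e (φ (Complex.exp (-q) * v)) ∈ BAcc Ω := hxE.resolve_left hxΩ
      have hq0 : q.re = 0 := by
        rcases lt_trichotomy q.re 0 with h2 | h2 | h2
        · exact absurd (BAcc.mem_closure hxB) (hR.neg_notMem hq h2)
        · exact h2
        · exact absurd ((hR.iff q hq).2 h2) hxΩ
      refine ⟨Complex.exp (-q) * v, ?_, hxz⟩
      rw [mem_sphere_zero_iff_norm, norm_mul, Complex.norm_exp, Complex.neg_re, hq0, hv]; simp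
    have hpre : IsPreconnected (sphere (0:ℂ) 1) := isPreconnected_sphere (by rw [Complex.rank_real_complex]; norm_num) _ _
    choose! O hO hwO hOs using hopen
    have := isPreconnected_iff_subset_of_disjoint.1 hpre (⋃ w ∈ g '' sphere 0 r1, O w) (g '' sphere 0 r1)ᶜ
      (isOpen_biUnion fun w hw => hO w hw) hcl.isOpen_compl ?_ ?_
    · rcases this with h1 | h1
      · intro z hz
        obtain ⟨w, hw, hzw⟩ := mem_iUnion₂.1 (h1 hz)
        exact hOs w hw ⟨hzw, hz⟩
      · exfalso
        have hr1n : ‖((r1 : ℝ) : ℂ)‖ = r1 := by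
          rw [Complex.norm_real, Real.norm_of_nonneg]; linarith
        exact h1 (show g (r1:ℝ) ∈ sphere (0:ℂ) 1 by rw [mem_sphere_zero_iff_norm]; exact hgn _ hr1n)
          ⟨_, by rw [mem_sphere_zero_iff_norm]; exact hr1n, rfl⟩
    · intro z hz
      by_cases hzg : z ∈ g '' sphere 0 r1
      · exact Or.inl (mem_iUnion₂.2 ⟨z, hzg, hwO z hzg⟩)
      · exact Or.inr hzg
    · rw [eq_empty_iff_forall_notMem]
      rintro z ⟨hz, hz1, hz2⟩
      obtain ⟨w, hw, hzw⟩ := mem_iUnion₂.1 hz1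
      exact hz2 (hOs w hw ⟨hzw, hz⟩)
  set F : Set ℂ := Ω ∪ (fun v => e (φ v)) '' sphere 0 r1 with hF
  have hFE : F ⊆ E := by
    rintro _ (hx | ⟨v, hv, rfl⟩)
    · exact Or.inl hx
    · rw [mem_sphere_zero_iff_norm] at hv
      exact Or.inr (hJ v hv)
  have hbs : ∀ z ∈ closedBall (0:ℂ) 1, ∃ w ∈ F, bext Ω ψ w = z := by
    intro z hz
    rw [mem_closedBall_zero_iff] at hz
    rcases hz.lt_or_eq with h1 | h1
    · have hz1 : z ∈ ball (0:ℂ) 1 := mem_ball_zero_iff.2 h1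
      exact ⟨φ' z, Or.inl (hrm.mφ hz1), by rw [hrm.bext_eq (hrm.mφ hz1), hrm.ψφ z hz1]⟩
    · obtain ⟨v, hv, hvz⟩ := hsurj (mem_sphere_zero_iff_norm.2 h1)
      exact ⟨_, Or.inr ⟨v, hv, rfl⟩, hvz⟩
  set inv := Function.invFunOn (bext Ω ψ) E with hinv
  have hinvl : ∀ w ∈ E, inv (bext Ω ψ w) = w := fun w hw => hrm.bext_inj.leftInvOn_invFunOn hw
  have hinvF : ∀ z ∈ closedBall (0:ℂ) 1, inv z ∈ F ∧ bext Ω ψ (inv z) = z := by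
    intro z hz
    obtain ⟨w, hw, rfl⟩ := hbs z hz
    rw [hinvl w (hFE hw)]
    exact ⟨hw, rfl⟩
  have hinvc : ContinuousOn inv (closedBall 0 1) := by
    refine hrm.binv_cont.mono ?_
    intro z hz
    obtain ⟨w, hw, hwz⟩ := hbs z hz
    exact ⟨w, hFE hw, hwz⟩
  -- the cone
  have hr1p : 0 < r1 := by linarith
  set pr : ℂ → ℂ := fun z => ((r1 * ‖z‖⁻¹ : ℝ) : ℂ) * z with hpr
  have hprn : ∀ z : ℂ, z ≠ 0 → ‖pr z‖ = r1 := by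
    intro z hz
    have : 0 < ‖z‖ := norm_pos_iff.2 hz
    simp only [hpr]
    rw [norm_mul, Complex.norm_real, Real.norm_of_nonneg (by positivity)]
    field_simp
  set κ : ℂ → ℂ := fun z => ((‖z‖ / r1 : ℝ) : ℂ) * g (pr z) with hκ
  have hκ0 : κ 0 = 0 := by simp [hκ]
  have hκn : ∀ z : ℂ, ‖κ z‖ = ‖z‖ / r1 := by
    intro z
    by_cases hz : z = 0
    · subst hz; rw [hκ0]; simp
    · simp only [hκ]
      rw [norm_mul, Complex.norm_real, Real.norm_of_nonneg (by positivity), hgn _ (hprn z hz), mul_one]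
  have hκc : Continuous κ := by
    rw [continuous_iff_continuousAt]
    intro z
    by_cases hz : z = 0
    · subst hz
      rw [ContinuousAt, hκ0, tendsto_zero_iff_norm_tendsto_zero]
      simp only [hκn]
      have : Continuous (fun z : ℂ => ‖z‖ / r1) := by fun_prop
      simpa using this.tendsto 0
    · have hprc : ContinuousAt pr z := by
        have : ContinuousAt (fun z : ℂ => r1 * ‖z‖⁻¹) z :=
          continuousAt_const.mul (continuous_norm.continuousAt.inv₀ (norm_ne_zero_iff.2 hz))
        exact (Complex.continuous_ofReal.continuousAt.comp this).mul continuousAt_id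
      have h1 : ContinuousAt (fun z => g (pr z)) z := by
        have h2 : Tendsto pr (𝓝 z) (𝓝[sphere 0 r1] (pr z)) := by
          refine tendsto_nhdsWithin_of_tendsto_nhds_of_eventually_within _ hprc ?_
          filter_upwards [isOpen_ne.mem_nhds hz] with w hw
          rw [mem_sphere_zero_iff_norm]; exact hprn w hw
        exact (hgc (pr z) (mem_sphere_zero_iff_norm.2 (hprn z hz))).tendsto.comp h2
      have h3 : Continuous (fun z : ℂ => ((‖z‖ / r1 : ℝ) : ℂ)) := by fun_prop
      exact h3.continuousAt.mul h1
  have hκm : ∀ z ∈ closedBall (0:ℂ) r1, κ z ∈ closedBall (0:ℂ) 1 := by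
    intro z hz
    rw [mem_closedBall_zero_iff] at hz ⊢
    rw [hκn, div_le_one hr1p]; exact hz
  have hκs : ∀ z : ℂ, ‖z‖ = r1 → κ z = g z := by
    intro z hz
    have h1 : pr z = z := by
      simp only [hpr]; rw [hz, mul_inv_cancel₀ hr1p.ne']; simp
    simp only [hκ]
    rw [h1, hz, div_self hr1p.ne']; simp
  have hκi : ∀ z w : ℂ, κ z = κ w → z = w := by
    intro z w hzw
    have h1 : ‖z‖ = ‖w‖ := by
      have : ‖κ z‖ = ‖κ w‖ := by rw [hzw]
      rw [hκn, hκn] at this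
      field_simp at this
      exact this
    by_cases hz : z = 0
    · subst hz; rw [norm_zero] at h1; exact (norm_eq_zero.1 h1.symm).symm
    · have hw : w ≠ 0 := by rw [← norm_pos_iff, ← h1]; exact norm_pos_iff.2 hz
      have hzp : 0 < ‖z‖ := norm_pos_iff.2 hz
      simp only [hκ] at hzw
      rw [← h1] at hzw
      have h2 := mul_left_cancel₀ (by
        rw [Complex.ofReal_ne_zero]; positivity) hzw
      have h3 := hgi _ _ (hprn z hz) (hprn w hw) h2
      simp only [hpr] at h3
      rw [← h1] at h3
      exact mul_left_cancel₀ (by rw [Complex.ofReal_ne_zero]; positivity) h3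
  have hnoF : ∀ x ∈ Y, x ≠ k0 → (∀ z : ℂ, ‖z‖ = r1 → x ≠ φ z) → e x ∉ F := by
    rintro x hx hxk hxz (hh | ⟨v, hv, hvx⟩)
    · exact hΩX _ hh ⟨x, ⟨hx, hxk⟩, rfl⟩
    · rw [mem_sphere_zero_iff_norm] at hv
      exact hxz v hv (h.inj (hring v (by linarith) (by linarith)) ⟨hYW hx, hxk⟩ hvx).symm
  refine band_chart h hφ (Rb := closedBall 0 r1) (Bb := ball 0 1) (b := fun z => inv (κ z))
    (isCompact_closedBall _ _) (hinvc.comp hκc.continuousOn hκm) ?_ isOpen_ball ?_ ?_ ?_ ?_ ?_ (Or.inl hk0K)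
  · intro z hz w hw hzw
    have h1 := (hinvF _ (hκm z hz)).2
    have h2 := (hinvF _ (hκm w hw)).2
    simp only at hzw
    rw [hzw, h2] at h1
    exact (hκi _ _ h1).symm
  · intro z hz hzk
    rw [mem_closedBall_zero_iff] at hz
    exact hoff z (by linarith) (by rw [hzk]; exact hk0K)
  · rintro z ⟨hz1, hz2⟩
    rw [mem_ball_zero_iff] at hz1
    rw [mem_closedBall_zero_iff, not_le] at hz2
    exact hring z (by linarith) hz1.le
  · rintro z ⟨hz1, hz2⟩ hcl
    rw [mem_closedBall_zero_iff] at hz2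
    have h5 : r1 ≤ ‖z‖ := by
      have : closure (ball (0:ℂ) 1 \ closedBall 0 r1) ⊆ {z : ℂ | r1 ≤ ‖z‖} := by
        refine closure_minimal (fun z hz => ?_) (isClosed_le continuous_const continuous_norm)
        have := hz.2
        rw [mem_closedBall_zero_iff, not_le] at this
        exact this.le
      exact this hcl
    have h6 : ‖z‖ = r1 := le_antisymm hz2 h5
    have h7 := hring z (by linarith) (by linarith)
    refine ⟨h7.1, h7.2, ?_⟩
    rw [hκs z h6, hinvl _ (Or.inr (hJ z h6))]
  · rintro z ⟨hz1, hz2⟩ w hw hzw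
    rw [mem_ball_zero_iff] at hz1
    rw [mem_closedBall_zero_iff, not_le] at hz2
    refine hnoF (φ z) (Or.inr ⟨z, ⟨hz2.le, hz1.le⟩, rfl⟩) (hring z (by linarith) hz1.le).2 ?_ (by
      rw [hzw]; exact (hinvF _ (hκm w hw)).1)
    intro v hv hvz
    rw [hφ.injective hvz] at hz2
    linarith
  · have hKcase : ∀ x ∈ K, x ∈ W ∧ x ∉ φ '' closedBall 0 r1 ∧ (x ≠ k0 → ∀ w ∈ closedBall (0:ℂ) r1, e x ≠ inv (κ w)) := by
      intro x hx
      refine ⟨hKW hx, ?_, ?_⟩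
      · rintro ⟨z, hz, rfl⟩
        rw [mem_closedBall_zero_iff] at hz
        exact hoff z (by linarith) hx
      · intro hxk w hw hxw
        refine hnoF x (Or.inl hx) hxk ?_ (by rw [hxw]; exact (hinvF _ (hκm w hw)).1)
        rintro z hz rfl
        exact hoff z (by linarith) hx
    rintro x (hx | ⟨z, hz, rfl⟩) hxB
    · exact hKcase x hx
    · rw [mem_closedBall_zero_iff] at hz
      refine hKcase _ (hsp z (le_antisymm hz ?_))
      by_contra hcon
      exact hxB ⟨z, mem_ball_zero_iff.2 (not_le.1 hcon), rfl⟩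

end Face


section TwoEnd
set_option linter.unusedSimpArgs false
set_option linter.unusedSectionVars false
set_option linter.unusedVariables false

/-- the data of an edge with two ends, in normalized coordinates -/
structure TE {S : Type*} [TopologicalSpace S] (k0 : S) (K U W : Set S) (e : S → ℂ) (φ : ℂ → S) (p : ℝ) : Prop where
  emb : Emb k0 W e
  KW : K ⊆ W
  hφ : IsOpenEmbedding φ
  hp : 1 < p
  hK : IsCompact K
  hKc : IsPreconnected K
  hk : k0 ∈ interior K
  KU : K ⊆ U
  hU : IsOpen U
  ends : ∀ t : ℝ, |t| = p + 2 → φ t ∈ K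
  off : ∀ z : ℂ, |z.re| ≤ p + 1 → |z.im| ≤ 1 → φ z ∉ K
  inW : ∀ z : ℂ, p - 1 ≤ |z.re| → |z.re| ≤ p + 2 → |z.im| ≤ 1 → φ z ∈ W \ {k0}
  inU : ∀ z : ℂ, |z.re| ≤ p + 2 → |z.im| ≤ 1 → φ z ∈ U

/-- the end pieces -/
def Qs (p s : ℝ) : Set ℂ :=
  {z | p ≤ s * z.re ∧ s * z.re ≤ p + 1 ∧ |z.im| ≤ 1} ∪ {z | p + 1 ≤ s * z.re ∧ s * z.re ≤ p + 2 ∧ z.im = 0}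

/-- the enlarged set -/
def YY {S : Type*} (K : Set S) (φ : ℂ → S) (p : ℝ) : Set S := K ∪ φ '' Qs p 1 ∪ φ '' Qs p (-1)

/-- its planar image -/
def XX {S : Type*} (k0 : S) (K : Set S) (e : S → ℂ) (φ : ℂ → S) (p : ℝ) : Set ℂ := e '' (YY K φ p \ {k0})

/-- the complementary components -/
def OM {S : Type*} (k0 : S) (K : Set S) (e : S → ℂ) (φ : ℂ → S) (p s : ℝ) : Set ℂ :=
  connectedComponentIn (XX k0 K e φ p)ᶜ (e (φ ((s * (p - 1/2) : ℝ) : ℂ)))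

def sgn1 (s : ℝ) : Prop := s = 1 ∨ s = -1

lemma sgn1.sq {s : ℝ} (hs : sgn1 s) : s * s = 1 := by rcases hs with rfl | rfl <;> norm_num
lemma sgn1.abs {s : ℝ} (hs : sgn1 s) : |s| = 1 := by rcases hs with rfl | rfl <;> norm_num
lemma sgn1.abs_eq {s : ℝ} (hs : sgn1 s) {x : ℝ} (hx : 0 ≤ s * x) : |x| = s * x := by
  rw [← abs_of_nonneg hx, abs_mul, hs.abs, one_mul]
lemma exists_sgn1 (x : ℝ) : ∃ s, sgn1 s ∧ s * x = |x| := by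
  rcases abs_cases x with h | h
  · exact ⟨1, Or.inl rfl, by linarith [h.1]⟩
  · exact ⟨-1, Or.inr rfl, by linarith [h.1]⟩

lemma convex_strip (s a b c d : ℝ) : Convex ℝ {z : ℂ | a ≤ s * z.re ∧ s * z.re ≤ b ∧ c ≤ z.im ∧ z.im ≤ d} := by
  intro z hz w hw α β hα hβ hab
  simp only [mem_ofPred_eq, Complex.add_re, Complex.add_im, Complex.smul_re, Complex.smul_im, smul_eq_mul] at hz hw ⊢
  obtain ⟨z1, z2, z3, z4⟩ := hz
  obtain ⟨w1, w2, w3, w4⟩ := hw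
  have hβ' : β = 1 - α := by linarith
  subst hβ'
  refine ⟨?_, ?_, ?_, ?_⟩ <;> nlinarith

lemma convex_strip' (s a b d : ℝ) : Convex ℝ {z : ℂ | a ≤ s * z.re ∧ s * z.re ≤ b ∧ |z.im| ≤ d} := by
  have := convex_strip s a b (-d) d
  simpa only [abs_le] using this

lemma convex_strip0 (s a b : ℝ) : Convex ℝ {z : ℂ | a ≤ s * z.re ∧ s * z.re ≤ b ∧ z.im = 0} := by
  have := convex_strip' s a b 0
  simpa only [abs_nonpos_iff] using this

lemma compact_strip {s : ℝ} (hs : sgn1 s) (a b d : ℝ) : IsCompact {z : ℂ | a ≤ s * z.re ∧ s * z.re ≤ b ∧ |z.im| ≤ d} := by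
  refine Metric.isCompact_of_isClosed_isBounded ?_ ?_
  · have h1 : Continuous (fun z : ℂ => s * z.re) := by fun_prop
    have h2 : Continuous (fun z : ℂ => |z.im|) := by fun_prop
    exact (isClosed_le continuous_const h1).inter ((isClosed_le h1 continuous_const).inter
      (isClosed_le h2 continuous_const))
  · rw [isBounded_iff_forall_norm_le]
    refine ⟨max |a| |b| + d, ?_⟩
    rintro z ⟨h1, h2, h3⟩
    refine (norm_le_abs z).trans (add_le_add ?_ h3)
    have : |z.re| = |s * z.re| := by rw [abs_mul, hs.abs, one_mul]
    rw [this]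
    exact abs_le_max_abs_abs h1 h2

lemma Qs_preconn (p s : ℝ) (hs : sgn1 s) : IsPreconnected (Qs p s) := by
  refine IsPreconnected.union ((s * (p+1) : ℝ) : ℂ) ?_ ?_ (convex_strip' s p (p+1) 1).isPreconnected
    (convex_strip0 s (p+1) (p+2)).isPreconnected
  · simp only [mem_ofPred_eq, Complex.ofReal_re, Complex.ofReal_im]
    rw [← mul_assoc, hs.sq]; norm_num
  · simp only [mem_ofPred_eq, Complex.ofReal_re, Complex.ofReal_im]
    rw [← mul_assoc, hs.sq]; norm_num

lemma Qs_compact (p s : ℝ) (hs : sgn1 s) : IsCompact (Qs p s) := by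
  refine (compact_strip hs p (p+1) 1).union ?_
  have := compact_strip hs (p+1) (p+2) 0
  simpa only [abs_nonpos_iff] using this

lemma Qs_abs {p s : ℝ} (hp : 0 ≤ p) (hs : sgn1 s) {z : ℂ} (hz : z ∈ Qs p s) : p ≤ |z.re| ∧ |z.re| ≤ p + 2 ∧ |z.im| ≤ 1 := by
  rcases hz with ⟨h1, h2, h3⟩ | ⟨h1, h2, h3⟩
  · rw [hs.abs_eq (by linarith)]; exact ⟨h1, by linarith, h3⟩
  · rw [hs.abs_eq (by linarith), h3]; exact ⟨by linarith, h2, by norm_num⟩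

namespace TE
variable {S : Type*} [TopologicalSpace S] [T2Space S] {k0 : S} {K U W : Set S} {e : S → ℂ} {φ : ℂ → S} {p : ℝ}

lemma k0K (t : TE k0 K U W e φ p) : k0 ∈ K := interior_subset t.hk

lemma Y_mem (t : TE k0 K U W e φ p) {z : ℂ} (h1 : p ≤ |z.re|) (h2 : |z.re| ≤ p + 1) (h3 : |z.im| ≤ 1) :
    φ z ∈ YY K φ p := by
  obtain ⟨s, hs, hz⟩ := exists_sgn1 z.re
  rcases hs with rfl | rfl
  · exact Or.inl (Or.inr ⟨z, Or.inl ⟨by linarith, by linarith, h3⟩, rfl⟩)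
  · exact Or.inr ⟨z, Or.inl ⟨by linarith, by linarith, h3⟩, rfl⟩

lemma Y_mem' (t : TE k0 K U W e φ p) {x : ℝ} (h1 : p ≤ |x|) (h2 : |x| ≤ p + 2) : φ x ∈ YY K φ p := by
  rcases le_or_gt |x| (p+1) with h3 | h3
  · exact t.Y_mem (by simpa using h1) (by simpa using h3) (by simp)
  · obtain ⟨s, hs, hz⟩ := exists_sgn1 x
    rcases hs with rfl | rfl
    · refine Or.inl (Or.inr ⟨x, Or.inr ⟨?_, ?_, ?_⟩, rfl⟩) <;> simp <;> linarith
    · refine Or.inr ⟨x, Or.inr ⟨?_, ?_, ?_⟩, rfl⟩ <;> simp <;> linarith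

lemma Y_cases (t : TE k0 K U W e φ p) {x : S} (hx : x ∈ YY K φ p) :
    x ∈ K ∨ ∃ z : ℂ, p ≤ |z.re| ∧ |z.re| ≤ p + 2 ∧ |z.im| ≤ 1 ∧ φ z = x := by
  have hp := t.hp
  rcases hx with (hx | ⟨z, hz, rfl⟩) | ⟨z, hz, rfl⟩
  · exact Or.inl hx
  · obtain ⟨h1, h2, h3⟩ := Qs_abs (by linarith) (Or.inl rfl) hz
    exact Or.inr ⟨z, h1, h2, h3, rfl⟩
  · obtain ⟨h1, h2, h3⟩ := Qs_abs (by linarith) (Or.inr rfl) hz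
    exact Or.inr ⟨z, h1, h2, h3, rfl⟩

lemma Y_not (t : TE k0 K U W e φ p) {z : ℂ} (h1 : |z.re| < p) (h3 : |z.im| ≤ 1) : φ z ∉ YY K φ p := by
  intro h
  rcases t.Y_cases h with h | ⟨w, h4, h5, h6, h7⟩
  · exact t.off z (by linarith) h3 h
  · rw [t.hφ.injective h7] at h4; linarith

lemma YW (t : TE k0 K U W e φ p) : YY K φ p ⊆ W := by
  intro x hx
  rcases t.Y_cases hx with h | ⟨w, h4, h5, h6, rfl⟩
  · exact t.KW h
  · exact (t.inW w (by linarith) h5 h6).1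

lemma YU (t : TE k0 K U W e φ p) : YY K φ p ⊆ U := by
  intro x hx
  rcases t.Y_cases hx with h | ⟨w, h4, h5, h6, rfl⟩
  · exact t.KU h
  · exact t.inU w h5 h6

lemma Y_compact (t : TE k0 K U W e φ p) : IsCompact (YY K φ p) :=
  (t.hK.union ((Qs_compact p 1 (Or.inl rfl)).image t.hφ.continuous)).union
    ((Qs_compact p (-1) (Or.inr rfl)).image t.hφ.continuous)

lemma Y_preconn (t : TE k0 K U W e φ p) : IsPreconnected (YY K φ p) := by
  have hp := t.hp
  have h1 : φ ((p + 2 : ℝ) : ℂ) ∈ K := t.ends _ (abs_of_pos (by linarith))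
  have h2 : φ ((-(p + 2) : ℝ) : ℂ) ∈ K := t.ends _ (by rw [abs_neg, abs_of_pos (by linarith)])
  refine IsPreconnected.union (φ ((-(p + 2) : ℝ) : ℂ)) (Or.inl h2) ?_
    (IsPreconnected.union (φ ((p + 2 : ℝ) : ℂ)) h1 ?_ t.hKc ?_) ?_
  · refine ⟨_, Or.inr ⟨?_, ?_, ?_⟩, rfl⟩
    · rw [Complex.ofReal_re]; linarith
    · rw [Complex.ofReal_re]; linarith
    · rw [Complex.ofReal_im]
  · refine ⟨_, Or.inr ⟨?_, ?_, ?_⟩, rfl⟩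
    · rw [Complex.ofReal_re]; linarith
    · rw [Complex.ofReal_re]; linarith
    · rw [Complex.ofReal_im]
  · exact (Qs_preconn p 1 (Or.inl rfl)).image _ t.hφ.continuous.continuousOn
  · exact (Qs_preconn p (-1) (Or.inr rfl)).image _ t.hφ.continuous.continuousOn

lemma Y_int (t : TE k0 K U W e φ p) : k0 ∈ interior (YY K φ p) :=
  interior_mono (fun _ hx => Or.inl (Or.inl hx)) t.hk

lemma X_closed (t : TE k0 K U W e φ p) : IsClosed (XX k0 K e φ p) := t.emb.isClosed_image t.Y_compact t.YW

lemma X_not (t : TE k0 K U W e φ p) {x : S} (hx : x ∈ W) (hk : x ≠ k0) (hY : x ∉ YY K φ p) : e x ∉ XX k0 K e φ p := by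
  rintro ⟨y, ⟨hy, hyk⟩, hyx⟩
  rw [t.emb.inj ⟨t.YW hy, hyk⟩ ⟨hx, hk⟩ hyx] at hy
  exact hY hy

lemma OMX (t : TE k0 K U W e φ p) {s : ℝ} {w : ℂ} (hw : w ∈ OM k0 K e φ p s) : w ∉ XX k0 K e φ p :=
  connectedComponentIn_subset _ _ hw

lemma OM_in (t : TE k0 K U W e φ p) {s : ℝ} (hs : sgn1 s) {z : ℂ} (h1 : p - 1 ≤ s * z.re) (h2 : s * z.re < p)
    (h3 : |z.im| ≤ 1) : e (φ z) ∈ OM k0 K e φ p s := by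
  have hp := t.hp
  set b := max (s * z.re) (p - 1/2) with hb
  have hbp : b < p := max_lt h2 (by linarith)
  have hA : ∀ w ∈ {z : ℂ | p - 1 ≤ s * z.re ∧ s * z.re ≤ b ∧ |z.im| ≤ 1}, φ w ∈ W \ {k0} := by
    rintro w ⟨w1, w2, w3⟩
    have : |w.re| = s * w.re := hs.abs_eq (by linarith)
    exact t.inW w (by linarith) (by linarith) w3
  have hpc : IsPreconnected ((fun z => e (φ z)) '' {z : ℂ | p - 1 ≤ s * z.re ∧ s * z.re ≤ b ∧ |z.im| ≤ 1}) :=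
    (convex_strip' s (p-1) b 1).isPreconnected.image _
      (t.emb.cont.comp t.hφ.continuous.continuousOn hA)
  refine hpc.subset_connectedComponentIn ⟨((s * (p - 1/2) : ℝ) : ℂ), ⟨?_, ?_, ?_⟩, rfl⟩ ?_ ⟨z, ⟨h1, le_max_left _ _, h3⟩, rfl⟩
  · rw [Complex.ofReal_re, ← mul_assoc, hs.sq]; linarith
  · rw [Complex.ofReal_re, ← mul_assoc, hs.sq, one_mul]; exact le_max_right _ _
  · simp
  · rintro _ ⟨w, hw, rfl⟩
    refine t.X_not (hA w hw).1 (hA w hw).2 (t.Y_not ?_ hw.2.2)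
    rw [hs.abs_eq (by linarith [hw.1])]; linarith [hw.2.1]

lemma OM_base (t : TE k0 K U W e φ p) {s : ℝ} (hs : sgn1 s) :
    e (φ ((s * (p - 1/2) : ℝ) : ℂ)) ∉ XX k0 K e φ p := by
  have hp := t.hp
  refine t.OMX (s := s) (t.OM_in hs ?_ ?_ ?_)
  · rw [Complex.ofReal_re, ← mul_assoc, hs.sq]; linarith
  · rw [Complex.ofReal_re, ← mul_assoc, hs.sq, one_mul]; linarith
  · simp

lemma rm (hch : Charted S) (t : TE k0 K U W e φ p) {s : ℝ} (hs : sgn1 s) : ∃ ψ φ', IsRM (OM k0 K e φ p s) ψ φ' :=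
  t.emb.exists_rm hch t.Y_compact t.YW t.Y_preconn t.Y_int (t.OM_base hs)

lemma X_in (t : TE k0 K U W e φ p) {z : ℂ} (h1 : p ≤ |z.re|) (h2 : |z.re| ≤ p + 1) (h3 : |z.im| ≤ 1) :
    e (φ z) ∈ XX k0 K e φ p :=
  ⟨φ z, ⟨t.Y_mem h1 h2 h3, (t.inW z (by linarith) (by linarith) h3).2⟩, rfl⟩

lemma collar (t : TE k0 K U W e φ p) {s : ℝ} (hs : sgn1 s) {y : ℝ} (hy : |y| < 1) :
    Collar (OM k0 K e φ p s) (fun q => e (φ ⟨s * (p - q.re), q.im⟩)) ⟨0, y⟩ (1 - |y|) := by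
  have hp := t.hp
  have hq : ∀ q ∈ ball (⟨0, y⟩ : ℂ) (1 - |y|), |q.re| < 1 ∧ |q.im| < 1 := by
    intro q hq
    rw [mem_ball, dist_eq_norm] at hq
    have a1 := Complex.abs_re_le_norm (q - ⟨0, y⟩)
    have a2 := Complex.abs_im_le_norm (q - ⟨0, y⟩)
    simp only [Complex.sub_re, Complex.sub_im, sub_zero] at a1 a2
    have a3 : |q.im| ≤ |q.im - y| + |y| := by
      have := abs_add_le (q.im - y) y
      rwa [sub_add_cancel] at this
    have := abs_nonneg y
    constructor <;> linarith
  have hss : ∀ x : ℝ, s * (s * x) = x := fun x => by rw [← mul_assoc, hs.sq, one_mul]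
  have habs : ∀ q ∈ ball (⟨0, y⟩ : ℂ) (1 - |y|), |s * (p - q.re)| = p - q.re := by
    intro q h
    rw [abs_mul, hs.abs, one_mul, abs_of_pos]
    linarith [(abs_lt.1 (hq q h).1).2]
  have hW : ∀ q ∈ ball (⟨0, y⟩ : ℂ) (1 - |y|), φ ⟨s * (p - q.re), q.im⟩ ∈ W \ {k0} := by
    intro q h
    have := abs_lt.1 (hq q h).1
    refine t.inW _ ?_ ?_ (hq q h).2.le
    · simp only [habs q h]; linarith
    · simp only [habs q h]; linarith
  refine ⟨by linarith, rfl, ?_, ?_, ?_⟩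
  · refine t.emb.cont.comp (t.hφ.continuous.comp ?_).continuousOn hW
    have : (fun q : ℂ => (⟨s * (p - q.re), q.im⟩ : ℂ)) = fun q => ((s * (p - q.re) : ℝ) : ℂ) + (q.im : ℝ) * Complex.I := by
      funext q; apply Complex.ext <;> simp
    rw [this]; fun_prop
  · intro q h q' h' hqq
    have h1 := t.hφ.injective (t.emb.inj (hW q h) (hW q' h') hqq)
    rw [Complex.ext_iff] at h1
    simp only at h1
    apply Complex.ext _ h1.2
    have h2 : s * (s * (p - q.re)) = s * (s * (p - q'.re)) := by rw [h1.1]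
    rw [hss, hss] at h2; linarith
  · intro q h
    have h1 := abs_lt.1 (hq q h).1
    constructor
    · intro hm
      by_contra hcon
      refine t.OMX hm (t.X_in ?_ ?_ (hq q h).2.le)
      · simp only [habs q h]; linarith
      · simp only [habs q h]; linarith
    · intro h0
      refine t.OM_in hs ?_ ?_ (hq q h).2.le
      · simp only [hss]; linarith
      · simp only [hss]; linarith

lemma bacc (t : TE k0 K U W e φ p) {s : ℝ} (hs : sgn1 s) {y : ℝ} (hy : |y| < 1) :
    e (φ ⟨s * p, y⟩) ∈ BAcc (OM k0 K e φ p s) :=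
  ⟨_, _, _, t.collar hs hy, by simp⟩

lemma OM_open (t : TE k0 K U W e φ p) (s : ℝ) : IsOpen (OM k0 K e φ p s) :=
  t.X_closed.isOpen_compl.connectedComponentIn

/-- the part of the surface over a component -/
def Z {S : Type*} (k0 : S) (W : Set S) (e : S → ℂ) (Ω : Set ℂ) : Set S := {x ∈ W \ {k0} | e x ∈ Ω}

lemma Z_open (t : TE k0 K U W e φ p) {Ω : Set ℂ} (hΩ : IsOpen Ω) : IsOpen (Z k0 W e Ω) :=
  t.emb.cont.isOpen_inter_preimage t.emb.op' hΩ

lemma Z_miss (t : TE k0 K U W e φ p) (s : ℝ) {x : S} (hx : x ∈ W) (hxY : x ∉ YY K φ p)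
    (hxO : e x ∉ OM k0 K e φ p s) : ∀ᶠ y in 𝓝 x, y ∉ Z k0 W e (OM k0 K e φ p s) := by
  have hxk : x ≠ k0 := by rintro rfl; exact hxY (interior_subset t.Y_int)
  have hX := t.X_not hx hxk hxY
  have ho : IsOpen (connectedComponentIn (XX k0 K e φ p)ᶜ (e x)) := t.X_closed.isOpen_compl.connectedComponentIn
  have hmem : e x ∈ connectedComponentIn (XX k0 K e φ p)ᶜ (e x) := mem_connectedComponentIn hX
  filter_upwards [(t.Z_open ho).mem_nhds ⟨⟨hx, hxk⟩, hmem⟩] with y hy hy2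
  have h1 := connectedComponentIn_eq hy.2
  have h2 := connectedComponentIn_eq hy2.2
  apply hxO
  unfold OM
  rw [h2, ← h1]
  exact hmem

lemma mem_int_of {Y1 : Set S} {x : S} : x ∉ Y1 ∨ x ∈ interior Y1 ∨ (x ∈ Y1 ∧ x ∉ interior Y1) := by tauto

lemma same_comp [CompactSpace S] (t : TE k0 K U W e φ p) (hU : GoodSet U) :
    OM k0 K e φ p (-1) = OM k0 K e φ p 1 := by
  classical
  by_contra hne
  have hp := t.hp
  have hdisj : ∀ w ∈ OM k0 K e φ p 1, w ∉ OM k0 K e φ p (-1) := by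
    intro w h1 h2
    apply hne
    unfold OM at *
    rw [connectedComponentIn_eq h1, connectedComponentIn_eq h2]
  have hcR : IsCompact {z : ℂ | -(p-1/2) ≤ 1 * z.re ∧ 1 * z.re ≤ p-1/2 ∧ |z.im| ≤ 1} := compact_strip (Or.inl rfl) _ _ _
  obtain ⟨Y1, hY1c, hY1i, hY1s⟩ := exists_compact_between t.Y_compact
    (((t.emb.op.inter t.hU).sdiff (hcR.image t.hφ.continuous).isClosed)) (by
      intro x hx
      refine ⟨⟨t.YW hx, t.YU hx⟩, ?_⟩
      rintro ⟨z, ⟨h1, h2, h3⟩, rfl⟩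
      refine t.Y_not ?_ h3 hx
      rw [one_mul] at h1 h2
      exact abs_lt.2 ⟨by linarith, by linarith⟩)
  have hY1mid : ∀ x : ℝ, |x| ≤ p - 1/2 → φ x ∉ Y1 := by
    intro x hx h
    refine (hY1s h).2 ⟨x, ⟨?_, ?_, ?_⟩, rfl⟩
    · simpa using (abs_le.1 hx).1
    · simpa using (abs_le.1 hx).2
    · simp
  set Zm := Z k0 W e (OM k0 K e φ p (-1)) with hZm
  have hZo : IsOpen Zm := t.Z_open (t.OM_open _)
  set i1 : S → ZMod 2 := fun x => if x ∈ Y1 then 1 else 0 with hi1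
  set ω : S → S → ZMod 2 := fun x y => if x ∈ Zm ∧ y ∈ Zm then i1 x + i1 y else 0 with hω
  have two : (1:ZMod 2) + 1 = 0 := by decide
  have hz1 : ∀ x ∉ Y1, ZeroAt ω x := by
    intro x hx
    rw [ZeroAt, eventually_prod_same_iff']
    refine ⟨Y1ᶜ, hY1c.isClosed.isOpen_compl.mem_nhds hx, ?_⟩
    intro a ha b hb
    simp only [hω, hi1, if_neg ha, if_neg hb, add_zero, ite_self]
  have hz2 : ∀ x ∈ interior Y1, ZeroAt ω x := by
    intro x hx
    rw [ZeroAt, eventually_prod_same_iff']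
    refine ⟨interior Y1, isOpen_interior.mem_nhds hx, ?_⟩
    intro a ha b hb
    simp only [hω, hi1, if_pos (interior_subset ha), if_pos (interior_subset hb), two, ite_self]
  have hcoc : IsCoc ω := by
    intro x
    have hzero : ZeroAt ω x → ∃ b : S → ZMod 2, ∀ᶠ p in 𝓝 x ×ˢ 𝓝 x, ω p.1 p.2 = b p.1 + b p.2 := by
      intro h
      refine ⟨fun _ => 0, ?_⟩
      filter_upwards [h] with p hp
      rw [hp, add_zero]
    by_cases hxZ : x ∈ Zm
    · refine ⟨i1, ?_⟩
      rw [eventually_prod_same_iff']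
      refine ⟨Zm, hZo.mem_nhds hxZ, ?_⟩
      intro a ha b hb
      simp only [hω, if_pos (And.intro ha hb)]
    · rcases mem_int_of (Y1 := Y1) (x := x) with h | h | ⟨h1, h2⟩
      · exact hzero (hz1 x h)
      · exact hzero (hz2 x h)
      · apply hzero
        have hxY : x ∉ YY K φ p := fun hh => h2 (hY1i hh)
        have hxk : x ≠ k0 := by rintro rfl; exact hxY (interior_subset t.Y_int)
        have := t.Z_miss (-1) (hY1s h1).1.1 hxY (fun hh => hxZ ⟨⟨(hY1s h1).1.1, hxk⟩, hh⟩)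
        rw [ZeroAt, eventually_prod_same_iff']
        refine ⟨_, this, ?_⟩
        intro a ha b hb
        simp only [hω]
        rw [if_neg]
        exact fun hh => ha hh.1
  have hpe : ∀ x : ℝ, |x| = p → φ x ∈ YY K φ p := fun x hx => t.Y_mem' (by linarith) (by linarith)
  set γ : ℝ → S := fun x => φ x with hγ
  have hγc : Continuous γ := t.hφ.continuous.comp Complex.continuous_ofReal
  set b : ℝ → ZMod 2 := fun x => if x < 0 ∧ φ x ∈ Y1 then 1 else 0 with hb
  have hpa : |p| = p := abs_of_pos (by linarith)
  have key := good_contra hU hcoc hY1c (fun x hx => (hY1s hx).1.2) hz1 t.Y_preconn t.YU (fun z hz => hz2 z (hY1i hz))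
    hγc (show -p ≤ p by linarith) (b := b) ?_ (hpe _ (by rw [abs_neg, hpa])) (hpe _ hpa) ?_
  · simp only [hb] at key
    rw [if_pos ⟨by linarith, interior_subset (hY1i (hpe _ (by rw [abs_neg, hpa])))⟩, if_neg (by
      rintro ⟨h, -⟩; linarith)] at key
    exact one_ne_zero key
  · intro x hx
    refine t.inU _ ?_ (by simp)
    rw [Complex.ofReal_re]
    exact (abs_le.2 hx).trans (by linarith)
  · intro x hx
    by_cases hmid : |x| ≤ p - 1/2
    · have h0 := hY1mid x hmid
      filter_upwards [hγc.continuousAt.preimage_mem_nhds (hY1c.isClosed.isOpen_compl.mem_nhds h0)] with y hy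
      have hy' : φ y ∉ Y1 := hy
      simp only [hω, hi1, hγ, hb, hy', h0, and_false, if_false, add_zero, ite_self]
    · push Not at hmid
      by_cases hxY : φ x ∈ interior Y1
      · have hx0 : x ≠ 0 := by rintro rfl; simp at hmid; linarith
        filter_upwards [hγc.continuousAt.preimage_mem_nhds (isOpen_interior.mem_nhds hxY),
          (show ∀ᶠ y in 𝓝 x, (y < 0 ↔ x < 0) by
            rcases lt_or_gt_of_ne hx0 with h | h
            · filter_upwards [Iio_mem_nhds h] with y hy
              exact ⟨fun _ => h, fun _ => hy⟩
            · filter_upwards [Ioi_mem_nhds h] with y hy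
              exact ⟨fun h' => absurd h' (not_lt.2 (le_of_lt hy)), fun h' => absurd h' (not_lt.2 h.le)⟩)] with y hy hyx
        have h1 : φ y ∈ Y1 := interior_subset hy
        have h2 : φ x ∈ Y1 := interior_subset hxY
        simp only [hω, hi1, hγ, hb, if_pos h1, if_pos h2, hyx, two, ite_self, h1, h2, and_true]
        split_ifs <;> simp [two]
      · have hxp : |x| < p := lt_of_le_of_ne (abs_le.2 hx) (fun hh => hxY (hY1i (hpe x hh)))
        rcases le_total 0 x with h0 | h0
        · rw [abs_of_nonneg h0] at hmid hxp
          have h1 : e (φ x) ∈ OM k0 K e φ p 1 := t.OM_in (Or.inl rfl) (by simp; linarith) (by simpa using hxp) (by simp)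
          have hW := t.inW (x:ℂ) (by rw [Complex.ofReal_re, abs_of_nonneg h0]; linarith)
            (by rw [Complex.ofReal_re, abs_of_nonneg h0]; linarith) (by simp)
          filter_upwards [Ioi_mem_nhds (show 0 < x by linarith)] with y hy
          have hnz : ¬ (φ x ∈ Zm) := fun hh => hdisj _ h1 hh.2
          have hy0 : ¬ y < 0 := not_lt.2 (le_of_lt hy)
          have hx0 : ¬ x < 0 := not_lt.2 h0
          simp only [hω, hγ, hb, hnz, hy0, hx0, and_false, false_and, if_false, add_zero]
        · rw [abs_of_nonpos h0] at hmid hxp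
          have hZmem : φ x ∈ Zm := by
            refine ⟨t.inW (x:ℂ) ?_ ?_ (by simp), t.OM_in (Or.inr rfl) ?_ ?_ (by simp)⟩
            · rw [Complex.ofReal_re, abs_of_nonpos h0]; linarith
            · rw [Complex.ofReal_re, abs_of_nonpos h0]; linarith
            · rw [Complex.ofReal_re]; linarith
            · rw [Complex.ofReal_re]; linarith
          filter_upwards [Iio_mem_nhds (show x < 0 by linarith),
            hγc.continuousAt.preimage_mem_nhds (hZo.mem_nhds hZmem)] with y hy hyZ
          have hyZ' : φ y ∈ Zm := hyZ
          have hy0 : y < 0 := hy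
          have hx0 : x < 0 := by linarith
          simp only [hω, hγ, hb, hZmem, hyZ', hy0, hx0, and_true, true_and, if_true, hi1]

end TE
end TwoEnd


section TwoEndB
set_option linter.unusedSectionVars false
set_option linter.unusedVariables false
set_option linter.unusedSimpArgs false

/-- boundary values on the two ends -/
noncomputable def gg {S : Type*} (k0 : S) (K : Set S) (e : S → ℂ) (φ : ℂ → S) (p : ℝ) (ψ : ℂ → ℂ) (s y : ℝ) : ℂ :=
  bext (OM k0 K e φ p 1) ψ (e (φ ⟨s * p, y⟩))

namespace TE
variable {S : Type*} [TopologicalSpace S] [T2Space S] {k0 : S} {K U W : Set S} {e : S → ℂ} {φ : ℂ → S} {p : ℝ}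
  {ψ φ' : ℂ → ℂ}

/-- everything we know after normalizing -/
structure Nrm {S : Type*} [TopologicalSpace S] (k0 : S) (K U W : Set S) (e : S → ℂ) (φ : ℂ → S) (p : ℝ)
    (ψ φ' : ℂ → ℂ) (h η : ℝ) : Prop where
  te : TE k0 K U W e φ p
  same : OM k0 K e φ p (-1) = OM k0 K e φ p 1
  rm : IsRM (OM k0 K e φ p 1) ψ φ'
  h1 : (gg k0 K e φ p ψ (-1) 0).im = h
  h2 : (gg k0 K e φ p ψ 1 0).im = h
  η0 : 0 < η
  η1 : η < 1
  neg : ∀ y : ℝ, |y| ≤ η → (gg k0 K e φ p ψ (-1) y).re < 0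
  pos : ∀ y : ℝ, |y| ≤ η → 0 < (gg k0 K e φ p ψ 1 y).re

lemma bacc' (t : TE k0 K U W e φ p) (hsame : OM k0 K e φ p (-1) = OM k0 K e φ p 1) {s : ℝ} (hs : sgn1 s) {y : ℝ}
    (hy : |y| < 1) : e (φ ⟨s * p, y⟩) ∈ BAcc (OM k0 K e φ p 1) := by
  have h := t.bacc hs hy
  rcases hs with rfl | rfl
  · exact h
  · rwa [hsame] at h

lemma OM_in' (t : TE k0 K U W e φ p) (hsame : OM k0 K e φ p (-1) = OM k0 K e φ p 1) {z : ℂ} (h1 : p - 1 ≤ |z.re|)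
    (h2 : |z.re| < p) (h3 : |z.im| ≤ 1) : e (φ z) ∈ OM k0 K e φ p 1 := by
  obtain ⟨s, hs, hz⟩ := exists_sgn1 z.re
  have h := t.OM_in hs (by linarith) (by linarith) h3
  rcases hs with rfl | rfl
  · exact h
  · rwa [hsame] at h

lemma spW (t : TE k0 K U W e φ p) {s : ℝ} (hs : sgn1 s) {y : ℝ} (hy : |y| ≤ 1) : φ ⟨s * p, y⟩ ∈ W \ {k0} := by
  have hp := t.hp
  have : |s * p| = p := by rw [abs_mul, hs.abs, one_mul, abs_of_pos (by linarith)]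
  exact t.inW _ (by simp only [this]; linarith) (by simp only [this]; linarith) hy

lemma gg_norm (t : TE k0 K U W e φ p) (hsame : OM k0 K e φ p (-1) = OM k0 K e φ p 1) (hrm : IsRM (OM k0 K e φ p 1) ψ φ')
    {s : ℝ} (hs : sgn1 s) {y : ℝ} (hy : |y| < 1) : ‖gg k0 K e φ p ψ s y‖ = 1 :=
  hrm.bext_norm (t.bacc' hsame hs hy)

lemma gg_inj (t : TE k0 K U W e φ p) (hsame : OM k0 K e φ p (-1) = OM k0 K e φ p 1) (hrm : IsRM (OM k0 K e φ p 1) ψ φ')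
    {s s' : ℝ} (hs : sgn1 s) (hs' : sgn1 s') {y y' : ℝ} (hy : |y| < 1) (hy' : |y'| < 1)
    (h : gg k0 K e φ p ψ s y = gg k0 K e φ p ψ s' y') : s = s' ∧ y = y' := by
  have hp := t.hp
  have h1 := hrm.bext_inj (Or.inr (t.bacc' hsame hs hy)) (Or.inr (t.bacc' hsame hs' hy')) h
  have h2 := t.hφ.injective (t.emb.inj (t.spW hs hy.le) (t.spW hs' hy'.le) h1)
  rw [Complex.ext_iff] at h2
  exact ⟨mul_right_cancel₀ (by linarith) h2.1, h2.2⟩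

lemma cont_mk (a : ℝ) : Continuous (fun y : ℝ => (⟨a, y⟩ : ℂ)) := by
  have : (fun y : ℝ => (⟨a, y⟩ : ℂ)) = fun y : ℝ => (a : ℂ) + y * Complex.I := by
    funext q; apply Complex.ext <;> simp
  rw [this]; fun_prop

lemma gg_cont (t : TE k0 K U W e φ p) (hsame : OM k0 K e φ p (-1) = OM k0 K e φ p 1) (hrm : IsRM (OM k0 K e φ p 1) ψ φ')
    {s : ℝ} (hs : sgn1 s) : ContinuousOn (gg k0 K e φ p ψ s) {y : ℝ | |y| < 1} := by
  refine hrm.bext_cont.comp (t.emb.cont.comp (t.hφ.continuous.comp (cont_mk _)).continuousOn ?_) ?_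
  · intro y hy; exact t.spW hs (le_of_lt hy)
  · intro y hy; exact Or.inr (t.bacc' hsame hs hy)

lemma exists_nrm [CompactSpace S] (hch : Charted S) (t : TE k0 K U W e φ p) (hU : GoodSet U) :
    ∃ ψ φ' h η, Nrm k0 K U W e φ p ψ φ' h η := by
  have hsame := t.same_comp hU
  obtain ⟨ψ0, φ0, hrm0⟩ := t.rm hch (Or.inl rfl)
  have s1 : sgn1 1 := Or.inl rfl
  have s2 : sgn1 (-1) := Or.inr rfl
  have z1 : |(0:ℝ)| < 1 := by simp
  set d := gg k0 K e φ p ψ0 1 0 - gg k0 K e φ p ψ0 (-1) 0 with hd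
  have hd0 : d ≠ 0 := by
    intro h0
    have := (t.gg_inj hsame hrm0 s1 s2 z1 z1 (sub_eq_zero.1 h0)).1
    norm_num at this
  have hdn : 0 < ‖d‖ := norm_pos_iff.2 hd0
  set u : ℂ := (starRingEnd ℂ) d * ((‖d‖⁻¹ : ℝ) : ℂ) with hu
  have hun : ‖u‖ = 1 := by
    rw [hu, norm_mul, Complex.norm_conj, Complex.norm_real, norm_inv, norm_norm, mul_inv_cancel₀ hdn.ne']
  have hud : u * d = (‖d‖ : ℝ) := by
    have : (starRingEnd ℂ) d * d = ((‖d‖^2 : ℝ) : ℂ) := by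
      rw [mul_comm, Complex.mul_conj, Complex.normSq_eq_norm_sq]
    calc u * d = ((starRingEnd ℂ) d * d) * ((‖d‖⁻¹ : ℝ) : ℂ) := by rw [hu]; ring
      _ = ((‖d‖^2 * ‖d‖⁻¹ : ℝ) : ℂ) := by rw [this]; push_cast; ring
      _ = (‖d‖ : ℝ) := by congr 1; field_simp
  have hrm := hrm0.rot hun
  set ψ : ℂ → ℂ := fun z => u * ψ0 z with hψ
  have hgg : ∀ s y : ℝ, sgn1 s → |y| < 1 → gg k0 K e φ p ψ s y = u * gg k0 K e φ p ψ0 s y := fun s y hs hy =>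
    hrm0.rot_bext hun (Or.inr (t.bacc' hsame hs hy))
  set ρ := gg k0 K e φ p ψ 1 0 with hρ
  set l := gg k0 K e φ p ψ (-1) 0 with hl
  have hdiff : ρ - l = (‖d‖ : ℝ) := by
    rw [hρ, hl, hgg 1 0 s1 z1, hgg (-1) 0 s2 z1, ← mul_sub, ← hd, hud]
  have hre : ρ.re - l.re = ‖d‖ := by rw [← Complex.sub_re, hdiff, Complex.ofReal_re]
  have him : ρ.im - l.im = 0 := by rw [← Complex.sub_im, hdiff, Complex.ofReal_im]
  have hρn : ρ.re * ρ.re + ρ.im * ρ.im = 1 := by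
    have := t.gg_norm hsame hrm s1 z1
    rw [← Complex.normSq_apply, Complex.normSq_eq_norm_sq, ← hρ] at *
    rw [this]; norm_num
  have hln : l.re * l.re + l.im * l.im = 1 := by
    have := t.gg_norm hsame hrm s2 z1
    rw [← Complex.normSq_apply, Complex.normSq_eq_norm_sq, ← hl] at *
    rw [this]; norm_num
  have hsum : ρ.re + l.re = 0 := by
    have h1 : ρ.im = l.im := by linarith
    rw [h1] at hρn
    have h2 : (ρ.re - l.re) * (ρ.re + l.re) = 0 := by nlinarith
    rcases mul_eq_zero.1 h2 with h3 | h3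
    · linarith
    · exact h3
  have hball : {y : ℝ | |y| < 1} ∈ 𝓝 (0:ℝ) := (isOpen_lt continuous_abs continuous_const).mem_nhds z1
  have c1 : ContinuousAt (fun y => (gg k0 K e φ p ψ 1 y).re) 0 :=
    Complex.continuous_re.continuousAt.comp ((t.gg_cont hsame hrm s1).continuousAt hball)
  have c2 : ContinuousAt (fun y => (gg k0 K e φ p ψ (-1) y).re) 0 :=
    Complex.continuous_re.continuousAt.comp ((t.gg_cont hsame hrm s2).continuousAt hball)
  have e1 := c1.eventually (lt_mem_nhds (show 0 < (gg k0 K e φ p ψ 1 0).re by rw [← hρ]; linarith))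
  have e2 := c2.eventually (gt_mem_nhds (show (gg k0 K e φ p ψ (-1) 0).re < 0 by rw [← hl]; linarith))
  obtain ⟨ε, hε, hb⟩ := Metric.eventually_nhds_iff.1 (e1.and e2)
  have hm : ∀ y : ℝ, |y| ≤ min (ε/2) (1/2) → dist y 0 < ε := by
    intro y hy
    rw [Real.dist_0_eq_abs]
    have := min_le_left (ε/2) (1/2 : ℝ)
    linarith
  refine ⟨ψ, _, l.im, min (ε/2) (1/2), t, hsame, hrm, rfl, by rw [← hρ]; linarith, by positivity, ?_, ?_, ?_⟩
  · exact lt_of_le_of_lt (min_le_right _ _) (by norm_num)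
  · intro y hy; exact (hb (hm y hy)).2
  · intro y hy; exact (hb (hm y hy)).1

variable {h η : ℝ}

lemma Nrm.nsq (n : Nrm k0 K U W e φ p ψ φ' h η) {s : ℝ} (hs : sgn1 s) {y : ℝ} (hy : |y| ≤ η) :
    (gg k0 K e φ p ψ s y).re ^ 2 + (gg k0 K e φ p ψ s y).im ^ 2 = 1 := by
  have h1 := n.te.gg_norm n.same n.rm hs (lt_of_le_of_lt hy n.η1)
  have h2 := Complex.normSq_apply (gg k0 K e φ p ψ s y)
  rw [Complex.normSq_eq_norm_sq, h1] at h2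
  nlinarith

lemma Nrm.im_lt (n : Nrm k0 K U W e φ p ψ φ' h η) {s : ℝ} (hs : sgn1 s) {y : ℝ} (hy : |y| ≤ η) :
    |(gg k0 K e φ p ψ s y).im| < 1 := by
  have h1 := n.nsq hs hy
  have h2 : (gg k0 K e φ p ψ s y).re ≠ 0 := by
    rcases hs with rfl | rfl
    · exact (n.pos y hy).ne'
    · exact (n.neg y hy).ne
  have h3 : 0 < (gg k0 K e φ p ψ s y).re ^ 2 := by positivity
  rw [← sq_lt_one_iff_abs_lt_one]
  linarith

lemma Nrm.re_eq (n : Nrm k0 K U W e φ p ψ φ' h η) {s : ℝ} (hs : sgn1 s) {y : ℝ} (hy : |y| ≤ η) :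
    (gg k0 K e φ p ψ s y).re = s * √(1 - (gg k0 K e φ p ψ s y).im ^ 2) := by
  have h1 := n.nsq hs hy
  have h4 : 1 - (gg k0 K e φ p ψ s y).im ^ 2 = (gg k0 K e φ p ψ s y).re ^ 2 := by linarith
  rw [h4, Real.sqrt_sq_eq_abs]
  rcases hs with rfl | rfl
  · rw [abs_of_pos (n.pos y hy), one_mul]
  · rw [abs_of_neg (n.neg y hy)]; ring

lemma Nrm.im_inj (n : Nrm k0 K U W e φ p ψ φ' h η) {s : ℝ} (hs : sgn1 s) :
    InjOn (fun y => (gg k0 K e φ p ψ s y).im) (Icc (-η) η) := by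
  intro y hy y' hy' hyy
  simp only at hyy
  have h1 : |y| ≤ η := abs_le.2 hy
  have h2 : |y'| ≤ η := abs_le.2 hy'
  refine (n.te.gg_inj n.same n.rm hs hs (lt_of_le_of_lt h1 n.η1) (lt_of_le_of_lt h2 n.η1) (Complex.ext ?_ hyy)).2
  rw [n.re_eq hs h1, n.re_eq hs h2, hyy]

lemma Nrm.g_cont (n : Nrm k0 K U W e φ p ψ φ' h η) {s : ℝ} (hs : sgn1 s) :
    ContinuousOn (gg k0 K e φ p ψ s) (Icc (-η) η) :=
  (n.te.gg_cont n.same n.rm hs).mono (fun y hy => lt_of_le_of_lt (abs_le.2 hy) n.η1)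

lemma Nrm.im_cont (n : Nrm k0 K U W e φ p ψ φ' h η) {s : ℝ} (hs : sgn1 s) :
    ContinuousOn (fun y => (gg k0 K e φ p ψ s y).im) (Icc (-η) η) :=
  Complex.continuous_im.comp_continuousOn (n.g_cont hs)

lemma Nrm.hinvl (n : Nrm k0 K U W e φ p ψ φ' h η) {w : ℂ} (hw : w ∈ OM k0 K e φ p 1 ∪ BAcc (OM k0 K e φ p 1)) :
    Function.invFunOn (bext (OM k0 K e φ p 1) ψ) (OM k0 K e φ p 1 ∪ BAcc (OM k0 K e φ p 1))
      (bext (OM k0 K e φ p 1) ψ w) = w := n.rm.bext_inj.leftInvOn_invFunOn hw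

lemma Nrm.ball_pre (n : Nrm k0 K U W e φ p ψ φ' h η) {w : ℂ} (hw : ‖w‖ < 1) :
    ∃ v ∈ OM k0 K e φ p 1, bext (OM k0 K e φ p 1) ψ v = w := by
  have hz1 : w ∈ ball (0:ℂ) 1 := mem_ball_zero_iff.2 hw
  exact ⟨φ' w, n.rm.mφ hz1, by rw [n.rm.bext_eq (n.rm.mφ hz1), n.rm.ψφ w hz1]⟩

theorem Nrm.case_same (n : Nrm k0 K U W e φ p ψ φ' h η)
    (hinj : ∀ τ ∈ Icc (0:ℝ) 1, InjOn (fun y => (1 - τ) * (gg k0 K e φ p ψ (-1) y).im + τ * (gg k0 K e φ p ψ 1 y).im)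
      (Icc (-η) η)) : Pl k0 (K ∪ (fun x : ℝ => φ x) '' Icc (-(p+2)) (p+2)) := by
  have t := n.te
  have hp := t.hp
  have s1 : sgn1 1 := Or.inl rfl
  have s2 : sgn1 (-1) := Or.inr rfl
  have hη0 := n.η0
  have hη1 := n.η1
  set Ω := OM k0 K e φ p 1 with hΩ
  set inv := Function.invFunOn (bext Ω ψ) (Ω ∪ BAcc Ω) with hinv
  set Rb : Set ℂ := {z : ℂ | -p ≤ 1 * z.re ∧ 1 * z.re ≤ p ∧ |z.im| ≤ η} with hRb
  have hRmem : ∀ z : ℂ, z ∈ Rb ↔ |z.re| ≤ p ∧ |z.im| ≤ η := by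
    intro z
    simp only [hRb, mem_ofPred_eq, one_mul, abs_le (b := p), and_assoc]
  set Bb : Set ℂ := {z : ℂ | |z.re| < p + 1} ∩ {z | |z.im| < η} with hBb
  have hBo : IsOpen Bb := (isOpen_lt (by fun_prop) continuous_const).inter (isOpen_lt (by fun_prop) continuous_const)
  set τ : ℂ → ℝ := fun z => (z.re + p) / (2 * p) with hτ
  have hτm : ∀ z ∈ Rb, τ z ∈ Icc (0:ℝ) 1 := by
    intro z hz
    have := abs_le.1 ((hRmem z).1 hz).1
    simp only [hτ]
    constructor
    · apply div_nonneg <;> linarith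
    · rw [div_le_one (by linarith)]; linarith
  set Yf : ℂ → ℝ := fun z => (1 - τ z) * (gg k0 K e φ p ψ (-1) z.im).im + τ z * (gg k0 K e φ p ψ 1 z.im).im with hYf
  have hY1 : ∀ z ∈ Rb, |Yf z| < 1 := by
    intro z hz
    have a1 := abs_lt.1 (n.im_lt s2 ((hRmem z).1 hz).2)
    have a2 := abs_lt.1 (n.im_lt s1 ((hRmem z).1 hz).2)
    obtain ⟨b1, b2⟩ := hτm z hz
    simp only [hYf]
    rw [abs_lt]
    rcases b1.eq_or_lt with h0 | h0
    · rw [← h0]; constructor <;> linarith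
    · constructor <;> nlinarith
  have hsq : ∀ z ∈ Rb, 0 < 1 - Yf z ^ 2 := by
    intro z hz
    have := (sq_lt_one_iff_abs_lt_one _).2 (hY1 z hz)
    linarith
  have hYc : ContinuousOn Yf Rb := by
    have m : MapsTo (fun z : ℂ => z.im) Rb (Icc (-η) η) := fun z hz => abs_le.1 ((hRmem z).1 hz).2
    have c1 := (n.im_cont s1).comp Complex.continuous_im.continuousOn m
    have c2 := (n.im_cont s2).comp Complex.continuous_im.continuousOn m
    have c3 : Continuous τ := by fun_prop
    exact ((continuous_const.sub c3).continuousOn.mul c2).add (c3.continuousOn.mul c1)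
  set β : ℂ → ℂ := fun z => (((z.re / p) * √(1 - Yf z ^ 2) : ℝ) : ℂ) + ((Yf z : ℝ) : ℂ) * Complex.I with hβ
  have hβre : ∀ z, (β z).re = (z.re / p) * √(1 - Yf z ^ 2) := fun z => by simp [hβ]
  have hβim : ∀ z, (β z).im = Yf z := fun z => by simp [hβ]
  have hβc : ContinuousOn β Rb := by
    have c1 : ContinuousOn (fun z : ℂ => (z.re / p) * √(1 - Yf z ^ 2)) Rb :=
      (by fun_prop : Continuous (fun z : ℂ => z.re / p)).continuousOn.mul
        (Real.continuous_sqrt.comp_continuousOn (continuousOn_const.sub (hYc.pow 2)))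
    exact (Complex.continuous_ofReal.comp_continuousOn c1).add
      ((Complex.continuous_ofReal.comp_continuousOn hYc).mul continuousOn_const)
  have hβi : InjOn β Rb := by
    intro z hz w hw hzw
    have e1 : Yf z = Yf w := by rw [← hβim, ← hβim, hzw]
    have e2 : (z.re / p) * √(1 - Yf z ^ 2) = (w.re / p) * √(1 - Yf w ^ 2) := by rw [← hβre, ← hβre, hzw]
    rw [e1] at e2
    have e3 := mul_right_cancel₀ (Real.sqrt_pos.2 (hsq w hw)).ne' e2
    have e4 : z.re = w.re := by field_simp at e3; exact e3
    refine Complex.ext e4 ?_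
    have e5 : τ z = τ w := by simp only [hτ, e4]
    refine hinj (τ w) (hτm w hw) (abs_le.1 ((hRmem z).1 hz).2) (abs_le.1 ((hRmem w).1 hw).2) ?_
    simp only [hYf] at e1
    rw [e5] at e1
    exact e1
  have hβlt : ∀ z ∈ Rb, |z.re| < p → ‖β z‖ < 1 := by
    intro z hz hzp
    have h1 : ‖β z‖ ^ 2 < 1 := by
      rw [← Complex.normSq_eq_norm_sq, Complex.normSq_apply, hβre, hβim]
      have h2 := Real.mul_self_sqrt (hsq z hz).le
      have h3 : (z.re / p) ^ 2 < 1 := by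
        rw [sq_lt_one_iff_abs_lt_one, abs_div, abs_of_pos (by linarith : 0 < p), div_lt_one (by linarith)]; exact hzp
      have h4 := hsq z hz
      have h5 : z.re / p * √(1 - Yf z ^ 2) * (z.re / p * √(1 - Yf z ^ 2)) = (z.re / p) ^ 2 * (1 - Yf z ^ 2) := by
        rw [← h2]; ring_nf
        rw [Real.sq_sqrt (by linarith)]
      rw [h5]
      nlinarith
    exact (sq_lt_one_iff₀ (norm_nonneg _)).1 h1
  have hβend : ∀ s : ℝ, sgn1 s → ∀ y : ℝ, |y| ≤ η → β ⟨s * p, y⟩ = gg k0 K e φ p ψ s y := by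
    intro s hs y hy
    have hYe : Yf ⟨s * p, y⟩ = (gg k0 K e φ p ψ s y).im := by
      rcases hs with rfl | rfl
      · simp only [hYf, hτ]
        have : (1 * p + p) / (2 * p) = 1 := by field_simp; ring
        rw [this]; ring
      · simp only [hYf, hτ]
        have : (-1 * p + p) / (2 * p) = 0 := by rw [neg_one_mul, neg_add_cancel, zero_div]
        rw [this]; ring
    apply Complex.ext
    · rw [hβre, hYe, n.re_eq hs hy]
      congr 1
      field_simp
    · rw [hβim, hYe]
  have hcase : ∀ z ∈ Rb, bext Ω ψ (inv (β z)) = β z ∧ (inv (β z) ∈ Ω ∨ (|z.re| = p ∧ inv (β z) = e (φ z))) := by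
    intro z hz
    obtain ⟨hz1, hz2⟩ := (hRmem z).1 hz
    rcases hz1.lt_or_eq with hlt | heq
    · obtain ⟨v, hv, hvz⟩ := n.ball_pre (hβlt z hz hlt)
      have h2 : inv (β z) = v := by rw [← hvz]; exact n.hinvl (Or.inl hv)
      rw [h2]
      exact ⟨hvz, Or.inl hv⟩
    · obtain ⟨s, hs, hsz⟩ := exists_sgn1 z.re
      have hre : z.re = s * p := by rw [← heq, ← hsz, ← mul_assoc, hs.sq, one_mul]
      have hzz : z = ⟨s * p, z.im⟩ := Complex.ext hre rfl
      have h1 : β z = bext Ω ψ (e (φ z)) := by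
        have := hβend s hs z.im hz2
        rw [← hzz] at this
        rw [this]; unfold gg; rw [← hzz]
      have hm : e (φ z) ∈ Ω ∪ BAcc Ω := by
        have := t.bacc' n.same hs (lt_of_le_of_lt hz2 hη1)
        rw [← hzz] at this
        exact Or.inr this
      have h2 : inv (β z) = e (φ z) := by rw [h1]; exact n.hinvl hm
      rw [h2]
      exact ⟨h1.symm, Or.inr ⟨heq, rfl⟩⟩
  have hmaps : MapsTo β Rb (bext Ω ψ '' (Ω ∪ BAcc Ω)) := by
    intro z hz
    obtain ⟨hz1, hz2⟩ := (hRmem z).1 hz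
    obtain ⟨h1, h2 | ⟨h2, h3⟩⟩ := hcase z hz
    · exact ⟨_, Or.inl h2, h1⟩
    · refine ⟨_, Or.inr ?_, h1⟩
      rw [h3]
      obtain ⟨s, hs, hsz⟩ := exists_sgn1 z.re
      have hre : z.re = s * p := by rw [← h2, ← hsz, ← mul_assoc, hs.sq, one_mul]
      have hzz : z = ⟨s * p, z.im⟩ := Complex.ext hre rfl
      rw [hzz]
      exact t.bacc' n.same hs (lt_of_le_of_lt hz2 hη1)
  have hno : ∀ x ∈ YY K φ p, x ≠ k0 → ∀ w ∈ Rb, e x = inv (β w) → |w.re| = p ∧ x = φ w := by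
    intro x hx hxk w hw hxw
    obtain ⟨h1, h2 | ⟨h2, h3⟩⟩ := hcase w hw
    · exfalso
      rw [← hxw] at h2
      exact t.OMX h2 ⟨x, ⟨hx, hxk⟩, rfl⟩
    · refine ⟨h2, ?_⟩
      rw [h3] at hxw
      refine t.emb.inj ⟨t.YW hx, hxk⟩ (t.inW w (by linarith) (by linarith) ?_) hxw
      linarith [((hRmem w).1 hw).2]
  have hK' : ∀ x ∈ YY K φ p, x ∉ φ '' Rb → x ∈ W ∧ x ∉ φ '' Rb ∧ (x ≠ k0 → ∀ w ∈ Rb, e x ≠ inv (β w)) := by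
    intro x hx hxR
    refine ⟨t.YW hx, hxR, ?_⟩
    intro hxk w hw hxw
    exact hxR ⟨w, hw, (hno x hx hxk w hw hxw).2.symm⟩
  refine band_chart t.emb t.hφ (Rb := Rb) (Bb := Bb) (b := fun z => inv (β z)) (compact_strip s1 _ _ _)
    (n.rm.binv_cont.comp hβc hmaps) ?_ hBo ?_ ?_ ?_ ?_ ?_ (Or.inl t.k0K)
  · intro z hz w hw hzw
    simp only at hzw
    have h1 := (hcase z hz).1
    rw [hzw, (hcase w hw).1] at h1
    exact hβi hz hw h1.symm
  · intro z hz hzk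
    obtain ⟨hz1, hz2⟩ := (hRmem z).1 hz
    refine t.off z (by linarith) (by linarith) ?_
    rw [hzk]; exact t.k0K
  · rintro z ⟨⟨hz1, hz2⟩, hz3⟩
    have hz1' : |z.re| < p + 1 := hz1
    have hz2' : |z.im| < η := hz2
    have h4 : p < |z.re| := by
      by_contra hcon
      exact hz3 ((hRmem z).2 ⟨not_lt.1 hcon, hz2'.le⟩)
    exact t.inW z (by linarith) (by linarith) (by linarith)
  · rintro z ⟨⟨hz1, hz2⟩, hz3⟩ hcl
    have hz2' : |z.im| < η := hz2
    have h5 : p ≤ |z.re| := by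
      have : closure (Bb \ Rb) ⊆ {z : ℂ | p ≤ |z.re|} := by
        refine closure_minimal (fun z hz => ?_) (isClosed_le continuous_const (by fun_prop))
        by_contra hcon
        have hcon' : |z.re| < p := not_le.1 hcon
        exact hz.2 ((hRmem z).2 ⟨hcon'.le, le_of_lt hz.1.2⟩)
      exact this hcl
    have h6 : |z.re| = p := le_antisymm ((hRmem z).1 hz3).1 h5
    have h7 := t.inW z (by linarith) (by linarith) (by linarith)
    refine ⟨h7.1, h7.2, ?_⟩
    rcases (hcase z hz3).2 with h8 | h8
    · exfalso
      have h9 := n.rm.bext_lt h8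
      rw [(hcase z hz3).1] at h9
      obtain ⟨s, hs, hsz⟩ := exists_sgn1 z.re
      have hre : z.re = s * p := by rw [← h6, ← hsz, ← mul_assoc, hs.sq, one_mul]
      have hzz : z = ⟨s * p, z.im⟩ := Complex.ext hre rfl
      rw [hzz, hβend s hs z.im hz2'.le, t.gg_norm n.same n.rm hs (hz2'.trans hη1)] at h9
      exact lt_irrefl _ h9
    · exact h8.2.symm
  · rintro z ⟨⟨hz1, hz2⟩, hz3⟩ w hw hzw
    have hz1' : |z.re| < p + 1 := hz1
    have hz2' : |z.im| < η := hz2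
    have h4 : p < |z.re| := by
      by_contra hcon
      exact hz3 ((hRmem z).2 ⟨not_lt.1 hcon, hz2'.le⟩)
    obtain ⟨h5, h6⟩ := hno (φ z) (t.Y_mem h4.le hz1'.le (by linarith))
      (t.inW z (by linarith) (by linarith) (by linarith)).2 w hw hzw
    rw [← t.hφ.injective h6] at h5
    linarith
  · rintro x (hx | ⟨y, hy, rfl⟩) hxB
    · refine hK' x (Or.inl (Or.inl hx)) ?_
      rintro ⟨z, hz, rfl⟩
      obtain ⟨hz1, hz2⟩ := (hRmem z).1 hz
      exact t.off z (by linarith) (by linarith) hx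
    · have hy2 : |y| ≤ p + 2 := abs_le.2 hy
      have hy1 : p + 1 ≤ |y| := by
        by_contra hcon
        refine hxB ⟨y, ⟨?_, ?_⟩, rfl⟩
        · simpa using not_le.1 hcon
        · simpa using hη0
      refine hK' _ (t.Y_mem' (by linarith) hy2) ?_
      rintro ⟨z, hz, hzy⟩
      obtain ⟨hz1, hz2⟩ := (hRmem z).1 hz
      rw [t.hφ.injective hzy, Complex.ofReal_re] at hz1
      linarith

end TE
end TwoEndB


section TwoEndC
set_option linter.unusedSectionVars false
set_option linter.unusedVariables false
set_option linter.unusedSimpArgs false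

namespace TE
variable {S : Type*} [TopologicalSpace S] [T2Space S] {k0 : S} {K U W : Set S} {e : S → ℂ} {φ : ℂ → S} {p : ℝ}
  {ψ φ' : ℂ → ℂ} {h η : ℝ}

lemma Nrm.seg_pre (n : Nrm k0 K U W e φ p ψ φ' h η) {w : ℂ} (hw : ‖w‖ ≤ 1) (hwh : w.im = h) :
    ∃ v, (v ∈ OM k0 K e φ p 1 ∨ ∃ s, sgn1 s ∧ v = e (φ ⟨s * p, 0⟩)) ∧ bext (OM k0 K e φ p 1) ψ v = w := by
  have s1 : sgn1 1 := Or.inl rfl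
  have s2 : sgn1 (-1) := Or.inr rfl
  have hz : |(0:ℝ)| ≤ η := by simpa using n.η0.le
  rcases hw.lt_or_eq with h1 | h1
  · obtain ⟨v, hv, hvw⟩ := n.ball_pre h1
    exact ⟨v, Or.inl hv, hvw⟩
  · have h2 := Complex.normSq_apply w
    rw [Complex.normSq_eq_norm_sq, h1, hwh] at h2
    have h3 : |w.re| = √(1 - h ^ 2) := by
      rw [← Real.sqrt_sq_eq_abs]; congr 1; nlinarith
    have h4 : √(1 - h ^ 2) = |√(1 - h^2)| := (abs_of_nonneg (Real.sqrt_nonneg _)).symm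
    have e1 := n.re_eq s1 hz
    have e2 := n.re_eq s2 hz
    rw [n.h2] at e1
    rw [n.h1] at e2
    rw [h4, abs_eq_abs] at h3
    rcases h3 with h3 | h3
    · refine ⟨_, Or.inr ⟨1, s1, rfl⟩, ?_⟩
      change gg k0 K e φ p ψ 1 0 = w
      apply Complex.ext
      · rw [e1, h3, one_mul]
      · rw [n.h2, hwh]
    · refine ⟨_, Or.inr ⟨-1, s2, rfl⟩, ?_⟩
      change gg k0 K e φ p ψ (-1) 0 = w
      apply Complex.ext
      · rw [e2, h3]; ring
      · rw [n.h1, hwh]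

theorem Nrm.case_opp [CompactSpace S] (n : Nrm k0 K U W e φ p ψ φ' h η) (hU : GoodSet U) {sg : ℝ} (hsg : sgn1 sg)
    (H1 : ∀ y : ℝ, |y| ≤ η → 0 < sg * y → h < (gg k0 K e φ p ψ (-1) y).im ∧ (gg k0 K e φ p ψ 1 y).im < h)
    (H2 : ∀ y : ℝ, |y| ≤ η → sg * y < 0 → (gg k0 K e φ p ψ (-1) y).im < h ∧ h < (gg k0 K e φ p ψ 1 y).im) : False := by
  classical
  have t := n.te
  have hp := t.hp
  have s1 : sgn1 1 := Or.inl rfl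
  have hη0 := n.η0
  have hη1 := n.η1
  set Ω := OM k0 K e φ p 1 with hΩ
  set inv := Function.invFunOn (bext Ω ψ) (Ω ∪ BAcc Ω) with hinv
  have hΩo : IsOpen Ω := t.OM_open 1
  -- the band
  set Bb : Set ℂ := {z : ℂ | |z.re| < p + 1} ∩ {z | |z.im| < η} with hBb
  have hBo : IsOpen Bb := (isOpen_lt (by fun_prop) continuous_const).inter (isOpen_lt (by fun_prop) continuous_const)
  set T := φ '' Bb with hT
  have hTo : IsOpen T := t.hφ.isOpenMap _ hBo
  set Tc := φ '' {z : ℂ | -(p+1) ≤ 1 * z.re ∧ 1 * z.re ≤ p+1 ∧ |z.im| ≤ η} with hTc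
  have hTcc : IsClosed Tc := ((compact_strip s1 _ _ _).image t.hφ.continuous).isClosed
  have hTcm : ∀ x ∈ Tc, ∃ w : ℂ, |w.re| ≤ p + 1 ∧ |w.im| ≤ η ∧ φ w = x := by
    rintro _ ⟨w, ⟨h1, h2, h3⟩, rfl⟩
    rw [one_mul] at h1 h2
    exact ⟨w, abs_le.2 ⟨h1, h2⟩, h3, rfl⟩
  have hTTc : T ⊆ Tc := by
    rintro _ ⟨w, ⟨h1, h2⟩, rfl⟩
    have h1' : |w.re| < p + 1 := h1
    have h2' : |w.im| < η := h2
    have := abs_lt.1 h1'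
    exact ⟨w, ⟨by linarith, by linarith, h2'.le⟩, rfl⟩
  have hTout : ∀ x ∉ Tc, ∀ᶠ y in 𝓝 x, y ∉ T := fun x hx => by
    filter_upwards [hTcc.isOpen_compl.mem_nhds hx] with y hy hyT
    exact hy (hTTc hyT)
  have hZo : IsOpen (Z k0 W e Ω) := t.Z_open hΩo
  have hψc : ContinuousOn (fun x => (ψ (e x)).im) (Z k0 W e Ω) :=
    Complex.continuous_im.comp_continuousOn (n.rm.dψ.continuousOn.comp
      (t.emb.cont.mono (fun x hx => hx.1)) (fun x hx => hx.2))
  set Zp : Set S := Z k0 W e Ω ∩ (fun x => (ψ (e x)).im) ⁻¹' Ioi h with hZp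
  set Zn : Set S := Z k0 W e Ω ∩ (fun x => (ψ (e x)).im) ⁻¹' Iio h with hZn
  have hZpo : IsOpen Zp := hψc.isOpen_inter_preimage hZo isOpen_Ioi
  have hZno : IsOpen Zn := hψc.isOpen_inter_preimage hZo isOpen_Iio
  -- the middle segment
  have hendmem : ∀ s, sgn1 s → e (φ ⟨s * p, 0⟩) ∈ BAcc Ω := fun s hs => t.bacc' n.same hs (by simp)
  set Sg : Set ℂ := closedBall 0 1 ∩ {w : ℂ | w.im = h} with hSg
  have hSgc : IsCompact Sg := (isCompact_closedBall _ _).inter_right (isClosed_eq Complex.continuous_im continuous_const)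
  have hSgp : ∀ w ∈ Sg, ∃ v, (v ∈ Ω ∨ ∃ s, sgn1 s ∧ v = e (φ ⟨s * p, 0⟩)) ∧ bext Ω ψ v = w := by
    rintro w ⟨hw1, hw2⟩
    exact n.seg_pre (mem_closedBall_zero_iff.1 hw1) hw2
  have hvE : ∀ v, (v ∈ Ω ∨ ∃ s, sgn1 s ∧ v = e (φ ⟨s * p, 0⟩)) → v ∈ Ω ∪ BAcc Ω := by
    rintro v (hv | ⟨s, hs, rfl⟩)
    · exact Or.inl hv
    · exact Or.inr (hendmem s hs)
  set Sh := inv '' Sg with hSh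
  have hShc : IsCompact Sh := by
    refine hSgc.image_of_continuousOn (n.rm.binv_cont.mono ?_)
    intro w hw
    obtain ⟨v, hv, hvw⟩ := hSgp w hw
    exact ⟨v, hvE v hv, hvw⟩
  have hShm : ∀ v ∈ Sh, v ∈ Ω ∨ ∃ s, sgn1 s ∧ v = e (φ ⟨s * p, 0⟩) := by
    rintro _ ⟨w, hw, rfl⟩
    obtain ⟨v, hv, rfl⟩ := hSgp w hw
    have : inv (bext Ω ψ v) = v := n.hinvl (hvE v hv)
    rw [this]; exact hv
  have hShi : ∀ v ∈ Ω, (ψ v).im = h → v ∈ Sh := by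
    intro v hv hvh
    have h1 := n.rm.bext_eq hv
    refine ⟨ψ v, ⟨ball_subset_closedBall (n.rm.mψ hv), hvh⟩, ?_⟩
    rw [← h1]; exact n.hinvl (Or.inl hv)
  -- the bad sides
  set Fc : Set ℂ := {z : ℂ | -p ≤ 1 * z.re ∧ 1 * z.re ≤ p ∧ |z.im| ≤ 1} ∩ {z : ℂ | p - 1 ≤ |z.re| ∧ |z.im| = η} with hFc
  have hFcm : ∀ z ∈ Fc, |z.re| ≤ p ∧ p - 1 ≤ |z.re| ∧ |z.im| = η := by
    rintro z ⟨⟨h1, h2, h3⟩, h4, h5⟩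
    rw [one_mul] at h1 h2
    exact ⟨abs_le.2 ⟨h1, h2⟩, h4, h5⟩
  have hFcc : IsCompact Fc := by
    refine (compact_strip s1 _ _ _).inter_right ?_
    have c1 : Continuous (fun z : ℂ => |z.re|) := by fun_prop
    have c2 : Continuous (fun z : ℂ => |z.im|) := by fun_prop
    exact (isClosed_le continuous_const c1).inter (isClosed_eq c2 continuous_const)
  set G : ℂ → ℝ := fun z => z.re * (sg * z.im) * ((bext Ω ψ (e (φ z))).im - h) with hG
  have hend : ∀ z : ℂ, |z.re| = p → ∃ s, sgn1 s ∧ z = ⟨s * p, z.im⟩ := by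
    intro z hz
    obtain ⟨s, hs, hsz⟩ := exists_sgn1 z.re
    refine ⟨s, hs, Complex.ext ?_ rfl⟩
    change z.re = s * p
    rw [← hz, ← hsz, ← mul_assoc, hs.sq, one_mul]
  have hGc : ContinuousOn G Fc := by
    have c1 : Continuous (fun z : ℂ => z.re * (sg * z.im)) := by fun_prop
    refine c1.continuousOn.mul (ContinuousOn.sub ?_ continuousOn_const)
    refine Complex.continuous_im.comp_continuousOn (n.rm.bext_cont.comp
      (t.emb.cont.comp t.hφ.continuous.continuousOn ?_) ?_)
    · intro z hz
      obtain ⟨h1, h2, h3⟩ := hFcm z hz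
      exact t.inW z h2 (by linarith) (by linarith)
    · intro z hz
      obtain ⟨h1, h2, h3⟩ := hFcm z hz
      rcases h1.lt_or_eq with h4 | h4
      · exact Or.inl (t.OM_in' n.same h2 h4 (by linarith))
      · obtain ⟨s, hs, hzs⟩ := hend z h4
        rw [hzs]
        exact Or.inr (t.bacc' n.same hs (by linarith))
  set F : Set S := φ '' (Fc ∩ G ⁻¹' Ici 0) with hF
  have hFcl : IsClosed F := by
    have h1 : IsClosed (Fc ∩ G ⁻¹' Ici 0) := hGc.preimage_isClosed_of_isClosed hFcc.isClosed isClosed_Ici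
    exact ((hFcc.of_isClosed_subset h1 inter_subset_left).image t.hφ.continuous).isClosed
  have hFY : ∀ x ∈ YY K φ p, x ∉ F := by
    rintro x hx ⟨z, ⟨hz, hzG⟩, rfl⟩
    obtain ⟨h1, h2, h3⟩ := hFcm z hz
    rcases h1.lt_or_eq with h4 | h4
    · exact t.Y_not h4 (by linarith) hx
    · obtain ⟨s, hs, hzs⟩ := hend z h4
      have hG0 : 0 ≤ G z := hzG
      have hgz : bext Ω ψ (e (φ z)) = gg k0 K e φ p ψ s z.im := by
        unfold gg; rw [← hzs]
      have hre : z.re = s * p := by rw [hzs]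
      simp only [hG] at hG0
      rw [hgz, hre] at hG0
      have him : z.im ≠ 0 := by
        intro h0; rw [h0, abs_zero] at h3; linarith
      have hsgi : sg * z.im ≠ 0 := mul_ne_zero (by rcases hsg with rfl | rfl <;> norm_num) him
      rcases lt_or_gt_of_ne hsgi with h5 | h5
      · obtain ⟨a1, a2⟩ := H2 z.im h3.le h5
        rcases hs with rfl | rfl
        · have : 0 < (1 * p * -(sg * z.im)) * ((gg k0 K e φ p ψ 1 z.im).im - h) :=
            mul_pos (mul_pos (by linarith) (by linarith)) (by linarith)
          linarith
        · have : 0 < (p * -(sg * z.im)) * (h - (gg k0 K e φ p ψ (-1) z.im).im) :=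
            mul_pos (mul_pos (by linarith) (by linarith)) (by linarith)
          linarith
      · obtain ⟨a1, a2⟩ := H1 z.im h3.le h5
        rcases hs with rfl | rfl
        · have : 0 < (1 * p * (sg * z.im)) * (h - (gg k0 K e φ p ψ 1 z.im).im) :=
            mul_pos (mul_pos (by linarith) (by linarith)) (by linarith)
          linarith
        · have : 0 < (p * (sg * z.im)) * ((gg k0 K e φ p ψ (-1) z.im).im - h) :=
            mul_pos (mul_pos (by linarith) (by linarith)) (by linarith)
          linarith
  -- the neighbourhood
  have hcR : IsCompact {z : ℂ | -(p-1/2) ≤ 1 * z.re ∧ 1 * z.re ≤ p-1/2 ∧ |z.im| ≤ 1} := compact_strip (Or.inl rfl) _ _ _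
  obtain ⟨Y1, hY1c, hY1i, hY1s⟩ := exists_compact_between t.Y_compact
    ((((t.emb.op.inter t.hU).sdiff (hcR.image t.hφ.continuous).isClosed).sdiff hFcl).inter
      ((t.emb.open_avoid hShc).union (t.emb.op.inter hTo))) (by
      intro x hx
      refine ⟨⟨⟨⟨t.YW hx, t.YU hx⟩, ?_⟩, hFY x hx⟩, ?_⟩
      · rintro ⟨z, ⟨h1, h2, h3⟩, rfl⟩
        refine t.Y_not ?_ h3 hx
        rw [one_mul] at h1 h2
        exact abs_lt.2 ⟨by linarith, by linarith⟩
      · by_cases hxS : x ≠ k0 ∧ e x ∈ Sh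
        · right
          refine ⟨t.YW hx, ?_⟩
          rcases hShm _ hxS.2 with hh | ⟨s, hs, hh⟩
          · exact absurd ⟨x, ⟨hx, hxS.1⟩, rfl⟩ (t.OMX hh)
          · rw [t.emb.inj ⟨t.YW hx, hxS.1⟩ (t.spW hs (by simp)) hh]
            refine ⟨_, ⟨?_, ?_⟩, rfl⟩
            · change |s * p| < p + 1
              rw [abs_mul, hs.abs, one_mul, abs_of_pos (by linarith)]; linarith
            · change |(0:ℝ)| < η
              simpa using hη0
        · left
          exact ⟨t.YW hx, fun hxk hxe => hxS ⟨hxk, hxe⟩⟩)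
  have hY1mid : ∀ z : ℂ, |z.im| ≤ 1 → φ z ∈ Y1 → p - 1/2 < |z.re| := by
    intro z hz hzY
    by_contra hcon
    have := abs_le.1 (not_lt.1 hcon)
    refine (hY1s hzY).1.1.2 ⟨z, ⟨?_, ?_, hz⟩, rfl⟩
    · rw [one_mul]; exact this.1
    · rw [one_mul]; exact this.2
  have hYY1 : ∀ x ∈ YY K φ p, x ∈ Y1 := fun x hx => interior_subset (hY1i hx)
  -- the cocycle
  set c : S → ℂ := Function.invFun φ with hc
  have hcφ : ∀ z, c (φ z) = z := Function.leftInverse_invFun t.hφ.injective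
  have hcc : ∀ z, ContinuousAt c (φ z) := fun z => inv_cont t.hφ z
  set i1 : S → ZMod 2 := fun x => if x ∈ Y1 then 1 else 0 with hi1
  set bT : S → ZMod 2 := fun x => if (c x).re < 0 then (if sg * (c x).im ≤ 0 ∨ x ∈ Y1 then 1 else 0)
    else (if sg * (c x).im ≤ 0 ∧ x ∉ Y1 then 1 else 0) with hbT
  set ω : S → S → ZMod 2 := fun x y => if x ∈ T ∧ y ∈ T then bT x + bT y else
    if x ∈ Zp ∧ y ∈ Zp then i1 x + i1 y else 0 with hω
  have two : ∀ a : ZMod 2, a + a = 0 := by decide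
  have hzero : ∀ (z : S) (a d : ZMod 2), (∀ᶠ x in 𝓝 z, x ∈ T → bT x = a) → (∀ᶠ x in 𝓝 z, x ∈ Zp → i1 x = d) →
      ZeroAt ω z := by
    intro z a d h1 h2
    rw [ZeroAt, eventually_prod_same_iff']
    refine ⟨_, h1.and h2, ?_⟩
    rintro x ⟨hx1, hx2⟩ y ⟨hy1, hy2⟩
    simp only [hω]
    split_ifs with h3 h4
    · rw [hx1 h3.1, hy1 h3.2, two]
    · rw [hx2 h4.1, hy2 h4.2, two]
    · rfl
  have hreneg : ∀ w : ℂ, w.re < 0 → ∀ᶠ x in 𝓝 (φ w), (c x).re < 0 := by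
    intro w hw
    have : ContinuousAt (fun x => (c x).re) (φ w) := Complex.continuous_re.continuousAt.comp (hcc w)
    exact this.eventually (gt_mem_nhds (show (c (φ w)).re < 0 by rw [hcφ]; exact hw))
  have hrepos : ∀ w : ℂ, 0 < w.re → ∀ᶠ x in 𝓝 (φ w), ¬ (c x).re < 0 := by
    intro w hw
    have : ContinuousAt (fun x => (c x).re) (φ w) := Complex.continuous_re.continuousAt.comp (hcc w)
    filter_upwards [this.eventually (lt_mem_nhds (show 0 < (c (φ w)).re by rw [hcφ]; exact hw))] with x hx
    exact not_lt.2 hx.le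
  have himc : ∀ w : ℂ, ContinuousAt (fun x => sg * (c x).im) (φ w) := fun w =>
    continuousAt_const.mul (Complex.continuous_im.continuousAt.comp (hcc w))
  have himneg : ∀ w : ℂ, sg * w.im < 0 → ∀ᶠ x in 𝓝 (φ w), sg * (c x).im ≤ 0 := by
    intro w hw
    filter_upwards [(himc w).eventually (gt_mem_nhds (show sg * (c (φ w)).im < 0 by rw [hcφ]; exact hw))] with x hx
    exact hx.le
  have himpos : ∀ w : ℂ, 0 < sg * w.im → ∀ᶠ x in 𝓝 (φ w), ¬ sg * (c x).im ≤ 0 := by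
    intro w hw
    filter_upwards [(himc w).eventually (lt_mem_nhds (show 0 < sg * (c (φ w)).im by rw [hcφ]; exact hw))] with x hx
    exact not_le.2 hx
  have hsgi : ∀ w : ℂ, w.im ≠ 0 → sg * w.im ≠ 0 := fun w hw =>
    mul_ne_zero (by rcases hsg with rfl | rfl <;> norm_num) hw
  have hvac : ∀ z ∉ Tc, ∀ a, ∀ᶠ x in 𝓝 z, x ∈ T → bT x = a := fun z hz a => by
    filter_upwards [hTout z hz] with x hx hx'
    exact absurd hx' hx
  have hA : ∀ z ∈ interior Y1, ZeroAt ω z := by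
    intro z hz
    have hnb : interior Y1 ∈ 𝓝 z := isOpen_interior.mem_nhds hz
    have h2 : ∀ᶠ x in 𝓝 z, x ∈ Zp → i1 x = 1 := by
      filter_upwards [hnb] with x hx _
      simp only [hi1, if_pos (interior_subset hx)]
    by_cases hzT : z ∈ Tc
    · obtain ⟨w, hw1, hw2, rfl⟩ := hTcm z hzT
      have hw3 := hY1mid w (by linarith) (interior_subset hz)
      have hw0 : w.re ≠ 0 := by intro h0; rw [h0, abs_zero] at hw3; linarith
      rcases lt_or_gt_of_ne hw0 with h0 | h0
      · refine hzero _ 1 1 ?_ h2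
        filter_upwards [hnb, hreneg w h0] with x hx hx2 _
        have := interior_subset hx
        simp only [hbT, if_pos hx2, this, or_true, if_true]
      · refine hzero _ 0 1 ?_ h2
        filter_upwards [hnb, hrepos w h0] with x hx hx2 _
        have := interior_subset hx
        simp only [hbT, if_neg hx2, this, not_true, and_false, if_false]
    · exact hzero _ 0 1 (hvac z hzT 0) h2
  have hB : ∀ z ∉ Y1, (∀ w : ℂ, |w.re| ≤ p + 1 → |w.im| ≤ η → φ w = z → w.im ≠ 0) → ZeroAt ω z := by
    intro z hz hzw
    have hnb : Y1ᶜ ∈ 𝓝 z := hY1c.isClosed.isOpen_compl.mem_nhds hz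
    have h2 : ∀ᶠ x in 𝓝 z, x ∈ Zp → i1 x = 0 := by
      filter_upwards [hnb] with x hx _
      simp only [hi1, if_neg hx]
    by_cases hzT : z ∈ Tc
    · obtain ⟨w, hw1, hw2, rfl⟩ := hTcm z hzT
      have hw0 := hsgi w (hzw w hw1 hw2 rfl)
      rcases lt_or_gt_of_ne hw0 with h0 | h0
      · refine hzero _ 1 0 ?_ h2
        filter_upwards [hnb, himneg w h0] with x hx hx2 _
        have hx' : x ∉ Y1 := hx
        simp only [hbT, hx2, hx', true_or, not_false_eq_true, and_self, if_true, ite_self]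
      · refine hzero _ 0 0 ?_ h2
        filter_upwards [hnb, himpos w h0] with x hx hx2 _
        have hx' : x ∉ Y1 := hx
        simp only [hbT, hx2, hx', or_self, false_and, if_false, ite_self]
    · exact hzero _ 0 0 (hvac z hzT 0) h2
  have hcoc : IsCoc ω := by
    intro z
    have hz0 : ZeroAt ω z → ∃ b : S → ZMod 2, ∀ᶠ p in 𝓝 z ×ˢ 𝓝 z, ω p.1 p.2 = b p.1 + b p.2 := by
      intro h
      refine ⟨fun _ => 0, ?_⟩
      filter_upwards [h] with p hp
      rw [hp, add_zero]
    by_cases hzT : z ∈ T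
    · refine ⟨bT, ?_⟩
      rw [eventually_prod_same_iff']
      refine ⟨T, hTo.mem_nhds hzT, ?_⟩
      intro a ha b hb
      simp only [hω, if_pos (And.intro ha hb)]
    rcases mem_int_of (Y1 := Y1) (x := z) with h1 | h1 | ⟨h1, h2⟩
    · apply hz0
      refine hB z h1 ?_
      rintro w hw1 hw2 rfl hw0
      rcases hw1.lt_or_eq with h3 | h3
      · refine hzT ⟨w, ⟨h3, ?_⟩, rfl⟩
        change |w.im| < η
        rw [hw0, abs_zero]; exact hη0
      · exact h1 (hYY1 _ (t.Y_mem (by linarith) (by linarith) (by linarith)))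
    · exact hz0 (hA z h1)
    · have hzY : z ∉ YY K φ p := fun hh => h2 (hY1i hh)
      have hzk : z ≠ k0 := by rintro rfl; exact hzY (interior_subset t.Y_int)
      have hzW : z ∈ W := (hY1s h1).1.1.1.1
      have hzF : z ∉ F := (hY1s h1).1.2
      have hzS : e z ∉ Sh := by
        rcases (hY1s h1).2 with hh | hh
        · exact hh.2 hzk
        · exact absurd hh.2 hzT
      have hw : ∀ w : ℂ, |w.re| ≤ p + 1 → |w.im| ≤ η → φ w = z → p - 1 ≤ |w.re| ∧ |w.re| < p ∧ |w.im| = η := by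
        rintro w hw1 hw2 rfl
        have h3 : |w.re| < p := by
          by_contra hcon
          exact hzY (t.Y_mem (not_lt.1 hcon) hw1 (by linarith))
        refine ⟨by linarith [hY1mid w (by linarith) h1], h3, le_antisymm hw2 ?_⟩
        by_contra hcon
        exact hzT ⟨w, ⟨by change |w.re| < p + 1; linarith, not_le.1 hcon⟩, rfl⟩
      by_cases hzΩ : e z ∈ Ω
      · have hne : (ψ (e z)).im ≠ h := fun hh => hzS (hShi _ hzΩ hh)
        have hGz : ∀ w : ℂ, |w.re| ≤ p + 1 → |w.im| ≤ η → φ w = z → w.re * (sg * w.im) * ((ψ (e z)).im - h) < 0 := by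
          rintro w hw1 hw2 rfl
          obtain ⟨a1, a2, a3⟩ := hw w hw1 hw2 rfl
          by_contra hcon
          have a4 := abs_lt.1 a2
          refine hzF ⟨w, ⟨⟨⟨by linarith, by linarith, by linarith⟩, a1, a3⟩, ?_⟩, rfl⟩
          change 0 ≤ G w
          simp only [hG]
          rw [n.rm.bext_eq hzΩ]
          exact not_lt.1 hcon
        rcases lt_or_gt_of_ne hne with hlt | hgt
        · apply hz0
          have hzn : z ∈ Zn := ⟨⟨⟨hzW, hzk⟩, hzΩ⟩, hlt⟩
          have hmiss : ∀ᶠ x in 𝓝 z, x ∈ Zp → i1 x = 0 := by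
            filter_upwards [hZno.mem_nhds hzn] with x hx hx'
            exact absurd hx.2 (not_lt.2 (le_of_lt (show h < (ψ (e x)).im from hx'.2)))
          by_cases hzTc : z ∈ Tc
          · obtain ⟨w, hw1, hw2, rfl⟩ := hTcm z hzTc
            have hg := hGz w hw1 hw2 rfl
            have hpos : 0 < w.re * (sg * w.im) := by
              by_contra hcon
              have := mul_nonneg_of_nonpos_of_nonpos (not_lt.1 hcon) (sub_nonpos.2 hlt.le)
              linarith
            rcases pos_and_pos_or_neg_and_neg_of_mul_pos hpos with ⟨a1, a2⟩ | ⟨a1, a2⟩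
            · refine hzero _ 0 0 ?_ hmiss
              filter_upwards [hrepos w a1, himpos w a2] with x hx hx2 _
              simp only [hbT, hx, hx2, false_and, if_false]
            · refine hzero _ 1 0 ?_ hmiss
              filter_upwards [hreneg w a1, himneg w a2] with x hx hx2 _
              simp only [hbT, hx, hx2, true_or, if_true]
          · exact hzero _ 0 0 (hvac z hzTc 0) hmiss
        · have hzp : z ∈ Zp := ⟨⟨⟨hzW, hzk⟩, hzΩ⟩, hgt⟩
          have hcase : ∃ a : ZMod 2, ∀ᶠ x in 𝓝 z, x ∈ T → bT x = i1 x + a := by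
            by_cases hzTc : z ∈ Tc
            · obtain ⟨w, hw1, hw2, rfl⟩ := hTcm z hzTc
              have hg := hGz w hw1 hw2 rfl
              have hneg : w.re * (sg * w.im) < 0 := by
                by_contra hcon
                have := mul_nonneg (not_lt.1 hcon) (sub_nonneg.2 (le_of_lt hgt))
                linarith
              rcases mul_neg_iff.1 hneg with ⟨a1, a2⟩ | ⟨a1, a2⟩
              · refine ⟨1, ?_⟩
                filter_upwards [hrepos w a1, himneg w a2] with x hx hx2 _
                simp only [hbT, hx, hx2, true_and, if_false, hi1]
                by_cases hxY : x ∈ Y1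
                · simp only [hxY, not_true, if_false, if_true, two]
                · simp only [hxY, not_false_eq_true, if_false, if_true, zero_add]
              · refine ⟨0, ?_⟩
                filter_upwards [hreneg w a1, himpos w a2] with x hx hx2 _
                simp only [hbT, hx, hx2, false_or, if_true, hi1, add_zero]
            · refine ⟨0, ?_⟩
              filter_upwards [hTout z hzTc] with x hx hx'
              exact absurd hx' hx
          obtain ⟨a, ha⟩ := hcase
          refine ⟨i1, ?_⟩
          rw [eventually_prod_same_iff']
          refine ⟨_, ha.and (hZpo.mem_nhds hzp), ?_⟩
          rintro x ⟨hx1, hx2⟩ y ⟨hy1, hy2⟩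
          have hx2' : x ∈ Zp := hx2
          have hy2' : y ∈ Zp := hy2
          simp only [hω]
          split_ifs with h3 h4
          · rw [hx1 h3.1, hy1 h3.2]
            have : ∀ u v a : ZMod 2, u + a + (v + a) = u + v := by decide
            exact this _ _ _
          · rfl
          · exact absurd ⟨hx2', hy2'⟩ h4
      · apply hz0
        have hmiss : ∀ᶠ x in 𝓝 z, x ∈ Zp → i1 x = 0 := by
          filter_upwards [t.Z_miss 1 hzW hzY hzΩ] with x hx hx'
          exact absurd hx'.1 hx
        have hzTc : z ∉ Tc := by
          intro hh
          obtain ⟨w, hw1, hw2, rfl⟩ := hTcm z hh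
          obtain ⟨a1, a2, a3⟩ := hw w hw1 hw2 rfl
          exact hzΩ (t.OM_in' n.same a1 a2 (by linarith))
        exact hzero _ 0 0 (hvac z hzTc 0) hmiss
  -- conclusion
  set γ : ℝ → S := fun x => φ x with hγ
  have hγc : Continuous γ := t.hφ.continuous.comp Complex.continuous_ofReal
  have hpa : |p| = p := abs_of_pos (by linarith)
  have hpe : ∀ x : ℝ, |x| = p → φ x ∈ YY K φ p := fun x hx => t.Y_mem' (by linarith) (by linarith)
  have hγU : ∀ x ∈ Icc (-p) p, γ x ∈ U := by
    intro x hx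
    refine t.inU _ ?_ (by simp)
    rw [Complex.ofReal_re]
    exact (abs_le.2 hx).trans (by linarith)
  have hγT : ∀ x ∈ Icc (-p) p, γ x ∈ T := by
    intro x hx
    refine ⟨x, ⟨?_, ?_⟩, rfl⟩
    · change |((x:ℝ):ℂ).re| < p + 1
      rw [Complex.ofReal_re]
      exact lt_of_le_of_lt (abs_le.2 hx) (by linarith)
    · change |((x:ℝ):ℂ).im| < η
      rw [Complex.ofReal_im, abs_zero]; exact hη0
  have key := good_contra hU hcoc (C := Y1 ∪ γ '' Icc (-p) p) (hY1c.union (isCompact_Icc.image hγc)) (by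
      rintro x (hx | ⟨y, hy, rfl⟩)
      · exact (hY1s hx).1.1.1.2
      · exact hγU y hy) (by
      intro z hz
      refine hB z (fun hh => hz (Or.inl hh)) ?_
      rintro w hw1 hw2 rfl hw0
      have hww : w = ((w.re : ℝ) : ℂ) := Complex.ext (by simp) (by simpa using hw0)
      rcases le_or_gt |w.re| p with h3 | h3
      · exact hz (Or.inr ⟨w.re, abs_le.1 h3, by simp only [hγ]; rw [← hww]⟩)
      · exact hz (Or.inl (hYY1 _ (t.Y_mem h3.le hw1 (by linarith)))))
    t.Y_preconn t.YU (fun z hz => hA z (hY1i hz))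
    hγc (show -p ≤ p by linarith) (b := fun x => bT (γ x)) hγU (hpe _ (by rw [abs_neg, hpa])) (hpe _ hpa) (by
      intro x hx
      filter_upwards [hγc.continuousAt.preimage_mem_nhds (hTo.mem_nhds (hγT x hx))] with y hy
      simp only [hω]
      rw [if_pos ⟨hy, hγT x hx⟩])
  have k1 : bT (γ (-p)) = 1 := by
    simp only [hbT, hγ, hcφ, Complex.ofReal_re, Complex.ofReal_im, mul_zero, le_refl, true_or, if_true]
    rw [if_pos (by linarith)]
  have k2 : bT (γ p) = 0 := by
    have hm : φ (p:ℝ) ∈ Y1 := hYY1 _ (hpe p hpa)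
    simp only [hbT, hγ, hcφ, Complex.ofReal_re, Complex.ofReal_im, mul_zero, le_refl, hm, not_true, and_false, if_false]
    rw [if_neg (by linarith)]
  rw [k1, k2] at key
  exact one_ne_zero key

theorem two_end [CompactSpace S] (hch : Charted S) (t : TE k0 K U W e φ p) (hU : GoodSet U) :
    Pl k0 (K ∪ (fun x : ℝ => φ x) '' Icc (-(p+2)) (p+2)) := by
  obtain ⟨ψ, φ', h, η, n⟩ := t.exists_nrm hch hU
  have s1 : sgn1 1 := Or.inl rfl
  have s2 : sgn1 (-1) := Or.inr rfl
  have hη0 := n.η0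
  have hle : -η ≤ η := by linarith
  have h0 : (0:ℝ) ∈ Icc (-η) η := ⟨by linarith, hη0.le⟩
  have m1 := (n.im_cont s1).strictMonoOn_of_injOn_Icc' hle (n.im_inj s1)
  have m2 := (n.im_cont s2).strictMonoOn_of_injOn_Icc' hle (n.im_inj s2)
  have e1 := n.h1
  have e2 := n.h2
  rcases m1 with m1 | m1 <;> rcases m2 with m2 | m2
  · refine n.case_same ?_
    intro τ hτ
    refine StrictMonoOn.injOn ?_
    intro y hy y' hy' hyy
    have a1 : (gg k0 K e φ p ψ 1 y).im < (gg k0 K e φ p ψ 1 y').im := m1 hy hy' hyy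
    have a2 : (gg k0 K e φ p ψ (-1) y).im < (gg k0 K e φ p ψ (-1) y').im := m2 hy hy' hyy
    obtain ⟨b1, b2⟩ := hτ
    simp only
    rcases b1.eq_or_lt with h0 | h0
    · rw [← h0]; linarith
    · nlinarith
  · refine (n.case_opp hU (sg := -1) s2 ?_ ?_).elim
    · intro y hy h5
      have hy' := abs_le.1 hy
      have a1 : (gg k0 K e φ p ψ 1 y).im < (gg k0 K e φ p ψ 1 0).im := m1 hy' h0 (by linarith)
      have a2 : (gg k0 K e φ p ψ (-1) 0).im < (gg k0 K e φ p ψ (-1) y).im := m2 hy' h0 (by linarith)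
      constructor <;> linarith
    · intro y hy h5
      have hy' := abs_le.1 hy
      have a1 : (gg k0 K e φ p ψ 1 0).im < (gg k0 K e φ p ψ 1 y).im := m1 h0 hy' (by linarith)
      have a2 : (gg k0 K e φ p ψ (-1) y).im < (gg k0 K e φ p ψ (-1) 0).im := m2 h0 hy' (by linarith)
      constructor <;> linarith
  · refine (n.case_opp hU (sg := 1) s1 ?_ ?_).elim
    · intro y hy h5
      have hy' := abs_le.1 hy
      have a1 : (gg k0 K e φ p ψ 1 y).im < (gg k0 K e φ p ψ 1 0).im := m1 h0 hy' (by linarith)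
      have a2 : (gg k0 K e φ p ψ (-1) 0).im < (gg k0 K e φ p ψ (-1) y).im := m2 h0 hy' (by linarith)
      constructor <;> linarith
    · intro y hy h5
      have hy' := abs_le.1 hy
      have a1 : (gg k0 K e φ p ψ 1 0).im < (gg k0 K e φ p ψ 1 y).im := m1 hy' h0 (by linarith)
      have a2 : (gg k0 K e φ p ψ (-1) y).im < (gg k0 K e φ p ψ (-1) 0).im := m2 hy' h0 (by linarith)
      constructor <;> linarith
  · refine n.case_same ?_
    intro τ hτ
    refine StrictAntiOn.injOn ?_
    intro y hy y' hy' hyy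
    have a1 : (gg k0 K e φ p ψ 1 y').im < (gg k0 K e φ p ψ 1 y).im := m1 hy hy' hyy
    have a2 : (gg k0 K e φ p ψ (-1) y').im < (gg k0 K e φ p ψ (-1) y).im := m2 hy hy' hyy
    obtain ⟨b1, b2⟩ := hτ
    simp only
    rcases b1.eq_or_lt with h0 | h0
    · rw [← h0]; linarith
    · nlinarith

end TE
end TwoEndC


section Squares
set_option linter.unusedSectionVars false
set_option linter.unusedVariables false
set_option linter.unusedSimpArgs false
variable {S : Type*} [TopologicalSpace S] [T2Space S]
variable {k0 : S} {K U W : Set S} {e : S → ℂ} {φ : ℂ → S}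

/-- axis-parallel linear rescaling of the plane -/
noncomputable def scaleHomeo (a b : ℝ) (ha : a ≠ 0) (hb : b ≠ 0) : ℂ ≃ₜ ℂ where
  toFun z := ⟨a * z.re, b * z.im⟩
  invFun z := ⟨a⁻¹ * z.re, b⁻¹ * z.im⟩
  left_inv z := by apply Complex.ext <;> simp [ha, hb]
  right_inv z := by apply Complex.ext <;> simp [ha, hb]
  continuous_toFun := by
    have : (fun z : ℂ => (⟨a * z.re, b * z.im⟩ : ℂ)) = fun z : ℂ => ((a * z.re : ℝ) : ℂ) + ((b * z.im : ℝ) : ℂ) * Complex.I := by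
      funext z; apply Complex.ext <;> simp
    show Continuous (fun z : ℂ => (⟨a * z.re, b * z.im⟩ : ℂ))
    rw [this]; fun_prop
  continuous_invFun := by
    have : (fun z : ℂ => (⟨a⁻¹ * z.re, b⁻¹ * z.im⟩ : ℂ)) = fun z : ℂ => ((a⁻¹ * z.re : ℝ) : ℂ) + ((b⁻¹ * z.im : ℝ) : ℂ) * Complex.I := by
      funext z; apply Complex.ext <;> simp
    show Continuous (fun z : ℂ => (⟨a⁻¹ * z.re, b⁻¹ * z.im⟩ : ℂ))
    rw [this]; fun_prop

theorem openEmb_scale (hφ : IsOpenEmbedding φ) {a b : ℝ} (ha : a ≠ 0) (hb : b ≠ 0) :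
    IsOpenEmbedding (fun z : ℂ => φ ⟨a * z.re, b * z.im⟩) :=
  hφ.comp (scaleHomeo a b ha hb).isOpenEmbedding

theorem openEmb_affine (hφ : IsOpenEmbedding φ) {u : ℂ} (hu : u ≠ 0) (v : ℂ) :
    IsOpenEmbedding (fun z : ℂ => φ (u * z + v)) :=
  hφ.comp (((Homeomorph.mulLeft₀ u hu).trans (Homeomorph.addRight v)).isOpenEmbedding)

/-- tube around a segment -/
theorem seg_tube {O : Set ℂ} (hO : IsOpen O) (L : ℝ) (h : ∀ t : ℝ, |t| ≤ L → (t : ℂ) ∈ O) :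
    ∃ d > 0, ∀ z : ℂ, |z.re| ≤ L → |z.im| ≤ d → z ∈ O := by
  have hc : IsCompact ((fun t : ℝ => (t : ℂ)) '' Icc (-L) L) := isCompact_Icc.image Complex.continuous_ofReal
  obtain ⟨d, hd, hs⟩ := hc.exists_cthickening_subset_open hO (by
    rintro _ ⟨t, ht, rfl⟩; exact h t (abs_le.2 ht))
  refine ⟨d, hd, fun z h1 h2 => hs ?_⟩
  refine mem_cthickening_of_dist_le z (z.re : ℂ) d _ ⟨z.re, abs_le.1 h1, rfl⟩ ?_
  rw [Complex.dist_eq]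
  refine (norm_le_abs _).trans ?_
  simpa using h2

/-- two-ended edge, normalised to the segment [-1,1] -/
theorem edge2 [CompactSpace S] (hch : Charted S) (hK : IsCompact K) (hKc : IsPreconnected K) (hk : k0 ∈ interior K)
    (hP : Pl k0 K) (hU : IsOpen U) (hG : GoodSet U) (hKU : K ⊆ U) (hφ : IsOpenEmbedding φ)
    (h1 : φ 1 ∈ K) (h2 : φ (-1) ∈ K) (hoff : ∀ t : ℝ, |t| < 1 → φ t ∉ K) (hin : ∀ t : ℝ, |t| ≤ 1 → φ t ∈ U) :
    Pl k0 (K ∪ (fun t : ℝ => φ t) '' Icc (-1) 1) := by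
  obtain ⟨W, e, h, hKW⟩ := hP
  have hcr : Continuous (fun t : ℝ => φ t) := hφ.continuous.comp Complex.continuous_ofReal
  have h1k : φ 1 ≠ k0 := by
    refine ne_k0_of_lim (l := 𝓝[<] (1:ℝ)) (f := fun t : ℝ => φ t) hk ?_ ?_
    · have := hcr.tendsto 1
      simp only [Complex.ofReal_one] at this
      exact this.mono_left nhdsWithin_le_nhds
    · filter_upwards [self_mem_nhdsWithin, mem_nhdsWithin_of_mem_nhds (lt_mem_nhds (show (-1:ℝ) < 1 by norm_num))] with t a b
      exact hoff t (abs_lt.2 ⟨b, a⟩)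
  have h2k : φ (-1) ≠ k0 := by
    refine ne_k0_of_lim (l := 𝓝[>] (-1:ℝ)) (f := fun t : ℝ => φ t) hk ?_ ?_
    · have := hcr.tendsto (-1)
      simp only [Complex.ofReal_neg, Complex.ofReal_one] at this
      exact this.mono_left nhdsWithin_le_nhds
    · filter_upwards [self_mem_nhdsWithin, mem_nhdsWithin_of_mem_nhds (gt_mem_nhds (show (-1:ℝ) < 1 by norm_num))] with t a b
      exact hoff t (abs_lt.2 ⟨a, b⟩)
  have hOo : IsOpen (φ ⁻¹' (W \ {k0})) := (h.op.sdiff isClosed_singleton).preimage hφ.continuous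
  have hm1 : (1:ℂ) ∈ φ ⁻¹' (W \ {k0}) := ⟨hKW h1, h1k⟩
  have hm2 : (-1:ℂ) ∈ φ ⁻¹' (W \ {k0}) := ⟨hKW h2, h2k⟩
  obtain ⟨ε1, hε1, hb1⟩ := Metric.isOpen_iff.1 hOo _ hm1
  obtain ⟨ε2, hε2, hb2⟩ := Metric.isOpen_iff.1 hOo _ hm2
  obtain ⟨ε, hε, hεa, hεb⟩ : ∃ ε > 0, ε ≤ ε1 ∧ ε ≤ ε2 := ⟨min ε1 ε2, lt_min hε1 hε2, min_le_left _ _, min_le_right _ _⟩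
  set L : ℝ := 6 / ε + 4 with hL
  have hLp : 4 < L := by have : 0 < 6/ε := by positivity
                         linarith
  have hL0 : 0 < L := by linarith
  have h3 : 3 / L < ε / 2 := by
    rw [div_lt_iff₀ hL0, hL]
    have : ε / 2 * (6/ε + 4) = 3 + 2 * ε := by field_simp; ring
    linarith
  obtain ⟨d1, hd1, ht1⟩ := seg_tube (O := φ ⁻¹' Kᶜ) (hK.isClosed.isOpen_compl.preimage hφ.continuous) (1 - 1/L) (by
    intro t ht
    refine hoff t (lt_of_le_of_lt ht ?_)
    have : 0 < 1/L := by positivity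
    linarith)
  obtain ⟨d2, hd2, ht2⟩ := seg_tube (O := φ ⁻¹' U) (hU.preimage hφ.continuous) 1 hin
  obtain ⟨d, hd, hda, hdb, hdc⟩ : ∃ d > 0, d ≤ d1 ∧ d ≤ d2 ∧ d < ε / 2 :=
    ⟨min (min d1 d2) (ε/4), lt_min (lt_min hd1 hd2) (by positivity), (min_le_left _ _).trans (min_le_left _ _),
      (min_le_left _ _).trans (min_le_right _ _), lt_of_le_of_lt (min_le_right _ _) (by linarith)⟩
  have hLi : L⁻¹ ≠ 0 := by positivity
  have habs : ∀ x : ℝ, |L⁻¹ * x| = |x| / L := by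
    intro x; rw [abs_mul, abs_of_pos (by positivity)]; field_simp
  have habd : ∀ y : ℝ, |y| ≤ 1 → |d * y| ≤ d := by
    intro y hy; rw [abs_mul, abs_of_pos hd]; nlinarith
  have te : TE k0 K U W e (fun z : ℂ => φ ⟨L⁻¹ * z.re, d * z.im⟩) (L - 2) := by
    refine ⟨h, hKW, openEmb_scale hφ hLi hd.ne', by linarith, hK, hKc, hk, hKU, hU, ?_, ?_, ?_, ?_⟩
    · intro t ht
      have ht' : |t| = L := by linarith
      rcases (abs_eq hL0.le).1 ht' with rfl | rfl
      · have : (⟨L⁻¹ * ((L:ℝ):ℂ).re, d * ((L:ℝ):ℂ).im⟩ : ℂ) = 1 := by apply Complex.ext <;> simp [hL0.ne']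
        show φ _ ∈ K
        rw [this]; exact h1
      · have : (⟨L⁻¹ * ((-L:ℝ):ℂ).re, d * ((-L:ℝ):ℂ).im⟩ : ℂ) = -1 := by apply Complex.ext <;> simp [hL0.ne']
        show φ _ ∈ K
        rw [this]; exact h2
    · intro z hz1 hz2
      refine ht1 _ ?_ ((habd _ hz2).trans hda)
      show |L⁻¹ * z.re| ≤ _
      rw [habs, div_le_iff₀ hL0]
      have : (1 - 1/L) * L = L - 1 := by field_simp
      linarith
    · intro z hz0 hz1 hz2
      have hy := habd _ hz2
      rcases le_total 0 z.re with hs | hs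
      · rw [abs_of_nonneg hs] at hz0 hz1
        refine hb1 ?_
        rw [mem_ball, Complex.dist_eq]
        refine lt_of_le_of_lt (norm_le_abs _) ?_
        have : |L⁻¹ * z.re - 1| ≤ 3 / L := by
          have : L⁻¹ * z.re - 1 = L⁻¹ * (z.re - L) := by field_simp
          rw [this, habs]
          gcongr
          rw [abs_le]; constructor <;> linarith
        simp only [Complex.sub_re, Complex.sub_im, Complex.one_re, Complex.one_im, sub_zero]
        linarith
      · rw [abs_of_nonpos hs] at hz0 hz1
        refine hb2 ?_
        rw [mem_ball, Complex.dist_eq]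
        refine lt_of_le_of_lt (norm_le_abs _) ?_
        have : |L⁻¹ * z.re - -1| ≤ 3 / L := by
          have : L⁻¹ * z.re - -1 = L⁻¹ * (z.re + L) := by field_simp; ring
          rw [this, habs]
          gcongr
          rw [abs_le]; constructor <;> linarith
        simp only [Complex.sub_re, Complex.sub_im, Complex.neg_re, Complex.neg_im, Complex.one_re, Complex.one_im, sub_zero, neg_zero]
        linarith
    · intro z hz1 hz2
      refine ht2 _ ?_ ((habd _ hz2).trans hdb)
      show |L⁻¹ * z.re| ≤ _
      rw [habs, div_le_iff₀ hL0]
      linarith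
  obtain ⟨W', e', h', hW'⟩ := te.two_end hch hG
  refine ⟨W', e', h', ?_⟩
  refine union_subset (subset_union_left.trans hW') ?_
  rintro _ ⟨t, ht, rfl⟩
  refine hW' (Or.inr ⟨L * t, ⟨by nlinarith [ht.1], by nlinarith [ht.2]⟩, ?_⟩)
  have : (⟨L⁻¹ * ((L * t : ℝ):ℂ).re, d * ((L * t : ℝ):ℂ).im⟩ : ℂ) = t := by
    apply Complex.ext
    · rw [Complex.ofReal_re, Complex.ofReal_re]; field_simp
    · rw [Complex.ofReal_im, Complex.ofReal_im]; simp
  show φ _ = φ _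
  rw [this]

/-- the standing package of hypotheses for growing a planar set -/
structure Gr {S : Type*} [TopologicalSpace S] (k0 : S) (U K : Set S) : Prop where
  hK : IsCompact K
  hKc : IsPreconnected K
  hk : k0 ∈ interior K
  hP : Pl k0 K
  KU : K ⊆ U

theorem Gr.union (g : Gr k0 U K) {B : Set S} (hB : IsCompact B) (hBc : IsPreconnected B) (hm : (K ∩ B).Nonempty)
    (hBU : B ⊆ U) (hP : Pl k0 (K ∪ B)) : Gr k0 U (K ∪ B) := by
  refine ⟨g.hK.union hB, ?_, interior_mono subset_union_left g.hk, hP, union_subset g.KU hBU⟩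
  obtain ⟨x, h1, h2⟩ := hm
  exact IsPreconnected.union x h1 h2 g.hKc hBc

/-- right edge of the standard square -/
def RE : Set ℂ := {z | z.re = 1 ∧ |z.im| ≤ 1}

theorem RE_eq : RE = (fun t : ℝ => (1 + t * Complex.I : ℂ)) '' Icc (-1) 1 := by
  ext z
  constructor
  · rintro ⟨h1, h2⟩
    exact ⟨z.im, abs_le.1 h2, by apply Complex.ext <;> simp [h1]⟩
  · rintro ⟨t, ht, rfl⟩
    exact ⟨by simp, by simpa using abs_le.2 ht⟩

/-- adding one edge of a square -/
theorem Gr.edge [CompactSpace S] (hch : Charted S) (hU : IsOpen U) (hG : GoodSet U) (g : Gr k0 U K)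
    (hφ : IsOpenEmbedding φ) (hc : φ (1 - Complex.I) ∈ K)
    (ho : (∀ z : ℂ, z.re = 1 → |z.im| < 1 → φ z ∈ K) ∨ (∀ z : ℂ, z.re = 1 → |z.im| < 1 → φ z ∉ K))
    (hin : φ '' RE ⊆ U) : Gr k0 U (K ∪ φ '' RE) := by
  have hcm : Continuous (fun t : ℝ => (1 + t * Complex.I : ℂ)) := by fun_prop
  have hREc : IsCompact RE := by rw [RE_eq]; exact isCompact_Icc.image hcm
  have hREp : IsPreconnected RE := by rw [RE_eq]; exact isPreconnected_Icc.image _ hcm.continuousOn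
  have hmR : (1 - Complex.I) ∈ RE := ⟨by simp, by simp⟩
  refine g.union (hREc.image hφ.continuous) (hREp.image _ hφ.continuous.continuousOn) ⟨_, hc, mem_image_of_mem _ hmR⟩ hin ?_
  have key : ∀ t : ℝ, |t| ≤ 1 → φ (1 + t * Complex.I) ∈ U := fun t ht => hin ⟨_, ⟨by simp, by simpa using ht⟩, rfl⟩
  rcases ho with ho | ho
  · have : φ '' RE ⊆ K := by
      rw [RE_eq, image_image]
      have hcl : IsClosed {t : ℝ | φ (1 + t * Complex.I) ∈ K} := g.hK.isClosed.preimage (hφ.continuous.comp hcm)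
      have : Icc (-1:ℝ) 1 ⊆ {t : ℝ | φ (1 + t * Complex.I) ∈ K} := by
        rw [← closure_Ioo (by norm_num)]
        refine hcl.closure_subset_iff.2 ?_
        intro t ht
        exact ho _ (by simp) (by simpa using abs_lt.2 ht)
      rintro _ ⟨t, ht, rfl⟩
      exact this ht
    rw [union_eq_self_of_subset_right this]; exact g.hP
  · by_cases h1 : φ (1 + Complex.I) ∈ K
    · have hφ' := openEmb_affine hφ Complex.I_ne_zero 1
      have := edge2 (φ := fun z => φ (Complex.I * z + 1)) hch g.hK g.hKc g.hk g.hP hU hG g.KU hφ' (by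
        convert h1 using 2; ring) (by convert hc using 2; ring) (by
          intro t ht
          exact ho _ (by simp) (by simpa using ht)) (by
          intro t ht
          exact hin ⟨_, ⟨by simp, by simpa using ht⟩, rfl⟩)
      convert this using 2
      rw [RE_eq, image_image]
      refine image_congr fun t _ => ?_
      congr 1; ring
    · have hφ' := openEmb_affine hφ (u := 2 * Complex.I) (by simp) (1 - Complex.I)
      have := edge1 (φ := fun z => φ (2 * Complex.I * z + (1 - Complex.I))) g.hK.isClosed g.hk g.hP hφ' (by
        simpa using hc) (by
          intro t ht ht1
          rcases ht1.eq_or_lt with rfl | ht1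
          · convert h1 using 3; push_cast; ring
          · refine ho _ (by simp) ?_
            simp; rw [abs_lt]; constructor <;> linarith)
      convert this using 2
      rw [RE_eq, image_image]
      ext x
      constructor
      · rintro ⟨t, ht, rfl⟩
        refine ⟨(t+1)/2, ⟨by linarith [ht.1], by linarith [ht.2]⟩, ?_⟩
        simp only
        congr 1; push_cast; ring
      · rintro ⟨t, ht, rfl⟩
        refine ⟨2*t-1, ⟨by linarith [ht.1], by linarith [ht.2]⟩, ?_⟩
        simp only
        congr 1; push_cast; ring

/-- the fourth roots of unity -/
def U4 (u : ℂ) : Prop := u = 1 ∨ u = Complex.I ∨ u = -1 ∨ u = -Complex.I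

/-- the standard closed box -/
def Bx (r : ℝ) : Set ℂ := {z | |z.re| ≤ r ∧ |z.im| ≤ r}

theorem Bx_eq (r : ℝ) : Bx r = Icc (-r) r ×ℂ Icc (-r) r := by
  ext z; simp [Bx, Complex.mem_reProdIm, abs_le]

theorem Bx_compact (r : ℝ) : IsCompact (Bx r) := by rw [Bx_eq]; exact isCompact_Icc.reProdIm isCompact_Icc

theorem Bx_convex (r : ℝ) : Convex ℝ (Bx r) := by
  rw [Bx_eq]
  intro x hx y hy a b ha hb hab
  rw [Complex.mem_reProdIm] at hx hy ⊢
  have h1 := convex_Icc (-r) r hx.1 hy.1 ha hb hab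
  have h2 := convex_Icc (-r) r hx.2 hy.2 ha hb hab
  constructor
  · simpa using h1
  · simpa using h2

theorem Bx_interior {z : ℂ} {r : ℝ} (hz : z ∈ interior (Bx r)) : |z.re| < r ∧ |z.im| < r := by
  rw [Bx_eq, Complex.interior_reProdIm, interior_Icc, Complex.mem_reProdIm] at hz
  exact ⟨abs_lt.2 hz.1, abs_lt.2 hz.2⟩

theorem Bx_open {r : ℝ} : {z : ℂ | |z.re| < r ∧ |z.im| < r} ⊆ interior (Bx r) := by
  rintro z ⟨h1, h2⟩
  rw [Bx_eq, Complex.interior_reProdIm, interior_Icc, Complex.mem_reProdIm]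
  exact ⟨abs_lt.1 h1, abs_lt.1 h2⟩

/-- adding a square, starting from the corner `1 - I` -/
theorem Gr.square0 [CompactSpace S] (hch : Charted S) (hU : IsOpen U) (hG : GoodSet U) (g : Gr k0 U K)
    (hφ : IsOpenEmbedding φ) (hc : φ (1 - Complex.I) ∈ K)
    (hintq : ∀ z : ℂ, |z.re| < 1 → |z.im| < 1 → φ z ∉ K)
    (ho : ∀ u, U4 u → (∀ z : ℂ, z.re = 1 → |z.im| < 1 → φ (u * z) ∈ K) ∨ (∀ z : ℂ, z.re = 1 → |z.im| < 1 → φ (u * z) ∉ K))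
    (hin : φ '' Bx 1 ⊆ U) : Gr k0 U (K ∪ φ '' Bx 1) := by
  have hinj := hφ.injective
  have hREi : ∀ u, U4 u → (fun z => φ (u * z)) '' RE ⊆ U := by
    rintro u hu _ ⟨z, ⟨h1, h2⟩, rfl⟩
    refine hin ⟨_, ?_, rfl⟩
    rcases hu with rfl | rfl | rfl | rfl <;> simp [Bx, h1, h2]
  have hem : ∀ u, U4 u → IsOpenEmbedding (fun z => φ (u * z)) := by
    intro u hu
    have := openEmb_affine hφ (u := u) (by rcases hu with rfl | rfl | rfl | rfl <;> simp) 0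
    simpa using this
  have a1 : U4 1 := Or.inl rfl
  have a2 : U4 Complex.I := Or.inr (Or.inl rfl)
  have a3 : U4 (-1) := Or.inr (Or.inr (Or.inl rfl))
  have a4 : U4 (-Complex.I) := Or.inr (Or.inr (Or.inr rfl))
  have aux : ∀ (u v : ℂ), U4 u → U4 v → u ≠ v → ∀ z : ℂ, z.re = 1 → |z.im| < 1 → φ (u * z) ∉ (fun z => φ (v * z)) '' RE := by
    rintro u v hu hv huv z h1 h2 ⟨w, ⟨h3, h4⟩, h5⟩
    have h6 := hinj h5
    have e1 := congrArg Complex.re h6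
    have e2 := congrArg Complex.im h6
    rw [abs_lt] at h2
    rw [abs_le] at h4
    rcases hu with rfl | rfl | rfl | rfl <;> rcases hv with rfl | rfl | rfl | rfl <;>
      first
      | exact huv rfl
      | (simp [h1, h3] at e1 e2; linarith)
  have aux2 : ∀ (L : Set S) (u v : ℂ), U4 u → U4 v → u ≠ v →
      ((∀ z : ℂ, z.re = 1 → |z.im| < 1 → φ (u * z) ∈ L) ∨ (∀ z : ℂ, z.re = 1 → |z.im| < 1 → φ (u * z) ∉ L)) →
      ((∀ z : ℂ, z.re = 1 → |z.im| < 1 → φ (u * z) ∈ L ∪ (fun z => φ (v * z)) '' RE) ∨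
       (∀ z : ℂ, z.re = 1 → |z.im| < 1 → φ (u * z) ∉ L ∪ (fun z => φ (v * z)) '' RE)) := by
    intro L u v hu hv huv h
    rcases h with h | h
    · exact Or.inl fun z h1 h2 => Or.inl (h z h1 h2)
    · refine Or.inr fun z h1 h2 => ?_
      rintro (h3 | h3)
      · exact h z h1 h2 h3
      · exact aux u v hu hv huv z h1 h2 h3
  have hcor : ∀ v, U4 v → φ (v * (1 + Complex.I)) ∈ (fun z => φ (v * z)) '' RE := fun v _ =>
    ⟨1 + Complex.I, ⟨by simp, by simp⟩, rfl⟩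
  have n12 : Complex.I ≠ 1 := fun h => by simpa using congrArg Complex.re h
  have n13 : (-1:ℂ) ≠ 1 := fun h => by have := congrArg Complex.re h; norm_num at this
  have n23 : (-1:ℂ) ≠ Complex.I := fun h => by simpa using congrArg Complex.re h
  have n14 : -Complex.I ≠ 1 := fun h => by simpa using congrArg Complex.re h
  have n24 : -Complex.I ≠ Complex.I := fun h => by have := congrArg Complex.im h; norm_num at this
  have n34 : -Complex.I ≠ -1 := fun h => by simpa using congrArg Complex.re h
  have g1 := g.edge hch hU hG (hem 1 a1) (by simpa using hc) (ho 1 a1) (hREi 1 a1)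
  have g2 := g1.edge hch hU hG (hem _ a2) (Or.inr (by
    have := hcor 1 a1
    convert this using 2
    apply Complex.ext <;> simp)) (aux2 _ _ _ a2 a1 n12 (ho _ a2)) (hREi _ a2)
  have g3 := g2.edge hch hU hG (hem _ a3) (Or.inr (by
    have := hcor _ a2
    convert this using 2
    apply Complex.ext <;> simp)) (aux2 _ _ _ a3 a2 n23 (aux2 _ _ _ a3 a1 n13 (ho _ a3))) (hREi _ a3)
  have g4 := g3.edge hch hU hG (hem _ a4) (Or.inr (by
    have := hcor _ a3
    convert this using 2
    apply Complex.ext <;> simp)) (aux2 _ _ _ a4 a3 n34 (aux2 _ _ _ a4 a2 n24 (aux2 _ _ _ a4 a1 n14 (ho _ a4)))) (hREi _ a4)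
  set K4 : Set S := K ∪ (fun z => φ (1 * z)) '' RE ∪ (fun z => φ (Complex.I * z)) '' RE ∪ (fun z => φ (-1 * z)) '' RE
    ∪ (fun z => φ (-Complex.I * z)) '' RE with hK4
  have hfr : ∀ z ∈ frontier (Bx 1), φ z ∈ K4 := by
    intro z hz
    have hz1 : z ∈ Bx 1 := (Bx_compact 1).isClosed.frontier_subset hz
    have hz2 : ¬ (|z.re| < 1 ∧ |z.im| < 1) := fun h => hz.2 (Bx_open h)
    obtain ⟨b1, b2⟩ := hz1
    by_cases c1 : |z.re| < 1
    · have c2 : |z.im| = 1 := le_antisymm b2 (not_lt.1 fun h => hz2 ⟨c1, h⟩)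
      rcases (abs_eq zero_le_one).1 c2 with c2 | c2
      · refine Or.inl (Or.inl (Or.inr ⟨-Complex.I * z, ⟨by simp [c2], by simpa using b1⟩, ?_⟩))
        show φ _ = φ _
        congr 1; apply Complex.ext <;> simp
      · refine Or.inr ⟨Complex.I * z, ⟨by simp [c2], by simpa using b1⟩, ?_⟩
        show φ _ = φ _
        congr 1; apply Complex.ext <;> simp
    · have c2 : |z.re| = 1 := le_antisymm b1 (not_lt.1 c1)
      rcases (abs_eq zero_le_one).1 c2 with c2 | c2
      · refine Or.inl (Or.inl (Or.inl (Or.inr ⟨z, ⟨by simp [c2], by simpa using b2⟩, ?_⟩)))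
        show φ _ = φ _
        congr 1; apply Complex.ext <;> simp
      · refine Or.inl (Or.inr ⟨-z, ⟨by simp [c2], by simpa using b2⟩, ?_⟩)
        show φ _ = φ _
        congr 1; apply Complex.ext <;> simp
  have hint4 : ∀ z ∈ interior (Bx 1), φ z ∉ K4 := by
    intro z hz
    obtain ⟨b1, b2⟩ := Bx_interior hz
    have : ∀ u, U4 u → φ z ∉ (fun z => φ (u * z)) '' RE := by
      rintro u hu ⟨w, ⟨h3, h4⟩, h5⟩
      have h6 := hinj h5
      have e1 := congrArg Complex.re h6
      have e2 := congrArg Complex.im h6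
      rw [abs_lt] at b1 b2
      rcases hu with rfl | rfl | rfl | rfl <;> (simp [h3] at e1 e2; linarith)
    rintro ((((h | h) | h) | h) | h)
    · exact hintq z b1 b2 h
    · exact this _ a1 h
    · exact this _ a2 h
    · exact this _ a3 h
    · exact this _ a4 h
  have hne : (interior (Bx 1)).Nonempty := ⟨0, Bx_open (by simp)⟩
  obtain ⟨Hh, H1, H2, H3⟩ := exists_homeomorph_image_interior_closure_frontier_eq_unitBall (Bx_convex 1) hne (Bx_compact 1).isBounded
  rw [(Bx_compact 1).isClosed.closure_eq] at H2
  have hpl : Pl k0 (K4 ∪ (φ ∘ Hh.symm) '' closedBall 0 1) := by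
    refine face hch g4.hK g4.hKc g4.hk g4.hP (hφ.comp Hh.symm.isOpenEmbedding) ?_ ?_
    · intro z hz
      have : z ∈ Hh '' frontier (Bx 1) := by rw [H3]; simpa using hz
      obtain ⟨w, hw, rfl⟩ := this
      simpa using hfr w hw
    · intro z hz
      have : z ∈ Hh '' interior (Bx 1) := by rw [H1]; simpa using hz
      obtain ⟨w, hw, rfl⟩ := this
      simpa using hint4 w hw
  have himg : (φ ∘ Hh.symm) '' closedBall 0 1 = φ '' Bx 1 := by
    rw [← H2, image_image]
    exact image_congr fun z _ => by simp
  rw [himg] at hpl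
  refine g.union ((Bx_compact 1).image hφ.continuous) ((Bx_convex 1).isPreconnected.image _ hφ.continuous.continuousOn)
    ⟨_, hc, ⟨_, ⟨by simp, by simp⟩, rfl⟩⟩ hin ?_
  obtain ⟨W, e, h, hW⟩ := hpl
  refine ⟨W, e, h, union_subset (fun x hx => hW (Or.inl ?_)) (subset_union_right.trans hW)⟩
  exact Or.inl (Or.inl (Or.inl (Or.inl hx)))

/-- adding a square from any corner -/
theorem Gr.square [CompactSpace S] (hch : Charted S) (hU : IsOpen U) (hG : GoodSet U) (g : Gr k0 U K)
    (hφ : IsOpenEmbedding φ) (hc : ∃ u, U4 u ∧ φ (u * (1 - Complex.I)) ∈ K)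
    (hintq : ∀ z : ℂ, |z.re| < 1 → |z.im| < 1 → φ z ∉ K)
    (ho : ∀ u, U4 u → (∀ z : ℂ, z.re = 1 → |z.im| < 1 → φ (u * z) ∈ K) ∨ (∀ z : ℂ, z.re = 1 → |z.im| < 1 → φ (u * z) ∉ K))
    (hin : φ '' Bx 1 ⊆ U) : Gr k0 U (K ∪ φ '' Bx 1) := by
  obtain ⟨u, hu, hc⟩ := hc
  have hu0 : u ≠ 0 := by rcases hu with rfl | rfl | rfl | rfl <;> simp
  have himg : (fun z => φ (u * z)) '' Bx 1 = φ '' Bx 1 := by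
    have : (fun z => u * z) '' Bx 1 = Bx 1 := by
      ext z
      constructor
      · rintro ⟨w, ⟨h1, h2⟩, rfl⟩
        rcases hu with rfl | rfl | rfl | rfl <;> simp [Bx, h1, h2]
      · rintro ⟨h1, h2⟩
        refine ⟨u⁻¹ * z, ?_, by field_simp⟩
        rcases hu with rfl | rfl | rfl | rfl <;> simp [Bx, h1, h2, inv_neg, Complex.inv_I]
    conv_rhs => rw [← this, image_image]
  have := Gr.square0 (φ := fun z => φ (u * z)) hch hU hG g (by simpa using openEmb_affine hφ hu0 0) hc (by
    intro z h1 h2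
    refine hintq _ ?_ ?_ <;> rcases hu with rfl | rfl | rfl | rfl <;> simp [h1, h2]) (by
    intro v hv
    have huv : U4 (u * v) := by
      have II := Complex.I_mul_I
      rcases hu with rfl | rfl | rfl | rfl <;> rcases hv with rfl | rfl | rfl | rfl <;> simp [U4]
    have := ho _ huv
    simpa only [mul_assoc] using this) (by rw [himg]; exact hin)
  rw [himg] at this
  exact this

end Squares


section Growing
set_option linter.unusedSectionVars false
set_option linter.unusedVariables false
set_option linter.unusedSimpArgs false

/-- growing a finite family of closed sets covering a connected set -/
theorem grow {X ι : Type*} [TopologicalSpace X] [DecidableEq ι] (t : Finset ι) (F : ι → Set X)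
    (hF : ∀ i ∈ t, IsClosed (F i)) {Z : Set X} (hZ : IsPreconnected Z) (hc : Z ⊆ ⋃ i ∈ t, F i)
    (hn : ∀ i ∈ t, (Z ∩ F i).Nonempty) (P : Finset ι → Prop) (T0 : Finset ι) (hT0 : T0 ⊆ t) (hT0n : T0.Nonempty)
    (h0 : P T0)
    (step : ∀ T, T0 ⊆ T → T ⊆ t → P T → ∀ i ∈ t, i ∉ T → ∀ j ∈ T, (F i ∩ F j).Nonempty → P (insert i T)) : P t := by
  classical
  obtain ⟨T, hT, hmax⟩ := Finset.exists_max_image (t.powerset.filter (fun T => T0 ⊆ T ∧ P T)) Finset.card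
    ⟨T0, by simp [hT0, h0]⟩
  simp only [Finset.mem_filter, Finset.mem_powerset] at hT hmax
  obtain ⟨h1, h2, h3⟩ := hT
  by_cases hTt : t ⊆ T
  · rw [Finset.Subset.antisymm hTt h1]; exact h3
  exfalso
  obtain ⟨i0, hi0, hi0T⟩ := Finset.not_subset.1 hTt
  obtain ⟨j0, hj0⟩ := hT0n
  have c1 : IsClosed (⋃ i ∈ T, F i) := T.finite_toSet.isClosed_biUnion fun i hi => hF i (h1 hi)
  have c2 : IsClosed (⋃ i ∈ t \ T, F i) := (t \ T).finite_toSet.isClosed_biUnion fun i hi => hF i (Finset.mem_sdiff.1 hi).1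
  have hcov : Z ⊆ (⋃ i ∈ T, F i) ∪ (⋃ i ∈ t \ T, F i) := by
    intro x hx
    obtain ⟨i, hi, hxi⟩ := mem_iUnion₂.1 (hc hx)
    by_cases hiT : i ∈ T
    · exact Or.inl (mem_iUnion₂.2 ⟨i, hiT, hxi⟩)
    · exact Or.inr (mem_iUnion₂.2 ⟨i, Finset.mem_sdiff.2 ⟨hi, hiT⟩, hxi⟩)
  obtain ⟨x, hx, hx1, hx2⟩ := isPreconnected_closed_iff.1 hZ _ _ c1 c2 hcov (by
    obtain ⟨x, a, b⟩ := hn j0 (hT0 hj0)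
    exact ⟨x, a, mem_iUnion₂.2 ⟨j0, h2 hj0, b⟩⟩) (by
    obtain ⟨x, a, b⟩ := hn i0 hi0
    exact ⟨x, a, mem_iUnion₂.2 ⟨i0, Finset.mem_sdiff.2 ⟨hi0, hi0T⟩, b⟩⟩)
  obtain ⟨j, hj, hxj⟩ := mem_iUnion₂.1 hx1
  obtain ⟨i, hi, hxi⟩ := mem_iUnion₂.1 hx2
  obtain ⟨hi1, hi2⟩ := Finset.mem_sdiff.1 hi
  have hp := step T h2 h1 h3 i hi1 hi2 j hj ⟨x, hxi, hxj⟩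
  have := hmax (insert i T) ⟨Finset.insert_subset hi1 h1, h2.trans (Finset.subset_insert _ _), hp⟩
  rw [Finset.card_insert_of_notMem hi2] at this
  omega

variable {S : Type*} [TopologicalSpace S] [T2Space S]
variable {k0 : S} {K U W : Set S} {e : S → ℂ} {φ : ℂ → S}

/-- grid squares of side two centred at even integer points -/
def Qg (q : ℤ × ℤ) : Set ℂ := {z | |z.re - 2 * q.1| ≤ 1 ∧ |z.im - 2 * q.2| ≤ 1}

theorem Qg_eq (q : ℤ × ℤ) : Qg q = (fun z => 1 * z + (⟨2 * q.1, 2 * q.2⟩ : ℂ)) '' Bx 1 := by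
  ext z
  constructor
  · rintro ⟨h1, h2⟩
    exact ⟨z - ⟨2 * q.1, 2 * q.2⟩, ⟨by simpa using h1, by simpa using h2⟩, by simp⟩
  · rintro ⟨w, ⟨h1, h2⟩, rfl⟩
    exact ⟨by simpa using h1, by simpa using h2⟩

theorem Qg_compact (q : ℤ × ℤ) : IsCompact (Qg q) := by
  rw [Qg_eq]; exact (Bx_compact 1).image (by fun_prop)

theorem Qg_preconn (q : ℤ × ℤ) : IsPreconnected (Qg q) := by
  rw [Qg_eq]; exact (Bx_convex 1).isPreconnected.image _ (by fun_prop)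

theorem cover1 (n : ℕ) (x : ℝ) (hx : |x| ≤ 2 * n + 1) : ∃ a : ℤ, -(n:ℤ) ≤ a ∧ a ≤ n ∧ |x - 2 * a| ≤ 1 := by
  have h := abs_le.1 (abs_sub_round (x/2))
  have hx' := abs_le.1 hx
  rcases lt_or_ge (n:ℤ) (round (x/2)) with h1 | h1
  · refine ⟨n, by omega, le_refl _, ?_⟩
    have h2 : ((n:ℤ):ℝ) + 1 ≤ (round (x/2) : ℝ) := by exact_mod_cast h1
    push_cast at h2 ⊢
    rw [abs_le]; constructor <;> linarith [h.1, h.2]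
  · rcases lt_or_ge (round (x/2)) (-(n:ℤ)) with h3 | h3
    · refine ⟨-n, le_refl _, by omega, ?_⟩
      have h2 : (round (x/2) : ℝ) + 1 ≤ ((-(n:ℤ) : ℤ):ℝ) := by exact_mod_cast h3
      push_cast at h2 ⊢
      rw [abs_le]; constructor <;> linarith [h.1, h.2]
    · exact ⟨round (x/2), h3, h1, by rw [abs_le]; constructor <;> linarith [h.1, h.2]⟩

theorem int_eq {a b : ℤ} {x : ℝ} (hx : |x| < 1) (h : |x + 2 * a - 2 * b| ≤ 1) : a = b := by
  rw [abs_lt] at hx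
  rw [abs_le] at h
  have h1 : (a:ℝ) < b + 1 := by linarith
  have h2 : (b:ℝ) < a + 1 := by linarith
  have h1' : a < b + 1 := by exact_mod_cast h1
  have h2' : b < a + 1 := by exact_mod_cast h2
  omega

theorem int_corner {a b : ℤ} {x : ℝ} (hx : |x - 2 * a| ≤ 1) (h : |x - 2 * b| ≤ 1) :
    |(1:ℝ) + 2 * a - 2 * b| ≤ 1 ∨ |(-1:ℝ) + 2 * a - 2 * b| ≤ 1 := by
  rw [abs_le] at hx h
  rcases le_or_gt a b with hab | hab
  · left
    have h1 : (a:ℝ) ≤ b := by exact_mod_cast hab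
    rw [abs_le]; constructor
    · linarith
    · linarith
  · right
    have h1 : (b:ℝ) + 1 ≤ a := by exact_mod_cast hab
    rw [abs_le]; constructor
    · linarith
    · linarith

theorem Gr.grid [CompactSpace S] (hch : Charted S) (hU : IsOpen U) (hG : GoodSet U) (g : Gr k0 U K)
    (hem : Emb k0 W e) (hKW : K ⊆ W) (hφ : IsOpenEmbedding φ) (n : ℕ) (hin : φ '' Bx (2 * n + 1) ⊆ U)
    (hm : (K ∩ φ '' Bx (2 * n + 1)).Nonempty)
    (hsm : ∀ q : ℤ × ℤ, (-(n:ℤ) ≤ q.1 ∧ q.1 ≤ n) ∧ (-(n:ℤ) ≤ q.2 ∧ q.2 ≤ n) → (φ '' Qg q ∩ K).Nonempty → φ '' Qg q ⊆ W) :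
    Gr k0 U (K ∪ φ '' Bx (2 * n + 1)) := by
  classical
  set t : Finset (ℤ × ℤ) := Finset.Icc (-(n:ℤ)) n ×ˢ Finset.Icc (-(n:ℤ)) n with ht
  have htm : ∀ q, q ∈ t ↔ (-(n:ℤ) ≤ q.1 ∧ q.1 ≤ n) ∧ (-(n:ℤ) ≤ q.2 ∧ q.2 ≤ n) := by
    intro q; simp [ht]
  have hQB : ∀ q ∈ t, Qg q ⊆ Bx (2 * n + 1) := by
    intro q hq z hz
    obtain ⟨⟨a1, a2⟩, ⟨a3, a4⟩⟩ := (htm q).1 hq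
    have b1 : (-(n:ℝ)) ≤ q.1 := by exact_mod_cast a1
    have b2 : (q.1:ℝ) ≤ n := by exact_mod_cast a2
    have b3 : (-(n:ℝ)) ≤ q.2 := by exact_mod_cast a3
    have b4 : (q.2:ℝ) ≤ n := by exact_mod_cast a4
    obtain ⟨h1, h2⟩ := hz
    rw [abs_le] at h1 h2
    constructor <;> rw [abs_le] <;> constructor <;> linarith
  have hcov : Bx (2 * n + 1) ⊆ ⋃ q ∈ t, Qg q := by
    intro z hz
    obtain ⟨a, a1, a2, a3⟩ := cover1 n z.re hz.1
    obtain ⟨b, b1, b2, b3⟩ := cover1 n z.im hz.2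
    exact mem_iUnion₂.2 ⟨(a, b), (htm _).2 ⟨⟨a1, a2⟩, ⟨b1, b2⟩⟩, a3, b3⟩
  set T0 := t.filter (fun q => (φ '' Qg q ∩ K).Nonempty) with hT0
  have hBeq : K ∪ ⋃ q ∈ t, φ '' Qg q = K ∪ φ '' Bx (2 * n + 1) := by
    congr 1
    refine Subset.antisymm (iUnion₂_subset fun q hq => image_mono (hQB q hq)) ?_
    rintro _ ⟨z, hz, rfl⟩
    obtain ⟨q, hq, hz⟩ := mem_iUnion₂.1 (hcov hz)
    exact mem_iUnion₂.2 ⟨q, hq, mem_image_of_mem _ hz⟩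
  have hcomm : ∀ (i : ℤ × ℤ) (T : Finset (ℤ × ℤ)), K ∪ ⋃ q ∈ insert i T, φ '' Qg q = (K ∪ ⋃ q ∈ T, φ '' Qg q) ∪ φ '' Qg i := by
    intro i T
    rw [Finset.set_biUnion_insert, union_assoc, union_comm (φ '' Qg i)]
  have hcpt : ∀ q, IsCompact (φ '' Qg q) := fun q => (Qg_compact q).image hφ.continuous
  have hpre : ∀ q, IsPreconnected (φ '' Qg q) := fun q => (Qg_preconn q).image _ hφ.continuous.continuousOn
  have hQU : ∀ q ∈ t, φ '' Qg q ⊆ U := fun q hq => (image_mono (hQB q hq)).trans hin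
  rw [← hBeq]
  refine grow t Qg (fun q _ => (Qg_compact q).isClosed) (Bx_convex (2 * n + 1)).isPreconnected hcov ?_
    (fun T => Gr k0 U (K ∪ ⋃ q ∈ T, φ '' Qg q)) T0 (Finset.filter_subset _ _) ?_ ?_ ?_
  · intro q hq
    have : (⟨2 * q.1, 2 * q.2⟩ : ℂ) ∈ Qg q := ⟨by simp, by simp⟩
    exact ⟨_, hQB q hq this, this⟩
  · obtain ⟨x, hx, z, hz, rfl⟩ := hm
    obtain ⟨q, hq, hz⟩ := mem_iUnion₂.1 (hcov hz)
    exact ⟨q, Finset.mem_filter.2 ⟨hq, _, mem_image_of_mem _ hz, hx⟩⟩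
  · have : ∀ T : Finset (ℤ × ℤ), T ⊆ T0 → Gr k0 U (K ∪ ⋃ q ∈ T, φ '' Qg q) ∧ (K ∪ ⋃ q ∈ T, φ '' Qg q) ⊆ W := by
      intro T
      induction T using Finset.induction_on with
      | empty => intro _; simpa using ⟨g, hKW⟩
      | insert i T hi ih =>
        intro hT
        obtain ⟨h1, h2⟩ := ih ((Finset.subset_insert _ _).trans hT)
        obtain ⟨hit, hiK⟩ := Finset.mem_filter.1 (hT (Finset.mem_insert_self _ _))
        have hiW := hsm i ((htm i).1 hit) hiK
        have hW := union_subset h2 hiW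
        rw [hcomm]
        refine ⟨h1.union (hcpt i) (hpre i) ?_ (hQU i hit) ⟨W, e, hem, hW⟩, hW⟩
        obtain ⟨x, a, b⟩ := hiK
        exact ⟨x, Or.inl b, a⟩
    exact (this T0 (Finset.Subset.refl _)).1
  · intro T hT0T hTt gT i hit hiT j hjT hij
    rw [hcomm]
    set KT : Set S := K ∪ ⋃ q ∈ T, φ '' Qg q with hKT
    have himg : φ '' Qg i = (fun z => φ (1 * z + (⟨2 * i.1, 2 * i.2⟩ : ℂ))) '' Bx 1 := by rw [Qg_eq, image_image]
    have hmem : ∀ z ∈ Bx 1, φ (1 * z + (⟨2 * i.1, 2 * i.2⟩ : ℂ)) ∈ KT ↔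
        ∃ q ∈ T, |z.re + 2 * i.1 - 2 * q.1| ≤ 1 ∧ |z.im + 2 * i.2 - 2 * q.2| ≤ 1 := by
      intro z hz
      constructor
      · rintro (h | h)
        · exfalso
          refine hiT (hT0T (Finset.mem_filter.2 ⟨hit, _, ?_, h⟩))
          rw [himg]; exact ⟨z, hz, rfl⟩
        · obtain ⟨q, hq, w, hw, hwz⟩ := mem_iUnion₂.1 h
          have := hφ.injective hwz
          rw [this] at hw
          refine ⟨q, hq, ?_⟩
          simpa [Qg] using hw
      · rintro ⟨q, hq, h⟩
        refine Or.inr (mem_iUnion₂.2 ⟨q, hq, _, ?_, rfl⟩)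
        simpa [Qg] using h
    rw [himg]
    refine gT.square hch hU hG (openEmb_affine hφ one_ne_zero _) ?_ ?_ ?_ (by rw [← himg]; exact hQU i hit)
    · obtain ⟨w, ⟨w1, w2⟩, ⟨w3, w4⟩⟩ := hij
      rcases int_corner w1 w3 with c1 | c1 <;> rcases int_corner w2 w4 with c2 | c2
      · refine ⟨Complex.I, Or.inr (Or.inl rfl), (hmem _ ?_).2 ⟨j, hjT, ?_⟩⟩
        · constructor <;> simp
        · constructor <;> simpa using ‹_›
      · refine ⟨1, Or.inl rfl, (hmem _ ?_).2 ⟨j, hjT, ?_⟩⟩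
        · constructor <;> simp
        · constructor <;> simpa using ‹_›
      · refine ⟨-1, Or.inr (Or.inr (Or.inl rfl)), (hmem _ ?_).2 ⟨j, hjT, ?_⟩⟩
        · constructor <;> simp
        · constructor <;> simpa using ‹_›
      · refine ⟨-Complex.I, Or.inr (Or.inr (Or.inr rfl)), (hmem _ ?_).2 ⟨j, hjT, ?_⟩⟩
        · constructor <;> simp
        · constructor <;> simpa using ‹_›
    · intro z h1 h2 h3
      obtain ⟨q, hq, q1, q2⟩ := (hmem z ⟨h1.le, h2.le⟩).1 h3
      have : i = q := Prod.ext (int_eq h1 q1) (int_eq h2 q2)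
      exact hiT (this ▸ hq)
    · intro u hu
      have hb : ∀ z : ℂ, z.re = 1 → |z.im| < 1 → u * z ∈ Bx 1 := by
        intro z h1 h2
        rcases hu with rfl | rfl | rfl | rfl <;> simp [Bx, h1, h2.le]
      by_cases hex : ∃ z : ℂ, z.re = 1 ∧ |z.im| < 1 ∧ φ (1 * (u * z) + (⟨2 * i.1, 2 * i.2⟩ : ℂ)) ∈ KT
      · left
        obtain ⟨z, h1, h2, h3⟩ := hex
        obtain ⟨q, hq, q1, q2⟩ := (hmem _ (hb z h1 h2)).1 h3
        intro w w1 w2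
        refine (hmem _ (hb w w1 w2)).2 ⟨q, hq, ?_⟩
        have h2n : |-z.im| < 1 := by rwa [abs_neg]
        have w2n : |-w.im| < 1 := by rwa [abs_neg]
        rcases hu with rfl | rfl | rfl | rfl
        · simp [h1, w1] at q1 q2 ⊢
          rw [int_eq h2 q2]
          exact ⟨q1, by simpa using w2.le⟩
        · simp [h1, w1] at q1 q2 ⊢
          rw [int_eq h2n q1]
          exact ⟨by simpa using w2.le, q2⟩
        · simp [h1, w1] at q1 q2 ⊢
          rw [int_eq h2n q2]
          exact ⟨q1, by simpa using w2.le⟩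
        · simp [h1, w1] at q1 q2 ⊢
          rw [int_eq h2 q1]
          exact ⟨by simpa using w2.le, q2⟩
      · right
        intro z h1 h2 h3
        exact hex ⟨z, h1, h2, h3⟩

theorem Gr.box [CompactSpace S] (hch : Charted S) (hU : IsOpen U) (hG : GoodSet U) (g : Gr k0 U K)
    (hφ : IsOpenEmbedding φ) (hin : φ '' Bx 1 ⊆ U) (hm : (K ∩ φ '' Bx 1).Nonempty) : Gr k0 U (K ∪ φ '' Bx 1) := by
  obtain ⟨W, e, hem, hKW⟩ := g.hP
  have hC : IsCompact (Bx 1 ∩ φ ⁻¹' K) := (Bx_compact 1).inter_right (g.hK.isClosed.preimage hφ.continuous)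
  obtain ⟨d, hd, hs⟩ := hC.exists_cthickening_subset_open (hem.op.preimage hφ.continuous) (fun z hz => hKW hz.2)
  obtain ⟨n, hn⟩ := exists_nat_gt (4 / d)
  set m : ℝ := 2 * n + 1 with hmdef
  have hm0 : 0 < m := by positivity
  have hmd : 4 / m ≤ d := by
    rw [div_lt_iff₀ hd] at hn
    rw [div_le_iff₀ hm0, hmdef]
    have : (0:ℝ) ≤ n := n.cast_nonneg
    nlinarith
  have hmi : ((m⁻¹ : ℝ) : ℂ) ≠ 0 := by exact_mod_cast (inv_pos.2 hm0).ne'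
  have hφ' := openEmb_affine hφ hmi 0
  have hre : ∀ z : ℂ, (((m⁻¹ : ℝ) : ℂ) * z + 0).re = z.re / m := by
    intro z; rw [add_zero, Complex.re_ofReal_mul]; field_simp
  have him : ∀ z : ℂ, (((m⁻¹ : ℝ) : ℂ) * z + 0).im = z.im / m := by
    intro z; rw [add_zero, Complex.im_ofReal_mul]; field_simp
  have hb : ∀ z : ℂ, z ∈ Bx m ↔ ((m⁻¹ : ℝ) : ℂ) * z + 0 ∈ Bx 1 := by
    intro z
    show (_ ∧ _) ↔ (_ ∧ _)
    rw [hre, him, abs_div, abs_div, abs_of_pos hm0, div_le_one hm0, div_le_one hm0]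
  have himg : (fun z => φ (((m⁻¹ : ℝ) : ℂ) * z + 0)) '' Bx m = φ '' Bx 1 := by
    ext x
    constructor
    · rintro ⟨z, hz, rfl⟩
      exact ⟨_, (hb z).1 hz, rfl⟩
    · rintro ⟨z, hz, rfl⟩
      have : ((m⁻¹ : ℝ) : ℂ) * (m * z) + 0 = z := by
        have hmc : (m:ℂ) ≠ 0 := by exact_mod_cast hm0.ne'
        push_cast; field_simp; simp
      refine ⟨m * z, (hb _).2 (by rw [this]; exact hz), ?_⟩
      show φ _ = φ _
      rw [this]
  have := g.grid (φ := fun z => φ (((m⁻¹ : ℝ) : ℂ) * z + 0)) hch hU hG hem hKW hφ' n (by rw [← hmdef, himg]; exact hin)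
    (by rw [← hmdef, himg]; exact hm) (by
    intro q hq hne
    obtain ⟨_, ⟨w, hw, rfl⟩, hwK⟩ := hne
    rintro _ ⟨w', hw', rfl⟩
    have hwm : w ∈ Bx m := by
      obtain ⟨⟨a1, a2⟩, ⟨a3, a4⟩⟩ := hq
      have b1 : (-(n:ℝ)) ≤ q.1 := by exact_mod_cast a1
      have b2 : (q.1:ℝ) ≤ n := by exact_mod_cast a2
      have b3 : (-(n:ℝ)) ≤ q.2 := by exact_mod_cast a3
      have b4 : (q.2:ℝ) ≤ n := by exact_mod_cast a4
      obtain ⟨h1, h2⟩ := hw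
      rw [abs_le] at h1 h2
      constructor <;> rw [abs_le] <;> constructor <;> rw [hmdef] <;> linarith
    refine hs (mem_cthickening_of_dist_le _ (((m⁻¹ : ℝ) : ℂ) * w + 0) d _ ⟨(hb w).1 hwm, hwK⟩ ?_)
    rw [Complex.dist_eq]
    refine (norm_le_abs _).trans (le_trans ?_ hmd)
    rw [Complex.sub_re, Complex.sub_im, hre, hre, him, him, ← sub_div, ← sub_div, abs_div, abs_div, abs_of_pos hm0, ← add_div]
    obtain ⟨h1, h2⟩ := hw
    obtain ⟨h3, h4⟩ := hw'
    rw [abs_le] at h1 h2 h3 h4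
    have k1 : |w'.re - w.re| ≤ 2 := by rw [abs_le]; constructor <;> linarith
    have k2 : |w'.im - w.im| ≤ 2 := by rw [abs_le]; constructor <;> linarith
    gcongr
    linarith)
  rw [← hmdef, himg] at this
  exact this

theorem Pl.of_chart (hφ : IsOpenEmbedding φ) (h0 : φ 0 = k0) : Pl k0 (range φ) := by
  refine ⟨range φ, fun x => (Function.invFun φ x)⁻¹, ⟨hφ.isOpen_range, ⟨0, h0⟩, ?_, ?_, ?_⟩, subset_rfl⟩
  · rintro _ ⟨⟨z, rfl⟩, hz⟩
    have h1 : ContinuousAt (Function.invFun φ) (φ z) := inv_cont hφ z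
    refine (h1.inv₀ ?_).continuousWithinAt
    rw [Function.leftInverse_invFun hφ.injective z]
    rintro rfl
    exact hz h0
  · rintro _ ⟨⟨z, rfl⟩, hz⟩ _ ⟨⟨w, rfl⟩, hw⟩ hzw
    simp only [Function.leftInverse_invFun hφ.injective _] at hzw
    rw [inv_injective hzw]
  · have h1 : ContinuousAt (Function.invFun φ) k0 := h0 ▸ inv_cont hφ 0
    have h2 : Function.invFun φ k0 = 0 := by rw [← h0]; exact Function.leftInverse_invFun hφ.injective 0
    have h3 : Tendsto (Function.invFun φ) (𝓝[≠] k0) (𝓝[≠] 0) := by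
      refine tendsto_nhdsWithin_of_tendsto_nhds_of_eventually_within _ ?_ ?_
      · have := h1.tendsto
        rw [h2] at this
        exact this.mono_left nhdsWithin_le_nhds
      · filter_upwards [self_mem_nhdsWithin, mem_nhdsWithin_of_mem_nhds (hφ.isOpen_range.mem_nhds ⟨0, h0⟩)] with x hx hxr
        obtain ⟨z, rfl⟩ := hxr
        show _ ≠ (0:ℂ)
        rw [Function.leftInverse_invFun hφ.injective z]
        rintro rfl
        exact hx h0
    have h4 : Tendsto (fun z : ℂ => ‖z⁻¹‖) (𝓝[≠] 0) atTop := by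
      simp only [norm_inv]
      exact tendsto_inv_nhdsGT_zero.comp tendsto_norm_nhdsNE_zero
    exact h4.comp h3

theorem pl_of_good [CompactSpace S] (hch : Charted S) (hU : IsOpen U) (hG : GoodSet U) {δ : Set S}
    (hδ : IsCompact δ) (hδc : IsPreconnected δ) (hδU : δ ⊆ U) (hk : k0 ∈ δ) : Pl k0 δ := by
  classical
  have hex : ∀ x : S, ∃ φ : ℂ → S, IsOpenEmbedding φ ∧ φ 0 = x ∧ (x ∈ U → φ '' Bx 1 ⊆ U) := by
    intro x
    obtain ⟨φ, hφ, h0⟩ := hch x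
    by_cases hx : x ∈ U
    · obtain ⟨r, hr, hb⟩ := Metric.isOpen_iff.1 (hU.preimage hφ.continuous) 0 (show φ 0 ∈ U by rw [h0]; exact hx)
      have hr3 : ((r/3 : ℝ) : ℂ) ≠ 0 := by
        have : r / 3 ≠ 0 := by positivity
        exact_mod_cast this
      refine ⟨_, openEmb_affine hφ hr3 0, by simpa using h0, fun _ => ?_⟩
      rintro _ ⟨z, ⟨h1, h2⟩, rfl⟩
      refine hb ?_
      rw [mem_ball, dist_zero_right, add_zero, norm_mul, Complex.norm_real, Real.norm_of_nonneg (by positivity)]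
      have := norm_le_abs z
      nlinarith
    · exact ⟨φ, hφ, h0, fun h => absurd h hx⟩
  choose φ hφ h0 hφU using hex
  have hnh : ∀ x, φ x '' Bx 1 ∈ 𝓝 x := by
    intro x
    have h1 : φ x '' Bx 1 ∈ 𝓝 (φ x 0) := (hφ x).image_mem_nhds.2 (mem_interior_iff_mem_nhds.1 (Bx_open (by simp)))
    rwa [h0] at h1
  obtain ⟨t, ht, hcov⟩ := hδ.elim_nhds_subcover (fun x => φ x '' Bx 1) (fun x _ => hnh x)
  have ht' : ∀ x ∈ insert k0 t, x ∈ δ := by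
    intro x hx
    rcases Finset.mem_insert.1 hx with rfl | hx
    · exact hk
    · exact ht x hx
  have hcpt : ∀ x, IsCompact (φ x '' Bx 1) := fun x => (Bx_compact 1).image (hφ x).continuous
  have hcov' : δ ⊆ ⋃ x ∈ insert k0 t, φ x '' Bx 1 := by
    rw [Finset.set_biUnion_insert]
    exact hcov.trans subset_union_right
  have := grow (insert k0 t) (fun x => φ x '' Bx 1) (fun x _ => (hcpt x).isClosed) hδc hcov'
    (fun x hx => ⟨x, ht' x hx, mem_of_mem_nhds (hnh x)⟩) (fun T => Gr k0 U (⋃ x ∈ T, φ x '' Bx 1)) {k0} (by simp) (by simp)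
    (by
      simp only [Finset.mem_singleton, iUnion_iUnion_eq_left]
      refine ⟨hcpt k0, (Bx_convex 1).isPreconnected.image _ (hφ k0).continuous.continuousOn,
        mem_interior_iff_mem_nhds.2 (hnh k0), ?_, hφU k0 (hδU hk)⟩
      obtain ⟨W, e, h1, h2⟩ := Pl.of_chart (hφ k0) (h0 k0)
      exact ⟨W, e, h1, (image_subset_range _ _).trans h2⟩) (by
      intro T hT0 hT gT i hi hiT j hj hij
      rw [Finset.set_biUnion_insert, union_comm]
      refine gT.box hch hU hG (hφ i) (hφU i (hδU (ht' i hi))) ?_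
      obtain ⟨x, hx1, hx2⟩ := hij
      exact ⟨x, mem_iUnion₂.2 ⟨j, hj, hx2⟩, hx1⟩)
  obtain ⟨W, e, h1, h2⟩ := this.hP
  exact ⟨W, e, h1, hcov'.trans h2⟩

/-- a planar connected set is either everything or has a neighbourhood embedding in the plane -/
theorem Pl.embeds [CompactSpace S] [ConnectedSpace S] {δ : Set S} (hδ : IsCompact δ) (hk : k0 ∈ δ) (hP : Pl k0 δ) :
    δ = univ ∨ ∃ V : Set S, IsOpen V ∧ δ ⊆ V ∧ ∃ f : V → ℝ × ℝ, Topology.IsEmbedding f := by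
  classical
  obtain ⟨W, e, h, hW⟩ := hP
  by_cases hd : W ⊆ δ
  · left
    have hWe : W = δ := Subset.antisymm hd hW
    have : IsClopen δ := ⟨hδ.isClosed, hWe ▸ h.op⟩
    exact this.eq_univ ⟨k0, hk⟩
  right
  obtain ⟨x, hxW, hxδ⟩ := not_subset.1 hd
  have hxk : x ≠ k0 := fun hh => hxδ (hh ▸ hk)
  have hW'o : IsOpen (W \ {x}) := h.op.sdiff isClosed_singleton
  have hδW' : δ ⊆ W \ {x} := fun y hy => ⟨hW hy, fun hh => hxδ (hh ▸ hy)⟩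
  set f : S → ℂ := fun y => if y = k0 then 0 else (e y - e x)⁻¹ with hf
  have hne : ∀ y ∈ W \ {x}, y ≠ k0 → e y - e x ≠ 0 := by
    intro y hy hyk hh
    exact hy.2 (h.inj ⟨hy.1, hyk⟩ ⟨hxW, hxk⟩ (sub_eq_zero.1 hh))
  have hfi : InjOn f (W \ {x}) := by
    intro y hy z hz hyz
    simp only [hf] at hyz
    split_ifs at hyz with h1 h2 h2
    · rw [h1, h2]
    · exact absurd hyz.symm (inv_ne_zero (hne z hz h2))
    · exact absurd hyz (inv_ne_zero (hne y hy h1))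
    · have := inv_injective hyz
      exact h.inj ⟨hy.1, h1⟩ ⟨hz.1, h2⟩ (by simpa using this)
  have hfc : ContinuousOn f (W \ {x}) := by
    intro y hy
    refine ContinuousAt.continuousWithinAt ?_
    by_cases hyk : y = k0
    · rw [hyk, continuousAt_iff_punctured_nhds]
      have h1 : Tendsto (fun y => ‖e y - e x‖) (𝓝[≠] k0) atTop := by
        refine tendsto_atTop_mono (fun y => norm_sub_norm_le (e y) (e x)) ?_
        exact tendsto_atTop_add_const_right _ (-‖e x‖) h.tend
      have h2 : Tendsto (fun y => (e y - e x)⁻¹) (𝓝[≠] k0) (𝓝 0) := by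
        rw [tendsto_zero_iff_norm_tendsto_zero]
        simp only [norm_inv]
        exact tendsto_inv_atTop_zero.comp h1
      have h3 : f k0 = 0 := by simp [hf]
      rw [h3]
      refine h2.congr' ?_
      filter_upwards [self_mem_nhdsWithin] with z hz
      simp only [hf]
      rw [if_neg (show z ≠ k0 from hz)]
    · have hWo : W \ {k0} ∈ 𝓝 y := (h.op.sdiff isClosed_singleton).mem_nhds ⟨hy.1, hyk⟩
      have h1 : ContinuousAt (fun y => (e y - e x)⁻¹) y :=
        ((h.cont.continuousAt hWo).sub continuousAt_const).inv₀ (hne y hy hyk)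
      refine h1.congr ?_
      filter_upwards [hWo] with z hz
      simp only [hf]
      rw [if_neg (show z ≠ k0 from hz.2)]
  obtain ⟨L, hL, hL1, hL2⟩ := exists_compact_between hδ hW'o hδW'
  refine ⟨interior L, isOpen_interior, hL1, ?_⟩
  haveI : CompactSpace L := isCompact_iff_compactSpace.1 hL
  have hg : IsEmbedding (fun y : L => f y) := by
    refine (Continuous.isClosedEmbedding ?_ ?_).isEmbedding
    · exact (hfc.mono hL2).domRestrict
    · intro y z hyz
      exact Subtype.ext (hfi (hL2 y.2) (hL2 z.2) hyz)
  have hinc : IsEmbedding (inclusion (interior_subset : interior L ⊆ L)) := IsEmbedding.inclusion _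
  exact ⟨_, (Complex.equivRealProdCLM.toHomeomorph.isEmbedding.comp hg).comp hinc⟩

/-- disjoint open neighbourhoods of finitely many disjoint compact sets -/
theorem sep_finite {n : ℕ} (δ : Fin n → Set S) (hc : ∀ i, IsCompact (δ i)) (hd : ∀ i j, i ≠ j → Disjoint (δ i) (δ j)) :
    ∃ V : Fin n → Set S, (∀ i, IsOpen (V i)) ∧ (∀ i, δ i ⊆ V i) ∧ Pairwise (fun i j => Disjoint (V i) (V j)) := by
  have h1 : ∀ i, ∃ A B : Set S, IsOpen A ∧ IsOpen B ∧ δ i ⊆ A ∧ (∀ j, j ≠ i → δ j ⊆ B) ∧ Disjoint A B := by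
    intro i
    have hcu : IsCompact (⋃ j ∈ {j | j ≠ i}, δ j) := (Set.toFinite _).isCompact_biUnion fun j _ => hc j
    have hdis : Disjoint (δ i) (⋃ j ∈ {j | j ≠ i}, δ j) := by
      rw [disjoint_iUnion₂_right]
      intro j hj
      exact hd i j (Ne.symm hj)
    obtain ⟨A, B, a, b, c, d, e⟩ := SeparatedNhds.of_isCompact_isCompact (hc i) hcu hdis
    exact ⟨A, B, a, b, c, fun j hj => (subset_iUnion₂ (s := fun j (_ : j ∈ {j | j ≠ i}) => δ j) j hj).trans d, e⟩
  choose A B hA hB hδA hδB hAB using h1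
  refine ⟨fun i => A i ∩ ⋂ j ∈ {j | j ≠ i}, B j, ?_, ?_, ?_⟩
  · intro i
    exact (hA i).inter ((Set.toFinite _).isOpen_biInter fun j _ => hB j)
  · intro i x hx
    refine ⟨hδA i hx, mem_iInter₂.2 fun j hj => hδB j i (Ne.symm hj) hx⟩
  · intro i j hij
    rw [Set.disjoint_left]
    rintro x ⟨h1, _⟩ ⟨_, h2⟩
    exact Set.disjoint_left.1 (hAB i) h1 (mem_iInter₂.1 h2 i hij)

end Growing


theorem charted_of_surface {S : Type*} [TopologicalSpace S] (hS : IsSurfaceLocallyEuclidean S) : Charted S := by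
  intro x
  obtain ⟨U, hU, hx, ⟨h⟩⟩ := hS x
  have h1 : IsOpenEmbedding (fun z : ℂ => ((h.symm (Complex.equivRealProdCLM.toHomeomorph z + h ⟨x, hx⟩) : U) : S)) :=
    hU.isOpenEmbedding_subtypeVal.comp (h.symm.isOpenEmbedding.comp
      ((Homeomorph.addRight (h ⟨x, hx⟩)).isOpenEmbedding.comp Complex.equivRealProdCLM.toHomeomorph.isOpenEmbedding))
  refine ⟨_, h1, ?_⟩
  have h2 : Complex.equivRealProdCLM.toHomeomorph (0:ℂ) = 0 := map_zero Complex.equivRealProdCLM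
  simp only [h2, zero_add, Homeomorph.symm_apply_apply]

/-- If `K` is a nonempty compact subset of a closed surface `S` and `D`
is an upper semicontinuous decomposition of `K` into subcontinua, then all but finitely
many elements of `D` are strictly planar. -/
theorem finite_non_strictly_planar_elements
    {S : Type*} [TopologicalSpace S] [T2Space S] [CompactSpace S] [ConnectedSpace S]
    [Nonempty S] (hS : IsSurfaceLocallyEuclidean S)
    (K : Set S) (hK : IsCompact K) (hKne : K.Nonempty)
    (D : Set (Set S)) (hD : IsUSCDecompCont K D) :
    {δ ∈ D | ¬ IsStrictlyPlanar δ}.Finite := by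
  have hch := charted_of_surface hS
  obtain ⟨⟨hD1, hD2, -, -⟩, hD3⟩ := hD
  by_cases huniv : univ ∈ D
  · refine (Set.finite_singleton (univ : Set S)).subset ?_
    rintro δ ⟨hδ, -⟩
    by_contra hne
    obtain ⟨x, hx⟩ := (hD1 δ hδ).1
    exact Set.disjoint_left.1 (hD2 δ hδ univ huniv hne) hx (mem_univ x)
  by_contra hinf
  have hinf' : {δ ∈ D | ¬ IsStrictlyPlanar δ}.Infinite := hinf
  obtain ⟨n, hn⟩ := exists_good hch
  set f := hinf'.natEmbedding with hf
  set d : Fin (n+1) → Set S := fun i => (f i : Set S) with hd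
  have hdD : ∀ i, d i ∈ D := fun i => (f i).2.1
  have hdn : ∀ i, ¬ IsStrictlyPlanar (d i) := fun i => (f i).2.2
  have hdc : ∀ i, IsCompact (d i) := fun i => (hD1 _ (hdD i)).2.1.isCompact
  have hdd : ∀ i j, i ≠ j → Disjoint (d i) (d j) := by
    intro i j hij
    refine hD2 _ (hdD i) _ (hdD j) fun h => hij ?_
    have h1 := f.injective (Subtype.ext h)
    exact Fin.ext h1
  obtain ⟨V, hVo, hdV, hVd⟩ := sep_finite d hdc hdd
  obtain ⟨i, hi⟩ := hn V hVo hVd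
  obtain ⟨k0, hk0⟩ := (hD1 _ (hdD i)).1
  have hP := pl_of_good hch (hVo i) hi (hdc i) (hD3 _ (hdD i)).isPreconnected (hdV i) hk0
  rcases hP.embeds (hdc i) hk0 with h | h
  · exact huniv (h ▸ hdD i)
  · exact hdn i h
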